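/- Let Q(t) be a polynomial with non-negative integer coefficients. Then for every contraction T on a (real or complex) Hilbert space H and every x ∈ H, the averages (1/n)∑_{j=1}^n T^{Q(p_j)} x converge in norm. -/

import Mathlib

open Filter Finset

/-! P1: Weyl differencing -/
noncomputable def ee (x : ℝ) : ℂ := Complex.exp ((2 * Real.pi * x : ℝ) * Complex.I)
lemma norm_ee (x : ℝ) : ‖ee x‖ = 1 := Complex.norm_exp_ofReal_mul_I _
lemma ee_add (x y : ℝ) : ee (x + y) = ee x * ee y := by
  unfold ee; rw [← Complex.exp_add]; congr 1; push_cast; ring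
lemma ee_conj (x : ℝ) : (starRingEnd ℂ) (ee x) = ee (-x) := by
  unfold ee; rw [← Complex.exp_conj]; congr 1
  rw [map_mul, Complex.conj_ofReal, Complex.conj_I]; push_cast; ring
lemma ee_zero : ee 0 = 1 := by simp [ee]
lemma ee_sub (x y : ℝ) : ee (x - y) = ee x * (starRingEnd ℂ) (ee y) := by
  rw [ee_conj, ← ee_add, sub_eq_add_neg]
lemma ee_int (n : ℤ) : ee n = 1 := by
  unfold ee; rw [Complex.exp_eq_one_iff]; exact ⟨n, by push_cast; ring⟩
lemma ee_add_int (x : ℝ) (n : ℤ) : ee (x + n) = ee x := by rw [ee_add, ee_int, mul_one]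

/-- distance to nearest integer -/
noncomputable def di (x : ℝ) : ℝ := |x - round x|
lemma di_nonneg (x : ℝ) : 0 ≤ di x := abs_nonneg _
lemma di_le_half (x : ℝ) : di x ≤ 1/2 := abs_sub_round x
lemma di_le (x : ℝ) (z : ℤ) : di x ≤ |x - z| := round_le x z
lemma di_neg (x : ℝ) : di (-x) = di x := by
  have h : ∀ y : ℝ, di (-y) ≤ di y := fun y => by
    have := di_le (-y) (-round y)
    have e : |-y - ((-round y : ℤ) : ℝ)| = di y := by
      unfold di; rw [← abs_neg]; congr 1; push_cast; ring
    rwa [e] at this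
  exact le_antisymm (h x) (by simpa using h (-x))

lemma norm_ee_sub_one (x : ℝ) : 4 * di x ≤ ‖ee x - 1‖ := by
  have h1 : ee x = ee (x - round x) := by
    have := ee_add_int (x - round x) (round x); rw [← this]; congr 1; ring
  set y := x - round x with hy
  have h2 : |y| ≤ 1/2 := abs_sub_round x
  have h3 : ‖ee y - 1‖ = 2 * |Real.sin (Real.pi * y)| := by
    unfold ee
    rw [mul_comm _ Complex.I, Complex.norm_exp_I_mul_ofReal_sub_one]
    rw [norm_mul]; simp; congr 1; ring
  rw [h1, h3]; unfold di; rw [← hy]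
  have h4 : |Real.sin (Real.pi * y)| = Real.sin (Real.pi * |y|) := by
    rw [abs_le] at h2
    rcases le_total 0 y with h | h
    · rw [abs_of_nonneg h, abs_of_nonneg]
      exact Real.sin_nonneg_of_nonneg_of_le_pi (by positivity) (by nlinarith [Real.pi_pos])
    · rw [abs_of_nonpos h, mul_neg, Real.sin_neg, abs_of_nonpos]
      exact Real.sin_nonpos_of_nonpos_of_neg_pi_le (by nlinarith [Real.pi_pos]) (by nlinarith [Real.pi_pos])
  rw [h4]
  have := Real.mul_le_sin (x := Real.pi * |y|) (by positivity) (by nlinarith [Real.pi_pos])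
  have e : 2 / Real.pi * (Real.pi * |y|) = 2 * |y| := by
    field_simp
  linarith

/-- Weyl kernel -/
noncomputable def wk (M : ℕ) (x : ℝ) : ℝ := 2 * M / (1 + M * di x)
lemma wk_nonneg (M : ℕ) (x : ℝ) : 0 ≤ wk M x := by
  unfold wk; have := di_nonneg x; positivity
lemma wk_neg (M : ℕ) (x : ℝ) : wk M (-x) = wk M x := by simp [wk, di_neg]
lemma wk_le (M : ℕ) (x : ℝ) : wk M x ≤ 2 * M := by
  unfold wk; have := di_nonneg x
  exact div_le_self (by positivity) (by nlinarith [show (0:ℝ) ≤ M * di x by positivity])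

def Ph : ℕ → ℝ → (ℤ → ℝ) → Prop
  | 0, α, p => ∀ n, p n = α
  | k+1, α, p => ∀ h : ℤ, Ph k ((k+1) * h * α) (fun n => p (n + h) - p n)

noncomputable def PSL : List ℕ → (ℤ → ℝ) → ℝ
  | [], f => f 1
  | D :: L, f => ∑ h ∈ Ioo (-(D:ℤ)) D, PSL L (fun l => f (h * l))

lemma PSL_mono (L : List ℕ) : ∀ {f g : ℤ → ℝ}, (∀ n, f n ≤ g n) → PSL L f ≤ PSL L g := by
  induction L with
  | nil => intro f g h; exact h 1
  | cons D L ih => intro f g h; exact sum_le_sum fun i _ => ih fun n => h _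
lemma PSL_nonneg (L : List ℕ) : ∀ {f : ℤ → ℝ}, (∀ n, 0 ≤ f n) → 0 ≤ PSL L f := by
  induction L with
  | nil => intro f h; exact h 1
  | cons D L ih => intro f h; exact sum_nonneg fun i _ => ih fun n => h _
lemma PSL_smul (L : List ℕ) (c : ℝ) : ∀ (f : ℤ → ℝ), PSL L (fun n => c * f n) = c * PSL L f := by
  induction L with
  | nil => intro f; rfl
  | cons D L ih => intro f; simp only [PSL, ih, mul_sum]
lemma PSL_append (L L' : List ℕ) : ∀ (f : ℤ → ℝ),
    PSL (L ++ L') f = PSL L (fun l => PSL L' (fun l' => f (l * l'))) := by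
  induction L with
  | nil => intro f; simp [PSL]
  | cons D L ih => intro f; simp only [List.cons_append, PSL, ih, mul_assoc]
lemma card_Ioo_le (D : ℕ) : ((Ioo (-(D:ℤ)) D).card : ℝ) ≤ 2 * D := by
  rw [Int.card_Ioo]
  have : ((D:ℤ) - -(D:ℤ) - 1).toNat ≤ 2 * D := by omega
  exact_mod_cast this
lemma PSL_pow (L : List ℕ) (n : ℕ) : ∀ (f : ℤ → ℝ), (∀ n, 0 ≤ f n) →
    (PSL L f) ^ (n+1) ≤ ((L.map (fun D : ℕ => (2 * (D:ℝ)))).prod) ^ n * PSL L (fun l => f l ^ (n+1)) := by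
  induction L with
  | nil => intro f hf; simp [PSL]
  | cons D L ih =>
    intro f hf
    simp only [PSL, List.map_cons, List.prod_cons]
    have h0 : ∀ i : ℤ, 0 ≤ PSL L (fun l => f (i * l)) := fun i => PSL_nonneg _ fun n => hf _
    refine (pow_sum_le_card_mul_sum_pow (fun i _ => h0 i) n).trans ?_
    rw [mul_pow, mul_assoc]
    refine mul_le_mul (pow_le_pow_left₀ (by positivity) (card_Ioo_le D) _) ?_ (sum_nonneg fun i _ => pow_nonneg (h0 i) _) (by positivity)
    rw [mul_sum]
    exact sum_le_sum fun i _ => ih _ fun n => hf _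

lemma weyl_sq (a b : ℤ) (M : ℕ) (hM : b - a ≤ M) (z : ℤ → ℂ) :
    (((‖∑ n ∈ Ico a b, z n‖ ^ 2 : ℝ)) : ℂ) = ∑ h ∈ Ioo (-(M:ℤ)) M,
      ∑ n ∈ Ico (max a (a - h)) (min b (b - h)), z (n + h) * (starRingEnd ℂ) (z n) := by
  have h1 : (((‖∑ n ∈ Ico a b, z n‖ ^ 2 : ℝ)) : ℂ) =
      ∑ n ∈ Ico a b, ∑ n' ∈ Ico a b, z n' * (starRingEnd ℂ) (z n) := by
    push_cast
    rw [← Complex.mul_conj', map_sum, sum_mul_sum, sum_comm]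
  rw [h1]
  have h2 : ∀ h : ℤ, Ico (max a (a - h)) (min b (b - h)) = (Ico a b).filter (fun n => n + h ∈ Ico a b) := by
    intro h; ext n; simp only [mem_Ico, mem_filter, max_le_iff, lt_min_iff]; omega
  simp only [h2, sum_filter]
  conv_rhs => rw [sum_comm]
  refine sum_congr rfl fun n hn => ?_
  rw [← sum_filter]
  refine sum_bij' (fun n' _ => n' - n) (fun h _ => n + h) ?_ ?_ ?_ ?_ ?_
  · intro n' hn'; simp only [mem_Ico, mem_filter, mem_Ioo] at *; omega
  · intro h hh; simp only [mem_Ico, mem_filter, mem_Ioo] at *; omega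
  · intros; ring
  · intros; ring
  · intro n' hn'; congr 2; ring

lemma card_Ico_inter (a b h : ℤ) (M : ℕ) (hM : b - a ≤ M) :
    min b (b - h) - max a (a - h) ≤ M := by omega

lemma weyl_W0 {ι : Type*} (s : Finset ι) (M : ℕ) (k : ℕ) : ∀ (a b : ℤ) (_ : b - a ≤ M)
    (p : ι → ℤ → ℝ) (α : ι → ℝ) (_ : ∀ i, Ph (k+1) (α i) (p i)),
    (2 * M : ℝ) ^ (k+2) * ∑ i ∈ s, ‖∑ n ∈ Ico a b, ee (p i n)‖ ^ (2 ^ (k+1)) ≤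
      (2 * M : ℝ) ^ (2 ^ (k+1)) * M * PSL (List.replicate (k+1) M)
        (fun H => ‖∑ i ∈ s, ee (((k+1).factorial : ℝ) * H * α i)‖) := by
  induction k with
  | zero =>
    intro a b hab p α hp
    simp only [zero_add, pow_one]
    have key : ((∑ i ∈ s, ‖∑ n ∈ Ico a b, ee (p i n)‖ ^ 2 : ℝ) : ℂ) =
       ∑ h ∈ Ioo (-(M:ℤ)) M, ∑ n ∈ Ico (max a (a - h)) (min b (b - h)), ∑ i ∈ s, ee (h * α i) := by
      push_cast
      have : ∀ i ∈ s, (((‖∑ n ∈ Ico a b, ee (p i n)‖ : ℝ) : ℂ)) ^ 2 = ∑ h ∈ Ioo (-(M:ℤ)) M,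
        ∑ n ∈ Ico (max a (a - h)) (min b (b - h)), ee (h * α i) := by
        intro i _
        have := weyl_sq a b M hab (fun n => ee (p i n))
        push_cast at this
        rw [this]
        refine sum_congr rfl fun h _ => sum_congr rfl fun n _ => ?_
        rw [← ee_sub]
        have := hp i h n
        simp only [Nat.cast_zero, zero_add, one_mul] at this
        rw [this]
      rw [sum_congr rfl this, sum_comm]
      refine sum_congr rfl fun h _ => sum_comm
    have h2 : ∑ i ∈ s, ‖∑ n ∈ Ico a b, ee (p i n)‖ ^ 2 ≤ M * ∑ h ∈ Ioo (-(M:ℤ)) M, ‖∑ i ∈ s, ee (h * α i)‖ := by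
      have h3 : ∑ i ∈ s, ‖∑ n ∈ Ico a b, ee (p i n)‖ ^ 2 = ‖((∑ i ∈ s, ‖∑ n ∈ Ico a b, ee (p i n)‖ ^ 2 : ℝ) : ℂ)‖ := by
        rw [Complex.norm_real, Real.norm_of_nonneg]; positivity
      rw [h3, key, mul_sum]
      refine (norm_sum_le _ _).trans (sum_le_sum fun h _ => ?_)
      rw [sum_const, nsmul_eq_mul, norm_mul]
      gcongr
      rw [Complex.norm_natCast, Int.card_Ico]
      have : (min b (b - h) - max a (a - h)).toNat ≤ M := by omega
      exact_mod_cast this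
    simp only [PSL, List.replicate]
    have : (0:ℝ) ≤ (2 * M) ^ 2 := by positivity
    calc (2 * M : ℝ) ^ 2 * ∑ i ∈ s, ‖∑ n ∈ Ico a b, ee (p i n)‖ ^ 2 ≤ _ := mul_le_mul_of_nonneg_left h2 this
      _ = _ := by rw [mul_assoc]; simp
  | succ k ih =>
    intro a b hab p α hp
    set B : ℝ := 2 * M with hB
    have hB0 : 0 ≤ B := by positivity
    set n := 2 ^ (k+1) with hn
    obtain ⟨m, hm⟩ : ∃ m, n = m + 1 := ⟨n - 1, by have : 0 < n := by positivity
                                                  omega⟩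
    have hstep : ∀ i ∈ s, ‖∑ n ∈ Ico a b, ee (p i n)‖ ^ (2 ^ (k+1+1)) ≤ B ^ m * ∑ h ∈ Ioo (-(M:ℤ)) M,
        ‖∑ n ∈ Ico (max a (a - h)) (min b (b - h)), ee (p i (n + h) - p i n)‖ ^ n := by
      intro i _
      have e : 2 ^ (k+1+1) = 2 * n := by rw [hn]; ring
      rw [e, pow_mul]
      have h1 : ‖∑ n ∈ Ico a b, ee (p i n)‖ ^ 2 ≤ ∑ h ∈ Ioo (-(M:ℤ)) M,
          ‖∑ n ∈ Ico (max a (a - h)) (min b (b - h)), ee (p i (n + h) - p i n)‖ := by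
        have h3 : ‖∑ n ∈ Ico a b, ee (p i n)‖ ^ 2 = ‖((‖∑ n ∈ Ico a b, ee (p i n)‖ ^ 2 : ℝ) : ℂ)‖ := by
          rw [Complex.norm_real, Real.norm_of_nonneg]; positivity
        rw [h3, weyl_sq a b M hab]
        refine (norm_sum_le _ _).trans (sum_le_sum fun h _ => le_of_eq ?_)
        simp only [ee_sub]
      refine (pow_le_pow_left₀ (by positivity) h1 n).trans ?_
      rw [hm]
      refine (pow_sum_le_card_mul_sum_pow (fun i _ => norm_nonneg _) m).trans ?_
      gcongr
      exact card_Ioo_le M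
    have h4 : ∀ h ∈ Ioo (-(M:ℤ)) M, B ^ (k+2) * ∑ i ∈ s, ‖∑ n ∈ Ico (max a (a - h)) (min b (b - h)), ee (p i (n + h) - p i n)‖ ^ n
        ≤ B ^ n * M * PSL (List.replicate (k+1) M) (fun l => ‖∑ i ∈ s, ee (((k+1+1).factorial : ℝ) * (h * l : ℤ) * α i)‖) := by
      intro h _
      refine (ih _ _ (card_Ico_inter a b h M hab) (fun i n => p i (n + h) - p i n) (fun i => ((k+1:ℕ)+1) * h * α i)
        (fun i => hp i h)).trans (le_of_eq ?_)
      congr 2; ext H; congr 2; ext i; congr 1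
      rw [Nat.factorial_succ (k+1)]; push_cast; ring
    calc B ^ (k+1+2) * ∑ i ∈ s, ‖∑ n ∈ Ico a b, ee (p i n)‖ ^ (2 ^ (k+1+1))
        ≤ B ^ (k+1+2) * ∑ i ∈ s, B ^ m * ∑ h ∈ Ioo (-(M:ℤ)) M,
        ‖∑ n ∈ Ico (max a (a - h)) (min b (b - h)), ee (p i (n + h) - p i n)‖ ^ n := by
          gcongr with i hi; exact hstep i hi
      _ = B ^ n * ∑ h ∈ Ioo (-(M:ℤ)) M, B ^ (k+2) * ∑ i ∈ s, ‖∑ n ∈ Ico (max a (a - h)) (min b (b - h)), ee (p i (n + h) - p i n)‖ ^ n := by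
          rw [← mul_sum, sum_comm, ← mul_sum, hm]; ring
      _ ≤ B ^ n * ∑ h ∈ Ioo (-(M:ℤ)) M, B ^ n * M * PSL (List.replicate (k+1) M) (fun l => ‖∑ i ∈ s, ee (((k+1+1).factorial : ℝ) * (h * l : ℤ) * α i)‖) := by
          exact mul_le_mul_of_nonneg_left (sum_le_sum h4) (by positivity)
      _ = _ := by
          rw [← mul_sum, ← mul_assoc, ← mul_assoc, ← pow_add]
          rw [show n + n = 2 ^ (k+1+1) by rw [hn]; ring]
          rfl

lemma geom_bound (a b : ℤ) (M : ℕ) (hM : b - a ≤ M) (p : ℤ → ℝ) (α : ℝ) (hp : Ph 1 α p) :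
    ‖∑ n ∈ Ico a b, ee (p n)‖ ≤ wk M α := by
  have hd := di_nonneg α
  have hM' : ‖∑ n ∈ Ico a b, ee (p n)‖ ≤ M := by
    refine (norm_sum_le _ _).trans ?_
    simp only [norm_ee, sum_const, nsmul_eq_mul, mul_one, Int.card_Ico]
    exact_mod_cast (by omega : (b - a).toNat ≤ M)
  unfold wk; rw [le_div_iff₀ (by positivity)]
  by_cases hab : a ≤ b
  swap
  · rw [Ico_eq_empty (by omega)]; simp
  have hstep : ∀ n, ee (p (n+1)) = ee α * ee (p n) := by
    intro n
    have := hp 1 n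
    simp at this
    rw [← ee_add]; congr 1; linarith
  have htel : (ee α - 1) * ∑ n ∈ Ico a b, ee (p n) = ee (p b) - ee (p a) := by
    have : ∀ b, a ≤ b → (ee α - 1) * ∑ n ∈ Ico a b, ee (p n) = ee (p b) - ee (p a) := by
      intro b hb
      induction b, hb using Int.leInduction with
      | base => simp
      | succ b hb ih =>
        rw [← Finset.insert_Ico_right_eq_Ico_add_one hb, sum_insert (by simp), mul_add, ih, hstep]; ring
    exact this b hab
  have h2 : 4 * di α * ‖∑ n ∈ Ico a b, ee (p n)‖ ≤ 2 := by
    calc _ ≤ ‖ee α - 1‖ * ‖∑ n ∈ Ico a b, ee (p n)‖ := by gcongr; exact norm_ee_sub_one α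
      _ = ‖ee (p b) - ee (p a)‖ := by rw [← norm_mul, htel]
      _ ≤ _ := by refine (norm_sub_le _ _).trans ?_; rw [norm_ee, norm_ee]; norm_num
  nlinarith [show (0:ℝ) ≤ M by positivity]

lemma weyl_W (M : ℕ) (k : ℕ) : ∀ (a b : ℤ) (_ : b - a ≤ M)
    (p : ℤ → ℝ) (α : ℝ) (_ : Ph (k+1) α p),
    (2 * M : ℝ) ^ (k+1) * ‖∑ n ∈ Ico a b, ee (p n)‖ ^ (2 ^ k) ≤
      (2 * M : ℝ) ^ (2 ^ k) * PSL (List.replicate k M)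
        (fun H => wk M (((k+1).factorial : ℝ) * H * α)) := by
  induction k with
  | zero =>
    intro a b hab p α hp
    simp only [zero_add, pow_one, pow_zero, List.replicate, PSL]
    gcongr
    simpa using geom_bound a b M hab p α hp
  | succ k ih =>
    intro a b hab p α hp
    set B : ℝ := 2 * M with hB
    have hB0 : 0 ≤ B := by positivity
    set n := 2 ^ k with hn
    obtain ⟨m, hm⟩ : ∃ m, n = m + 1 := ⟨n - 1, by have : 0 < n := by positivity
                                                  omega⟩
    have hstep : ‖∑ n ∈ Ico a b, ee (p n)‖ ^ (2 ^ (k+1)) ≤ B ^ m * ∑ h ∈ Ioo (-(M:ℤ)) M,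
        ‖∑ n ∈ Ico (max a (a - h)) (min b (b - h)), ee (p (n + h) - p n)‖ ^ n := by
      have e : 2 ^ (k+1) = 2 * n := by rw [hn]; ring
      rw [e, pow_mul]
      have h1 : ‖∑ n ∈ Ico a b, ee (p n)‖ ^ 2 ≤ ∑ h ∈ Ioo (-(M:ℤ)) M,
          ‖∑ n ∈ Ico (max a (a - h)) (min b (b - h)), ee (p (n + h) - p n)‖ := by
        have h3 : ‖∑ n ∈ Ico a b, ee (p n)‖ ^ 2 = ‖((‖∑ n ∈ Ico a b, ee (p n)‖ ^ 2 : ℝ) : ℂ)‖ := by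
          rw [Complex.norm_real, Real.norm_of_nonneg]; positivity
        rw [h3, weyl_sq a b M hab]
        refine (norm_sum_le _ _).trans (sum_le_sum fun h _ => le_of_eq ?_)
        simp only [ee_sub]
      refine (pow_le_pow_left₀ (by positivity) h1 n).trans ?_
      rw [hm]
      refine (pow_sum_le_card_mul_sum_pow (fun i _ => norm_nonneg _) m).trans ?_
      gcongr
      exact card_Ioo_le M
    calc B ^ (k+1+1) * ‖∑ n ∈ Ico a b, ee (p n)‖ ^ (2 ^ (k+1))
        ≤ B ^ (k+1+1) * (B ^ m * ∑ h ∈ Ioo (-(M:ℤ)) M,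
        ‖∑ n ∈ Ico (max a (a - h)) (min b (b - h)), ee (p (n + h) - p n)‖ ^ n) := by gcongr
      _ = B ^ n * ∑ h ∈ Ioo (-(M:ℤ)) M, B ^ (k+1) * ‖∑ n ∈ Ico (max a (a - h)) (min b (b - h)), ee (p (n + h) - p n)‖ ^ n := by
          rw [← mul_sum, hm]; ring
      _ ≤ B ^ n * ∑ h ∈ Ioo (-(M:ℤ)) M, B ^ n * PSL (List.replicate k M) (fun l => wk M (((k+1+1).factorial : ℝ) * (h * l : ℤ) * α)) := by
          refine mul_le_mul_of_nonneg_left (sum_le_sum fun h _ => ?_) (by positivity)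
          refine (ih _ _ (card_Ico_inter a b h M hab) (fun n => p (n + h) - p n) (((k+1:ℕ)+1) * h * α) (hp h)).trans (le_of_eq ?_)
          congr 2; ext H; congr 1
          rw [Nat.factorial_succ (k+1)]; push_cast; ring
      _ = _ := by
          rw [← mul_sum, ← mul_assoc, ← pow_add]
          rw [show n + n = 2 ^ (k+1) by rw [hn]; ring]
          rfl
lemma Ph_poly (k : ℕ) : ∀ (P : Polynomial ℝ), P.natDegree ≤ k → Ph k (P.coeff k) (fun n : ℤ => P.eval (n:ℝ)) := by
  induction k with
  | zero =>
    intro P hP n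
    have := Polynomial.eq_C_of_natDegree_le_zero hP
    rw [this]; simp
  | succ k ih =>
    intro P hP h
    have h1 : ∀ n, k + 1 ≤ n → (Polynomial.taylor (h:ℝ) P).coeff n = P.coeff n := by
      intro n hn
      rw [Polynomial.taylor_coeff, Polynomial.eval_eq_sum_range' (n := 1)
        (lt_of_le_of_lt (Polynomial.natDegree_hasseDeriv_le _ _) (by omega))]
      simp [Polynomial.hasseDeriv_coeff]
    have h2 : (Polynomial.taylor (h:ℝ) P).coeff k = P.coeff k + (k+1) * h * P.coeff (k+1) := by
      rw [Polynomial.taylor_coeff, Polynomial.eval_eq_sum_range' (n := 2)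
        (lt_of_le_of_lt (Polynomial.natDegree_hasseDeriv_le _ _) (by omega))]
      simp [Polynomial.hasseDeriv_coeff, sum_range_succ, add_comm 1 k]; ring
    have h3 := ih (Polynomial.taylor (h:ℝ) P - P) (by
      rw [Polynomial.natDegree_le_iff_coeff_eq_zero]
      intro n hn
      rw [Polynomial.coeff_sub, h1 n (by omega), sub_self])
    rw [Polynomial.coeff_sub, h2] at h3
    convert h3 using 1
    · ring
    · ext n; simp [Polynomial.taylor_eval]

/-! P2: divisor sums, product sums, minsum -/
def tau (n : ℕ) : ℕ := n.divisors.card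

lemma tau_le_mul {h l : ℕ} (h0 : h ≠ 0) (l0 : l ≠ 0) : tau l ≤ tau (h * l) :=
  card_le_card (Nat.divisors_subset_of_dvd (by positivity) (Dvd.intro_left _ rfl))
lemma tau_mul_le (m n : ℕ) : tau (m * n) ≤ tau m * tau n := by
  unfold tau; rw [Nat.divisors_mul]; exact card_mul_le

lemma mulsum (D P : ℕ) (g : ℕ → ℝ) (hg : ∀ n, 0 ≤ g n) :
    ∑ h ∈ Icc 1 D, ∑ l ∈ Icc 1 P, g (h * l) ≤ ∑ n ∈ Icc 1 (D * P), tau n * g n := by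
  rw [← sum_product' (f := fun h l => g (h * l))]
  rw [← sum_fiberwise_of_maps_to (s := Icc 1 D ×ˢ Icc 1 P) (t := Icc 1 (D * P)) (g := fun x => x.1 * x.2)
    (by
      intro x hx; simp only [mem_product, mem_Icc] at hx ⊢
      exact ⟨Nat.mul_pos hx.1.1 hx.2.1, Nat.mul_le_mul hx.1.2 hx.2.2⟩)]
  refine sum_le_sum fun n hn => ?_
  rw [sum_congr rfl (g := fun _ => g n) (by intro x hx; rw [(mem_filter.1 hx).2]), sum_const, nsmul_eq_mul]
  refine mul_le_mul_of_nonneg_right ?_ (hg n)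
  norm_cast
  refine card_le_card_of_injOn (fun x => x.1) ?_ ?_
  · intro x hx
    simp only [coe_filter, mem_product, mem_Icc, Set.mem_ofPred_eq] at hx
    simp only [Finset.mem_coe, Nat.mem_divisors]
    exact ⟨⟨x.2, hx.2.symm⟩, by have := (mem_Icc.1 hn).1; omega⟩
  · intro x hx y hy hxy
    simp only [coe_filter, mem_product, mem_Icc, Set.mem_ofPred_eq] at hx hy hxy
    have : x.1 * x.2 = x.1 * y.2 := by rw [hx.2, hxy, hy.2]
    exact Prod.ext hxy (Nat.eq_of_mul_eq_mul_left (by omega) this)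

lemma sum_Ioo_natAbs (D : ℕ) (φ : ℕ → ℝ) (hφ : ∀ n, 0 ≤ φ n) :
    ∑ h ∈ Ioo (-(D:ℤ)) D, φ h.natAbs ≤ φ 0 + 2 * ∑ h ∈ Icc 1 D, φ h := by
  have h1 : ∀ D : ℕ, ∑ h ∈ Ioo (-((D:ℤ)+1)) (D+1), φ h.natAbs = φ 0 + 2 * ∑ h ∈ Icc 1 D, φ h := by
    intro D
    induction D with
    | zero =>
      have : Ioo (-(((0:ℕ):ℤ)+1)) ((0:ℕ)+1) = {0} := by ext; simp; omega
      rw [this]; simp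
    | succ D ih =>
      have : Ioo (-(((D+1:ℕ):ℤ)+1)) ((D+1:ℕ)+1) = insert ((D:ℤ)+1) (insert (-((D:ℤ)+1)) (Ioo (-((D:ℤ)+1)) (D+1))) := by
        ext; simp; omega
      rw [this, sum_insert (by simp; omega), sum_insert (by simp), ih, sum_Icc_succ_top (by omega)]
      have e1 : ((D:ℤ)+1).natAbs = D+1 := by omega
      have e2 : (-((D:ℤ)+1)).natAbs = D+1 := by omega
      rw [e1, e2]; ring
  rw [← h1]
  exact sum_le_sum_of_subset_of_nonneg (Ioo_subset_Ioo (by omega) (by omega)) fun _ _ _ => hφ _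

lemma PSL_const (L : List ℕ) (c : ℝ) (hc : 0 ≤ c) : PSL L (fun _ => c) ≤ (L.map (fun D : ℕ => (2 * (D:ℝ)))).prod * c := by
  induction L with
  | nil => simp [PSL]
  | cons D L ih =>
    simp only [PSL, sum_const, nsmul_eq_mul, List.map_cons, List.prod_cons]
    rw [mul_assoc]
    exact mul_le_mul (card_Ioo_le D) ih (PSL_nonneg _ fun _ => hc) (by positivity)

lemma prod2_nonneg (L : List ℕ) : 0 ≤ (L.map (fun D : ℕ => (2 * (D:ℝ)))).prod :=
  List.prod_nonneg (by intro a ha; simp at ha; obtain ⟨b, _, rfl⟩ := ha; positivity)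

lemma PSL_bound (L : List ℕ) (hL : ∀ D ∈ L, 0 < D) : ∀ (f : ℤ → ℝ) (_ : ∀ n, 0 ≤ f n) (_ : ∀ n, f (-n) = f n),
    PSL L f ≤ (L.map (fun D : ℕ => (2 * (D:ℝ)))).prod * (L.map (fun D : ℕ => (1 / (2 * (D:ℝ))))).sum * f 0
      + 2 ^ L.length * ∑ l ∈ Icc 1 L.prod, (tau l : ℝ) ^ L.length * f l := by
  induction L with
  | nil => intro f hf he; simp [PSL, tau]
  | cons D L ih =>
    intro f hf he
    have hL' : ∀ D ∈ L, 0 < D := fun D hD => hL D (List.mem_cons_of_mem _ hD)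
    have hD : 0 < D := hL D List.mem_cons_self
    have ih' := ih hL'
    set Pr := (L.map (fun D : ℕ => (2 * (D:ℝ)))).prod with hPr
    set Sg := (L.map (fun D : ℕ => (1 / (2 * (D:ℝ))))).sum with hSg
    set j := L.length with hj
    have hPr0 : 0 ≤ Pr := prod2_nonneg L
    have hSg0 : 0 ≤ Sg := List.sum_nonneg (by intro a ha; simp at ha; obtain ⟨b, _, rfl⟩ := ha; positivity)
    simp only [PSL, List.map_cons, List.prod_cons, List.sum_cons, List.length_cons, ← hPr, ← hSg, ← hj]
    let φ : ℕ → ℝ := fun h => if h = 0 then Pr * f 0 else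
      Pr * Sg * f 0 + 2 ^ j * ∑ l ∈ Icc 1 L.prod, (tau l : ℝ) ^ j * f ((h * l : ℕ) : ℤ)
    have hφ : ∀ n, 0 ≤ φ n := by
      intro n; simp only [φ]; split_ifs
      · exact mul_nonneg hPr0 (hf 0)
      · have := hf 0
        have : 0 ≤ ∑ l ∈ Icc 1 L.prod, (tau l : ℝ) ^ j * f ((n * l : ℕ) : ℤ) :=
          sum_nonneg fun l _ => mul_nonneg (by positivity) (hf _)
        positivity
    have h1 : ∀ h ∈ Ioo (-(D:ℤ)) D, PSL L (fun l => f (h * l)) ≤ φ h.natAbs := by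
      intro h _
      simp only [φ]; split_ifs with h0
      · have : h = 0 := by omega
        subst this; simp only [zero_mul]; exact PSL_const L _ (hf 0)
      · refine (ih' (fun l => f (h * l)) (fun n => hf _) (fun n => by rw [mul_neg, he])).trans ?_
        simp only [mul_zero]
        refine le_of_eq ?_
        congr 2; refine sum_congr rfl fun l _ => ?_
        congr 1
        push_cast
        rcases abs_choice h with hh | hh
        · rw [hh]
        · rw [hh, neg_mul, he]
    refine (sum_le_sum h1).trans ((sum_Ioo_natAbs D φ hφ).trans ?_)
    have h2 : ∑ h ∈ Icc 1 D, φ h ≤ D * (Pr * Sg * f 0) + 2 ^ j * ∑ l ∈ Icc 1 (D * L.prod), (tau l : ℝ) ^ (j+1) * f l := by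
      have : ∑ h ∈ Icc 1 D, φ h = D * (Pr * Sg * f 0) + 2 ^ j * ∑ h ∈ Icc 1 D, ∑ l ∈ Icc 1 L.prod, (tau l : ℝ) ^ j * f ((h * l : ℕ) : ℤ) := by
        rw [mul_sum]
        rw [sum_congr rfl (g := fun h => Pr * Sg * f 0 + 2 ^ j * ∑ l ∈ Icc 1 L.prod, (tau l : ℝ) ^ j * f ((h * l : ℕ) : ℤ))
          (by intro h hh; simp only [φ]; rw [if_neg (by have := (mem_Icc.1 hh).1; omega)])]
        rw [sum_add_distrib]; simp
      rw [this]
      gcongr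
      refine le_trans ?_ ((mulsum D L.prod (fun n => (tau n : ℝ) ^ j * f n) (fun n => mul_nonneg (by positivity) (hf _))).trans (le_of_eq ?_))
      · refine sum_le_sum fun h hh => sum_le_sum fun l hl => ?_
        refine mul_le_mul_of_nonneg_right ?_ (hf _)
        gcongr
        exact tau_le_mul (by have := (mem_Icc.1 hh).1; omega) (by have := (mem_Icc.1 hl).1; omega)
      · refine sum_congr rfl fun n _ => ?_; ring
    have h3 : φ 0 = Pr * f 0 := by simp [φ]
    rw [h3]
    have e : 2 * (D:ℝ) * Pr * (1 / (2 * D) + Sg) * f 0 = Pr * f 0 + 2 * (D * (Pr * Sg * f 0)) := by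
      have : (D:ℝ) ≠ 0 := by positivity
      field_simp
    rw [e, pow_succ]; linarith

lemma harm_le (X : ℕ) : ∑ n ∈ Icc 1 X, (1:ℝ) / n ≤ 1 + Real.log X := by
  have := harmonic_le_one_add_log X
  rw [harmonic_eq_sum_Icc] at this
  push_cast at this
  simpa [one_div] using this

lemma tau_sum_le (X : ℕ) (g : ℕ → ℝ) (hg : ∀ n, 0 ≤ g n) :
    ∑ n ∈ Icc 1 X, tau n * g n ≤ ∑ d ∈ Icc 1 X, ∑ m ∈ Icc 1 X, g (d * m) := by
  have h1 : ∀ n ∈ Icc 1 X, tau n * g n = ∑ d ∈ Icc 1 X, if d ∣ n then g n else 0 := by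
    intro n hn
    rw [← sum_filter, sum_const, nsmul_eq_mul]
    congr 2
    unfold tau; congr 1; ext d
    have h := mem_Icc.1 hn
    simp only [Nat.mem_divisors, mem_filter, mem_Icc]
    constructor
    · rintro ⟨h1, h2⟩; exact ⟨⟨Nat.pos_of_dvd_of_pos h1 (by omega), (Nat.le_of_dvd (by omega) h1).trans h.2⟩, h1⟩
    · rintro ⟨h1, h2⟩; exact ⟨h2, by omega⟩
  rw [sum_congr rfl h1, sum_comm]
  refine sum_le_sum fun d hd => ?_
  have hd := mem_Icc.1 hd
  rw [← sum_filter, ← sum_image (s := Icc 1 X) (g := fun m => d * m) (f := g)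
    (by intro x _ y _ h; exact Nat.eq_of_mul_eq_mul_left (by omega) h)]
  refine sum_le_sum_of_subset_of_nonneg ?_ fun _ _ _ => hg _
  intro n hn
  obtain ⟨hn, m, rfl⟩ := mem_filter.1 hn
  have hn := mem_Icc.1 hn
  refine mem_image.2 ⟨m, mem_Icc.2 ⟨Nat.pos_of_ne_zero (by rintro rfl; simp at hn), ?_⟩, rfl⟩
  nlinarith

lemma tau_mom_div (X j : ℕ) (hX : 0 < X) : ∑ n ∈ Icc 1 X, (tau n : ℝ) ^ j / n ≤ (1 + Real.log X) ^ (2 ^ j) := by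
  induction j with
  | zero => simpa using harm_le X
  | succ j ih =>
    have h1 : ∑ n ∈ Icc 1 X, (tau n : ℝ) ^ (j+1) / n ≤ (∑ n ∈ Icc 1 X, (tau n : ℝ) ^ j / n) ^ 2 := by
      rw [sq, sum_mul_sum]
      refine le_trans (le_of_eq ?_) ((tau_sum_le X (fun n => (tau n : ℝ) ^ j / n) (fun n => by positivity)).trans ?_)
      · refine sum_congr rfl fun n _ => ?_; ring
      · refine sum_le_sum fun d hd => sum_le_sum fun m hm => ?_
        push_cast
        rw [div_mul_div_comm, ← mul_pow]
        gcongr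
        exact_mod_cast tau_mul_le d m
    calc _ ≤ _ := h1
      _ ≤ ((1 + Real.log X) ^ (2 ^ j)) ^ 2 := by gcongr
      _ = _ := by rw [← pow_mul]; ring_nf

lemma tau_mom (X j : ℕ) (hX : 0 < X) : ∑ n ∈ Icc 1 X, (tau n : ℝ) ^ j ≤ X * (1 + Real.log X) ^ (2 ^ j) := by
  refine le_trans ?_ (mul_le_mul_of_nonneg_left (tau_mom_div X j hX) (by positivity))
  rw [mul_sum]
  refine sum_le_sum fun n hn => ?_
  have h1 := mem_Icc.1 hn
  have h2 : (0:ℝ) < n := by exact_mod_cast h1.1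
  have h3 : (n:ℝ) ≤ X := by exact_mod_cast h1.2
  rw [mul_div_assoc', le_div_iff₀ h2, mul_comm]; gcongr

lemma wk_le_inv (M : ℕ) (x δ : ℝ) (hδ : 0 < δ) (h : δ ≤ di x) : wk M x ≤ 2 / δ := by
  unfold wk
  rw [div_le_div_iff₀ (by have := di_nonneg x; positivity) hδ]
  nlinarith [mul_le_mul_of_nonneg_left h (Nat.cast_nonneg (α := ℝ) M)]

noncomputable def Afun (M q : ℕ) (r : ℕ) : ℝ := if r ≤ 2 then 2 * M else 2 * q / (r - 2 : ℝ)
lemma Afun_nonneg (M q r : ℕ) : 0 ≤ Afun M q r := by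
  unfold Afun; split_ifs with h
  · positivity
  · have : (2:ℝ) ≤ r := by exact_mod_cast (by omega : 2 ≤ r)
    exact div_nonneg (by positivity) (by linarith)

lemma Afun_sum (M q : ℕ) (hq : 0 < q) : ∑ r ∈ range (q+1), Afun M q r ≤ 6 * M + 2 * q * (1 + Real.log q) := by
  have h1 : ∑ r ∈ range (q+1), Afun M q r ≤ ∑ r ∈ range (q + 3), Afun M q r :=
    sum_le_sum_of_subset_of_nonneg (range_mono (by omega)) fun _ _ _ => Afun_nonneg _ _ _
  refine h1.trans ?_
  rw [add_comm q 3, sum_range_add]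
  have h2 : ∑ r ∈ range 3, Afun M q r = 6 * M := by
    simp [sum_range_succ, Afun]; ring
  rw [h2]
  gcongr
  calc ∑ x ∈ range q, Afun M q (3 + x) = 2 * q * ∑ x ∈ range q, (1:ℝ) / (x + 1 : ℕ) := by
        rw [mul_sum]; refine sum_congr rfl fun x _ => ?_
        unfold Afun; rw [if_neg (by omega)]; push_cast; rw [mul_one_div]; congr 1; ring
    _ = 2 * q * ∑ x ∈ Icc 1 q, (1:ℝ) / x := by
        congr 1; rw [range_eq_Ico, sum_Ico_add' (fun x : ℕ => (1:ℝ) / x) 0 q 1]; rfl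
    _ ≤ _ := by gcongr; exact harm_le q

lemma wk_block (M q : ℕ) (hq : 0 < q) (a : ℤ) (ha : IsCoprime a (q:ℤ)) (θ : ℝ) (hθ : |θ - a / q| ≤ 1 / (q:ℝ) ^ 2) (l0 : ℕ) :
    ∑ s ∈ range q, wk M (θ * ((l0 + s : ℕ) : ℝ)) ≤ 12 * M + 4 * q * (1 + Real.log q) := by
  have hq' : (0:ℝ) < q := by exact_mod_cast hq
  have hqz : (0:ℤ) < q := by exact_mod_cast hq
  set t0 : ℤ := ⌊q * (θ * l0)⌋ with ht0
  let r : ℕ → ℕ := fun s => ((t0 + s * a) % q).toNat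
  have hr : ∀ s, ((r s : ℕ) : ℤ) = (t0 + s * a) % q := fun s => Int.toNat_of_nonneg (Int.emod_nonneg _ hqz.ne')
  have hrlt : ∀ s, r s < q := fun s => by
    have := Int.emod_lt_of_pos (t0 + s * a) hqz; rw [← hr] at this; exact_mod_cast this
  have hinj : Set.InjOn r (range q : Finset ℕ) := by
    intro s hs s' hs' h
    have hs := mem_range.1 (mem_coe.1 hs); have hs' := mem_range.1 (mem_coe.1 hs')
    have h1 : (t0 + s * a) % q = (t0 + s' * a) % q := by rw [← hr, ← hr, h]
    have h2 : (q:ℤ) ∣ (s - s') * a := by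
      have := Int.ModEq.dvd (show (t0 + s' * a) ≡ (t0 + s * a) [ZMOD q] from h1.symm)
      convert this using 1; ring
    have h3 : (q:ℤ) ∣ (s - s') := ha.symm.dvd_of_dvd_mul_right h2
    have h4 : ((s:ℤ) - s') = 0 := Int.eq_zero_of_abs_lt_dvd h3 (by rw [abs_lt]; omega)
    omega
  have key : ∀ s ∈ range q, wk M (θ * ((l0 + s : ℕ) : ℝ)) ≤ Afun M q (r s) + Afun M q (q - r s) := by
    intro s hs
    have hs := mem_range.1 hs
    have hA1 := Afun_nonneg M q (r s)
    have hA2 := Afun_nonneg M q (q - r s)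
    have hlt := hrlt s
    by_cases hc : r s ≤ 2
    · have : Afun M q (r s) = 2 * M := by simp [Afun, hc]
      have := wk_le M (θ * ((l0 + s : ℕ) : ℝ)); linarith
    by_cases hc' : q - r s ≤ 2
    · have : Afun M q (q - r s) = 2 * M := by simp [Afun, hc']
      have := wk_le M (θ * ((l0 + s : ℕ) : ℝ)); linarith
    set x := θ * ((l0 + s : ℕ) : ℝ) with hx
    set w := (t0 + s * a) / (q:ℤ) with hw
    have hdecomp : (t0:ℝ) + s * a = q * w + r s := by
      have := Int.mul_ediv_add_emod (t0 + s * a) q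
      rw [← hr] at this; exact_mod_cast this.symm
    have herr : |q * x - (t0 + s * a)| ≤ 2 := by
      have e1 : q * x - (t0 + s * a) = (q * (θ * l0) - t0) + s * (q * (θ - a / q)) := by
        rw [hx]; push_cast; field_simp; ring
      have e2 : |q * (θ * l0) - t0| ≤ 1 := by
        rw [abs_le]; have := Int.floor_le (q * (θ * l0)); have := Int.lt_floor_add_one (q * (θ * l0))
        constructor <;> linarith
      have e3 : |s * (q * (θ - a / q))| ≤ 1 := by
        rw [abs_mul, abs_mul, abs_of_nonneg (Nat.cast_nonneg s), abs_of_pos hq']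
        calc (s:ℝ) * (q * |θ - a / q|) ≤ q * (q * (1 / (q:ℝ)^2)) := by gcongr
          _ = 1 := by field_simp
      rw [e1]; exact (abs_add_le _ _).trans (by linarith)
    have hmin : ∀ B : ℕ, B ≤ r s → B ≤ q - r s → (B:ℝ) - 2 ≤ q * di x := by
      intro B h1 h2
      have h3 : (B:ℝ) ≤ |(q:ℝ) * w + r s - q * round x| := by
        have : (B:ℤ) ≤ |(q:ℤ) * w + r s - q * round x| := by
          rw [show (q:ℤ) * w + r s - q * round x = q * (w - round x) + r s by ring]
          rcases le_or_gt 0 (w - round x) with h | h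
          · refine le_trans ?_ (le_abs_self _); nlinarith [mul_nonneg hqz.le h]
          · refine le_trans ?_ (neg_le_abs _)
            have : w - round x ≤ -1 := by omega
            nlinarith [mul_le_mul_of_nonneg_left this hqz.le, (by omega : (B:ℤ) ≤ q - r s)]
        exact_mod_cast this
      have h4 : q * di x = |q * x - q * round x| := by
        unfold di; rw [← mul_sub, abs_mul, abs_of_pos hq']
      rw [h4, ← hdecomp] at *
      have := abs_sub_abs_le_abs_sub ((t0:ℝ) + s * a - q * round x) (q * x - q * round x)
      have e : |(t0:ℝ) + s * a - q * round x - (q * x - q * round x)| = |q * x - (t0 + s * a)| := by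
        rw [← abs_neg]; congr 1; ring
      rw [e] at this; linarith
    have fin : ∀ B : ℕ, B ≤ r s → B ≤ q - r s → 2 < B → wk M x ≤ Afun M q B := by
      intro B h1 h2 h3
      have h3' : (0:ℝ) < (B:ℝ) - 2 := by
        have : (2:ℝ) < B := by exact_mod_cast h3
        linarith
      unfold Afun; rw [if_neg (by omega)]
      have := wk_le_inv M x ((B - 2) / q) (by positivity) (by
        rw [div_le_iff₀ hq', mul_comm]; exact hmin B h1 h2)
      refine this.trans (le_of_eq ?_)
      field_simp
    rcases le_total (r s) (q - r s) with h | h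
    · have := fin (r s) le_rfl h (by omega); linarith
    · have := fin (q - r s) h le_rfl (by omega); linarith
  refine (sum_le_sum key).trans ?_
  rw [← sum_image (f := fun r => Afun M q r + Afun M q (q - r)) (g := r) hinj]
  have hsub : image r (range q) ⊆ range q := by
    intro x hx; obtain ⟨s, _, rfl⟩ := mem_image.1 hx; exact mem_range.2 (hrlt s)
  refine (sum_le_sum_of_subset_of_nonneg hsub fun _ _ _ => add_nonneg (Afun_nonneg _ _ _) (Afun_nonneg _ _ _)).trans ?_
  have e1 : ∑ r ∈ range q, Afun M q r ≤ ∑ r ∈ range (q+1), Afun M q r :=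
    sum_le_sum_of_subset_of_nonneg (range_mono (by omega)) fun _ _ _ => Afun_nonneg _ _ _
  have e2 : ∑ r ∈ range q, Afun M q (q - r) ≤ ∑ r ∈ range (q+1), Afun M q r := by
    rw [← sum_range_reflect (Afun M q) (q+1)]
    simp only [add_tsub_cancel_right]
    exact sum_le_sum_of_subset_of_nonneg (range_mono (by omega)) fun _ _ _ => Afun_nonneg _ _ _
  rw [sum_add_distrib]
  have := Afun_sum M q hq
  linarith

lemma minsum (M q : ℕ) (hq : 0 < q) (a : ℤ) (ha : IsCoprime a (q:ℤ)) (θ : ℝ) (hθ : |θ - a / q| ≤ 1 / (q:ℝ) ^ 2) (X : ℕ) :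
    ∑ l ∈ Icc 1 X, wk M (θ * l) ≤ (X / q + 1) * (12 * M + 4 * q * (1 + Real.log q)) := by
  have h1 : ∀ K : ℕ, ∑ l ∈ range (q * K), wk M (θ * l) ≤ K * (12 * M + 4 * q * (1 + Real.log q)) := by
    intro K
    induction K with
    | zero => simp
    | succ K ih =>
      rw [mul_add, mul_one, sum_range_add]
      have := wk_block M q hq a ha θ hθ (q * K)
      push_cast at *; linarith
  have hq' : (1:ℝ) ≤ q := by exact_mod_cast hq
  have h0 : 0 ≤ Real.log q := Real.log_nonneg hq'
  have h2 : ∑ l ∈ Icc 1 X, wk M (θ * l) ≤ ∑ l ∈ range (q * (X / q + 1)), wk M (θ * l) := by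
    refine sum_le_sum_of_subset_of_nonneg ?_ fun _ _ _ => wk_nonneg _ _
    intro l hl
    have := (mem_Icc.1 hl).2
    have := Nat.lt_mul_div_succ X hq
    rw [mem_range]; omega
  refine h2.trans ((h1 _).trans ?_)
  gcongr
  push_cast
  gcongr
  exact Nat.cast_div_le

/-! P3: bilinear estimate -/
noncomputable def EE (q X M : ℝ) : ℝ := 1 / q + 1 / X + (1 + Real.log q) / M + q * (1 + Real.log q) / (X * M)

lemma PSLmin (L : List ℕ) (hL : ∀ D ∈ L, 0 < D) (M q c : ℕ) (hM : 0 < M) (hc : 0 < c) (hq : 0 < q) (a : ℤ) (ha : IsCoprime a (q:ℤ)) (θ : ℝ)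
    (hθ : |θ - a / q| ≤ 1 / (q:ℝ) ^ 2) :
    PSL L (fun H => wk M (c * θ * H)) ≤ (L.map (fun D : ℕ => (2 * (D:ℝ)))).prod * M *
      ((L.map (fun D : ℕ => (1 / (D:ℝ)))).sum +
        √(24 * c * (1 + Real.log L.prod) ^ (4 ^ L.length) * EE q L.prod M)) := by
  set f : ℤ → ℝ := fun H => wk M (c * θ * H) with hf
  set j := L.length with hj
  set X := L.prod with hX
  have hX0 : 0 < X := List.prod_pos hL
  have hX0' : (0:ℝ) < X := by exact_mod_cast hX0
  have hM' : (0:ℝ) < M := by exact_mod_cast hM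
  have hc' : (1:ℝ) ≤ c := by exact_mod_cast hc
  have hq' : (1:ℝ) ≤ q := by exact_mod_cast hq
  have hlq : 0 ≤ Real.log q := Real.log_nonneg hq'
  have hlX : 0 ≤ Real.log X := Real.log_nonneg (by exact_mod_cast hX0)
  have hf0 : ∀ n, 0 ≤ f n := fun n => wk_nonneg _ _
  have h1 := PSL_bound L hL f hf0 (fun n => by
    simp only [hf]; push_cast; rw [mul_neg, wk_neg])
  have hprod : (L.map (fun D : ℕ => (2 * (D:ℝ)))).prod = 2 ^ j * X := by
    rw [hj, hX]; clear * -
    induction L with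
    | nil => simp
    | cons D L ih => simp only [List.map_cons, List.prod_cons, ih, List.length_cons]; push_cast; ring
  have hsum : (L.map (fun D : ℕ => (1 / (2 * (D:ℝ))))).sum = (1/2) * (L.map (fun D : ℕ => (1 / (D:ℝ)))).sum := by
    clear * -
    induction L with
    | nil => simp
    | cons D L ih =>
      simp only [List.map_cons, List.sum_cons, ih, mul_add]; congr 1; rw [one_div_mul_one_div]
  rw [hprod, hsum] at h1
  rw [hprod]
  have hSg0 : 0 ≤ (L.map (fun D : ℕ => (1 / (D:ℝ)))).sum := List.sum_nonneg (by intro a ha; simp at ha; obtain ⟨b, _, rfl⟩ := ha; positivity)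
  set Sg := (L.map (fun D : ℕ => (1 / (D:ℝ)))).sum
  -- sums
  have hs : ∑ l ∈ Icc 1 X, f l ≤ (c * X / q + 1) * (12 * M + 4 * q * (1 + Real.log q)) := by
    have h2 : ∑ l ∈ Icc 1 X, f l ≤ ∑ l ∈ Icc 1 (c * X), wk M (θ * l) := by
      rw [sum_congr rfl (g := fun l => (fun l : ℕ => wk M (θ * l)) (c * l)) (by
        intro l _; simp only [hf]; push_cast; congr 1; ring)]
      rw [← sum_image (f := fun l : ℕ => wk M (θ * l)) (g := fun l => c * l) (by intro x _ y _ h; exact Nat.eq_of_mul_eq_mul_left hc h)]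
      refine sum_le_sum_of_subset_of_nonneg ?_ fun _ _ _ => wk_nonneg _ _
      intro x hx
      obtain ⟨l, hl, rfl⟩ := mem_image.1 hx
      have hl := mem_Icc.1 hl
      exact mem_Icc.2 ⟨Nat.mul_pos hc hl.1, Nat.mul_le_mul_left _ hl.2⟩
    refine h2.trans ((minsum M q hq a ha θ hθ (c * X)).trans (le_of_eq ?_))
    push_cast; ring
  have hs2 : ∑ l ∈ Icc 1 X, f l ≤ 12 * c * X * M * EE q X M := by
    refine hs.trans ?_
    have e : 12 * c * X * M * EE q X M = 12 * c * (X / q + 1) * (M + q * (1 + Real.log q)) := by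
      unfold EE; field_simp; ring
    rw [e]
    have a1 : (c * X / q + 1 : ℝ) ≤ c * (X / q + 1) := by rw [mul_add, mul_div_assoc]; linarith
    have a2 : 12 * M + 4 * q * (1 + Real.log q) ≤ 12 * (M + q * (1 + Real.log q)) := by nlinarith [show 0 ≤ (q:ℝ) * (1 + Real.log q) by positivity]
    calc _ ≤ (c * (X / q + 1)) * (12 * (M + q * (1 + Real.log q))) := by gcongr
      _ = _ := by ring
  have hEE : 0 ≤ EE q X M := by unfold EE; positivity
  have hcs : ∑ l ∈ Icc 1 X, (tau l : ℝ) ^ j * f l ≤ X * M * √(24 * c * (1 + Real.log X) ^ (4 ^ j) * EE q X M) := by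
    have h3 := sum_mul_sq_le_sq_mul_sq (Icc 1 X) (fun l => (tau l : ℝ) ^ j) (fun l => f l)
    have h4 : ∑ l ∈ Icc 1 X, ((tau l : ℝ) ^ j) ^ 2 ≤ X * (1 + Real.log X) ^ (4 ^ j) := by
      have := tau_mom X (j * 2) hX0
      simp only [← pow_mul]
      rw [mul_comm j 2, pow_mul 2 2 j] at this
      rw [mul_comm j 2]
      simpa using this
    have h5 : ∑ l ∈ Icc 1 X, (f l) ^ 2 ≤ 2 * M * (12 * c * X * M * EE q X M) := by
      refine le_trans ?_ (mul_le_mul_of_nonneg_left hs2 (by positivity))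
      rw [mul_sum]
      refine sum_le_sum fun l _ => ?_
      rw [sq]; exact mul_le_mul_of_nonneg_right (wk_le _ _) (hf0 _)
    have h6 : (∑ l ∈ Icc 1 X, (tau l : ℝ) ^ j * f l) ^ 2 ≤ (X * M) ^ 2 * (24 * c * (1 + Real.log X) ^ (4 ^ j) * EE q X M) := by
      refine h3.trans ((mul_le_mul h4 h5 (sum_nonneg fun _ _ => sq_nonneg _) (by positivity)).trans (le_of_eq ?_))
      ring
    have h7 := Real.le_sqrt_of_sq_le h6
    rwa [Real.sqrt_mul (by positivity), Real.sqrt_sq (by positivity)] at h7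
  have hf00 : f 0 ≤ 2 * M := wk_le _ _
  refine h1.trans ?_
  calc _ ≤ 2 ^ j * X * (1 / 2 * Sg) * (2 * M) + 2 ^ j * (X * M * √(24 * c * (1 + Real.log X) ^ (4 ^ j) * EE q X M)) := by gcongr
    _ = _ := by ring

lemma Ph_mul_pow (k : ℕ) (β : ℝ) : Ph k β (fun m : ℤ => β * (m:ℝ) ^ k) := by
  have := Ph_poly k (Polynomial.C β * Polynomial.X ^ k) (Polynomial.natDegree_C_mul_X_pow_le _ _)
  simpa using this

lemma Ph_diff (k : ℕ) (P : Polynomial ℝ) (hP : P.natDegree ≤ k) (m m' : ℝ) :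
    Ph k (P.coeff k * (m ^ k - m' ^ k)) (fun d : ℤ => P.eval (d * m) - P.eval (d * m')) := by
  have hd : ∀ m : ℝ, (P.comp (Polynomial.C m * Polynomial.X)).natDegree ≤ k := fun m => by
    refine Polynomial.natDegree_comp_le.trans ?_
    calc _ ≤ P.natDegree * 1 := Nat.mul_le_mul_left _ ((Polynomial.natDegree_C_mul_le _ _).trans Polynomial.natDegree_X_le)
      _ ≤ k := by omega
  have := Ph_poly k (P.comp (Polynomial.C m * Polynomial.X) - P.comp (Polynomial.C m' * Polynomial.X))
    ((Polynomial.natDegree_sub_le _ _).trans (max_le (hd m) (hd m')))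
  rw [Polynomial.coeff_sub, Polynomial.comp_C_mul_X_coeff, Polynomial.comp_C_mul_X_coeff, ← mul_sub] at this
  have e : (fun d : ℤ => P.eval (d * m) - P.eval (d * m')) = fun d : ℤ =>
      (P.comp (Polynomial.C m * Polynomial.X) - P.comp (Polynomial.C m' * Polynomial.X)).eval (d:ℝ) := by
    ext d
    simp only [Polynomial.eval_sub, Polynomial.eval_comp, Polynomial.eval_mul, Polynomial.eval_C, Polynomial.eval_X]
    rw [mul_comm m, mul_comm m']
  rw [e]; exact this

lemma BL_main (κ D M q c0 : ℕ) (hD : 0 < D) (hM : 0 < M) (hc : 0 < c0) (hq : 0 < q) (a : ℤ) (ha : IsCoprime a (q:ℤ)) (θ : ℝ)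
    (hθ : |θ - a / q| ≤ 1 / (q:ℝ) ^ 2) (P : Polynomial ℝ) (hP : P.natDegree ≤ κ+1) (hPc : P.coeff (κ+1) = c0 * θ)
    (a1 a2 b1 b2 : ℤ) (hI : a2 - a1 ≤ D) (hJ : b2 - b1 ≤ M) (u v : ℤ → ℂ) (hu : ∀ d, ‖u d‖ ≤ 1) (hv : ∀ m, ‖v m‖ ≤ 1) :
    ((‖∑ d ∈ Ico a1 a2, ∑ m ∈ Ico b1 b2, u d * v m * ee (P.eval (d * m : ℝ))‖) / (D * M)) ^ (2 * 2 ^ (κ+1) * 2 ^ κ) ≤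
      2 ^ (2 ^ (κ+1) * 2 ^ κ) * ((κ+1) * (1 / D + 1 / M) +
        √(24 * ((κ+1).factorial ^ 2 * c0) * (1 + Real.log (D ^ (κ+1) * M ^ κ)) ^ (4 ^ (2*κ+1)) * EE q (D ^ (κ+1) * M ^ κ) M)) := by
  have hD' : (0:ℝ) < D := by exact_mod_cast hD
  have hM' : (0:ℝ) < M := by exact_mod_cast hM
  set S := ∑ d ∈ Ico a1 a2, ∑ m ∈ Ico b1 b2, u d * v m * ee (P.eval (d * m : ℝ)) with hS
  set n := 2 ^ (κ+1) with hn
  set n' := 2 ^ κ with hn'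
  set k := κ + 1 with hk
  obtain ⟨r, hr⟩ : ∃ r, n = r + 1 := ⟨n - 1, by have : 0 < n := by positivity
                                                omega⟩
  obtain ⟨r', hr'⟩ : ∃ r, n' = r + 1 := ⟨n' - 1, by have : 0 < n' := by positivity
                                                    omega⟩
  set J := Ico b1 b2 with hJd
  have hJc : (J.card : ℝ) ≤ M := by
    rw [hJd, Int.card_Ico]; exact_mod_cast (by omega : (b2 - b1).toNat ≤ M)
  have hIc : ((Ico a1 a2).card : ℝ) ≤ D := by
    rw [Int.card_Ico]; exact_mod_cast (by omega : (a2 - a1).toNat ≤ D)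
  let T : ℤ × ℤ → ℝ := fun x => ‖∑ d ∈ Ico a1 a2, ee (P.eval (d * x.1 : ℝ) - P.eval (d * x.2 : ℝ))‖
  have s1 : ‖S‖ ^ 2 ≤ D * ∑ x ∈ J ×ˢ J, T x := by
    have e1 : ‖S‖ ≤ ∑ d ∈ Ico a1 a2, ‖∑ m ∈ J, v m * ee (P.eval (d * m : ℝ))‖ := by
      refine (norm_sum_le _ _).trans (sum_le_sum fun d _ => ?_)
      simp only [mul_assoc]
      rw [← mul_sum, norm_mul]
      exact mul_le_of_le_one_left (norm_nonneg _) (hu d)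
    have e2 : ‖S‖ ^ 2 ≤ D * ∑ d ∈ Ico a1 a2, ‖∑ m ∈ J, v m * ee (P.eval (d * m : ℝ))‖ ^ 2 := by
      refine (pow_le_pow_left₀ (norm_nonneg _) e1 2).trans ((pow_sum_le_card_mul_sum_pow (fun _ _ => norm_nonneg _) 1).trans ?_)
      rw [pow_one]; gcongr
    refine e2.trans (mul_le_mul_of_nonneg_left ?_ hD'.le)
    have e3 : ((∑ d ∈ Ico a1 a2, ‖∑ m ∈ J, v m * ee (P.eval (d * m : ℝ))‖ ^ 2 : ℝ) : ℂ) =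
        ∑ x ∈ J ×ˢ J, v x.1 * (starRingEnd ℂ) (v x.2) * ∑ d ∈ Ico a1 a2, ee (P.eval (d * x.1 : ℝ) - P.eval (d * x.2 : ℝ)) := by
      push_cast
      simp only [mul_sum]
      rw [sum_comm]
      refine sum_congr rfl fun d _ => ?_
      rw [← Complex.mul_conj', map_sum, sum_mul_sum, sum_product]
      refine sum_congr rfl fun m _ => sum_congr rfl fun m' _ => ?_
      rw [ee_sub, map_mul]; ring
    have e4 : ∑ d ∈ Ico a1 a2, ‖∑ m ∈ J, v m * ee (P.eval (d * m : ℝ))‖ ^ 2 =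
        ‖((∑ d ∈ Ico a1 a2, ‖∑ m ∈ J, v m * ee (P.eval (d * m : ℝ))‖ ^ 2 : ℝ) : ℂ)‖ := by
      rw [Complex.norm_real, Real.norm_of_nonneg]; positivity
    rw [e4, e3]
    refine (norm_sum_le _ _).trans (sum_le_sum fun x _ => ?_)
    rw [norm_mul, norm_mul, RCLike.norm_conj]
    exact mul_le_of_le_one_left (norm_nonneg _) (mul_le_one₀ (hv _) (norm_nonneg _) (hv _))
  have s2 : ‖S‖ ^ (2 * n) ≤ D ^ n * ((M:ℝ) ^ 2) ^ r * ∑ x ∈ J ×ˢ J, T x ^ n := by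
    rw [pow_mul]
    refine (pow_le_pow_left₀ (by positivity) s1 n).trans ?_
    rw [mul_pow, mul_assoc]
    refine mul_le_mul_of_nonneg_left ?_ (by positivity)
    rw [hr]
    refine (pow_sum_le_card_mul_sum_pow (fun _ _ => norm_nonneg _) r).trans ?_
    refine mul_le_mul_of_nonneg_right ?_ (sum_nonneg fun _ _ => by positivity)
    gcongr
    rw [card_product, sq]; push_cast; gcongr
  let σ : ℤ → ℝ := fun H => ‖∑ m ∈ J, ee ((k.factorial : ℝ) * H * (c0 * θ) * m ^ k)‖
  have s3 := weyl_W0 (J ×ˢ J) D κ a1 a2 hI (fun x d => P.eval (d * x.1 : ℝ) - P.eval (d * x.2 : ℝ))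
    (fun x => P.coeff k * ((x.1:ℝ) ^ k - (x.2:ℝ) ^ k)) (fun x => Ph_diff k P hP x.1 x.2)
  have s3' : ∀ H : ℤ, ‖∑ x ∈ J ×ˢ J, ee (((κ+1).factorial : ℝ) * H * (P.coeff k * ((x.1:ℝ) ^ k - (x.2:ℝ) ^ k)))‖ = σ H ^ 2 := by
    intro H
    have : ∑ x ∈ J ×ˢ J, ee (((κ+1).factorial : ℝ) * H * (P.coeff k * ((x.1:ℝ) ^ k - (x.2:ℝ) ^ k))) =
       (∑ m ∈ J, ee ((k.factorial : ℝ) * H * (c0 * θ) * m ^ k)) * (starRingEnd ℂ) (∑ m ∈ J, ee ((k.factorial : ℝ) * H * (c0 * θ) * m ^ k)) := by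
      rw [map_sum, sum_mul_sum, sum_product]
      refine sum_congr rfl fun m _ => sum_congr rfl fun m' _ => ?_
      rw [← ee_sub, hPc]; congr 1; ring
    rw [this, norm_mul, RCLike.norm_conj, sq]
  simp only [s3'] at s3
  set A := PSL (List.replicate (κ+1) D) (fun H => σ H ^ 2) with hA
  have hA0 : 0 ≤ A := PSL_nonneg _ fun _ => by positivity
  have hσ0 : ∀ H, 0 ≤ σ H := fun H => norm_nonneg _
  have hσM : ∀ H, σ H ≤ M := fun H => by
    refine (norm_sum_le _ _).trans ?_
    simp only [norm_ee, sum_const, nsmul_eq_mul, mul_one]; exact hJc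
  have s4 : (‖S‖ / (D * M)) ^ (2 * n) ≤ 2 ^ r * (A / ((2 * D) ^ k * M ^ 2)) := by
    have e1 : ∑ x ∈ J ×ˢ J, T x ^ n ≤ (2 * D : ℝ) ^ n * D * A / (2 * D) ^ (κ+2) := by
      rw [le_div_iff₀ (by positivity), mul_comm]; exact s3
    rw [div_pow, div_le_iff₀ (by positivity)]
    refine (s2.trans (mul_le_mul_of_nonneg_left e1 (by positivity))).trans (le_of_eq ?_)
    rw [hr, hk]; field_simp; ring
  have hmap : ∀ (j D : ℕ), ((List.replicate j D).map (fun D : ℕ => (2 * (D:ℝ)))).prod = (2 * D : ℝ) ^ j := by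
    intro j D; simp
  have s5 : (A / ((2 * D) ^ k * M ^ 2)) ^ n' ≤ PSL (List.replicate k D) (fun H => σ H ^ n') / ((2 * D) ^ k * M ^ n') := by
    have e1 := PSL_pow (List.replicate k D) r' (fun H => σ H ^ 2) (fun _ => by positivity)
    rw [hmap, ← hr'] at e1
    have e2 : PSL (List.replicate k D) (fun H => (σ H ^ 2) ^ n') ≤ M ^ n' * PSL (List.replicate k D) (fun H => σ H ^ n') := by
      rw [← PSL_smul]
      refine PSL_mono _ fun H => ?_
      rw [← pow_mul, two_mul, pow_add]
      have := hσ0 H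
      gcongr
      exact hσM H
    rw [div_pow, div_le_div_iff₀ (by positivity) (by positivity)]
    calc A ^ n' * ((2 * D) ^ k * M ^ n') ≤ (((2 * D:ℝ) ^ k) ^ r' * (M ^ n' * PSL (List.replicate k D) (fun H => σ H ^ n'))) * ((2 * D) ^ k * M ^ n') := by
          gcongr; exact e1.trans (by gcongr)
      _ = _ := by rw [hr', mul_pow]; ring
  set L := List.replicate k D ++ List.replicate κ M with hL
  have s6 : PSL (List.replicate k D) (fun H => σ H ^ n') ≤ (2 * M) ^ n' / (2 * M) ^ k * PSL L (fun H => wk M ((k.factorial ^ 2 * c0 : ℕ) * θ * H)) := by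
    rw [hL, PSL_append, ← PSL_smul]
    refine PSL_mono _ fun H => ?_
    have := weyl_W M κ b1 b2 hJ (fun m => (k.factorial : ℝ) * H * (c0 * θ) * m ^ k) ((k.factorial : ℝ) * H * (c0 * θ)) (Ph_mul_pow k _)
    rw [div_mul_eq_mul_div, le_div_iff₀ (by positivity), mul_comm]
    refine this.trans (le_of_eq ?_)
    congr 2; ext H'; congr 1; push_cast; ring
  have hLpos : ∀ D' ∈ L, 0 < D' := by
    intro D' h; rw [hL, List.mem_append, List.mem_replicate, List.mem_replicate] at h
    rcases h with h | h <;> rw [h.2] <;> assumption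
  have s7 := PSLmin L hLpos M q (k.factorial ^ 2 * c0) hM (by positivity) hq a ha θ hθ
  have hp1 : (L.map (fun D : ℕ => (2 * (D:ℝ)))).prod = (2 * D) ^ k * (2 * M) ^ κ := by
    rw [hL, List.map_append, List.prod_append, hmap, hmap]
  have hp2 : (L.map (fun D : ℕ => (1 / (D:ℝ)))).sum = k / D + κ / M := by
    rw [hL, List.map_append, List.sum_append]; simp [div_eq_mul_inv]
  have hp3 : (L.prod : ℝ) = D ^ k * M ^ κ := by
    rw [hL, List.prod_append]; simp
  have hp4 : L.length = 2 * κ + 1 := by rw [hL]; simp; omega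
  rw [hp1, hp2, hp3, hp4] at s7
  set R := √(24 * ((k.factorial ^ 2 * c0 : ℕ):ℝ) * (1 + Real.log (D ^ k * M ^ κ)) ^ (4 ^ (2*κ+1)) * EE q (D ^ k * M ^ κ) M) with hR
  have hR0 : 0 ≤ R := Real.sqrt_nonneg _
  have s8 : (A / ((2 * D) ^ k * M ^ 2)) ^ n' ≤ 2 ^ n' * ((k / D + κ / M) + R) := by
    refine s5.trans ?_
    rw [div_le_iff₀ (by positivity)]
    refine (s6.trans (mul_le_mul_of_nonneg_left s7 (by positivity))).trans ?_
    have : (2 * M : ℝ) ^ n' / (2 * M) ^ k * ((2 * D) ^ k * (2 * M) ^ κ * M * (k / D + κ / M + R)) =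
      1/2 * (2 ^ n' * (k / D + κ / M + R) * ((2 * D) ^ k * M ^ n')) := by
      rw [hk]; field_simp; ring
    rw [this]
    have : 0 ≤ (2 ^ n' * (k / D + κ / M + R) * ((2 * D) ^ k * M ^ n')) := by positivity
    linarith
  calc (‖S‖ / (D * M)) ^ (2 * n * n') = ((‖S‖ / (D * M)) ^ (2 * n)) ^ n' := by rw [pow_mul]
    _ ≤ (2 ^ r * (A / ((2 * D) ^ k * M ^ 2))) ^ n' := by gcongr
    _ = (2 ^ r) ^ n' * (A / ((2 * D) ^ k * M ^ 2)) ^ n' := by rw [mul_pow]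
    _ ≤ (2 ^ r) ^ n' * (2 ^ n' * ((k / D + κ / M) + R)) := by gcongr
    _ = 2 ^ (n * n') * ((k / D + κ / M) + R) := by rw [hr]; ring
    _ ≤ _ := by
      rw [hR]
      push_cast
      gcongr
      rw [hk, mul_add, mul_one_div, mul_one_div]
      push_cast
      gcongr
      linarith

/-- normalized error -/
noncomputable def E2 (k : ℕ) (q D M : ℝ) : ℝ := 1 / q + 1 / D + (1 + Real.log q) / M + q * (1 + Real.log q) / (D * M) ^ k

set_option maxHeartbeats 800000 in
lemma BL (k c0 : ℕ) (hk : 0 < k) (hc : 0 < c0) : ∃ C : ℕ, ∀ (D M q : ℕ) (_ : 0 < D) (_ : 0 < M) (_ : 0 < q) (a : ℤ) (_ : IsCoprime a (q:ℤ)) (θ : ℝ)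
    (_ : |θ - a / q| ≤ 1 / (q:ℝ) ^ 2) (P : Polynomial ℝ) (_ : P.natDegree ≤ k) (_ : P.coeff k = c0 * θ)
    (a1 a2 b1 b2 : ℤ) (_ : a2 - a1 ≤ D) (_ : b2 - b1 ≤ M) (u v : ℤ → ℂ) (_ : ∀ d, ‖u d‖ ≤ 1) (_ : ∀ m, ‖v m‖ ≤ 1),
    ((‖∑ d ∈ Ico a1 a2, ∑ m ∈ Ico b1 b2, u d * v m * ee (P.eval (d * m : ℝ))‖) / (D * M)) ^ (2 ^ (2 * k)) ≤
      C * (1 + Real.log (D * M)) ^ C * √(E2 k q D M) := by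
  obtain ⟨κ, rfl⟩ : ∃ κ, k = κ + 1 := ⟨k - 1, by omega⟩
  obtain ⟨K0, hK0⟩ : ∃ K0 : ℕ, K0 = 24 * ((κ+1).factorial ^ 2 * c0) := ⟨_, rfl⟩
  obtain ⟨pw, hpw⟩ : ∃ pw : ℕ, pw = 4 ^ (2*κ+1) := ⟨_, rfl⟩
  obtain ⟨nn, hnn⟩ : ∃ nn : ℕ, nn = 2 ^ (κ+1) * 2 ^ κ := ⟨_, rfl⟩
  obtain ⟨C, hC⟩ : ∃ C : ℕ, C = 2 ^ nn * ((κ+1) + K0 * (κ+1) ^ pw) + pw := ⟨_, rfl⟩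
  have hK1 : (1:ℝ) ≤ K0 := by exact_mod_cast (by rw [hK0]; positivity : 0 < K0)
  refine ⟨C, ?_⟩
  intro D M q hD hM hq a ha θ hθ P hP hPc a1 a2 b1 b2 hI hJ u v hu hv
  have hD' : (1:ℝ) ≤ D := by exact_mod_cast hD
  have hM' : (1:ℝ) ≤ M := by exact_mod_cast hM
  have hq' : (1:ℝ) ≤ q := by exact_mod_cast hq
  have hlq : 0 ≤ Real.log q := Real.log_nonneg hq'
  have hmain := BL_main κ D M q c0 hD hM hc hq a ha θ hθ P hP hPc a1 a2 b1 b2 hI hJ u v hu hv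
  set S := ∑ d ∈ Ico a1 a2, ∑ m ∈ Ico b1 b2, u d * v m * ee (P.eval (d * m : ℝ)) with hS
  have hexp : 2 * 2 ^ (κ+1) * 2 ^ κ = 2 ^ (2 * (κ+1)) := by ring
  have hK0' : (24 * ((κ+1).factorial ^ 2 * c0) : ℝ) = K0 := by rw [hK0]; push_cast; ring
  rw [hexp, ← hpw, ← hnn, hK0'] at hmain
  have hlDM : 0 ≤ Real.log (D * M) := Real.log_nonneg (by nlinarith)
  set l := 1 + Real.log (D * M) with hl
  have hl1 : 1 ≤ l := by linarith
  have hE0 : 0 ≤ E2 (κ+1) q D M := by unfold E2; positivity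
  have hCpw : pw ≤ C := by omega
  have hC1 : (2:ℝ) ^ nn * ((κ+1) + K0 * (κ+1) ^ pw) ≤ C := by rw [hC]; push_cast; linarith [show (0:ℝ) ≤ pw by positivity]
  have hC2 : (1:ℝ) ≤ C := by
    refine le_trans ?_ hC1
    have : (1:ℝ) ≤ 2 ^ nn := one_le_pow₀ (by norm_num)
    have : (0:ℝ) ≤ K0 * (κ+1) ^ pw := by positivity
    have : (0:ℝ) ≤ κ := by positivity
    nlinarith
  have hS1 : ‖S‖ / (D * M) ≤ 1 := by
    rw [div_le_one (by positivity)]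
    refine (norm_sum_le _ _).trans ?_
    calc _ ≤ ∑ d ∈ Ico a1 a2, (M:ℝ) := by
          refine sum_le_sum fun d _ => (norm_sum_le _ _).trans ?_
          calc _ ≤ ∑ m ∈ Ico b1 b2, (1:ℝ) := by
                refine sum_le_sum fun m _ => ?_
                rw [norm_mul, norm_mul, norm_ee, mul_one]; exact mul_le_one₀ (hu _) (norm_nonneg _) (hv _)
            _ ≤ M := by
              simp only [sum_const, Int.card_Ico, nsmul_eq_mul, mul_one]
              exact_mod_cast (by omega : (b2 - b1).toNat ≤ M)
      _ ≤ _ := by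
          simp only [sum_const, Int.card_Ico, nsmul_eq_mul]
          gcongr
          exact_mod_cast (by omega : (a2 - a1).toNat ≤ D)
  clear_value S l
  clear hS hu hv hI hJ hP hPc hθ ha hC hexp hnn hpw hK0' hK0
  by_cases hbig : 1 ≤ E2 (κ+1) q D M
  · refine (pow_le_one₀ (by positivity) hS1).trans ?_
    have h1 : 1 ≤ √(E2 (κ+1) q D M) := Real.one_le_sqrt.2 hbig
    have h2 : 1 ≤ l ^ C := one_le_pow₀ hl1
    exact one_le_mul_of_one_le_of_one_le (one_le_mul_of_one_le_of_one_le hC2 h2) h1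
  push Not at hbig
  set E := E2 (κ+1) q D M with hE
  have hEs : E ≤ √E := by
    apply Real.le_sqrt_of_sq_le; nlinarith
  have hX1 : (D:ℝ) ≤ D ^ (κ+1) * M ^ κ := by
    rw [pow_succ]
    nlinarith [one_le_mul_of_one_le_of_one_le (one_le_pow₀ hD' : (1:ℝ) ≤ D ^ κ) (one_le_pow₀ hM' : (1:ℝ) ≤ M ^ κ)]
  have hEE : EE q (D ^ (κ+1) * M ^ κ) M ≤ E := by
    rw [hE]; unfold EE E2
    have e : ((D:ℝ) * M) ^ (κ+1) = D ^ (κ+1) * M ^ κ * M := by rw [mul_pow]; ring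
    rw [e]
    gcongr
  have hEE0 : 0 ≤ EE q (D ^ (κ+1) * M ^ κ) M := by unfold EE; positivity
  have hlog : 1 + Real.log (D ^ (κ+1) * M ^ κ) ≤ (κ+1) * l := by
    have h1 : Real.log (D ^ (κ+1) * M ^ κ) ≤ Real.log ((D * M) ^ (κ+1)) := by
      apply Real.log_le_log (by positivity)
      rw [mul_pow]; gcongr
      omega
    rw [Real.log_pow] at h1
    push_cast at h1
    rw [hl]; clear hmain; nlinarith [show (0:ℝ) ≤ κ by positivity]
  have hlog0 : 0 ≤ 1 + Real.log ((D:ℝ) ^ (κ+1) * M ^ κ) := by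
    have := Real.log_nonneg (hD'.trans hX1); linarith
  have hfirst : (1:ℝ) / D + 1 / M ≤ E := by
    rw [hE]; unfold E2
    have h1 : (1:ℝ) / M ≤ (1 + Real.log q) / M := by gcongr; linarith
    have h2 : 0 ≤ 1 / (q:ℝ) := by positivity
    have h3 : 0 ≤ q * (1 + Real.log q) / ((D:ℝ) * M) ^ (κ+1) := by positivity
    linarith
  have hsq : √(K0 * (1 + Real.log (D ^ (κ+1) * M ^ κ)) ^ pw * EE q (D ^ (κ+1) * M ^ κ) M) ≤
      K0 * ((κ+1) * l) ^ pw * √E := by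
    have h0 : (1:ℝ) ≤ ((κ+1) * l) ^ pw := one_le_pow₀ (one_le_mul_of_one_le_of_one_le (by linarith [show (0:ℝ) ≤ κ by positivity]) hl1)
    calc _ ≤ √((K0 * ((κ+1) * l) ^ pw) * E) := by
          apply Real.sqrt_le_sqrt
          gcongr
      _ ≤ √((K0 * ((κ+1) * l) ^ pw) ^ 2 * E) := by
          apply Real.sqrt_le_sqrt
          gcongr
          exact le_self_pow₀ (one_le_mul_of_one_le_of_one_le hK1 h0) (by norm_num)
      _ = _ := by rw [Real.sqrt_mul (by positivity), Real.sqrt_sq (by positivity)]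
  refine hmain.trans ?_
  have hlp : 1 ≤ l ^ pw := one_le_pow₀ hl1
  calc _ ≤ 2 ^ nn * ((κ+1) * √E + K0 * ((κ+1) * l) ^ pw * √E) := by
        gcongr
        exact hfirst.trans hEs
    _ ≤ 2 ^ nn * ((κ+1) * l ^ pw * √E + K0 * ((κ+1) * l) ^ pw * √E) := by
        gcongr
        exact le_mul_of_one_le_right (by positivity) hlp
    _ = (2 ^ nn * ((κ+1) + K0 * (κ+1) ^ pw)) * l ^ pw * √E := by rw [mul_pow]; ring
    _ ≤ C * l ^ C * √E := by gcongr

noncomputable def E1 (k : ℕ) (q M : ℝ) : ℝ := 1 / q + (1 + Real.log q) / M + q * (1 + Real.log q) / M ^ k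

lemma Ph_scale (k : ℕ) (P : Polynomial ℝ) (hP : P.natDegree ≤ k) (m : ℝ) :
    Ph k (P.coeff k * m ^ k) (fun d : ℤ => P.eval (m * d)) := by
  have hd : (P.comp (Polynomial.C m * Polynomial.X)).natDegree ≤ k := by
    refine Polynomial.natDegree_comp_le.trans ?_
    calc _ ≤ P.natDegree * 1 := Nat.mul_le_mul_left _ ((Polynomial.natDegree_C_mul_le _ _).trans Polynomial.natDegree_X_le)
      _ ≤ k := by omega
  have := Ph_poly k _ hd
  rw [Polynomial.comp_C_mul_X_coeff] at this
  simpa only [Polynomial.eval_comp, Polynomial.eval_mul, Polynomial.eval_C, Polynomial.eval_X] using this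

lemma di_lower (q : ℕ) (hq : 0 < q) (a : ℤ) (ha : IsCoprime a (q:ℤ)) (θ : ℝ) (hθ : |θ - a / q| ≤ 1 / (q:ℝ) ^ 2)
    (c : ℕ) (hc : 0 < c) (hcq : 2 * c < q) : 1 / (2 * q) ≤ di (c * θ) := by
  have hq' : (0:ℝ) < q := by exact_mod_cast hq
  set z := round (c * θ) with hz
  have h1 : (c:ℤ) * a - q * z ≠ 0 := by
    intro h
    have : (q:ℤ) ∣ c * a := ⟨z, by linarith⟩
    have h2 : (q:ℤ) ∣ c := ha.symm.dvd_of_dvd_mul_right this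
    have := Nat.le_of_dvd hc (Int.natCast_dvd_natCast.1 h2)
    omega
  have h2 : (1:ℝ) ≤ |(c:ℝ) * a - q * z| := by exact_mod_cast Int.one_le_abs h1
  have h3 : |(c:ℝ) * (θ - a / q)| ≤ 1 / (2 * q) := by
    rw [abs_mul, abs_of_nonneg (Nat.cast_nonneg c)]
    have : (2 * c : ℝ) ≤ q := by exact_mod_cast hcq.le
    calc (c:ℝ) * |θ - a / q| ≤ (q / 2) * (1 / (q:ℝ)^2) := by gcongr; linarith
      _ = _ := by field_simp
  have h4 : |(c:ℝ) * a / q - z| = |(c:ℝ) * a - q * z| / q := by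
    rw [← abs_of_pos hq', ← abs_div, abs_of_pos hq']; congr 1; field_simp
  have h5 : 1 / (q:ℝ) ≤ |(c:ℝ) * a / q - z| := by rw [h4]; gcongr
  have h6 : |(c:ℝ) * a / q - z| ≤ di (c * θ) + |(c:ℝ) * (θ - a / q)| := by
    unfold di; rw [← hz, abs_sub_comm]
    have e : (z:ℝ) - c * a / q = -(c * θ - z) + c * (θ - a / q) := by ring
    rw [e]; refine (abs_add_le _ _).trans ?_; rw [abs_neg]
  have e : 1 / (q:ℝ) = 1 / (2 * q) + 1 / (2 * q) := by field_simp; norm_num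
  linarith

lemma SW_one (c0 : ℕ) (hc : 0 < c0) (M q d : ℕ) (hM : 0 < M) (hq : 0 < q) (hd : 0 < d) (a : ℤ) (ha : IsCoprime a (q:ℤ)) (θ : ℝ)
    (hθ : |θ - a / q| ≤ 1 / (q:ℝ) ^ 2) (P : Polynomial ℝ) (hP : P.natDegree ≤ 1) (hPc : P.coeff 1 = c0 * θ)
    (b1 b2 : ℤ) (hJ : b2 - b1 ≤ M) :
    ‖∑ m ∈ Ico b1 b2, ee (P.eval (d * m : ℝ))‖ / M ≤ 4 * c0 * d * (1 / q + q / M) := by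
  have hM' : (0:ℝ) < M := by exact_mod_cast hM
  have hq' : (0:ℝ) < q := by exact_mod_cast hq
  have h1 := geom_bound b1 b2 M hJ _ _ (Ph_scale 1 P hP d)
  have hcd : (1:ℝ) ≤ c0 * d := by exact_mod_cast Nat.mul_pos hc hd
  rw [div_le_iff₀ hM']
  refine h1.trans ?_
  by_cases h : 2 * (c0 * d) < q
  · have h2 := di_lower q hq a ha θ hθ (c0 * d) (Nat.mul_pos hc hd) h
    rw [hPc, show c0 * θ * (d:ℝ) ^ 1 = ((c0 * d : ℕ):ℝ) * θ by push_cast; ring]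
    refine (wk_le_inv M _ _ (by positivity) h2).trans ?_
    have e : 4 * c0 * d * (1 / q + q / M) * (M:ℝ) = 4 * (c0 * d) * (M / q + q) := by field_simp
    rw [e, div_div_eq_mul_div]
    have : 0 ≤ (M:ℝ) / q := by positivity
    nlinarith [mul_le_mul_of_nonneg_right hcd (by positivity : 0 ≤ (M:ℝ) / q + q)]
  · refine (wk_le _ _).trans ?_
    have h3 : (q:ℝ) ≤ 2 * (c0 * d) := by exact_mod_cast (by omega : q ≤ 2 * (c0 * d))
    have : 1 ≤ 2 * (c0 * d) * (1 / (q:ℝ)) := by rw [mul_one_div, le_div_iff₀ hq']; linarith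
    have h4 : 0 ≤ (q:ℝ) / M := by positivity
    have h5 : 2 ≤ 4 * c0 * d * (1 / q + q / (M:ℝ)) := by nlinarith [mul_nonneg (by positivity : (0:ℝ) ≤ 4 * c0 * d) h4]
    nlinarith

lemma SW_main (κ c0 : ℕ) (hc : 0 < c0) (M q d : ℕ) (hM : 0 < M) (hq : 0 < q) (hd : 0 < d) (a : ℤ) (ha : IsCoprime a (q:ℤ)) (θ : ℝ)
    (hθ : |θ - a / q| ≤ 1 / (q:ℝ) ^ 2) (P : Polynomial ℝ) (hP : P.natDegree ≤ κ+1) (hPc : P.coeff (κ+1) = c0 * θ)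
    (b1 b2 : ℤ) (hJ : b2 - b1 ≤ M) :
    (‖∑ m ∈ Ico b1 b2, ee (P.eval (d * m : ℝ))‖ / M) ^ (2 ^ κ) ≤ 2 ^ (2 ^ κ) * (κ / M +
        √(24 * ((κ+1).factorial * c0 * d ^ (κ+1)) * (1 + Real.log (M ^ κ)) ^ (4 ^ κ) * EE q (M ^ κ) M)) := by
  have hM' : (0:ℝ) < M := by exact_mod_cast hM
  have h1 := weyl_W M κ b1 b2 hJ _ _ (Ph_scale (κ+1) P hP d)
  have h2 := PSLmin (List.replicate κ M) (by intro D h; rw [List.mem_replicate] at h; omega) M q ((κ+1).factorial * c0 * d ^ (κ+1)) hM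
    (by positivity) hq a ha θ hθ
  have e : (fun H : ℤ => wk M (((κ+1).factorial : ℝ) * H * (P.coeff (κ+1) * d ^ (κ+1)))) = fun H : ℤ => wk M (((κ+1).factorial * c0 * d ^ (κ+1) : ℕ) * θ * H) := by
    ext H; congr 1; rw [hPc]; push_cast; ring
  rw [e] at h1
  have e1 : ((List.replicate κ M).map (fun D : ℕ => (2 * (D:ℝ)))).prod = (2 * M) ^ κ := by simp
  have e2 : ((List.replicate κ M).map (fun D : ℕ => (1 / (D:ℝ)))).sum = κ / M := by simp [div_eq_mul_inv]
  have e3 : ((List.replicate κ M).prod : ℝ) = M ^ κ := by simp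
  rw [e1, e2, e3, List.length_replicate] at h2
  push_cast at h2
  set R := √(24 * ((κ+1).factorial * c0 * d ^ (κ+1)) * (1 + Real.log (M ^ κ)) ^ (4 ^ κ) * EE q (M ^ κ) M) with hR
  have hR0 : 0 ≤ R := Real.sqrt_nonneg _
  have h3 : (2 * M : ℝ) ^ (κ+1) * ‖∑ m ∈ Ico b1 b2, ee (P.eval (d * m : ℝ))‖ ^ (2 ^ κ) ≤ (2 * M) ^ (2 ^ κ) * ((2 * M) ^ κ * M * (κ / M + R)) := by
    refine h1.trans ?_
    push_cast
    gcongr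
  rw [div_pow, div_le_iff₀ (by positivity)]
  have h4 : (2 * M : ℝ) ^ (2 ^ κ) * ((2 * M) ^ κ * M * (κ / M + R)) = (2 * M) ^ (κ+1) * (1/2 * (2 ^ (2 ^ κ) * (κ / M + R) * M ^ (2 ^ κ))) := by
    rw [mul_pow (2:ℝ) (M:ℝ) (2^κ)]; ring
  rw [h4] at h3
  have h5 := le_of_mul_le_mul_left h3 (by positivity)
  have : 0 ≤ 2 ^ (2 ^ κ) * (κ / M + R) * (M:ℝ) ^ (2 ^ κ) := by positivity
  linarith

lemma sqrt_ge_self {x : ℝ} (h0 : 0 ≤ x) (h : x ≤ 1) : x ≤ √x := by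
  apply Real.le_sqrt_of_sq_le; nlinarith

lemma SW (k c0 : ℕ) (hk : 0 < k) (hc : 0 < c0) : ∃ C : ℕ, ∀ (M q d : ℕ) (_ : 0 < M) (_ : 0 < q) (_ : 0 < d) (a : ℤ) (_ : IsCoprime a (q:ℤ)) (θ : ℝ)
    (_ : |θ - a / q| ≤ 1 / (q:ℝ) ^ 2) (P : Polynomial ℝ) (_ : P.natDegree ≤ k) (_ : P.coeff k = c0 * θ)
    (b1 b2 : ℤ) (_ : b2 - b1 ≤ M),
    (‖∑ m ∈ Ico b1 b2, ee (P.eval (d * m : ℝ))‖ / M) ^ (2 ^ (2 * k)) ≤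
      C * d ^ C * (1 + Real.log M) ^ C * √(E1 k q M) := by
  obtain ⟨κ, rfl⟩ : ∃ κ, k = κ + 1 := ⟨k - 1, by omega⟩
  obtain ⟨K0, hK0⟩ : ∃ K0 : ℕ, K0 = 48 * ((κ+1).factorial * c0) := ⟨_, rfl⟩
  obtain ⟨pw, hpw⟩ : ∃ pw : ℕ, pw = 4 ^ κ := ⟨_, rfl⟩
  obtain ⟨nn, hnn⟩ : ∃ nn : ℕ, nn = 2 ^ κ := ⟨_, rfl⟩
  obtain ⟨C, hC⟩ : ∃ C : ℕ, C = 2 ^ nn * (κ + K0 * (κ+1) ^ pw) + pw + (κ+1) + 4 * c0 := ⟨_, rfl⟩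
  have hK1 : (1:ℝ) ≤ K0 := by exact_mod_cast (by rw [hK0]; positivity : 0 < K0)
  refine ⟨C, ?_⟩
  intro M q d hM hq hd a ha θ hθ P hP hPc b1 b2 hJ
  have hM' : (1:ℝ) ≤ M := by exact_mod_cast hM
  have hq' : (1:ℝ) ≤ q := by exact_mod_cast hq
  have hd' : (1:ℝ) ≤ d := by exact_mod_cast hd
  have hc' : (1:ℝ) ≤ c0 := by exact_mod_cast hc
  have hlq : 0 ≤ Real.log q := Real.log_nonneg hq'
  have hl0 : 0 ≤ Real.log M := Real.log_nonneg hM'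
  set l := 1 + Real.log M with hl
  have hl1 : 1 ≤ l := by linarith
  set E := E1 (κ+1) q M with hE
  have hE0 : 0 ≤ E := by rw [hE]; unfold E1; positivity
  have hS1 : ‖∑ m ∈ Ico b1 b2, ee (P.eval (d * m : ℝ))‖ / M ≤ 1 := by
    rw [div_le_one (by positivity)]
    refine (norm_sum_le _ _).trans ?_
    simp only [norm_ee, sum_const, Int.card_Ico, nsmul_eq_mul, mul_one]
    exact_mod_cast (by omega : (b2 - b1).toNat ≤ M)
  have hmain := SW_main κ c0 hc M q d hM hq hd a ha θ hθ P hP hPc b1 b2 hJ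
  have hone := fun (h : κ = 0) => SW_one c0 hc M q d hM hq hd a ha θ hθ P (by rw [h] at hP; simpa using hP) (by rw [h] at hPc; simpa using hPc) b1 b2 hJ
  set s := ‖∑ m ∈ Ico b1 b2, ee (P.eval (d * m : ℝ))‖ / M with hs
  have hs0 : 0 ≤ s := by positivity
  clear_value s
  clear hs hJ hP hPc hθ ha
  have hdC : (1:ℝ) ≤ d ^ C := one_le_pow₀ hd'
  have hlC : 1 ≤ l ^ C := one_le_pow₀ hl1
  have hC2 : (1:ℝ) ≤ C := by exact_mod_cast (by omega : 1 ≤ C)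
  by_cases hbig : 1 ≤ E
  · refine (pow_le_one₀ hs0 hS1).trans ?_
    have h1 : 1 ≤ √E := Real.one_le_sqrt.2 hbig
    exact one_le_mul_of_one_le_of_one_le (one_le_mul_of_one_le_of_one_le (one_le_mul_of_one_le_of_one_le hC2 hdC) hlC) h1
  push Not at hbig
  have hEs : E ≤ √E := sqrt_ge_self hE0 hbig.le
  rcases Nat.eq_zero_or_pos κ with h0 | h0
  · have h1 := hone h0
    have h2 : 1 / (q:ℝ) + q / M ≤ E := by
      rw [hE, h0]; unfold E1
      have : (q:ℝ) / M ≤ q * (1 + Real.log q) / M ^ (0+1) := by rw [zero_add, pow_one]; gcongr; nlinarith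
      have : 0 ≤ (1 + Real.log q) / (M:ℝ) := by positivity
      linarith
    have h3 : s ^ (2 ^ (2 * (κ+1))) ≤ s := pow_le_of_le_one hs0 hS1 (by positivity)
    have hC3 : (4 * c0 : ℝ) ≤ C := by exact_mod_cast (by omega : 4 * c0 ≤ C)
    have hC4 : (d:ℝ) ≤ d ^ C := le_self_pow₀ hd' (by omega)
    calc _ ≤ s := h3
      _ ≤ 4 * c0 * d * (1 / q + q / M) := h1
      _ ≤ C * d ^ C * √E := by gcongr; exact h2.trans hEs
      _ ≤ _ := by
        have : (0:ℝ) ≤ C * d ^ C * √E := by positivity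
        nlinarith
  · have h3 : s ^ (2 ^ (2 * (κ+1))) ≤ s ^ (2 ^ κ) := pow_le_pow_of_le_one hs0 hS1 (Nat.pow_le_pow_right (by norm_num) (by omega))
    refine h3.trans (hmain.trans ?_)
    rw [← hnn, ← hpw]
    have hMk : (M:ℝ) ≤ M ^ κ := le_self_pow₀ hM' (by omega)
    have hEE : EE q (M ^ κ) M ≤ 2 * E := by
      rw [hE]; unfold EE E1
      have a1 : 1 / (M:ℝ) ^ κ ≤ (1 + Real.log q) / M := by
        calc 1 / (M:ℝ) ^ κ ≤ 1 / M := by gcongr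
          _ ≤ _ := by gcongr; linarith
      have a2 : 0 ≤ 1 / (q:ℝ) := by positivity
      have a3 : 0 ≤ q * (1 + Real.log q) / (M:ℝ) ^ (κ+1) := by positivity
      rw [← pow_succ]
      linarith
    have hEE0 : 0 ≤ EE q (M ^ κ) M := by unfold EE; positivity
    have hlog : 1 + Real.log ((M:ℝ) ^ κ) ≤ (κ+1) * l := by
      rw [Real.log_pow, hl]; nlinarith [show (0:ℝ) ≤ κ by positivity]
    have hlog0 : 0 ≤ 1 + Real.log ((M:ℝ) ^ κ) := by rw [Real.log_pow]; positivity
    have hM1 : 1 / (M:ℝ) ≤ E := by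
      rw [hE]; unfold E1
      have a1 : 1 / (M:ℝ) ≤ (1 + Real.log q) / M := by gcongr; linarith
      have a2 : 0 ≤ 1 / (q:ℝ) := by positivity
      have a3 : 0 ≤ q * (1 + Real.log q) / (M:ℝ) ^ (κ+1) := by positivity
      linarith
    have h1k : (1:ℝ) ≤ ((κ+1) * l) ^ pw := one_le_pow₀ (one_le_mul_of_one_le_of_one_le (by linarith [show (0:ℝ) ≤ κ by positivity]) hl1)
    have h1d : (1:ℝ) ≤ d ^ (κ+1) := one_le_pow₀ hd'
    have hsq : √(24 * ((κ+1).factorial * c0 * d ^ (κ+1)) * (1 + Real.log (M ^ κ)) ^ pw * EE q (M ^ κ) M) ≤ K0 * d ^ (κ+1) * ((κ+1) * l) ^ pw * √E := by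
      calc _ ≤ √((K0 * d ^ (κ+1) * ((κ+1) * l) ^ pw) * E) := by
            apply Real.sqrt_le_sqrt
            calc _ ≤ 24 * ((κ+1).factorial * c0 * d ^ (κ+1)) * ((κ+1) * l) ^ pw * (2 * E) := by gcongr
              _ = _ := by rw [hK0]; push_cast; ring
        _ ≤ √((K0 * d ^ (κ+1) * ((κ+1) * l) ^ pw) ^ 2 * E) := by
            apply Real.sqrt_le_sqrt
            gcongr
            exact le_self_pow₀ (one_le_mul_of_one_le_of_one_le (one_le_mul_of_one_le_of_one_le hK1 h1d) h1k) (by norm_num)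
        _ = _ := by rw [Real.sqrt_mul (by positivity), Real.sqrt_sq (by positivity)]
    have hlp : 1 ≤ l ^ pw := one_le_pow₀ hl1
    have hC5 : (2:ℝ) ^ nn * (κ + K0 * (κ+1) ^ pw) ≤ C := by exact_mod_cast (by omega : 2 ^ nn * (κ + K0 * (κ+1) ^ pw) ≤ C)
    calc (2:ℝ) ^ nn * (κ / M + √(24 * ((κ+1).factorial * c0 * d ^ (κ+1)) * (1 + Real.log (M ^ κ)) ^ pw * EE q (M ^ κ) M))
        ≤ 2 ^ nn * (κ * (d ^ (κ+1) * l ^ pw * √E) + K0 * d ^ (κ+1) * ((κ+1) * l) ^ pw * √E) := by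
          gcongr
          rw [div_eq_mul_one_div]
          gcongr
          refine (hM1.trans hEs).trans ?_
          exact le_mul_of_one_le_left (by positivity) (one_le_mul_of_one_le_of_one_le h1d hlp)
      _ = (2 ^ nn * (κ + K0 * (κ+1) ^ pw)) * d ^ (κ+1) * l ^ pw * √E := by rw [mul_pow]; ring
      _ ≤ C * d ^ C * l ^ C * √E := by
          gcongr <;> omega

section P4
open ArithmeticFunction

/-- weighted Dirichlet convolution sum -/
lemma conv_sum (f g : ArithmeticFunction ℝ) (c : ℕ → ℂ) (N : ℕ) :
    ∑ n ∈ Ioc 0 N, ((f * g) n : ℂ) * c n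
      = ∑ d ∈ Ioc 0 N, ∑ m ∈ Ioc 0 (N / d), (f d : ℂ) * (g m : ℂ) * c (d * m) := by
  simp only [ArithmeticFunction.mul_apply]
  push_cast
  simp only [sum_mul]
  rw [sum_sigma', sum_sigma']
  refine sum_bij' (fun x _ => ⟨x.2.1, x.2.2⟩) (fun x _ => ⟨x.1 * x.2, (x.1, x.2)⟩) ?_ ?_ ?_ ?_ ?_
  · rintro ⟨n, d, m⟩ h
    simp only [mem_sigma, mem_Ioc, Nat.mem_divisorsAntidiagonal] at h ⊢
    obtain ⟨⟨h1, h2⟩, h3, h4⟩ := h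
    subst h3
    have hd : 0 < d := Nat.pos_of_mul_pos_right h1
    have hm : 0 < m := Nat.pos_of_mul_pos_left h1
    exact ⟨⟨hd, (Nat.le_mul_of_pos_right d hm).trans h2⟩, hm, (Nat.le_div_iff_mul_le hd).2 (by rwa [mul_comm])⟩
  · rintro ⟨d, m⟩ h
    simp only [mem_sigma, mem_Ioc, Nat.mem_divisorsAntidiagonal] at h ⊢
    obtain ⟨⟨h1, h2⟩, h3, h4⟩ := h
    have := (Nat.le_div_iff_mul_le h1).1 h4
    exact ⟨⟨by positivity, by rwa [mul_comm]⟩, by simp, by positivity⟩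
  · rintro ⟨n, d, m⟩ h
    simp only [mem_sigma, mem_Ioc, Nat.mem_divisorsAntidiagonal] at h ⊢
    obtain ⟨⟨h1, h2⟩, h3, h4⟩ := h
    subst h3
    rfl
  · rintro ⟨d, m⟩ h
    rfl
  · rintro ⟨n, d, m⟩ h
    simp only [mem_sigma, mem_Ioc, Nat.mem_divisorsAntidiagonal] at h ⊢
    rw [h.2.1]

noncomputable def lsq : ArithmeticFunction ℝ := ⟨fun n => Real.log n ^ 2, by simp⟩
noncomputable def llm : ArithmeticFunction ℝ := ⟨fun n => vonMangoldt n * Real.log n, by simp⟩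
/-- the Selberg function `h = Λ log + Λ * Λ = μ * log²` -/
noncomputable def hh : ArithmeticFunction ℝ := llm + vonMangoldt * vonMangoldt

lemma lsq_apply (n : ℕ) : lsq n = Real.log n ^ 2 := rfl
lemma llm_apply (n : ℕ) : llm n = vonMangoldt n * Real.log n := rfl

lemma deriv_conv (n : ℕ) : (llm * (zeta : ArithmeticFunction ℝ)) n + (vonMangoldt * ArithmeticFunction.log) n = Real.log n * (vonMangoldt * (zeta : ArithmeticFunction ℝ)) n := by
  simp only [ArithmeticFunction.mul_apply]
  rw [← sum_add_distrib, mul_sum]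
  apply sum_congr rfl
  rintro ⟨d, m⟩ h
  rw [Nat.mem_divisorsAntidiagonal] at h
  obtain ⟨h1, h2⟩ := h
  simp only at h1
  subst h1
  have hd : (d:ℝ) ≠ 0 := by
    intro h; apply h2; have : d = 0 := by exact_mod_cast h
    simp [this]
  have hm' : m ≠ 0 := by rintro rfl; exact h2 (by simp)
  have hm : (m:ℝ) ≠ 0 := by exact_mod_cast hm'
  simp only [llm_apply, log_apply, natCoe_apply, zeta_apply, hm', if_false]
  push_cast
  rw [Real.log_mul hd hm]
  ring

lemma hh_zeta : hh * (zeta : ArithmeticFunction ℝ) = lsq := by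
  rw [hh, add_mul, mul_assoc, vonMangoldt_mul_zeta]
  ext n
  rw [ArithmeticFunction.add_apply, deriv_conv, vonMangoldt_mul_zeta, lsq_apply, log_apply, sq]

lemma hh_eq : hh = (moebius : ArithmeticFunction ℝ) * lsq := by
  rw [← hh_zeta, mul_comm hh, ← mul_assoc, coe_moebius_mul_coe_zeta, one_mul]

lemma llm_nonneg (n : ℕ) : 0 ≤ llm n := by
  rw [llm_apply]; exact mul_nonneg vonMangoldt_nonneg (Real.log_natCast_nonneg n)

lemma VV_nonneg (n : ℕ) : 0 ≤ (vonMangoldt * vonMangoldt) n := by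
  rw [ArithmeticFunction.mul_apply]
  exact sum_nonneg fun _ _ => mul_nonneg vonMangoldt_nonneg vonMangoldt_nonneg

lemma hh_apply (n : ℕ) : hh n = llm n + (vonMangoldt * vonMangoldt) n := rfl

lemma llm_le_hh (n : ℕ) : llm n ≤ hh n := by rw [hh_apply]; linarith [VV_nonneg n]
lemma hh_nonneg (n : ℕ) : 0 ≤ hh n := (llm_nonneg n).trans (llm_le_hh n)

lemma VV_le (n : ℕ) : (vonMangoldt * vonMangoldt) n ≤ Real.log n ^ 2 := by
  rw [ArithmeticFunction.mul_apply]
  calc _ ≤ ∑ x ∈ n.divisorsAntidiagonal, vonMangoldt x.1 * Real.log n := by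
        apply sum_le_sum
        rintro ⟨d, m⟩ h
        rw [Nat.mem_divisorsAntidiagonal] at h
        obtain ⟨h1, h2⟩ := h
        simp only at h1
        apply mul_le_mul_of_nonneg_left _ vonMangoldt_nonneg
        refine vonMangoldt_le_log.trans ?_
        have hm' : 0 < m := Nat.pos_of_ne_zero (by rintro rfl; exact h2 (by rw [← h1]; simp))
        apply Real.log_le_log (by exact_mod_cast hm')
        exact_mod_cast Nat.le_of_dvd (Nat.pos_of_ne_zero h2) ⟨d, by rw [← h1, mul_comm]⟩
    _ = _ := by
        rw [← sum_mul, Nat.sum_divisorsAntidiagonal (f := fun i _ => vonMangoldt i), vonMangoldt_sum, sq]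

lemma llm_le (n : ℕ) : llm n ≤ Real.log n ^ 2 := by
  rw [llm_apply, sq]; exact mul_le_mul_of_nonneg_right vonMangoldt_le_log (Real.log_natCast_nonneg n)

lemma hh_le (n : ℕ) : hh n ≤ 2 * Real.log n ^ 2 := by
  rw [hh_apply]; linarith [VV_le n, llm_le n]

lemma psi_bd (N : ℕ) : ∑ n ∈ Ioc 0 N, vonMangoldt n ≤ 6 * N := by
  have h := Chebyshev.psi_le_const_mul_self (x := N) (by positivity)
  rw [Chebyshev.psi, Nat.floor_natCast] at h
  have h2 : Real.log 4 ≤ 2 := by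
    rw [show (4:ℝ) = 2 ^ 2 by norm_num, Real.log_pow]
    have := Real.log_two_lt_d9; push_cast; linarith
  have : (0:ℝ) ≤ N := by positivity
  nlinarith

lemma sum_log_le (N : ℕ) : ∑ n ∈ Ioc 0 N, Real.log n ≤ N * Real.log N := by
  calc _ ≤ ∑ n ∈ Ioc 0 N, Real.log N := by
        apply sum_le_sum; intro n hn; rw [mem_Ioc] at hn
        exact Real.log_le_log (by exact_mod_cast hn.1) (by exact_mod_cast hn.2)
    _ = _ := by simp

lemma natdiv_ge (N n : ℕ) : (N:ℝ) / n - 1 ≤ ((N / n : ℕ) : ℝ) := by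
  have := Nat.lt_floor_add_one ((N:ℝ) / n)
  rw [Nat.floor_div_eq_div] at this
  linarith

lemma mertens (N : ℕ) : ∑ n ∈ Ioc 0 N, vonMangoldt n / n ≤ Real.log N + 6 := by
  rcases Nat.eq_zero_or_pos N with rfl | hN
  · simp
  have h1 : ∑ n ∈ Ioc 0 N, Real.log n = ∑ n ∈ Ioc 0 N, vonMangoldt n * ((N / n : ℕ) : ℝ) := by
    have := sum_Ioc_mul_zeta_eq_sum vonMangoldt N
    rw [vonMangoldt_mul_zeta] at this
    simpa [log_apply] using this
  have h2 : ∑ n ∈ Ioc 0 N, vonMangoldt n * ((N:ℝ) / n - 1) ≤ ∑ n ∈ Ioc 0 N, vonMangoldt n * ((N / n : ℕ) : ℝ) := by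
    apply sum_le_sum; intro n hn
    apply mul_le_mul_of_nonneg_left _ vonMangoldt_nonneg
    exact natdiv_ge N n
  have h3 : ∑ n ∈ Ioc 0 N, vonMangoldt n * ((N:ℝ) / n - 1) = N * ∑ n ∈ Ioc 0 N, vonMangoldt n / n - ∑ n ∈ Ioc 0 N, vonMangoldt n := by
    rw [mul_sum, ← sum_sub_distrib]; apply sum_congr rfl; intros; ring
  have h4 := psi_bd N
  have h5 := sum_log_le N
  have hN' : (0:ℝ) < N := by exact_mod_cast hN
  have : (N:ℝ) * ∑ n ∈ Ioc 0 N, vonMangoldt n / n ≤ N * (Real.log N + 6) := by linarith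
  exact le_of_mul_le_mul_left this hN'

lemma sum_VV (N : ℕ) : ∑ n ∈ Ioc 0 N, (vonMangoldt * vonMangoldt) n ≤ 6 * N * (Real.log N + 6) := by
  rw [sum_Ioc_mul_eq_sum_sum]
  calc _ ≤ ∑ n ∈ Ioc 0 N, vonMangoldt n * (6 * (N / n)) := by
        apply sum_le_sum; intro n hn
        apply mul_le_mul_of_nonneg_left _ vonMangoldt_nonneg
        refine (psi_bd _).trans ?_
        gcongr; exact Nat.cast_div_le
    _ = 6 * N * ∑ n ∈ Ioc 0 N, vonMangoldt n / n := by
        rw [mul_sum]; apply sum_congr rfl; intros; ring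
    _ ≤ _ := by gcongr; exact mertens N

lemma sum_llm (N : ℕ) : ∑ n ∈ Ioc 0 N, llm n ≤ 6 * N * Real.log N := by
  calc _ ≤ ∑ n ∈ Ioc 0 N, vonMangoldt n * Real.log N := by
        apply sum_le_sum; intro n hn; rw [mem_Ioc] at hn; rw [llm_apply]
        apply mul_le_mul_of_nonneg_left _ vonMangoldt_nonneg
        exact Real.log_le_log (by exact_mod_cast hn.1) (by exact_mod_cast hn.2)
    _ ≤ _ := by
        rw [← sum_mul]; exact mul_le_mul_of_nonneg_right (psi_bd N) (Real.log_natCast_nonneg N)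

lemma sum_hh (N : ℕ) : ∑ n ∈ Ioc 0 N, hh n ≤ 36 * N * (Real.log N + 1) := by
  have h1 := sum_VV N
  have h2 := sum_llm N
  have : ∑ n ∈ Ioc 0 N, hh n = ∑ n ∈ Ioc 0 N, llm n + ∑ n ∈ Ioc 0 N, (vonMangoldt * vonMangoldt) n := by
    rw [← sum_add_distrib]; rfl
  have h3 := Real.log_natCast_nonneg N
  have h4 : (0:ℝ) ≤ N * Real.log N := by positivity
  nlinarith


lemma approx_sum (f F : ℝ → ℝ) (hf : ∀ a b, 1 ≤ a → a ≤ b → f a ≤ f b) (hf1 : f 1 = 0)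
    (hF : ∀ t, 1 ≤ t → HasDerivAt F (f t) t) (y : ℝ) (hy : 1 ≤ y) :
    |∑ m ∈ Ioc 0 ⌊y⌋₊, f m - (F y - F 1)| ≤ f y := by
  have key : ∀ a b, 1 ≤ a → a ≤ b → (b - a) * f a ≤ F b - F a ∧ F b - F a ≤ (b - a) * f b := by
    intro a b ha hab
    rcases hab.eq_or_lt with rfl | hab
    · simp
    obtain ⟨c, hc, h⟩ := exists_hasDerivAt_eq_slope F f hab
      (fun t ht => (hF t (ha.trans ht.1)).continuousAt.continuousWithinAt) (fun t ht => hF t (ha.trans ht.1.le))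
    have hp : 0 < b - a := by linarith
    rw [eq_div_iff hp.ne'] at h
    rw [← h]
    have h1 := hf a c ha hc.1.le
    have h2 := hf c b (ha.trans hc.1.le) hc.2.le
    constructor <;> nlinarith
  have ind : ∀ n : ℕ, 1 ≤ n → F n - F 1 ≤ ∑ m ∈ Ioc 0 n, f m ∧ ∑ m ∈ Ioc 0 n, f m ≤ F n - F 1 + f n := by
    intro n hn
    induction n, hn using Nat.le_induction with
    | base => simp [hf1]
    | succ n hn ih =>
      have hn' : (1:ℝ) ≤ n := by exact_mod_cast hn
      have := key n (n+1) hn' (by linarith)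
      rw [sum_Ioc_succ_top (by omega)]
      push_cast
      constructor <;> linarith
  have hn : 1 ≤ ⌊y⌋₊ := by rwa [Nat.one_le_floor_iff]
  have hn' : (1:ℝ) ≤ (⌊y⌋₊ : ℝ) := by exact_mod_cast hn
  have h1 := ind _ hn
  have h2 := Nat.floor_le (show 0 ≤ y by linarith)
  have h3 := Nat.lt_floor_add_one y
  have h4 := key _ y hn' h2
  have h5 := hf _ y hn' h2
  have h6 := hf 1 _ le_rfl hn'
  rw [hf1] at h6
  rw [abs_le]
  constructor <;> nlinarith

noncomputable def gg (j Y : ℕ) : ℝ := ∑ d ∈ Ioc 0 Y, (moebius d : ℝ) / d * Real.log (Y / d) ^ j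

lemma mu_abs (d : ℕ) : |(moebius d : ℝ)| ≤ 1 := by
  exact_mod_cast abs_moebius_le_one

lemma mu_sum_abs (Y : ℕ) (r : ℕ → ℝ) (s : ℕ → ℝ) (hs : ∀ d ∈ Ioc 0 Y, |s d| ≤ r d) : |∑ d ∈ Ioc 0 Y, (moebius d : ℝ) * s d| ≤ ∑ d ∈ Ioc 0 Y, r d := by
  refine (abs_sum_le_sum_abs _ _).trans (sum_le_sum fun d hd => ?_)
  rw [abs_mul]
  calc _ ≤ 1 * r d := mul_le_mul (mu_abs d) (hs d hd) (abs_nonneg _) zero_le_one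
    _ = _ := one_mul _

lemma gg0_le (Y : ℕ) (hY : 0 < Y) : |gg 0 Y| ≤ 2 := by
  have h1 : ∑ d ∈ Ioc 0 Y, (moebius d : ℝ) * ((Y / d : ℕ) : ℝ) = 1 := by
    have := sum_Ioc_mul_zeta_eq_sum (moebius : ArithmeticFunction ℝ) Y
    rw [coe_moebius_mul_coe_zeta] at this
    simp only [intCoe_apply] at this
    rw [← this, sum_eq_single 1]
    · simp
    · intro b _ hb; simp [hb]
    · simp; omega
  have hY' : (0:ℝ) < Y := by exact_mod_cast hY
  have h2 : Y * gg 0 Y = 1 + ∑ d ∈ Ioc 0 Y, (moebius d : ℝ) * ((Y:ℝ) / d - ((Y / d : ℕ) : ℝ)) := by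
    rw [← h1, gg, mul_sum, ← sum_add_distrib]; apply sum_congr rfl; intros; ring
  have h3 := mu_sum_abs Y (fun _ => 1) (fun d => (Y:ℝ) / d - ((Y / d : ℕ) : ℝ)) (by
    intro d hd
    have h1 := natdiv_ge Y d
    have h2 : ((Y / d : ℕ) : ℝ) ≤ (Y:ℝ) / d := Nat.cast_div_le
    rw [abs_le]; constructor <;> linarith)
  simp at h3
  have hY1 : (1:ℝ) ≤ Y := by exact_mod_cast hY
  rw [abs_le] at h3 ⊢
  constructor <;> nlinarith

lemma d1 (t : ℝ) (ht : 1 ≤ t) : HasDerivAt (fun t => t * Real.log t - t) (Real.log t) t := by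
  have h := ((hasDerivAt_id t).mul (Real.hasDerivAt_log (by positivity : t ≠ 0))).sub (hasDerivAt_id t)
  refine h.congr_deriv ?_
  simp only [id]; field_simp; ring

lemma d2 (t : ℝ) (ht : 1 ≤ t) : HasDerivAt (fun t => t * Real.log t ^ 2 - 2 * (t * Real.log t) + 2 * t) (Real.log t ^ 2) t := by
  have hl := Real.hasDerivAt_log (by positivity : t ≠ 0)
  have h := (((hasDerivAt_id t).mul (hl.pow 2)).sub (((hasDerivAt_id t).mul hl).const_mul 2)).add ((hasDerivAt_id t).const_mul 2)
  refine h.congr_deriv ?_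
  simp only [id, Pi.pow_apply]; field_simp; ring

lemma approx1 (y : ℝ) (hy : 1 ≤ y) : |∑ m ∈ Ioc 0 ⌊y⌋₊, Real.log m - (y * Real.log y - y + 1)| ≤ Real.log y := by
  have := approx_sum Real.log (fun t => t * Real.log t - t) (fun a b ha hab => Real.log_le_log (by linarith) hab) (by simp) d1 y hy
  simpa using this

lemma approx2 (y : ℝ) (hy : 1 ≤ y) : |∑ m ∈ Ioc 0 ⌊y⌋₊, Real.log m ^ 2 - (y * Real.log y ^ 2 - 2 * (y * Real.log y) + 2 * y - 2)| ≤ Real.log y ^ 2 := by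
  have := approx_sum (fun t => Real.log t ^ 2) (fun t => t * Real.log t ^ 2 - 2 * (t * Real.log t) + 2 * t) (fun a b ha hab => pow_le_pow_left₀ (Real.log_nonneg ha) (Real.log_le_log (by linarith) hab) 2) (by simp) d2 y hy
  simpa using this

lemma nat_one_le_div {Y d : ℕ} (hd : d ∈ Ioc 0 Y) : 1 ≤ (Y:ℝ) / d := by
  rw [mem_Ioc] at hd
  rw [one_le_div (by exact_mod_cast hd.1)]; exact_mod_cast hd.2

lemma sum_log_div (Y : ℕ) (hY : 0 < Y) : ∑ d ∈ Ioc 0 Y, Real.log (Y / d) ≤ Y := by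
  have hY1 : (1:ℝ) ≤ Y := by exact_mod_cast hY
  have h := approx_sum Real.log (fun t => t * Real.log t - t) (fun a b ha hab => Real.log_le_log (by linarith) hab) (by simp) d1
  have : ∀ n : ℕ, 1 ≤ n → (n:ℝ) * Real.log n - n ≤ ∑ m ∈ Ioc 0 n, Real.log m := by
    intro n hn
    induction n, hn using Nat.le_induction with
    | base => simp
    | succ n hn ih =>
      rw [sum_Ioc_succ_top (by omega)]
      push_cast
      have hn' : (1:ℝ) ≤ n := by exact_mod_cast hn
      have h1 := Real.log_le_sub_one_of_pos (show (0:ℝ) < (n+1)/n by positivity)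
      rw [Real.log_div (by positivity) (by positivity)] at h1
      have h2 : (n:ℝ) * ((n+1)/n - 1) = 1 := by field_simp; ring
      nlinarith
  have h2 := this Y hY
  have : ∑ d ∈ Ioc 0 Y, Real.log (Y / d) = Y * Real.log Y - ∑ d ∈ Ioc 0 Y, Real.log d := by
    rw [show (Y:ℝ) * Real.log Y = ∑ d ∈ Ioc 0 Y, Real.log Y by simp, ← sum_sub_distrib]
    apply sum_congr rfl; intro d hd; rw [mem_Ioc] at hd
    have : (0:ℝ) < d := by exact_mod_cast hd.1
    rw [Real.log_div (by positivity) (by positivity)]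
  linarith

lemma gg1_le (Y : ℕ) (hY : 0 < Y) : |gg 1 Y| ≤ 10 := by
  have hY1 : (1:ℝ) ≤ Y := by exact_mod_cast hY
  have h1 : ∑ d ∈ Ioc 0 Y, (moebius d : ℝ) * ∑ m ∈ Ioc 0 (Y / d), Real.log m = ∑ n ∈ Ioc 0 Y, vonMangoldt n := by
    have := sum_Ioc_mul_eq_sum_sum (moebius : ArithmeticFunction ℝ) ArithmeticFunction.log Y
    rw [moebius_mul_log_eq_vonMangoldt] at this
    rw [this]; rfl
  have h2 : Y * gg 1 Y = ∑ n ∈ Ioc 0 Y, vonMangoldt n + Y * gg 0 Y - ∑ d ∈ Ioc 0 Y, (moebius d : ℝ) * 1 - ∑ d ∈ Ioc 0 Y, (moebius d : ℝ) * (∑ m ∈ Ioc 0 (Y / d), Real.log m - ((Y:ℝ) / d * Real.log (Y / d) - Y / d + 1)) := by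
    rw [← h1, gg, gg, mul_sum, mul_sum, ← sum_add_distrib, ← sum_sub_distrib, ← sum_sub_distrib]; apply sum_congr rfl; intros; ring
  have h3 := mu_sum_abs Y (fun _ => 1) (fun d => 1) (by simp)
  have h4 := mu_sum_abs Y (fun d => Real.log (Y / d)) (fun d => ∑ m ∈ Ioc 0 (Y / d), Real.log m - ((Y:ℝ) / d * Real.log (Y / d) - Y / d + 1)) (by
    intro d hd
    have := approx1 ((Y:ℝ)/d) (nat_one_le_div hd)
    rwa [Nat.floor_div_eq_div] at this)
  have h5 := sum_log_div Y hY
  have h6 := psi_bd Y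
  have h7 : 0 ≤ ∑ n ∈ Ioc 0 Y, vonMangoldt n := sum_nonneg fun _ _ => vonMangoldt_nonneg
  have h8 := gg0_le Y hY
  simp only [sum_const, Nat.card_Ioc, nsmul_eq_mul, mul_one, Nat.sub_zero] at h3
  simp only [mul_one] at h2
  rw [abs_le] at h3 h4 h8 ⊢
  constructor <;> nlinarith

lemma gg2_le (Y : ℕ) (hY : 0 < Y) : |gg 2 Y| ≤ 63 * (1 + Real.log Y) := by
  have hY1 : (1:ℝ) ≤ Y := by exact_mod_cast hY
  have h1 : ∑ d ∈ Ioc 0 Y, (moebius d : ℝ) * ∑ m ∈ Ioc 0 (Y / d), Real.log m ^ 2 = ∑ n ∈ Ioc 0 Y, hh n := by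
    have := sum_Ioc_mul_eq_sum_sum (moebius : ArithmeticFunction ℝ) lsq Y
    rw [← hh_eq] at this
    rw [this]; rfl
  have h2 : Y * gg 2 Y = ∑ n ∈ Ioc 0 Y, hh n + 2 * (Y * gg 1 Y) - 2 * (Y * gg 0 Y) + 2 * ∑ d ∈ Ioc 0 Y, (moebius d : ℝ) * 1 - ∑ d ∈ Ioc 0 Y, (moebius d : ℝ) * (∑ m ∈ Ioc 0 (Y / d), Real.log m ^ 2 - ((Y:ℝ) / d * Real.log (Y / d) ^ 2 - 2 * (Y / d * Real.log (Y / d)) + 2 * (Y / d) - 2)) := by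
    rw [← h1, gg, gg, gg]
    simp only [mul_sum]
    rw [← sum_add_distrib, ← sum_sub_distrib, ← sum_add_distrib, ← sum_sub_distrib]
    apply sum_congr rfl; intro d hd
    simp only [← mul_sum]
    ring
  have h3 := mu_sum_abs Y (fun _ => 1) (fun d => 1) (by simp)
  have h4 := mu_sum_abs Y (fun d => Real.log (Y / d) ^ 2)  (fun d => ∑ m ∈ Ioc 0 (Y / d), Real.log m ^ 2 - ((Y:ℝ) / d * Real.log (Y / d) ^ 2 - 2 * (Y / d * Real.log (Y / d)) + 2 * (Y / d) - 2)) (by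
    intro d hd
    have := approx2 ((Y:ℝ)/d) (nat_one_le_div hd)
    rwa [Nat.floor_div_eq_div] at this)
  have h5 := sum_log_div Y hY
  have h5' : ∑ d ∈ Ioc 0 Y, Real.log (Y / d) ^ 2 ≤ Real.log Y * Y := by
    refine le_trans ?_ (mul_le_mul_of_nonneg_left h5 (Real.log_natCast_nonneg Y))
    rw [mul_sum]
    apply sum_le_sum; intro d hd
    rw [sq]
    have h0 := nat_one_le_div hd
    apply mul_le_mul_of_nonneg_right _ (Real.log_nonneg h0)
    apply Real.log_le_log (by linarith)
    rw [mem_Ioc] at hd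
    exact div_le_self (by positivity) (by exact_mod_cast hd.1)
  have h6 := sum_hh Y
  have h7 : 0 ≤ ∑ n ∈ Ioc 0 Y, hh n := sum_nonneg fun _ _ => hh_nonneg _
  have h8 := gg0_le Y hY
  have h9 := gg1_le Y hY
  simp only [sum_const, Nat.card_Ioc, nsmul_eq_mul, mul_one, Nat.sub_zero] at h3
  simp only [mul_one] at h2
  have hl := Real.log_natCast_nonneg Y
  rw [abs_le] at h3 h4 h8 h9 ⊢
  have e1 : |Y * gg 2 Y| ≤ Y * (63 * (1 + Real.log Y)) := by
    have a1 : -(2 * Y) ≤ Y * gg 0 Y ∧ Y * gg 0 Y ≤ 2 * Y := by constructor <;> nlinarith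
    have a2 : -(10 * Y) ≤ Y * gg 1 Y ∧ Y * gg 1 Y ≤ 10 * Y := by constructor <;> nlinarith
    have a3 : 0 ≤ Y * Real.log Y := by positivity
    rw [h2, abs_le]
    constructor <;> nlinarith
  rw [abs_mul, abs_of_nonneg (by linarith : (0:ℝ) ≤ Y)] at e1
  rw [← abs_le]
  exact le_of_mul_le_mul_left e1 (by linarith)

lemma gg_shift (X Y : ℕ) (hY : 0 < Y) (hX : Y ≤ X) :
    |∑ d ∈ Ioc 0 Y, (moebius d : ℝ) / d * Real.log (X / d) ^ 2| ≤ 63 * (1 + Real.log Y) + 20 * Real.log (X / Y) + 2 * Real.log (X / Y) ^ 2 := by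
  have hY1 : (1:ℝ) ≤ Y := by exact_mod_cast hY
  have hXY : (Y:ℝ) ≤ X := by exact_mod_cast hX
  have hl : 0 ≤ Real.log (X / Y) := Real.log_nonneg (by rw [one_le_div (by linarith)]; exact hXY)
  have : ∑ d ∈ Ioc 0 Y, (moebius d : ℝ) / d * Real.log (X / d) ^ 2 = gg 2 Y + 2 * Real.log (X / Y) * gg 1 Y + Real.log (X/Y) ^ 2 * gg 0 Y := by
    rw [gg, gg, gg, mul_sum, mul_sum, ← sum_add_distrib, ← sum_add_distrib]
    apply sum_congr rfl; intro d hd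
    rw [mem_Ioc] at hd
    have hd' : (0:ℝ) < d := by exact_mod_cast hd.1
    have : Real.log (X / d) = Real.log (X / Y) + Real.log (Y / d) := by
      have hX0 : (0:ℝ) < X := by linarith
      rw [Real.log_div hX0.ne' hd'.ne', Real.log_div hX0.ne' (by positivity), Real.log_div (by positivity) hd'.ne']
      ring
    rw [this]; ring
  rw [this]
  have h0 := gg0_le Y hY
  have h1 := gg1_le Y hY
  have h2 := gg2_le Y hY
  rw [abs_le] at *
  have := sq_nonneg (Real.log (X/Y))
  constructor <;> nlinarith

end P4

section P5
open ArithmeticFunction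

lemma block_sum (f : ℕ → ℂ) (w : ℕ → ℝ) (R N0 N : ℕ) (E : ℝ) (hR : 0 < R) (hN0 : R ≤ N0) (hw : ∀ m, 0 ≤ w m)
    (h1 : ∀ X, N0 ≤ X → X + X / R ≤ N → ‖∑ m ∈ Ico X (X + X / R), f m‖ ≤ ∑ m ∈ Ico X (X + X / R), w m)
    (h2 : ∀ X, N0 ≤ X → X ≤ N → N < X + X / R → ‖∑ m ∈ Ico X N, f m‖ ≤ E) (hN : N0 ≤ N) :
    ‖∑ m ∈ Ico N0 N, f m‖ ≤ ∑ m ∈ Ico N0 N, w m + E := by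
  suffices H : ∀ j X, N0 ≤ X → X ≤ N → N - X ≤ j → ‖∑ m ∈ Ico X N, f m‖ ≤ ∑ m ∈ Ico X N, w m + E from
    H _ N0 le_rfl hN le_rfl
  intro j
  induction j with
  | zero =>
    intro X hX hXN hj
    have : X = N := by omega
    subst this
    have h3 : 0 < X / R := Nat.div_pos (hN0.trans hX) hR
    have := h2 X hX le_rfl (by omega)
    simpa using this
  | succ j ih =>
    intro X hX hXN hj
    have h3 : 0 < X / R := Nat.div_pos (hN0.trans hX) hR
    rcases le_or_gt (X + X / R) N with h | h
    · rw [← sum_Ico_consecutive f (by omega : X ≤ X + X / R) h, ← sum_Ico_consecutive w (by omega : X ≤ X + X / R) h]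
      refine (norm_add_le _ _).trans ?_
      have := h1 X hX h
      have := ih (X + X / R) (by omega) h (by omega)
      linarith
    · have := h2 X hX hXN h
      have := sum_nonneg (s := Ico X N) fun m _ => hw m
      linarith

lemma abel_mono (w : ℕ → ℝ) (hw : Monotone w) (c : ℕ → ℂ) (b : ℕ) (B : ℝ) (a : ℕ) (hab : a ≤ b) (hwa : 0 ≤ w a)
    (hB : ∀ t, a ≤ t → t ≤ b → ‖∑ m ∈ Ico t b, c m‖ ≤ B) : ‖∑ m ∈ Ico a b, (w m : ℂ) * c m‖ ≤ w b * B := by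
  have key : ∀ t, t ≤ b → a ≤ t → ‖∑ m ∈ Ico t b, ((w m - w t : ℝ) : ℂ) * c m‖ ≤ (w b - w t) * B := by
    intro t ht
    induction ht using Nat.decreasingInduction with
    | self => intro _; simp
    | of_succ t ht ih =>
      intro hat
      have e : ∑ m ∈ Ico t b, ((w m - w t : ℝ) : ℂ) * c m = ∑ m ∈ Ico (t+1) b, ((w m - w (t+1) : ℝ) : ℂ) * c m + ((w (t+1) - w t : ℝ) : ℂ) * ∑ m ∈ Ico (t+1) b, c m := by
        rw [sum_eq_sum_Ico_succ_bot ht, mul_sum, ← sum_add_distrib]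
        simp only [sub_self, Complex.ofReal_zero, zero_mul, zero_add]
        apply sum_congr rfl; intros; push_cast; ring
      rw [e]
      refine (norm_add_le _ _).trans ?_
      rw [norm_mul, Complex.norm_real, Real.norm_of_nonneg (by linarith [hw (Nat.le_succ t)])]
      have h1 := ih (by omega)
      have h2 := mul_le_mul_of_nonneg_left (hB (t+1) (by omega) ht) (by linarith [hw (Nat.le_succ t)] : 0 ≤ w (t+1) - w t)
      linarith
  have e : ∑ m ∈ Ico a b, (w m : ℂ) * c m = ∑ m ∈ Ico a b, ((w m - w a : ℝ) : ℂ) * c m + (w a : ℂ) * ∑ m ∈ Ico a b, c m := by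
    rw [mul_sum, ← sum_add_distrib]
    apply sum_congr rfl; intros; push_cast; ring
  rw [e]
  refine (norm_add_le _ _).trans ?_
  rw [norm_mul, Complex.norm_real, Real.norm_of_nonneg hwa]
  have h1 := key a hab le_rfl
  have h2 := mul_le_mul_of_nonneg_left (hB a le_rfl hab) hwa
  linarith

lemma sum_Ico_int (g : ℤ → ℂ) (a b : ℕ) : ∑ m ∈ Ico (a:ℤ) (b:ℤ), g m = ∑ m ∈ Ico a b, g (m:ℤ) := by
  symm
  refine sum_bij (fun m _ => (m:ℤ)) ?_ ?_ ?_ ?_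
  · intro m hm; rw [mem_Ico] at *; omega
  · intro m _ n _ h; exact_mod_cast h
  · intro m hm; rw [mem_Ico] at hm; exact ⟨m.toNat, by rw [mem_Ico]; omega, by omega⟩
  · intros; rfl

lemma BLn (k c0 : ℕ) (hk : 0 < k) (hc : 0 < c0) : ∃ C : ℕ, ∀ (D M q : ℕ), 0 < D → 0 < M → 0 < q → ∀ a : ℤ, IsCoprime a (q:ℤ) →
    ∀ θ : ℝ, |θ - a / q| ≤ 1 / (q:ℝ) ^ 2 → ∀ P : Polynomial ℝ, P.natDegree ≤ k → P.coeff k = c0 * θ → ∀ a1 a2 b1 b2 : ℕ,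
    a2 - a1 ≤ D → b2 - b1 ≤ M → ∀ u v : ℕ → ℂ, (∀ d, ‖u d‖ ≤ 1) → (∀ m, ‖v m‖ ≤ 1) → ∀ η : ℝ, 0 ≤ η →
    C * (1 + Real.log (D * M)) ^ C * √(E2 k q D M) ≤ η ^ (2 ^ (2 * k)) →
    ‖∑ d ∈ Ico a1 a2, ∑ m ∈ Ico b1 b2, u d * v m * ee (P.eval ((d * m : ℕ) : ℝ))‖ ≤ D * M * η := by
  obtain ⟨C, hC⟩ := BL k c0 hk hc
  refine ⟨C, fun D M q hD hM hq a ha θ hθ P hP1 hP2 a1 a2 b1 b2 h1 h2 u v hu hv η hη h => ?_⟩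
  have := hC D M q hD hM hq a ha θ hθ P hP1 hP2 a1 a2 b1 b2 (by omega) (by omega) (fun d => u d.toNat) (fun m => v m.toNat) (fun d => hu _) (fun m => hv _)
  simp only [sum_Ico_int] at this
  simp only [Int.toNat_natCast, Int.cast_natCast] at this
  push_cast
  have hp : (0:ℝ) < D * M := by positivity
  have h3 := le_of_pow_le_pow_left₀ (by positivity) hη (this.trans h)
  rw [div_le_iff₀ hp] at h3
  linarith

lemma SWn (k c0 : ℕ) (hk : 0 < k) (hc : 0 < c0) : ∃ C : ℕ, ∀ (M q d : ℕ), 0 < M → 0 < q → 0 < d → ∀ a : ℤ, IsCoprime a (q:ℤ) →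
    ∀ θ : ℝ, |θ - a / q| ≤ 1 / (q:ℝ) ^ 2 → ∀ P : Polynomial ℝ, P.natDegree ≤ k → P.coeff k = c0 * θ → ∀ b1 b2 : ℕ,
    b2 - b1 ≤ M → ∀ η : ℝ, 0 ≤ η →
    C * d ^ C * (1 + Real.log M) ^ C * √(E1 k q M) ≤ η ^ (2 ^ (2 * k)) →
    ‖∑ m ∈ Ico b1 b2, ee (P.eval ((d * m : ℕ) : ℝ))‖ ≤ M * η := by
  obtain ⟨C, hC⟩ := SW k c0 hk hc
  refine ⟨C, fun M q d hM hq hd a ha θ hθ P hP1 hP2 b1 b2 h2 η hη h => ?_⟩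
  have := hC M q d hM hq hd a ha θ hθ P hP1 hP2 b1 b2 (by omega)
  simp only [sum_Ico_int] at this
  simp only [Int.cast_natCast] at this
  push_cast
  have hp : (0:ℝ) < M := by positivity
  have h3 := le_of_pow_le_pow_left₀ (by positivity) hη (this.trans h)
  rw [div_le_iff₀ hp] at h3
  linarith

end P5

section P5
open ArithmeticFunction

lemma inv_bd {x y c : ℝ} (hx : 0 < x) (hy : 0 < y) (h : y ≤ c * x) : 1 / x ≤ c / y := by
  rw [div_le_div_iff₀ hx hy]; linarith

lemma E2_bd (k G r A B N l q W V X : ℕ) (hk : 0 < k) (hB : r + 1 + G ≤ B) (hA : G + 1 + r * k ≤ A) (hl : 1 ≤ l) (hlog : Real.log N ≤ l)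
    (hq1 : l ^ A ≤ q) (hq2 : q * l ^ A ≤ N ^ k) (hX : l ^ B ≤ X) (hW : X ≤ 2 * l ^ r * W) (hV : l ^ B ≤ V) (hN : N ≤ 8 * l ^ r * (W * V)) :
    E2 k q W V ≤ ((4 + (1 + k) + (1 + k) * 8 ^ k : ℕ) : ℝ) / (l:ℝ) ^ G := by
  have hl' : (1:ℝ) ≤ l := by exact_mod_cast hl
  have hlp : 0 < l := hl
  have hq0 : 0 < q := lt_of_lt_of_le (by positivity) hq1
  have hXp : 0 < X := lt_of_lt_of_le (by positivity) hX
  have hVp : 0 < V := lt_of_lt_of_le (by positivity) hV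
  have hWp : 0 < W := Nat.pos_of_ne_zero (by rintro rfl; simp at hW; omega)
  have hNp : 0 < N := Nat.pos_of_ne_zero (by rintro rfl; rw [zero_pow hk.ne'] at hq2; have : 0 < q * l ^ A := by positivity
                                             omega)
  have hlq : Real.log q ≤ k * l := by
    have h1 : (q:ℝ) ≤ (N:ℝ) ^ k := by
      have : q ≤ N ^ k := le_trans (Nat.le_mul_of_pos_right q (by positivity)) hq2
      exact_mod_cast this
    have := Real.log_le_log (by exact_mod_cast hq0) h1
    rw [Real.log_pow] at this
    refine this.trans (by gcongr)
  have hlq0 : 0 ≤ Real.log q := Real.log_natCast_nonneg q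
  have hlq1 : 1 + Real.log q ≤ (1 + k) * l := by linarith
  have pw : ∀ i j : ℕ, i ≤ j → (l:ℝ) ^ i ≤ (l:ℝ) ^ j := fun i j h => pow_le_pow_right₀ hl' h
  have t1 : 1 / (q:ℝ) ≤ 1 / (l:ℝ) ^ G := by
    apply inv_bd (by exact_mod_cast hq0) (by positivity)
    have : (l:ℝ) ^ A ≤ q := by exact_mod_cast hq1
    linarith [pw G A (by omega)]
  have t2 : 1 / (W:ℝ) ≤ 2 / (l:ℝ) ^ G := by
    apply inv_bd (by exact_mod_cast hWp) (by positivity)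
    have : (l:ℝ) ^ B ≤ 2 * l ^ r * W := by exact_mod_cast hX.trans hW
    have h3 := pw (r + G) B (by omega)
    rw [pow_add] at h3
    have h4 : (0:ℝ) < (l:ℝ) ^ r := by positivity
    have : (l:ℝ) ^ r * l ^ G ≤ (l:ℝ) ^ r * (2 * W) := by linarith
    exact le_of_mul_le_mul_left this h4
  have t3 : (1 + Real.log q) / (V:ℝ) ≤ (1 + k) / (l:ℝ) ^ G := by
    rw [div_le_div_iff₀ (by exact_mod_cast hVp) (by positivity)]
    have : (l:ℝ) ^ B ≤ V := by exact_mod_cast hV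
    have h3 := pw (1 + G) B (by omega)
    rw [pow_add, pow_one] at h3
    calc _ ≤ (1 + k) * l * (l:ℝ) ^ G := by gcongr
      _ ≤ (1 + k) * V := by rw [mul_assoc]; gcongr; linarith
  have t4 : q * (1 + Real.log q) / ((W:ℝ) * V) ^ k ≤ (1 + k) * 8 ^ k / (l:ℝ) ^ G := by
    rw [div_le_div_iff₀ (by positivity) (by positivity)]
    have h1 : (q:ℝ) * l ^ A ≤ N ^ k := by exact_mod_cast hq2
    have h2 : (N:ℝ) ≤ 8 * l ^ r * (W * V) := by exact_mod_cast hN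
    have h3 : (N:ℝ) ^ k ≤ 8 ^ k * l ^ (r * k) * (W * V) ^ k := by
      calc _ ≤ (8 * (l:ℝ) ^ r * (W * V)) ^ k := by gcongr
        _ = _ := by rw [mul_pow, mul_pow, ← pow_mul]
    have h4 : (l:ℝ) ^ (r * k) * (l * l ^ G) ≤ l ^ A := by
      calc _ = (l:ℝ) ^ (G + 1 + r * k) := by ring
        _ ≤ _ := pw _ _ hA
    have h5 : (0:ℝ) < (l:ℝ) ^ (r * k) := by positivity
    have h6 : (l:ℝ) ^ (r * k) * (q * (l * l ^ G)) ≤ l ^ (r * k) * (8 ^ k * (W * V) ^ k) := by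
      calc _ = q * ((l:ℝ) ^ (r * k) * (l * l ^ G)) := by ring
        _ ≤ q * l ^ A := by gcongr
        _ ≤ _ := h1.trans (h3.trans (le_of_eq (by ring)))
    have h7 := le_of_mul_le_mul_left h6 h5
    calc _ ≤ q * ((1 + k) * l) * (l:ℝ) ^ G := by gcongr
      _ = (1 + k) * (q * (l * l ^ G)) := by ring
      _ ≤ (1 + k) * (8 ^ k * (W * V) ^ k) := by gcongr
      _ = _ := by ring
  rw [E2]
  push_cast
  have : ((4:ℝ) + (1 + k) + (1 + k) * 8 ^ k) / l ^ G = 1 / (l:ℝ) ^ G + 2 / (l:ℝ) ^ G + 1 / (l:ℝ) ^ G + (1 + k) / (l:ℝ) ^ G + (1 + k) * 8 ^ k / (l:ℝ) ^ G := by ring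
  have : 0 ≤ 1 / (l:ℝ) ^ G := by positivity
  linarith

lemma eta_bd (C n r G l cc : ℕ) (x E : ℝ) (hl : 1 ≤ l) (hG : G = 2 * (C + r * n + 1)) (hl0 : C * 2 ^ C * cc ≤ l) (hcc : 1 ≤ cc)
    (hx0 : 0 ≤ x) (hx : x ≤ l) (hE : E ≤ cc / (l:ℝ) ^ G) : C * (1 + x) ^ C * √E ≤ (1 / (l:ℝ) ^ r) ^ n := by
  have hl' : (1:ℝ) ≤ l := by exact_mod_cast hl
  have hcc' : (1:ℝ) ≤ cc := by exact_mod_cast hcc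
  have h1 : √E ≤ cc / (l:ℝ) ^ (C + r * n + 1) := by
    apply Real.sqrt_le_iff.2 ⟨by positivity, ?_⟩
    refine hE.trans ?_
    rw [div_pow, ← pow_mul, hG, mul_comm 2]
    gcongr
    exact le_self_pow₀ hcc' (by norm_num)
  have hl0' : (C:ℝ) * 2 ^ C * cc ≤ l := by exact_mod_cast hl0
  calc _ ≤ C * (2 * l) ^ C * (cc / (l:ℝ) ^ (C + r * n + 1)) := by gcongr; linarith
    _ = (C * 2 ^ C * cc) * (l ^ C / (l:ℝ) ^ (C + r * n + 1)) := by rw [mul_pow]; ring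
    _ ≤ l * (l ^ C / (l:ℝ) ^ (C + r * n + 1)) := by gcongr
    _ = _ := by rw [pow_add, pow_add, pow_one, one_div, inv_pow, ← pow_mul]; field_simp

lemma natdiv_le (N n : ℕ) : ((N / n : ℕ) : ℝ) ≤ (N:ℝ) / n := Nat.cast_div_le

lemma harm_Ico (a b N : ℕ) (ha : 1 ≤ a) (hb : b ≤ N + 1) : ∑ m ∈ Ico a b, (1:ℝ) / m ≤ 1 + Real.log N := by
  refine le_trans ?_ (harm_le N)
  apply sum_le_sum_of_subset_of_nonneg
  · intro x hx; rw [mem_Ico] at hx; rw [mem_Icc]; omega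
  · intros; positivity

/-- general bilinear reduction to blocks -/
lemma bil_blocks (f : ℕ → ℕ → ℂ) (hf : ∀ m n, ‖f m n‖ ≤ 1) (N K R : ℕ) (η : ℝ) (hη : 0 ≤ η) (hR : 0 < R) (hK : R ≤ K)
    (hb : ∀ X W V : ℕ, K ≤ X → W = X / R → V = N / (X + W) → K ≤ V → ‖∑ m ∈ Ico X (X + W), ∑ n ∈ Ico K (V + 1), f m n‖ ≤ W * V * η) :
    ‖∑ m ∈ Ico K (N / K + 1), ∑ n ∈ Ico K (N / m + 1), f m n‖ ≤ N * (η + 1 / R) * (1 + Real.log N) + (N / K + 1) + N / R := by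
  have hK1 : 1 ≤ K := by omega
  rcases le_or_gt K (N / K + 1) with hKN | hKN
  swap
  · rw [Ico_eq_empty (by omega)]
    have := Real.log_natCast_nonneg N
    simp; positivity
  have hR' : (0:ℝ) < R := by exact_mod_cast hR
  have key := block_sum (fun m => ∑ n ∈ Ico K (N / m + 1), f m n) (fun m => N * (η + 1 / R) * (1 / m) + 1) R K (N / K + 1) (N / R) hR hK (fun m => by positivity) ?_ ?_ hKN
  · refine key.trans ?_
    rw [sum_add_distrib, ← mul_sum]
    have h1 := harm_Ico K (N / K + 1) N hK1 (by have := Nat.div_le_self N K; omega)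
    have h2 : ∑ m ∈ Ico K (N / K + 1), (1:ℝ) ≤ N / K + 1 := by
      simp only [sum_const, Nat.card_Ico, nsmul_eq_mul, mul_one]
      have : ((N / K + 1 - K : ℕ) : ℝ) ≤ ((N / K + 1 : ℕ) : ℝ) := by exact_mod_cast Nat.sub_le _ _
      have := natdiv_le N K
      push_cast at *
      linarith
    have := mul_le_mul_of_nonneg_left h1 (by positivity : 0 ≤ N * (η + 1 / R))
    linarith
  · intro X hX hXN
    obtain ⟨W, hW⟩ : ∃ W, W = X / R := ⟨_, rfl⟩
    obtain ⟨V, hV⟩ : ∃ V, V = N / (X + W) := ⟨_, rfl⟩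
    rw [← hW]
    have hX0 : 0 < X := by omega
    have hs : ∀ m ∈ Ico X (X + W), ∑ n ∈ Ico K (N / m + 1), f m n = ∑ n ∈ Ico K (V + 1), f m n + ∑ n ∈ Ico (max K (V + 1)) (N / m + 1), f m n := by
      intro m hm
      rw [mem_Ico] at hm
      have hVm : V ≤ N / m := by rw [hV]; exact Nat.div_le_div_left hm.2.le (by omega)
      rcases le_or_gt K (V + 1) with h | h
      · rw [max_eq_right h, sum_Ico_consecutive _ h (by omega)]
      · rw [max_eq_left h.le, Ico_eq_empty (by omega : ¬ K < V + 1), sum_empty, zero_add]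
    rw [sum_congr rfl hs, sum_add_distrib]
    have hrest : ‖∑ m ∈ Ico X (X + W), ∑ n ∈ Ico (max K (V + 1)) (N / m + 1), f m n‖ ≤ ∑ m ∈ Ico X (X + W), (N / R * (1 / m) + 1 : ℝ) := by
      refine (norm_sum_le _ _).trans (sum_le_sum fun m hm => ?_)
      refine (norm_sum_le _ _).trans ?_
      refine (sum_le_sum fun n _ => hf m n).trans ?_
      rw [mem_Ico] at hm
      simp only [sum_const, Nat.card_Ico, nsmul_eq_mul, mul_one]
      have h1 : ((N / m + 1 - max K (V + 1) : ℕ) : ℝ) ≤ ((N / m : ℕ):ℝ) - V := by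
        have hVm : V ≤ N / m := by rw [hV]; exact Nat.div_le_div_left hm.2.le (by omega)
        rw [← Nat.cast_sub hVm]
        exact_mod_cast (by omega)
      refine h1.trans ?_
      have h2 := natdiv_le N m
      have h3 := natdiv_ge N (X + W)
      rw [← hV] at h3
      have hm0 : (0:ℝ) < m := by exact_mod_cast (by omega : 0 < m)
      have hXW : (0:ℝ) < ((X + W : ℕ) : ℝ) := by exact_mod_cast (by omega : 0 < X + W)
      have h4 : (N:ℝ) / m - N / ((X + W : ℕ) : ℝ) ≤ N / R * (1 / m) := by
        have h5 : (R:ℝ) * (((X + W : ℕ) : ℝ) - m) ≤ ((X + W : ℕ) : ℝ) := by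
          have h6 : R * W ≤ X := by rw [hW]; exact Nat.mul_div_le X R
          have h6' : (R:ℝ) * W ≤ X := by exact_mod_cast h6
          have h7 : (X:ℝ) ≤ m := by exact_mod_cast hm.1
          push_cast
          nlinarith [show (0:ℝ) ≤ W by positivity]
        have h8 : (N:ℝ) / m - N / ((X + W : ℕ) : ℝ) = N * (((X + W : ℕ) : ℝ) - m) / (m * ((X + W : ℕ) : ℝ)) := by field_simp
        have h9 : N / R * (1 / m) = (N:ℝ) * (((X + W : ℕ) : ℝ) / R) / (m * ((X + W : ℕ) : ℝ)) := by field_simp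
        rw [h8, h9]
        gcongr
        rw [le_div_iff₀ hR']; linarith
      linarith
    have hmain : ‖∑ m ∈ Ico X (X + W), ∑ n ∈ Ico K (V + 1), f m n‖ ≤ ∑ m ∈ Ico X (X + W), (N * η * (1 / m) : ℝ) := by
      rcases le_or_gt K V with h | h
      · refine (hb X W V hX hW hV h).trans ?_
        calc (W:ℝ) * V * η = ∑ m ∈ Ico X (X + W), (V * η : ℝ) := by simp; ring
          _ ≤ _ := by
            apply sum_le_sum; intro m hm; rw [mem_Ico] at hm
            have h2 := natdiv_le N m
            have hVm : V ≤ N / m := by rw [hV]; exact Nat.div_le_div_left hm.2.le (by omega)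
            have : (V:ℝ) ≤ ((N / m : ℕ) : ℝ) := by exact_mod_cast hVm
            calc (V:ℝ) * η ≤ N / m * η := by gcongr; linarith
              _ = _ := by ring
      · rw [Ico_eq_empty (by omega : ¬ K < V + 1)]; simp
        apply sum_nonneg; intros; positivity
    refine (norm_add_le _ _).trans ((add_le_add hmain hrest).trans (le_of_eq ?_))
    rw [← sum_add_distrib]
    apply sum_congr rfl; intros; ring
  · intro X hX hXN hN
    have hX0 : 0 < X := by omega
    calc _ ≤ ∑ m ∈ Ico X (N / K + 1), (N / X : ℝ) := by
          refine (norm_sum_le _ _).trans (sum_le_sum fun m hm => ?_)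
          refine (norm_sum_le _ _).trans ?_
          refine (sum_le_sum fun n _ => hf m n).trans ?_
          rw [mem_Ico] at hm
          simp only [sum_const, Nat.card_Ico, nsmul_eq_mul, mul_one]
          refine le_trans ?_ (natdiv_le N X)
          have : N / m ≤ N / X := Nat.div_le_div_left hm.1 hX0
          have h3 : N / m + 1 - K ≤ N / X := by
            generalize N / m = a at *
            generalize N / X = b at *
            omega
          exact_mod_cast h3
      _ ≤ (X / R : ℝ) * (N / X) := by
          simp only [sum_const, Nat.card_Ico, nsmul_eq_mul]
          gcongr
          refine le_trans ?_ (natdiv_le X R)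
          exact_mod_cast (by omega)
      _ = _ := by
          have : (0:ℝ) < X := by exact_mod_cast hX0
          field_simp

lemma minor_bl (k c0 : ℕ) (hk : 0 < k) (hc : 0 < c0) (r : ℕ) (hr : 1 ≤ r) : ∃ A0 B : ℕ, r ≤ B ∧ ∀ A, A0 ≤ A → ∃ l0 : ℕ, ∀ N l q : ℕ, l0 ≤ l → 1 ≤ l → Real.log N ≤ l →
    l ^ A ≤ q → q * l ^ A ≤ N ^ k → ∀ a : ℤ, IsCoprime a (q:ℤ) →
    ∀ θ : ℝ, |θ - a / q| ≤ 1 / (q:ℝ) ^ 2 → ∀ P : Polynomial ℝ, P.natDegree ≤ k → P.coeff k = c0 * θ →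
    ∀ u v : ℕ → ℂ, (∀ d, ‖u d‖ ≤ 1) → (∀ m, ‖v m‖ ≤ 1) →
    ‖∑ m ∈ Ico (l ^ B) (N / l ^ B + 1), ∑ n ∈ Ico (l ^ B) (N / m + 1), u m * v n * ee (P.eval ((m * n : ℕ) : ℝ))‖ ≤ 7 * N * l / (l:ℝ) ^ r := by
  obtain ⟨C, hC⟩ := BLn k c0 hk hc
  obtain ⟨G, hG⟩ : ∃ G, G = 2 * (C + r * 2 ^ (2 * k) + 1) := ⟨_, rfl⟩
  obtain ⟨cc, hcc⟩ : ∃ cc, cc = 4 + (1 + k) + (1 + k) * 8 ^ k := ⟨_, rfl⟩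
  refine ⟨G + 1 + r * k, r + 1 + G, by omega, fun A hA => ⟨C * 2 ^ C * cc, fun N l q hl0 hl hlog hq1 hq2 a ha θ hθ P hP1 hP2 u v hu hv => ?_⟩⟩
  obtain ⟨B, hB⟩ : ∃ B, B = r + 1 + G := ⟨_, rfl⟩
  rw [← hB]
  have hl' : (1:ℝ) ≤ l := by exact_mod_cast hl
  have hq0 : 0 < q := lt_of_lt_of_le (by positivity) hq1
  have hNp : 0 < N := Nat.pos_of_ne_zero (by rintro rfl; rw [zero_pow hk.ne'] at hq2; have : 0 < q * l ^ A := by positivity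
                                             omega)
  have hN1 : (1:ℝ) ≤ N := by exact_mod_cast hNp
  have hlr : 0 < l ^ r := by positivity
  have hKR : l ^ r ≤ l ^ B := Nat.pow_le_pow_right hl (by omega)
  have key := bil_blocks (fun m n => u m * v n * ee (P.eval ((m * n : ℕ) : ℝ))) (fun m n => by
    rw [norm_mul, norm_mul, norm_ee, mul_one]
    exact mul_le_one₀ (hu m) (norm_nonneg _) (hv n)) N (l ^ B) (l ^ r) (1 / (l:ℝ) ^ r) (by positivity) hlr hKR ?_
  · refine key.trans ?_
    push_cast
    have h1 : (N:ℝ) / (l:ℝ) ^ B ≤ N / (l:ℝ) ^ r := by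
      gcongr
      omega
    have hNl : (l:ℝ) ^ r ≤ N := by
      have h2 : l ^ (r * k) ≤ N ^ k := le_trans (le_trans (Nat.pow_le_pow_right hl (by omega)) (Nat.le_mul_of_pos_left (l ^ A) hq0)) hq2
      rw [pow_mul] at h2
      exact_mod_cast (Nat.pow_le_pow_iff_left hk.ne').1 h2
    have h2 : (1:ℝ) ≤ N / (l:ℝ) ^ r := by rw [one_le_div (by positivity)]; exact hNl
    have h3 : (0:ℝ) ≤ N / (l:ℝ) ^ r := by positivity
    calc _ = 2 * (N / (l:ℝ) ^ r) * (1 + Real.log N) + (N / (l:ℝ) ^ B + 1) + N / (l:ℝ) ^ r := by ring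
      _ ≤ 2 * (N / (l:ℝ) ^ r) * (l + l) + (N / (l:ℝ) ^ r * l + N / (l:ℝ) ^ r * l) + N / (l:ℝ) ^ r * l := by
          have h4 : (N:ℝ) / (l:ℝ) ^ r ≤ N / (l:ℝ) ^ r * l := le_mul_of_one_le_right h3 hl'
          gcongr <;> linarith
      _ = _ := by ring
  · intro X W V hX hW hV hVK
    have hX0 : 0 < X := lt_of_lt_of_le (by positivity) hX
    have hW0 : 0 < W := by rw [hW]; exact Nat.div_pos (hKR.trans hX) hlr
    have hV0 : 0 < V := lt_of_lt_of_le (by positivity) hVK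
    have hX2 : X ≤ 2 * l ^ r * W := by
      have h1 := Nat.lt_mul_div_succ X hlr
      rw [← hW] at h1
      calc X ≤ l ^ r * (W + 1) := h1.le
        _ ≤ l ^ r * (W + W) := by gcongr; omega
        _ = _ := by ring
    have hWX : W ≤ X := by rw [hW]; exact Nat.div_le_self _ _
    have hN8 : N ≤ 8 * l ^ r * (W * V) := by
      have h1 := Nat.lt_mul_div_succ N (by omega : 0 < X + W)
      rw [← hV] at h1
      calc N ≤ (X + W) * (V + 1) := h1.le
        _ ≤ (X + X) * (V + V) := by gcongr; omega
        _ = X * (4 * V) := by ring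
        _ ≤ (2 * l ^ r * W) * (4 * V) := by gcongr
        _ = _ := by ring
    have hWV : W * V ≤ N := by
      calc W * V ≤ (X + W) * (N / (X + W)) := by rw [← hV]; gcongr; omega
        _ ≤ N := Nat.mul_div_le _ _
    have hE := E2_bd k G r A B N l q W V X hk (by omega) hA hl hlog hq1 hq2 hX hX2 hVK hN8
    rw [← hcc] at hE
    have hWV1 : 1 ≤ W * V := Nat.mul_pos hW0 hV0
    refine hC W V q hW0 hV0 hq0 a ha θ hθ P hP1 hP2 X (X + W) _ (V + 1) (by omega) (by have : 0 < l ^ B := by positivity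
                                                                                       omega) u v hu hv _ (by positivity) ?_
    apply eta_bd C (2 ^ (2 * k)) r G l cc _ _ hl hG hl0 (by omega) _ _ hE
    · exact_mod_cast Real.log_natCast_nonneg (W * V)
    · refine le_trans ?_ hlog
      apply Real.log_le_log
      · exact_mod_cast hWV1
      · exact_mod_cast hWV

end P5

section P5
open ArithmeticFunction

lemma N_ge (k A j N l q : ℕ) (hk : 0 < k) (hl : 1 ≤ l) (hA : j * k ≤ A) (hq1 : l ^ A ≤ q) (hq2 : q * l ^ A ≤ N ^ k) : l ^ j ≤ N := by
  have hq0 : 0 < q := lt_of_lt_of_le (by positivity) hq1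
  have h2 : l ^ (j * k) ≤ N ^ k := le_trans (le_trans (Nat.pow_le_pow_right hl hA) (Nat.le_mul_of_pos_left (l ^ A) hq0)) hq2
  rw [pow_mul] at h2
  exact (Nat.pow_le_pow_iff_left hk.ne').1 h2

lemma minor_SW (k c0 : ℕ) (hk : 0 < k) (hc : 0 < c0) (r B : ℕ) : ∃ A0 : ℕ, ∀ A, A0 ≤ A → ∃ l0 : ℕ, ∀ N l q : ℕ, l0 ≤ l → 1 ≤ l → Real.log N ≤ l →
    l ^ A ≤ q → q * l ^ A ≤ N ^ k → ∀ a : ℤ, IsCoprime a (q:ℤ) →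
    ∀ θ : ℝ, |θ - a / q| ≤ 1 / (q:ℝ) ^ 2 → ∀ P : Polynomial ℝ, P.natDegree ≤ k → P.coeff k = c0 * θ →
    ∀ d b1 b2 : ℕ, 1 ≤ d → d ≤ l ^ B → 1 ≤ b1 → b2 ≤ N / d + 1 →
    ‖∑ m ∈ Ico b1 b2, ee (P.eval ((d * m : ℕ) : ℝ))‖ ≤ N / d * (1 / (l:ℝ) ^ r) := by
  obtain ⟨C, hC⟩ := SWn k c0 hk hc
  obtain ⟨G, hG⟩ : ∃ G, G = 2 * (C + (r + B * C) * 2 ^ (2 * k) + 1) := ⟨_, rfl⟩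
  obtain ⟨cc, hcc⟩ : ∃ cc, cc = 1 + 2 * (1 + k) + (1 + k) * 2 ^ k := ⟨_, rfl⟩
  refine ⟨(B + 1 + G) * k + (G + 1), fun A hA => ⟨C * 2 ^ C * cc, fun N l q hl0 hl hlog hq1 hq2 a ha θ hθ P hP1 hP2 d b1 b2 hd hdK hb1 hb2 => ?_⟩⟩
  have hl' : (1:ℝ) ≤ l := by exact_mod_cast hl
  have hq0 : 0 < q := lt_of_lt_of_le (by positivity) hq1
  have hNl : l ^ (B + 1 + G) ≤ N := N_ge k A _ N l q hk hl (by omega) hq1 hq2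
  have hNp : 0 < N := lt_of_lt_of_le (by positivity) hNl
  have hdN : d ≤ N := hdK.trans (le_trans (Nat.pow_le_pow_right hl (by omega)) hNl)
  obtain ⟨M, hM⟩ : ∃ M, M = N / d := ⟨_, rfl⟩
  have hM0 : 0 < M := by rw [hM]; exact Nat.div_pos hdN hd
  have hNM : N ≤ 2 * l ^ B * M := by
    have h1 := Nat.lt_mul_div_succ N hd
    rw [← hM] at h1
    calc N ≤ d * (M + 1) := h1.le
      _ ≤ l ^ B * (M + M) := by gcongr; omega
      _ = _ := by ring
  have hlq : Real.log q ≤ k * l := by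
    have h1 : (q:ℝ) ≤ (N:ℝ) ^ k := by
      have : q ≤ N ^ k := le_trans (Nat.le_mul_of_pos_right q (by positivity)) hq2
      exact_mod_cast this
    have := Real.log_le_log (by exact_mod_cast hq0) h1
    rw [Real.log_pow] at this
    refine this.trans (by gcongr)
  have hlq0 : 0 ≤ Real.log q := Real.log_natCast_nonneg q
  have hlq1 : 1 + Real.log q ≤ (1 + k) * l := by linarith
  have pw : ∀ i j : ℕ, i ≤ j → (l:ℝ) ^ i ≤ (l:ℝ) ^ j := fun i j h => pow_le_pow_right₀ hl' h
  have hNMr : (N:ℝ) ≤ 2 * l ^ B * M := by exact_mod_cast hNM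
  have hE : E1 k q M ≤ (cc:ℝ) / (l:ℝ) ^ G := by
    have t1 : 1 / (q:ℝ) ≤ 1 / (l:ℝ) ^ G := by
      apply inv_bd (by exact_mod_cast hq0) (by positivity)
      have : (l:ℝ) ^ A ≤ q := by exact_mod_cast hq1
      linarith [pw G A (by omega)]
    have t3 : (1 + Real.log q) / (M:ℝ) ≤ 2 * (1 + k) / (l:ℝ) ^ G := by
      rw [div_le_div_iff₀ (by exact_mod_cast hM0) (by positivity)]
      have h3 : (l:ℝ) ^ (B + 1 + G) ≤ 2 * l ^ B * M := by exact_mod_cast hNl.trans hNM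
      have h4 : (l:ℝ) ^ B * (l * l ^ G) ≤ l ^ B * (2 * M) := by
        calc _ = (l:ℝ) ^ (B + 1 + G) := by ring
          _ ≤ _ := h3
          _ = _ := by ring
      have h5 := le_of_mul_le_mul_left h4 (by positivity)
      calc _ ≤ (1 + k) * l * (l:ℝ) ^ G := by gcongr
        _ = (1 + k) * (l * l ^ G) := by ring
        _ ≤ (1 + k) * (2 * M) := by gcongr
        _ = _ := by ring
    have t4 : q * (1 + Real.log q) / (M:ℝ) ^ k ≤ (1 + k) * 2 ^ k / (l:ℝ) ^ G := by
      rw [div_le_div_iff₀ (by positivity) (by positivity)]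
      have h1 : (q:ℝ) * l ^ A ≤ N ^ k := by exact_mod_cast hq2
      have h3 : (N:ℝ) ^ k ≤ 2 ^ k * l ^ (B * k) * M ^ k := by
        calc _ ≤ (2 * (l:ℝ) ^ B * M) ^ k := by gcongr
          _ = _ := by rw [mul_pow, mul_pow, ← pow_mul]
      have h4 : (l:ℝ) ^ (B * k) * (l * l ^ G) ≤ l ^ A := by
        calc _ = (l:ℝ) ^ (G + 1 + B * k) := by ring
          _ ≤ _ := pw _ _ (by
            have : B * k ≤ (B + 1 + G) * k := Nat.mul_le_mul_right k (by omega)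
            omega)
      have h6 : (l:ℝ) ^ (B * k) * (q * (l * l ^ G)) ≤ l ^ (B * k) * (2 ^ k * M ^ k) := by
        calc _ = q * ((l:ℝ) ^ (B * k) * (l * l ^ G)) := by ring
          _ ≤ q * l ^ A := by gcongr
          _ ≤ _ := h1.trans (h3.trans (le_of_eq (by ring)))
      have h7 := le_of_mul_le_mul_left h6 (by positivity)
      calc _ ≤ q * ((1 + k) * l) * (l:ℝ) ^ G := by gcongr
        _ = (1 + k) * (q * (l * l ^ G)) := by ring
        _ ≤ (1 + k) * (2 ^ k * M ^ k) := by gcongr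
        _ = _ := by ring
    rw [E1, hcc]
    push_cast
    have : ((1:ℝ) + 2*(1+k) + (1+k)*2^k) / (l:ℝ)^G = 1/(l:ℝ)^G + 2*(1+k)/(l:ℝ)^G + (1+k)*2^k/(l:ℝ)^G := by ring
    linarith
  have hMN : M ≤ N := by rw [hM]; exact Nat.div_le_self _ _
  have h0 := hC M q d hM0 hq0 hd a ha θ hθ P hP1 hP2 b1 b2 (by omega) (1 / (l:ℝ) ^ r) (by positivity) ?_
  · refine h0.trans ?_
    gcongr
    rw [hM]; exact natdiv_le N d
  · obtain ⟨n, hn⟩ : ∃ n, n = 2 ^ (2 * k) := ⟨_, rfl⟩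
    have hn1 : 1 ≤ n := by rw [hn]; exact Nat.one_le_two_pow
    rw [← hn] at hG ⊢
    have h1 := eta_bd C n (r + B * C) G l cc (Real.log M) (E1 k q M) hl hG hl0 (by omega) (Real.log_natCast_nonneg M) (le_trans (Real.log_le_log (by exact_mod_cast hM0) (by exact_mod_cast hMN)) hlog) hE
    have hd' : (d:ℝ) ≤ (l:ℝ) ^ B := by exact_mod_cast hdK
    calc C * (d:ℝ) ^ C * (1 + Real.log M) ^ C * √(E1 k q M) = (d:ℝ) ^ C * (C * (1 + Real.log M) ^ C * √(E1 k q M)) := by ring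
      _ ≤ ((l:ℝ) ^ B) ^ C * (1 / (l:ℝ) ^ (r + B * C)) ^ n := by gcongr
      _ = ((l:ℝ) ^ (B * C) * (1 / (l:ℝ) ^ (B * C)) ^ n) * (1 / (l:ℝ) ^ r) ^ n := by
          rw [pow_add, ← pow_mul, one_div, one_div, one_div, mul_inv, mul_pow]; ring
      _ ≤ 1 * (1 / (l:ℝ) ^ r) ^ n := by
          gcongr
          obtain ⟨y, hy⟩ : ∃ y, y = (l:ℝ) ^ (B * C) := ⟨_, rfl⟩
          have hy1 : 1 ≤ y := by rw [hy]; exact one_le_pow₀ hl'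
          rw [← hy, one_div, inv_pow]
          have : y ≤ y ^ n := le_self_pow₀ hy1 (by omega)
          rw [← div_eq_mul_inv, div_le_one (by positivity)]; exact this
      _ = _ := one_mul _

end P5

section P5
open ArithmeticFunction

lemma norm_add₃_le' (x y z : ℂ) (a b c : ℝ) (h1 : ‖x‖ ≤ a) (h2 : ‖y‖ ≤ b) (h3 : ‖z‖ ≤ c) : ‖x + (y + z)‖ ≤ a + (b + c) :=
  (norm_add_le _ _).trans (add_le_add h1 ((norm_add_le _ _).trans (add_le_add h2 h3)))

lemma split3 (G : ℕ → ℕ → ℂ) (N K : ℕ) (hK : 1 ≤ K) : ∑ d ∈ Ioc 0 N, ∑ m ∈ Ioc 0 (N / d), G d m =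
    ∑ m ∈ Ico 1 K, ∑ d ∈ Ico 1 (N / m + 1), G d m + (∑ d ∈ Ico 1 K, ∑ m ∈ Ico K (N / d + 1), G d m
     + ∑ d ∈ Ico K (N / K + 1), ∑ m ∈ Ico K (N / d + 1), G d m) := by
  have key : ∀ d m : ℕ, 1 ≤ d → 1 ≤ m → (m ≤ N / d ↔ d ≤ N / m) := fun d m hd hm => by
    rw [Nat.le_div_iff_mul_le hd, Nat.le_div_iff_mul_le hm, mul_comm]
  have h1 : ∀ d ∈ Ioc 0 N, ∑ m ∈ Ioc 0 (N / d), G d m = ∑ m ∈ (Ioc 0 (N / d)).filter (· < K), G d m + ∑ m ∈ Ico K (N / d + 1), G d m := fun d _ => by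
    rw [← sum_filter_add_sum_filter_not (Ioc 0 (N / d)) (· < K)]
    congr 1
    apply sum_congr _ (fun _ _ => rfl)
    ext m; simp only [mem_filter, mem_Ioc, mem_Ico]; omega
  rw [sum_congr rfl h1, sum_add_distrib]
  congr 1
  · apply sum_comm'
    intro d m
    simp only [mem_filter, mem_Ioc, mem_Ico]
    constructor
    · rintro ⟨h, h2, h3⟩
      have := (key d m h.1 h2.1).1 h2.2
      omega
    · rintro ⟨h, h2⟩
      have := (key d m h.1 h2.1).2 (by omega)
      have := Nat.div_le_self N m
      omega
  · have hz : ∀ d, 1 ≤ d → N / K < d → ∑ m ∈ Ico K (N / d + 1), G d m = 0 := fun d hd h => by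
      rw [Ico_eq_empty, sum_empty]
      intro h3
      have := (key d K hd hK).1 (by omega)
      omega
    have h3 : ∑ d ∈ Ioc 0 N, ∑ m ∈ Ico K (N / d + 1), G d m = ∑ d ∈ Ioc 0 (N / K), ∑ m ∈ Ico K (N / d + 1), G d m := by
      symm
      apply sum_subset
      · intro d; simp only [mem_Ioc]; have := Nat.div_le_self N K; omega
      · intro d; simp only [mem_Ioc]; intro h h2; exact hz d h.1 (by omega)
    rw [h3]
    by_cases h : K ≤ N / K + 1
    · rw [sum_Ico_consecutive _ hK h]; rfl
    · rw [Ico_eq_empty (a := K) (b := N / K + 1) (by omega), sum_empty, add_zero]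
      apply sum_subset
      · intro d; simp only [mem_Ioc, mem_Ico]; omega
      · intro d; simp only [mem_Ioc, mem_Ico]; intro h h2; exact hz d h.1 (by omega)

lemma log_le_of (m N l : ℕ) (hm : m ≤ N) (hlog : Real.log N ≤ l) : Real.log m ≤ l := by
  rcases Nat.eq_zero_or_pos m with rfl | h
  · simp
  · exact le_trans (Real.log_le_log (by exact_mod_cast h) (by exact_mod_cast hm)) hlog

lemma scale2 (s1 : Finset ℕ) (s2 : ℕ → Finset ℕ) (f g : ℕ → ℝ) (c : ℕ → ℕ → ℂ) (a b E : ℝ) (ha : 0 < a) (hb : 0 < b)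
    (hf : ∀ d ∈ s1, |f d| ≤ a) (hg : ∀ d ∈ s1, ∀ m ∈ s2 d, |g m| ≤ b)
    (h : ∀ u v : ℕ → ℂ, (∀ d, ‖u d‖ ≤ 1) → (∀ d, ‖v d‖ ≤ 1) → ‖∑ d ∈ s1, ∑ m ∈ s2 d, u d * v m * c d m‖ ≤ E) :
    ‖∑ d ∈ s1, ∑ m ∈ s2 d, (f d : ℂ) * (g m : ℂ) * c d m‖ ≤ a * b * E := by
  have aux : ∀ (f : ℕ → ℝ) (a : ℝ), 0 < a → ∀ d, ‖(if |f d| ≤ a then ((f d / a : ℝ) : ℂ) else 0)‖ ≤ 1 := fun f a ha d => by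
    split_ifs with h
    · rw [Complex.norm_real, Real.norm_eq_abs, abs_div, abs_of_pos ha, div_le_one ha]; exact h
    · simp
  have h0 := h _ _ (aux f a ha) (aux g b hb)
  have : ∑ d ∈ s1, ∑ m ∈ s2 d, (f d : ℂ) * (g m : ℂ) * c d m = ((a * b : ℝ) : ℂ) * ∑ d ∈ s1, ∑ m ∈ s2 d, (if |f d| ≤ a then ((f d / a : ℝ) : ℂ) else 0) * (if |g m| ≤ b then ((g m / b : ℝ) : ℂ) else 0) * c d m := by
    rw [mul_sum]; apply sum_congr rfl; intro d hd; rw [mul_sum]; apply sum_congr rfl; intro m hm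
    rw [if_pos (hf d hd), if_pos (hg d hd m hm)]
    have ha' : (a:ℂ) ≠ 0 := by exact_mod_cast ha.ne'
    have hb' : (b:ℂ) ≠ 0 := by exact_mod_cast hb.ne'
    push_cast; field_simp
  rw [this, norm_mul, Complex.norm_real, Real.norm_of_nonneg (by positivity)]
  gcongr

lemma triv_VV (c : ℕ → ℕ → ℂ) (hc : ∀ d m, ‖c d m‖ ≤ 1) (N K : ℕ) (s : ℕ → Finset ℕ) (hs : ∀ m, s m ⊆ Ioc 0 (N / m)) :
    ‖∑ m ∈ Ico 1 K, ∑ d ∈ s m, (vonMangoldt m : ℂ) * (vonMangoldt d : ℂ) * c m d‖ ≤ 6 * N * (Real.log K + 6) := by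
  calc _ ≤ ∑ m ∈ Ico 1 K, 6 * N * (vonMangoldt m / m) := by
        refine norm_sum_le_of_le _ fun m hm => ?_
        calc _ ≤ ∑ d ∈ s m, vonMangoldt m * vonMangoldt d := by
              refine norm_sum_le_of_le _ fun d hd => ?_
              rw [norm_mul, norm_mul, Complex.norm_real, Complex.norm_real, Real.norm_of_nonneg vonMangoldt_nonneg, Real.norm_of_nonneg vonMangoldt_nonneg]
              exact mul_le_of_le_one_right (mul_nonneg vonMangoldt_nonneg vonMangoldt_nonneg) (hc _ _)
          _ ≤ ∑ d ∈ Ioc 0 (N / m), vonMangoldt m * vonMangoldt d :=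
              sum_le_sum_of_subset_of_nonneg (hs m) fun _ _ _ => mul_nonneg vonMangoldt_nonneg vonMangoldt_nonneg
          _ = vonMangoldt m * ∑ d ∈ Ioc 0 (N / m), vonMangoldt d := by rw [mul_sum]
          _ ≤ vonMangoldt m * (6 * (N / m)) := by
              have h1 := psi_bd (N / m)
              have h2 := natdiv_le N m
              exact mul_le_mul_of_nonneg_left (by linarith) vonMangoldt_nonneg
          _ = _ := by ring
    _ ≤ ∑ m ∈ Ioc 0 K, 6 * N * (vonMangoldt m / m) := by
        apply sum_le_sum_of_subset_of_nonneg
        · intro m; simp only [mem_Ico, mem_Ioc]; omega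
        · intros; have := @vonMangoldt_nonneg; positivity
    _ ≤ _ := by rw [← mul_sum]; exact mul_le_mul_of_nonneg_left (mertens K) (by positivity)

lemma log_mono_nat {m n : ℕ} (h : m ≤ n) : Real.log m ≤ Real.log n := by
  rcases Nat.eq_zero_or_pos m with rfl | h0
  · simpa using Real.log_natCast_nonneg n
  · exact Real.log_le_log (by exact_mod_cast h0) (by exact_mod_cast h)

lemma triv_ml (c : ℕ → ℕ → ℂ) (hc : ∀ d m, ‖c d m‖ ≤ 1) (N K : ℕ) :
    ‖∑ m ∈ Ico 1 K, ∑ d ∈ Ico 1 (N / m + 1), ((moebius d : ℤ) : ℂ) * ((Real.log m ^ 2 : ℝ) : ℂ) * c d m‖ ≤ N * (1 + Real.log K) ^ 3 := by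
  have hK := Real.log_natCast_nonneg K
  calc _ ≤ ∑ m ∈ Ico 1 K, N * (1 + Real.log K) ^ 2 * (1 / (m:ℝ)) := by
        refine norm_sum_le_of_le _ fun m hm => ?_
        rw [mem_Ico] at hm
        calc _ ≤ ∑ d ∈ Ico 1 (N / m + 1), (1 + Real.log K) ^ 2 := by
              refine norm_sum_le_of_le _ fun d hd => ?_
              have h1 : ‖((moebius d : ℤ) : ℂ)‖ ≤ 1 := by
                rw [Complex.norm_intCast]; exact mu_abs d
              have h3 := Real.log_natCast_nonneg m
              have h2 : ‖((Real.log m ^ 2 : ℝ) : ℂ)‖ ≤ (1 + Real.log K) ^ 2 := by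
                rw [Complex.norm_real, Real.norm_of_nonneg (by positivity)]
                have := log_mono_nat hm.2.le
                gcongr; linarith
              rw [norm_mul, norm_mul]
              calc _ ≤ 1 * (1 + Real.log K) ^ 2 * 1 := by gcongr; exact hc d m
                _ = _ := by ring
          _ = (N / m : ℕ) * (1 + Real.log K) ^ 2 := by simp
          _ ≤ N / m * (1 + Real.log K) ^ 2 := by gcongr; exact natdiv_le N m
          _ = _ := by ring
    _ = N * (1 + Real.log K) ^ 2 * ∑ m ∈ Ico 1 K, (1 / (m:ℝ)) := by rw [mul_sum]
    _ ≤ N * (1 + Real.log K) ^ 2 * (1 + Real.log K) := by gcongr; exact harm_Ico 1 K K le_rfl (by omega)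
    _ = _ := by ring

lemma minor (k c0 : ℕ) (hk : 0 < k) (hc : 0 < c0) : ∃ A0 B : ℕ, ∀ A, A0 ≤ A → ∃ l0 : ℕ, ∀ N l q : ℕ, l0 ≤ l → 1 ≤ l → Real.log N ≤ l →
    l ^ A ≤ q → q * l ^ A ≤ N ^ k → ∀ a : ℤ, IsCoprime a (q:ℤ) →
    ∀ θ : ℝ, |θ - a / q| ≤ 1 / (q:ℝ) ^ 2 → ∀ P : Polynomial ℝ, P.natDegree ≤ k → P.coeff k = c0 * θ →
    ‖∑ n ∈ Ioc 0 N, (llm n : ℂ) * ee (P.eval (n:ℝ))‖ ≤ 110 * N * (1 + B * Real.log l) ^ 3 := by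
  obtain ⟨A0, B, hB, h1⟩ := minor_bl k c0 hk hc 5 (by norm_num)
  obtain ⟨A1, h2⟩ := minor_SW k c0 hk hc 5 B
  refine ⟨max A0 A1, B, fun A hA => ?_⟩
  obtain ⟨l1, h1⟩ := h1 A (le_trans (le_max_left _ _) hA)
  obtain ⟨l2, h2⟩ := h2 A (le_trans (le_max_right _ _) hA)
  refine ⟨max l1 l2, fun N l q hl0 hl hlog hq1 hq2 a ha θ hθ P hP1 hP2 => ?_⟩
  have h1 := h1 N l q (le_trans (le_max_left _ _) hl0) hl hlog hq1 hq2 a ha θ hθ P hP1 hP2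
  have h2 := h2 N l q (le_trans (le_max_right _ _) hl0) hl hlog hq1 hq2 a ha θ hθ P hP1 hP2
  have hl' : (1:ℝ) ≤ l := by exact_mod_cast hl
  have hll := Real.log_natCast_nonneg l
  have hlK : Real.log ((l ^ B : ℕ) : ℝ) = B * Real.log l := by push_cast; rw [Real.log_pow]
  obtain ⟨K, hK⟩ : ∃ K, K = l ^ B := ⟨_, rfl⟩
  rw [← hK] at h1 h2 hlK
  have hK1 : 1 ≤ K := by rw [hK]; exact Nat.one_le_pow _ _ hl
  rw [← hlK]
  have hlK0 : 0 ≤ Real.log K := Real.log_natCast_nonneg K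
  have hid : llm = (moebius : ArithmeticFunction ℝ) * lsq - vonMangoldt * vonMangoldt := by
    rw [← hh_eq, hh, add_sub_cancel_right]
  have e1 : ∑ n ∈ Ioc 0 N, (llm n : ℂ) * ee (P.eval (n:ℝ)) = ∑ n ∈ Ioc 0 N, ((((moebius : ArithmeticFunction ℝ) * lsq) n : ℝ) : ℂ) * ee (P.eval (n:ℝ)) - ∑ n ∈ Ioc 0 N, (((vonMangoldt * vonMangoldt : ArithmeticFunction ℝ) n : ℝ) : ℂ) * ee (P.eval (n:ℝ)) := by
    rw [← sum_sub_distrib]; apply sum_congr rfl; intro n _; rw [hid, ← sub_mul]; congr 1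
    rw [← Complex.ofReal_sub]; rfl
  have hN0 : (0:ℝ) ≤ N := by positivity
  have hdiv : ∀ d m : ℕ, 1 ≤ d → m < N / d + 1 → m ≤ N := fun d m _ h => by
    have := Nat.div_le_self N d; omega
  have hV : ∀ m, m ≤ N → |vonMangoldt m| ≤ l := fun m hm => by
    rw [abs_of_nonneg vonMangoldt_nonneg]; exact vonMangoldt_le_log.trans (log_le_of m N l hm hlog)
  have h7 : 7 * N * l / (l:ℝ) ^ 5 * l ^ 2 ≤ 7 * N := by
    rw [div_mul_eq_mul_div, div_le_iff₀ (by positivity)]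
    have : (l:ℝ) ^ 3 ≤ l ^ 5 := pow_le_pow_right₀ hl' (by norm_num)
    calc _ = 7 * N * (l:ℝ) ^ 3 := by ring
      _ ≤ _ := by gcongr
  -- type II
  have b2 : ‖∑ n ∈ Ioc 0 N, (((vonMangoldt * vonMangoldt : ArithmeticFunction ℝ) n : ℝ) : ℂ) * ee (P.eval (n:ℝ))‖ ≤ 2 * (6 * N * (Real.log K + 6)) + 7 * N := by
    have e := conv_sum vonMangoldt vonMangoldt (fun n => ee (P.eval (n:ℝ))) N
    rw [e, split3 _ N K hK1]
    have t1 := triv_VV (fun m d => ee (P.eval ((d * m : ℕ) : ℝ))) (fun d m => (norm_ee _).le) N K (fun m => Ico 1 (N / m + 1)) (fun m d => by simp only [mem_Ico, mem_Ioc]; omega)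
    have t2 := triv_VV (fun d m => ee (P.eval ((d * m : ℕ) : ℝ))) (fun d m => (norm_ee _).le) N K (fun m => Ico K (N / m + 1)) (fun m d => by simp only [mem_Ico, mem_Ioc]; omega)
    have t3 := scale2 (Ico K (N / K + 1)) (fun m => Ico K (N / m + 1)) vonMangoldt vonMangoldt (fun d m => ee (P.eval ((d * m : ℕ) : ℝ))) l l (7 * N * l / (l:ℝ) ^ 5) (by positivity) (by positivity) (fun d hd => hV d (by rw [mem_Ico] at hd; exact hdiv K d hK1 hd.2)) (fun d hd m hm => hV m (by rw [mem_Ico] at hd hm; exact hdiv d m (by omega) hm.2)) h1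
    have t1' : ‖∑ m ∈ Ico 1 K, ∑ d ∈ Ico 1 (N / m + 1), (vonMangoldt d : ℂ) * (vonMangoldt m : ℂ) * ee (P.eval ((d * m : ℕ) : ℝ))‖ ≤ 6 * N * (Real.log K + 6) := by
      refine le_trans (le_of_eq ?_) t1
      congr 1; apply sum_congr rfl; intro m _; apply sum_congr rfl; intro d _; ring
    refine (norm_add₃_le' _ _ _ _ _ _ t1' t2 t3).trans ?_
    nlinarith
  have b1 : ‖∑ n ∈ Ioc 0 N, ((((moebius : ArithmeticFunction ℝ) * lsq) n : ℝ) : ℂ) * ee (P.eval (n:ℝ))‖ ≤ N * (1 + Real.log K) ^ 3 + 4 * N * (1 + Real.log K) + 7 * N := by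
    have e := conv_sum (moebius : ArithmeticFunction ℝ) lsq (fun n => ee (P.eval (n:ℝ))) N
    rw [e, split3 _ N K hK1]
    have t1 := triv_ml (fun d m => ee (P.eval ((d * m : ℕ) : ℝ))) (fun d m => (norm_ee _).le) N K
    have t3 := scale2 (Ico K (N / K + 1)) (fun m => Ico K (N / m + 1)) (fun d => ((moebius : ArithmeticFunction ℝ) d)) lsq (fun d m => ee (P.eval ((d * m : ℕ) : ℝ))) 1 (l ^ 2) (7 * N * l / (l:ℝ) ^ 5) (by positivity) (by positivity) (fun d hd => by simpa using mu_abs d) (fun d hd m hm => by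
      rw [mem_Ico] at hd hm
      have := log_le_of m N l (hdiv d m (by omega) hm.2) hlog
      have h0 := Real.log_natCast_nonneg m
      rw [lsq_apply, abs_of_nonneg (by positivity)]
      gcongr) h1
    have t2 : ‖∑ d ∈ Ico 1 K, ∑ m ∈ Ico K (N / d + 1), (((moebius : ArithmeticFunction ℝ) d : ℝ) : ℂ) * (lsq m : ℂ) * ee (P.eval ((d * m : ℕ) : ℝ))‖ ≤ 4 * N * (1 + Real.log K) := by
      calc _ ≤ ∑ d ∈ Ico 1 K, 4 * N * (1 / (d:ℝ)) := by
            refine norm_sum_le_of_le _ fun d hd => ?_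
            rw [mem_Ico] at hd
            by_cases hKd : K ≤ N / d + 1
            swap
            · rw [Ico_eq_empty (by omega), sum_empty, norm_zero]; positivity
            have hab := abel_mono (fun m => Real.log m ^ 2) (fun m n h => by
              have := Real.log_natCast_nonneg m
              have := log_mono_nat h
              dsimp only; gcongr) (fun m => ee (P.eval ((d * m : ℕ) : ℝ))) (N / d + 1) (N / d * (1 / (l:ℝ) ^ 5)) K hKd (by positivity) (fun t ht1 ht2 => h2 d t (N / d + 1) hd.1 hd.2.le (by omega) le_rfl)
            have : ∑ m ∈ Ico K (N / d + 1), (((moebius : ArithmeticFunction ℝ) d : ℝ) : ℂ) * (lsq m : ℂ) * ee (P.eval ((d * m : ℕ) : ℝ)) = (((moebius : ArithmeticFunction ℝ) d : ℝ) : ℂ) * ∑ m ∈ Ico K (N / d + 1), ((Real.log m ^ 2 : ℝ) : ℂ) * ee (P.eval ((d * m : ℕ) : ℝ)) := by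
              rw [mul_sum]; apply sum_congr rfl; intro m _; rw [lsq_apply, mul_assoc]
            rw [this, norm_mul]
            have hm1 : ‖(((moebius : ArithmeticFunction ℝ) d : ℝ) : ℂ)‖ ≤ 1 := by
              rw [Complex.norm_real]; simpa using mu_abs d
            have hlb : Real.log ((N / d + 1 : ℕ) : ℝ) ≤ 2 * l := by
              rcases Nat.eq_zero_or_pos N with rfl | hNp
              · simp
              have h5 : Real.log ((N / d + 1 : ℕ) : ℝ) ≤ Real.log ((2 * N : ℕ) : ℝ) := log_mono_nat (by have := Nat.div_le_self N d; omega)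
              rw [Nat.cast_mul, Real.log_mul (by norm_num) (by exact_mod_cast hNp.ne')] at h5
              have := Real.log_two_lt_d9
              push_cast at h5 ⊢
              linarith
            have h0 := Real.log_natCast_nonneg (N / d + 1)
            calc _ ≤ 1 * ((2 * l) ^ 2 * (N / d * (1 / (l:ℝ) ^ 5))) := by
                  refine mul_le_mul hm1 (hab.trans ?_) (norm_nonneg _) zero_le_one
                  gcongr
              _ = 4 * N * (1 / (d:ℝ)) * (l ^ 2 * (1 / (l:ℝ) ^ 5)) := by ring
              _ ≤ 4 * N * (1 / (d:ℝ)) * 1 := by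
                  gcongr
                  rw [mul_one_div, div_le_one (by positivity)]
                  exact pow_le_pow_right₀ hl' (by norm_num)
              _ = _ := mul_one _
        _ = 4 * N * ∑ d ∈ Ico 1 K, (1 / (d:ℝ)) := by rw [mul_sum]
        _ ≤ _ := by gcongr; exact harm_Ico 1 K K le_rfl (by omega)
    have t1' : ‖∑ m ∈ Ico 1 K, ∑ d ∈ Ico 1 (N / m + 1), (((moebius : ArithmeticFunction ℝ) d : ℝ) : ℂ) * (lsq m : ℂ) * ee (P.eval ((d * m : ℕ) : ℝ))‖ ≤ N * (1 + Real.log K) ^ 3 := by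
      refine le_trans (le_of_eq ?_) t1
      rfl
    refine (norm_add₃_le' _ _ _ _ _ _ t1' t2 t3).trans ?_
    nlinarith
  rw [e1]
  refine (norm_sub_le _ _).trans ((add_le_add b1 b2).trans ?_)
  obtain ⟨x, hx⟩ : ∃ x, x = Real.log K := ⟨_, rfl⟩
  rw [← hx] at hlK0 ⊢
  have : (1 + x) ^ 3 + 4 * (1 + x) + 7 + (2 * (6 * (x + 6)) + 7) ≤ 110 * (1 + x) ^ 3 := by nlinarith [pow_nonneg hlK0 3, pow_nonneg hlK0 2]
  nlinarith

end P5

section P6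
open ArithmeticFunction

lemma cnt_mod (X W M v : ℕ) (hM : 0 < M) : |((#{n ∈ Ico X (X + W) | n ≡ v [MOD M]} : ℕ) : ℝ) - W / M| ≤ 1 := by
  have h := Nat.Ico_filter_modEq_card X (X + W) hM v
  have hM' : (0:ℝ) < M := by exact_mod_cast hM
  have hQ : ((#{n ∈ Ico X (X + W) | n ≡ v [MOD M]} : ℤ) : ℝ) = max ((⌈(((X + W : ℕ) : ℝ) - v) / M⌉ : ℝ) - (⌈((X : ℝ) - v) / M⌉ : ℝ)) 0 := by
    have e1 : ⌈(((X + W : ℕ) : ℝ) - v) / M⌉ = ⌈(((X + W : ℕ) : ℚ) - v) / M⌉ := by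
      rw [← Rat.ceil_cast (α := ℝ)]; push_cast; rfl
    have e2 : ⌈((X : ℝ) - v) / M⌉ = ⌈((X : ℚ) - v) / M⌉ := by
      rw [← Rat.ceil_cast (α := ℝ)]; push_cast; rfl
    rw [e1, e2, h]; push_cast; rfl
  rw [Int.cast_natCast] at hQ
  rw [hQ]
  obtain ⟨x, hx⟩ : ∃ x, x = ((X:ℝ) - v) / M := ⟨_, rfl⟩
  obtain ⟨w, hw⟩ : ∃ w, w = (W:ℝ) / M := ⟨_, rfl⟩
  have hw0 : 0 ≤ w := by rw [hw]; positivity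
  have : (((X + W : ℕ) : ℝ) - v) / M = x + w := by rw [hx, hw]; push_cast; ring
  rw [this, ← hx, ← hw]
  have h1 := Int.le_ceil x
  have h2 := Int.ceil_lt_add_one x
  have h3 := Int.le_ceil (x + w)
  have h4 := Int.ceil_lt_add_one (x + w)
  rw [abs_le]
  constructor
  · have := le_max_left ((⌈x + w⌉ : ℝ) - (⌈x⌉ : ℝ)) 0
    linarith
  · have : max ((⌈x + w⌉ : ℝ) - (⌈x⌉ : ℝ)) 0 ≤ w + 1 := max_le (by linarith) (by linarith)
    linarith

lemma cntd (X W q b d : ℕ) (hq : 0 < q) (hd : 0 < d) (h : d.Coprime q) :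
    |((#{n ∈ Ico X (X + W) | n ≡ b [MOD q] ∧ d ∣ n} : ℕ) : ℝ) - W / (d * q)| ≤ 1 := by
  obtain ⟨c, hc1, hc2⟩ := Nat.chineseRemainder h 0 b
  have := cnt_mod X W (d * q) c (by positivity)
  rw [Nat.cast_mul] at this
  have e : ∀ n, (n ≡ b [MOD q] ∧ d ∣ n) ↔ n ≡ c [MOD (d * q)] := fun n => by
    rw [← Nat.modEq_and_modEq_iff_modEq_mul h, ← Nat.modEq_zero_iff_dvd, and_comm]
    exact and_congr ⟨fun h => h.trans hc1.symm, fun h => h.trans hc1⟩ ⟨fun h => h.trans hc2.symm, fun h => h.trans hc2⟩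
  simp only [e]; exact this

lemma cntd0 (X W q b d : ℕ) (hb : b.Coprime q) (h : ¬ d.Coprime q) :
    #{n ∈ Ico X (X + W) | n ≡ b [MOD q] ∧ d ∣ n} = 0 := by
  rw [card_eq_zero, filter_eq_empty_iff]
  rintro n _ ⟨h1, h2⟩
  have : n.Coprime q := by rw [Nat.Coprime, h1.gcd_eq]; exact hb
  exact h (Nat.Coprime.coprime_dvd_left h2 this)

lemma cntd_le (X W q b d : ℕ) (hq : 0 < q) (hd : 0 < d) (hb : b.Coprime q) :
    ((#{n ∈ Ico X (X + W) | n ≡ b [MOD q] ∧ d ∣ n} : ℕ) : ℝ) ≤ W / (d * q) + 1 := by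
  by_cases h : d.Coprime q
  · linarith [(abs_le.1 (cntd X W q b d hq hd h)).2]
  · rw [cntd0 X W q b d hb h]; push_cast; positivity

lemma hh_split (n Y M0 : ℕ) (hn : 0 < n) (hM : n ≤ Y * M0) :
    |hh n - ∑ d ∈ Ioc 0 Y with d ∣ n, (moebius d : ℝ) * Real.log ((n:ℝ) / d) ^ 2| ≤ ∑ m ∈ Ioc 0 M0 with m ∣ n, Real.log m ^ 2 := by
  have e : hh n = ∑ d ∈ n.divisors, (moebius d : ℝ) * Real.log ((n:ℝ) / d) ^ 2 := by
    rw [hh_eq, mul_apply, Nat.sum_divisorsAntidiagonal (fun i j => (moebius : ArithmeticFunction ℝ) i * lsq j)]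
    apply sum_congr rfl; intro d hd
    rw [lsq_apply, Nat.cast_div (Nat.dvd_of_mem_divisors hd) (by exact_mod_cast (Nat.pos_of_mem_divisors hd).ne')]; rfl
  have e2 : ∑ d ∈ Ioc 0 Y with d ∣ n, (moebius d : ℝ) * Real.log ((n:ℝ) / d) ^ 2 = ∑ d ∈ n.divisors with d ≤ Y, (moebius d : ℝ) * Real.log ((n:ℝ) / d) ^ 2 := by
    apply sum_congr _ (fun _ _ => rfl)
    ext d; simp only [mem_filter, mem_Ioc, Nat.mem_divisors]
    constructor
    · rintro ⟨⟨h1, h2⟩, h3⟩; exact ⟨⟨h3, hn.ne'⟩, h2⟩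
    · rintro ⟨⟨h1, h2⟩, h3⟩; exact ⟨⟨Nat.pos_of_dvd_of_pos h1 hn, h3⟩, h1⟩
  rw [e, e2, ← sum_filter_add_sum_filter_not n.divisors (· ≤ Y), add_sub_cancel_left]
  calc _ ≤ ∑ d ∈ n.divisors with ¬ d ≤ Y, Real.log ((n / d : ℕ) : ℝ) ^ 2 := by
        refine (abs_sum_le_sum_abs _ _).trans (sum_le_sum fun d hd => ?_)
        rw [mem_filter] at hd
        rw [Nat.cast_div (Nat.dvd_of_mem_divisors hd.1) (by exact_mod_cast (Nat.pos_of_mem_divisors hd.1).ne'), abs_mul, abs_of_nonneg (sq_nonneg (Real.log ((n:ℝ) / d)))]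
        exact mul_le_of_le_one_left (sq_nonneg _) (mu_abs d)
    _ = ∑ d ∈ n.divisors, (fun m => if Y < n / m then Real.log m ^ 2 else 0) (n / d) := by
        rw [sum_filter]; apply sum_congr rfl; intro d hd
        rw [Nat.mem_divisors] at hd
        dsimp only; rw [Nat.div_div_self hd.1 hd.2]
        simp only [not_le]
    _ = ∑ m ∈ n.divisors with Y < n / m, Real.log m ^ 2 := by rw [Nat.sum_div_divisors n (fun m => if Y < n / m then Real.log m ^ 2 else 0), sum_filter]
    _ ≤ _ := by
        apply sum_le_sum_of_subset_of_nonneg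
        · intro m; simp only [mem_filter, mem_Ioc, Nat.mem_divisors]
          rintro ⟨⟨h1, _⟩, h3⟩
          have hm := Nat.pos_of_dvd_of_pos h1 hn
          refine ⟨⟨hm, ?_⟩, h1⟩
          have h4 := Nat.div_mul_cancel h1
          by_contra! h5
          have : Y * M0 < n / m * m := Nat.mul_lt_mul_of_lt_of_le h3 h5.le hm
          omega
        · intros; positivity

lemma S1 (X W q b Y M0 : ℕ) (hq : 0 < q) (hb : b.Coprime q) (hX : 0 < X) (hYX : Y ≤ X) (hM : X + W ≤ Y * M0) (hW : W ≤ X) :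
    |∑ n ∈ Ico X (X + W) with n ≡ b [MOD q], hh n - W / q * ∑ d ∈ Ioc 0 Y with d.Coprime q, (moebius d : ℝ) / d * Real.log ((X:ℝ) / d) ^ 2|
     ≤ Y * Real.log (2 * X) ^ 2 + 2 * Real.log (2 * X) * (W / X) * (W / q * (1 + Real.log Y) + Y) + Real.log M0 ^ 2 * (W / q * (1 + Real.log M0) + M0) := by
  have hX' : (0:ℝ) < X := by exact_mod_cast hX
  have hq' : (0:ℝ) < q := by exact_mod_cast hq
  obtain ⟨D, hD⟩ : ∃ D, D = Real.log (2 * X) := ⟨_, rfl⟩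
  have hD0 : 0 ≤ D := by rw [hD]; apply Real.log_nonneg; have : (1:ℝ) ≤ X := by exact_mod_cast hX
                         linarith
  obtain ⟨cn, hcn⟩ : ∃ cn : ℕ → ℝ, cn = fun d => ((#{n ∈ Ico X (X + W) | n ≡ b [MOD q] ∧ d ∣ n} : ℕ) : ℝ) := ⟨_, rfl⟩
  have hcn1 : ∀ d, 0 < d → cn d ≤ 1 / d * (W / q) + 1 := fun d hd => by
    have := cntd_le X W q b d hq hd hb
    rw [hcn]; refine this.trans (le_of_eq ?_); field_simp
  have hcn0 : ∀ d, 0 ≤ cn d := fun d => by rw [hcn]; positivity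
  have hsum : ∀ d (f : ℕ → ℝ), ∑ n ∈ Ico X (X + W) with n ≡ b [MOD q], (if d ∣ n then f n else 0) = ∑ n ∈ Ico X (X + W) with (n ≡ b [MOD q] ∧ d ∣ n), f n := fun d f => by
    rw [← sum_filter, filter_filter]
  -- large d
  have A1 : |∑ n ∈ Ico X (X + W) with n ≡ b [MOD q], hh n - ∑ n ∈ Ico X (X + W) with n ≡ b [MOD q], ∑ d ∈ Ioc 0 Y with d ∣ n, (moebius d : ℝ) * Real.log ((n:ℝ) / d) ^ 2| ≤ Real.log M0 ^ 2 * (W / q * (1 + Real.log M0) + M0) := by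
    rw [← sum_sub_distrib]
    refine (abs_sum_le_sum_abs _ _).trans ?_
    calc _ ≤ ∑ n ∈ Ico X (X + W) with n ≡ b [MOD q], ∑ m ∈ Ioc 0 M0 with m ∣ n, Real.log m ^ 2 := by
          apply sum_le_sum; intro n hn
          rw [mem_filter, mem_Ico] at hn
          exact hh_split n Y M0 (by omega) (by omega)
      _ = ∑ m ∈ Ioc 0 M0, cn m * Real.log m ^ 2 := by
          simp only [sum_filter (p := fun m => m ∣ _)]
          rw [sum_comm]
          apply sum_congr rfl; intro m _
          rw [hsum, sum_const, nsmul_eq_mul, hcn]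
      _ ≤ ∑ m ∈ Ioc 0 M0, (1 / m * (W / q) + 1) * Real.log M0 ^ 2 := by
          apply sum_le_sum; intro m hm
          rw [mem_Ioc] at hm
          have := hcn1 m hm.1
          have h0 := Real.log_natCast_nonneg m
          have := log_mono_nat hm.2
          gcongr
      _ = Real.log M0 ^ 2 * (W / q * (∑ m ∈ Icc 1 M0, 1 / (m:ℝ)) + M0) := by
          rw [← sum_mul, sum_add_distrib, ← sum_mul]
          simp only [sum_const, Nat.card_Ioc, nsmul_eq_mul, mul_one, Nat.sub_zero]
          rw [show Ioc 0 M0 = Icc 1 M0 from rfl]; ring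
      _ ≤ _ := by gcongr; exact harm_le M0
  have A2 : |∑ n ∈ Ico X (X + W) with n ≡ b [MOD q], ∑ d ∈ Ioc 0 Y with d ∣ n, (moebius d : ℝ) * Real.log ((n:ℝ) / d) ^ 2 - W / q * ∑ d ∈ Ioc 0 Y with d.Coprime q, (moebius d : ℝ) / d * Real.log ((X:ℝ) / d) ^ 2| ≤ ∑ d ∈ Ioc 0 Y, (D ^ 2 + (1 / d * (W / q) + 1) * (2 * D * (W / X))) := by
    have e : ∑ n ∈ Ico X (X + W) with n ≡ b [MOD q], ∑ d ∈ Ioc 0 Y with d ∣ n, (moebius d : ℝ) * Real.log ((n:ℝ) / d) ^ 2 = ∑ d ∈ Ioc 0 Y, ∑ n ∈ Ico X (X + W) with (n ≡ b [MOD q] ∧ d ∣ n), (moebius d : ℝ) * Real.log ((n:ℝ) / d) ^ 2 := by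
      simp only [sum_filter (p := fun m => m ∣ _)]
      rw [sum_comm]
      apply sum_congr rfl; intro m _
      rw [hsum]
    rw [e, mul_sum, sum_filter, ← sum_sub_distrib]
    refine (abs_sum_le_sum_abs _ _).trans (sum_le_sum fun d hd => ?_)
    rw [mem_Ioc] at hd
    have hd' : (0:ℝ) < d := by exact_mod_cast hd.1
    have hXd : 0 ≤ Real.log ((X:ℝ) / d) := Real.log_nonneg (by rw [le_div_iff₀ hd', one_mul]; exact_mod_cast hd.2.trans hYX)
    have hXd2 : Real.log ((X:ℝ) / d) ≤ D := by
      rw [hD]; apply Real.log_le_log (by positivity)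
      have : (1:ℝ) ≤ d := by exact_mod_cast hd.1
      exact (div_le_self hX'.le this).trans (by linarith)
    have hn : ∀ n ∈ Ico X (X + W), |Real.log ((n:ℝ) / d) ^ 2 - Real.log ((X:ℝ) / d) ^ 2| ≤ 2 * D * (W / X) := fun n hn => by
      rw [mem_Ico] at hn
      have hn1 : (X:ℝ) ≤ n := by exact_mod_cast hn.1
      have hn2 : (n:ℝ) ≤ X + W := by exact_mod_cast hn.2.le
      have hW' : (W:ℝ) ≤ X := by exact_mod_cast hW
      have hn0 : (0:ℝ) < n := by linarith
      have h1 : Real.log ((X:ℝ) / d) ≤ Real.log ((n:ℝ) / d) := Real.log_le_log (by positivity) (by gcongr)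
      have h2 : Real.log ((n:ℝ) / d) - Real.log ((X:ℝ) / d) ≤ W / X := by
        rw [← Real.log_div (by positivity) (by positivity)]
        have : (n:ℝ) / d / (X / d) = n / X := by field_simp
        rw [this]
        refine (Real.log_le_sub_one_of_pos (by positivity)).trans ?_
        rw [div_sub_one hX'.ne']
        gcongr; linarith
      have h3 : Real.log ((n:ℝ) / d) ≤ D := by
        rw [hD]; apply Real.log_le_log (by positivity)
        have : (1:ℝ) ≤ d := by exact_mod_cast hd.1
        exact (div_le_self hn0.le this).trans (by linarith)
      rw [abs_of_nonneg (by nlinarith)]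
      nlinarith
    have hc : |∑ n ∈ Ico X (X + W) with (n ≡ b [MOD q] ∧ d ∣ n), (moebius d : ℝ) * Real.log ((n:ℝ) / d) ^ 2 - cn d * ((moebius d : ℝ) * Real.log ((X:ℝ) / d) ^ 2)| ≤ cn d * (2 * D * (W / X)) := by
      have e1 : cn d * ((moebius d : ℝ) * Real.log ((X:ℝ) / d) ^ 2) = ∑ n ∈ Ico X (X + W) with (n ≡ b [MOD q] ∧ d ∣ n), (moebius d : ℝ) * Real.log ((X:ℝ) / d) ^ 2 := by rw [sum_const, nsmul_eq_mul, hcn]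
      have e2 : cn d * (2 * D * (W / X)) = ∑ n ∈ Ico X (X + W) with (n ≡ b [MOD q] ∧ d ∣ n), 2 * D * ((W:ℝ) / X) := by rw [sum_const, nsmul_eq_mul, hcn]
      rw [e1, e2, ← sum_sub_distrib]
      refine (abs_sum_le_sum_abs _ _).trans (sum_le_sum fun n hn' => ?_)
      rw [← mul_sub, abs_mul]
      exact (mul_le_of_le_one_left (abs_nonneg _) (mu_abs d)).trans (hn n (mem_filter.1 hn').1)
    have hc2 : |cn d * ((moebius d : ℝ) * Real.log ((X:ℝ) / d) ^ 2) - (if d.Coprime q then W / q * ((moebius d : ℝ) / d * Real.log ((X:ℝ) / d) ^ 2) else 0)| ≤ D ^ 2 := by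
      split_ifs with h
      · have h1 : |cn d - W / (d * q)| ≤ 1 := by rw [hcn]; exact cntd X W q b d hq hd.1 h
        have : cn d * ((moebius d : ℝ) * Real.log ((X:ℝ) / d) ^ 2) - W / q * ((moebius d : ℝ) / d * Real.log ((X:ℝ) / d) ^ 2) = (cn d - W / (d * q)) * (moebius d : ℝ) * Real.log ((X:ℝ) / d) ^ 2 := by field_simp
        rw [this, abs_mul, abs_mul, abs_of_nonneg (sq_nonneg (Real.log ((X:ℝ) / d)))]
        calc _ ≤ 1 * 1 * D ^ 2 := by gcongr; exact mu_abs d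
          _ = _ := by ring
      · have : cn d = 0 := by rw [hcn]; simp only; rw [cntd0 X W q b d hb h]; simp
        rw [this]; simp; positivity
    refine (abs_sub_le _ (cn d * ((moebius d : ℝ) * Real.log ((X:ℝ) / d) ^ 2)) _).trans ?_
    have h8 : cn d * (2 * D * (W / X)) ≤ (1 / d * (W / q) + 1) * (2 * D * (W / X)) := mul_le_mul_of_nonneg_right (hcn1 d hd.1) (by positivity)
    linarith
  have A3 : ∑ d ∈ Ioc 0 Y, (D ^ 2 + (1 / d * (W / q) + 1) * (2 * D * (W / X))) ≤ Y * D ^ 2 + 2 * D * (W / X) * (W / q * (1 + Real.log Y) + Y) := by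
    calc _ = Y * D ^ 2 + 2 * D * (W / X) * (W / q * (∑ d ∈ Icc 1 Y, 1 / (d:ℝ)) + Y) := by
          rw [sum_add_distrib, ← sum_mul, sum_add_distrib, ← sum_mul]
          simp only [sum_const, Nat.card_Ioc, nsmul_eq_mul, mul_one, Nat.sub_zero]
          rw [show Ioc 0 Y = Icc 1 Y from rfl]; ring
      _ ≤ _ := by gcongr; exact harm_le Y
  rw [← hD]
  refine (abs_sub_le _ _ _).trans ((add_le_add A1 (A2.trans A3)).trans (le_of_eq (by ring)))

end P6

section P6
open ArithmeticFunction

lemma logpow_small (c : ℝ) (n : ℕ) (ε : ℝ) (hε : 0 < ε) : ∃ l0 : ℕ, ∀ l : ℕ, l0 ≤ l → (c * (1 + Real.log l)) ^ n ≤ ε * l := by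
  have h1 : (fun x : ℝ => (c * (1 + Real.log x)) ^ n) =o[atTop] (fun x : ℝ => x) := by
    have : (fun x : ℝ => (c * (1 + Real.log x)) ^ n) =O[atTop] (fun x : ℝ => Real.log x ^ n) := by
      apply Asymptotics.IsBigO.pow
      apply Asymptotics.IsBigO.const_mul_left
      apply Asymptotics.IsBigO.add _ (Asymptotics.isBigO_refl _ _)
      exact (Real.isLittleO_const_log_atTop).isBigO
    exact this.trans_isLittleO Real.isLittleO_pow_log_id_atTop
  have h2 := (h1.bound hε).natCast_atTop
  obtain ⟨l0, h⟩ := eventually_atTop.1 h2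
  refine ⟨l0, fun l hl => ?_⟩
  have := h l hl
  rw [Real.norm_of_nonneg (r := (l:ℝ)) (by positivity)] at this
  exact (Real.le_norm_self _).trans this

lemma S2aux (A E J X W q b l : ℕ) (hJ : J = A + E + 2) (hq : 0 < q) (hb : b.Coprime q) (hl : 1 ≤ l) (hqA : q ≤ l ^ A) (hW1 : W * l ^ 2 ≤ X)
    (hW2 : X ≤ W * l ^ E) (hlog : Real.log X ≤ l) (hX : 4 * l ^ (J + A + E) ≤ X) :
    |∑ n ∈ Ico X (X + W) with n ≡ b [MOD q], hh n - W / q * ∑ d ∈ Ioc 0 (X / l ^ J) with d.Coprime q, (moebius d : ℝ) / d * Real.log ((X:ℝ) / d) ^ 2|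
     ≤ W / q * (16 + (4 + J * Real.log l) ^ 3) ∧ 0 < X / l ^ J ∧ (X:ℝ) ≤ 4 * l ^ J * ((X / l ^ J : ℕ) : ℝ) := by
  obtain ⟨K, hK⟩ : ∃ K, K = l ^ J := ⟨_, rfl⟩
  have hK0 : 0 < K := by rw [hK]; positivity
  have hl' : (1:ℝ) ≤ l := by exact_mod_cast hl
  have hX0 : 0 < X := lt_of_lt_of_le (by positivity) hX
  have hX' : (0:ℝ) < X := by exact_mod_cast hX0
  have hq' : (0:ℝ) < q := by exact_mod_cast hq
  have hKX : K ≤ X := by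
    rw [hK]; refine le_trans ?_ hX
    have : l ^ J ≤ l ^ (J + A + E) := Nat.pow_le_pow_right hl (by omega)
    omega
  obtain ⟨Y, hY⟩ : ∃ Y, Y = X / K := ⟨_, rfl⟩
  have hY0 : 0 < Y := by rw [hY]; exact Nat.div_pos hKX hK0
  have hYX : Y ≤ X := by rw [hY]; exact Nat.div_le_self _ _
  have hWX : W ≤ X := le_trans (Nat.le_mul_of_pos_right W (by positivity)) hW1
  have hXY : X ≤ 2 * K * Y := by
    have h1 := Nat.lt_mul_div_succ X hK0
    rw [← hY] at h1
    calc X ≤ K * (Y + 1) := h1.le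
      _ ≤ K * (Y + Y) := by gcongr; omega
      _ = _ := by ring
  rw [← hK, ← hY]
  refine ⟨?_, hY0, by have : (X:ℝ) ≤ 2 * K * Y := by exact_mod_cast hXY
                      have h3 : (0:ℝ) ≤ K * Y := by positivity
                      have : (K:ℝ) = (l:ℝ) ^ J := by rw [hK]; push_cast; rfl
                      rw [← this]; linarith⟩
  have h := S1 X W q b Y (4 * K) hq hb hX0 hYX (by nlinarith) hWX
  have hlM : Real.log ((4 * K : ℕ) : ℝ) ≤ 3 + J * Real.log l := by
    rw [Nat.cast_mul, Real.log_mul (by norm_num) (by positivity), hK]; push_cast; rw [Real.log_pow]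
    have : Real.log (4:ℝ) ≤ 4 - 1 := Real.log_le_sub_one_of_pos (by norm_num)
    linarith
  have hlM0 := Real.log_natCast_nonneg (4 * K)
  have hY1 : (Y:ℝ) * l ^ 2 ≤ W / q := by
    rw [le_div_iff₀ hq']
    have : Y * l ^ 2 * q ≤ W := by
      have h1 : Y * K ≤ X := by rw [hY]; exact Nat.div_mul_le_self X K
      have h2 : (Y * l ^ 2 * q) * l ^ E ≤ W * l ^ E := by
        calc (Y * l ^ 2 * q) * l ^ E ≤ (Y * l ^ 2 * l ^ A) * l ^ E := by gcongr
          _ = Y * K := by rw [hK, hJ]; ring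
          _ ≤ _ := h1.trans hW2
      exact Nat.le_of_mul_le_mul_right h2 (by positivity)
    exact_mod_cast this
  have hM1 : ((4 * K : ℕ) : ℝ) ≤ W / q := by
    rw [le_div_iff₀ hq']
    have : 4 * K * q ≤ W := by
      have h2 : (4 * K * q) * l ^ E ≤ W * l ^ E := by
        calc (4 * K * q) * l ^ E ≤ (4 * K * l ^ A) * l ^ E := by gcongr
          _ = 4 * l ^ (J + A + E) := by rw [hK]; ring
          _ ≤ _ := hX.trans hW2
      exact Nat.le_of_mul_le_mul_right h2 (by positivity)
    exact_mod_cast this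
  have hl2X : Real.log (2 * X) ≤ 2 * l := by
    rw [Real.log_mul (by norm_num) hX'.ne']
    have := Real.log_two_lt_d9
    linarith
  have hl2X0 : 0 ≤ Real.log (2 * X) := by
    apply Real.log_nonneg; have : (1:ℝ) ≤ X := by exact_mod_cast hX0
    linarith
  have hlY : Real.log Y ≤ l := log_le_of Y X l hYX hlog
  have hlY0 := Real.log_natCast_nonneg Y
  have hWX2 : (W:ℝ) / X ≤ 1 / l ^ 2 := by
    rw [div_le_div_iff₀ hX' (by positivity), one_mul]; exact_mod_cast hW1
  obtain ⟨w, hw⟩ : ∃ w, w = (W:ℝ) / q := ⟨_, rfl⟩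
  have hw0 : 0 ≤ w := by rw [hw]; positivity
  obtain ⟨z, hz⟩ : ∃ z, z = J * Real.log l := ⟨_, rfl⟩
  have hz0 : 0 ≤ z := by rw [hz]; have := Real.log_natCast_nonneg l; positivity
  rw [← hw] at h hY1 hM1 ⊢
  rw [← hz] at hlM ⊢
  refine h.trans ?_
  have t1 : Y * Real.log (2 * X) ^ 2 ≤ 4 * w := by
    calc (Y:ℝ) * Real.log (2 * X) ^ 2 ≤ (Y:ℝ) * (2 * (l:ℝ)) ^ 2 := by gcongr
      _ = 4 * ((Y:ℝ) * (l:ℝ) ^ 2) := by ring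
      _ ≤ _ := by gcongr
  have hYw : (Y:ℝ) ≤ w := le_trans (le_mul_of_one_le_right (by positivity) (one_le_pow₀ hl')) hY1
  have t2 : 2 * Real.log (2 * X) * (W / X) * (w * (1 + Real.log Y) + Y) ≤ 12 * w := by
    calc _ ≤ 2 * (2 * l) * (1 / (l:ℝ) ^ 2) * (w * (l + l) + w * l) := by
          gcongr
          nlinarith
      _ = 12 * w * ((l:ℝ) ^ 2 * (1 / (l:ℝ) ^ 2)) := by ring
      _ = _ := by rw [mul_one_div, div_self (by positivity), mul_one]
  have t3 : Real.log ((4 * K : ℕ) : ℝ) ^ 2 * (w * (1 + Real.log ((4 * K : ℕ) : ℝ)) + ((4 * K : ℕ) : ℝ)) ≤ w * (4 + z) ^ 3 := by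
    calc _ ≤ (3 + z) ^ 2 * (w * (1 + (3 + z)) + w) := by gcongr
      _ ≤ _ := by
          have : (3 + z) ^ 2 * (1 + (3 + z) + 1) ≤ (4 + z) ^ 3 := by nlinarith
          calc _ = w * ((3 + z) ^ 2 * (1 + (3 + z) + 1)) := by ring
            _ ≤ _ := by gcongr
  linarith

noncomputable def Hb (X W q b : ℕ) : ℝ := ∑ n ∈ Ico X (X + W) with n ≡ b [MOD q], hh n

lemma Hb_nonneg (X W q b : ℕ) : 0 ≤ Hb X W q b := sum_nonneg fun n _ => hh_nonneg n

lemma sum_mod {M : Type*} [AddCommMonoid M] (s : Finset ℕ) (q : ℕ) (hq : 0 < q) (f : ℕ → M) : ∑ n ∈ s with n.Coprime q, f n =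
    ∑ b ∈ range q with b.Coprime q, ∑ n ∈ s with n ≡ b [MOD q], f n := by
  rw [← sum_fiberwise_of_maps_to (g := fun n => n % q) (t := (range q).filter (fun b => b.Coprime q))]
  · apply sum_congr rfl; intro b hb
    rw [mem_filter, mem_range] at hb
    rw [filter_filter]
    apply sum_congr _ (fun _ _ => rfl)
    ext n; simp only [mem_filter, Nat.ModEq, Nat.mod_eq_of_lt hb.1]
    constructor
    · rintro ⟨h1, _, h2⟩; exact ⟨h1, h2⟩
    · rintro ⟨h1, h2⟩; refine ⟨h1, ?_, h2⟩
      have h3 : n ≡ b [MOD q] := by rw [Nat.ModEq, h2, Nat.mod_eq_of_lt hb.1]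
      rw [Nat.Coprime, h3.gcd_eq]; exact hb.2
  · intro n hn
    rw [mem_filter] at hn ⊢
    refine ⟨mem_range.2 (Nat.mod_lt _ hq), ?_⟩
    rw [Nat.Coprime, (Nat.mod_modEq n q).gcd_eq]; exact hn.2

lemma card_cop (q : ℕ) : #{b ∈ range q | b.Coprime q} = q.totient := by
  rw [Nat.totient]; congr 1; apply filter_congr; intro b _; exact Nat.coprime_comm

lemma S2 (A E : ℕ) (ε : ℝ) (hε : 0 < ε) (hε1 : ε ≤ 1) : ∃ l0 : ℕ, ∀ l X W q : ℕ, l0 ≤ l → 1 ≤ l → 0 < q → q ≤ l ^ A → W * l ^ 2 ≤ X →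
    X ≤ W * l ^ E → Real.log X ≤ l → 4 * l ^ ((A + E + 2) + A + E) ≤ X →
    ∃ Mn : ℝ, |Mn| ≤ 151 * W * l / q.totient ∧ ∀ b : ℕ, b.Coprime q → |Hb X W q b - Mn| ≤ ε * W * l / q ∧ Hb X W q b ≤ 152 * W * l / q.totient := by
  obtain ⟨J, hJ⟩ : ∃ J, J = A + E + 2 := ⟨_, rfl⟩
  obtain ⟨l0, hl0⟩ := logpow_small (20 + J) 3 (ε / 50) (by positivity)
  refine ⟨l0, fun l X W q h0 hl hq hqA hW1 hW2 hlog hX => ?_⟩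
  rw [← hJ] at hX
  have hl' : (1:ℝ) ≤ l := by exact_mod_cast hl
  have hll := Real.log_natCast_nonneg l
  obtain ⟨ρ, hρ⟩ : ∃ ρ, ρ = 16 + (4 + J * Real.log l) ^ 3 := ⟨_, rfl⟩
  obtain ⟨κ, hκ⟩ : ∃ κ, κ = 4 + J * Real.log l := ⟨_, rfl⟩
  have hκ4 : 4 ≤ κ := by rw [hκ]; have : 0 ≤ J * Real.log l := by positivity
                         linarith
  have hρl : ρ ≤ ε / 50 * l := by
    refine le_trans ?_ (hl0 l h0)
    have : 16 + κ ≤ (20 + J) * (1 + Real.log l) := by rw [hκ]; nlinarith [(Nat.cast_nonneg J : (0:ℝ) ≤ J)]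
    calc ρ ≤ (16 + κ) ^ 3 := by rw [hρ, ← hκ]; nlinarith [pow_nonneg (by linarith : 0 ≤ κ) 2]
      _ ≤ _ := by gcongr
  have hρκ : 20 * κ + 2 * κ ^ 2 ≤ 7 * ρ := by rw [hρ, ← hκ]; nlinarith [pow_nonneg (by linarith : 0 ≤ κ) 2]
  have hρ0 : 0 ≤ ρ := by nlinarith
  have hq1 : (1:ℝ) ≤ q := by exact_mod_cast hq
  have hφ : (0:ℝ) < q.totient := by exact_mod_cast Nat.totient_pos.2 hq
  have hφq : (q.totient:ℝ) ≤ q := by exact_mod_cast Nat.totient_le q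
  -- total
  have hT : ∑ n ∈ Ico X (X + W), hh n ≤ 149 * W * l := by
    obtain ⟨h1, h2, h3⟩ := S2aux A E J X W 1 0 l hJ one_pos (by norm_num) hl (Nat.one_le_pow _ _ hl) hW1 hW2 hlog hX
    have hYX : X / l ^ J ≤ X := Nat.div_le_self _ _
    have h4 := gg_shift X (X / l ^ J) h2 hYX
    obtain ⟨Y, hY⟩ : ∃ Y, Y = X / l ^ J := ⟨_, rfl⟩
    rw [← hY] at h1 h2 h3 h4 hYX
    have hY0 : (0:ℝ) < Y := by exact_mod_cast h2
    have hX0 : (0:ℝ) < X := lt_of_lt_of_le hY0 (by exact_mod_cast hYX)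
    have hXY : Real.log ((X:ℝ) / Y) ≤ κ := by
      have : (X:ℝ) / Y ≤ 4 * l ^ J := by rw [div_le_iff₀ hY0]; exact h3
      refine (Real.log_le_log (by positivity) this).trans ?_
      rw [Real.log_mul (by norm_num) (by positivity), Real.log_pow, hκ]
      have : Real.log (4:ℝ) ≤ 4 - 1 := Real.log_le_sub_one_of_pos (by norm_num)
      linarith
    have hXY0 : 0 ≤ Real.log ((X:ℝ) / Y) := Real.log_nonneg (by rw [le_div_iff₀ hY0, one_mul]; exact_mod_cast hYX)
    have hlY := log_le_of Y X l hYX hlog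
    simp only [Nat.modEq_one, filter_true, Nat.coprime_one_right_iff] at h1
    rw [← hρ, Nat.cast_one, div_one] at h1
    have h5 := (abs_le.1 h1).2
    have h6 := (abs_le.1 h4).2
    have h7 : 63 * (1 + Real.log Y) + 20 * Real.log ((X:ℝ) / Y) + 2 * Real.log ((X:ℝ) / Y) ^ 2 ≤ 126 * l + 7 * ρ := by
      have : Real.log ((X:ℝ) / Y) ^ 2 ≤ κ ^ 2 := by gcongr
      linarith
    have h8 : (W:ℝ) * ∑ d ∈ Ioc 0 Y, (moebius d : ℝ) / d * Real.log ((X:ℝ) / d) ^ 2 ≤ W * (126 * l + 7 * ρ) := by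
      gcongr; linarith
    have h9 : (W:ℝ) * ρ ≤ W * l := by gcongr; nlinarith
    nlinarith
  obtain ⟨Mn, hMn⟩ : ∃ Mn, Mn = (W:ℝ) / q * ∑ d ∈ Ioc 0 (X / l ^ J) with d.Coprime q, (moebius d : ℝ) / d * Real.log ((X:ℝ) / d) ^ 2 := ⟨_, rfl⟩
  have hH : ∀ b : ℕ, b.Coprime q → |Hb X W q b - Mn| ≤ W / q * ρ := fun b hb => by
    rw [hMn, hρ, Hb]; exact (S2aux A E J X W q b l hJ hq hb hl hqA hW1 hW2 hlog hX).1
  have hρq : W / q * ρ ≤ ε * W * l / q := by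
    calc W / q * ρ ≤ W / q * (ε * l) := by
          gcongr; refine hρl.trans ?_; gcongr; linarith
      _ = _ := by ring
  have hρφ : W / q * ρ ≤ W * l / q.totient := by
    calc _ ≤ ε * W * l / q := hρq
      _ ≤ 1 * W * l / q.totient := by gcongr
      _ = _ := by ring
  have hφM : q.totient * |Mn| ≤ 150 * W * l := by
    calc q.totient * |Mn| = ∑ b ∈ range q with b.Coprime q, |Mn| := by rw [sum_const, card_cop, nsmul_eq_mul]
      _ ≤ ∑ b ∈ range q with b.Coprime q, (Hb X W q b + W / q * ρ) := by
          apply sum_le_sum; intro b hb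
          have h1 := hH b (mem_filter.1 hb).2
          have h2 := abs_sub_abs_le_abs_sub Mn (Hb X W q b)
          rw [abs_sub_comm, abs_of_nonneg (Hb_nonneg X W q b)] at h2
          linarith
      _ = ∑ n ∈ Ico X (X + W) with n.Coprime q, hh n + q.totient * (W / q * ρ) := by
          rw [sum_add_distrib, sum_const, card_cop, nsmul_eq_mul, sum_mod (Ico X (X + W)) q hq]; rfl
      _ ≤ ∑ n ∈ Ico X (X + W), hh n + q.totient * (W * l / q.totient) := by
          gcongr
          · intros; exact hh_nonneg _
          · exact filter_subset _ _
      _ ≤ 149 * W * l + W * l := by rw [mul_div_cancel₀ _ hφ.ne']; linarith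
      _ = _ := by ring
  have hMn' : |Mn| ≤ 150 * W * l / q.totient := by rw [le_div_iff₀ hφ]; linarith
  have e : ∀ c : ℝ, c * W * l / q.totient = c * (W * l / q.totient) := fun c => by ring
  rw [e] at hMn'
  have hp : 0 ≤ (W:ℝ) * l / q.totient := by positivity
  refine ⟨Mn, by rw [e]; linarith, fun b hb => ⟨(hH b hb).trans hρq, ?_⟩⟩
  have h1 := (abs_le.1 (hH b hb)).2
  have := le_abs_self Mn
  rw [e]; linarith

end P6

section P6
open ArithmeticFunction

lemma prod_one_sub (S : Finset ℕ) (hS : ∀ p ∈ S, 2 ≤ p) : 1 / ((#S : ℝ) + 1) ≤ ∏ p ∈ S, (1 - (p:ℝ)⁻¹) := by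
  induction S using Finset.induction_on_max with
  | empty => simp
  | insert p S hp ih =>
    have hpS : p ∉ S := fun h => lt_irrefl _ (hp p h)
    rw [prod_insert hpS, card_insert_of_notMem hpS]
    have ih := ih fun x hx => hS x (mem_insert_of_mem hx)
    have hc : #S + 2 ≤ p := by
      have h2 := hS p (mem_insert_self _ _)
      have : S ⊆ Ico 2 p := fun x hx => mem_Ico.2 ⟨hS x (mem_insert_of_mem hx), hp x hx⟩
      have := card_le_card this
      rw [Nat.card_Ico] at this; omega
    have hc' : (#S : ℝ) + 2 ≤ p := by exact_mod_cast hc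
    have h1 : ((#S : ℝ) + 1) / (#S + 2) ≤ 1 - (p:ℝ)⁻¹ := by
      have h3 : (p:ℝ)⁻¹ ≤ ((#S : ℝ) + 2)⁻¹ := by gcongr
      have : ((#S : ℝ) + 1) / (#S + 2) = 1 - ((#S : ℝ) + 2)⁻¹ := by field_simp; ring
      linarith
    calc _ = ((#S : ℝ) + 1) / (#S + 2) * (1 / ((#S : ℝ) + 1)) := by push_cast; field_simp; ring
      _ ≤ _ := by gcongr; exact le_trans (by positivity) h1

lemma totient_ge (q : ℕ) (hq : 0 < q) : (q:ℝ) ≤ q.totient * (2 * (1 + Real.log q)) := by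
  have hq' : (0:ℝ) < q := by exact_mod_cast hq
  have h1 : (q.totient : ℝ) = q * ∏ p ∈ q.primeFactors, (1 - (p:ℝ)⁻¹) := by
    have := Nat.totient_eq_mul_prod_factors q
    have h2 : ((q.totient : ℚ) : ℝ) = ((q * ∏ p ∈ q.primeFactors, (1 - (p:ℚ)⁻¹) : ℚ) : ℝ) := by rw [this]
    push_cast at h2; exact h2
  have h2 := prod_one_sub q.primeFactors fun p hp => (Nat.prime_of_mem_primeFactors hp).two_le
  have h3 : 2 ^ #q.primeFactors ≤ q := by
    refine le_trans ?_ (Nat.le_of_dvd hq (Nat.prod_primeFactors_dvd q))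
    exact Finset.pow_card_le_prod _ _ _ fun p hp => (Nat.prime_of_mem_primeFactors hp).two_le
  have h4 : (#q.primeFactors : ℝ) * Real.log 2 ≤ Real.log q := by
    rw [← Real.log_pow]; exact Real.log_le_log (by positivity) (by exact_mod_cast h3)
  have h5 := Real.log_two_gt_d9
  have h6 : (#q.primeFactors : ℝ) + 1 ≤ 2 * (1 + Real.log q) := by nlinarith [(Nat.cast_nonneg #q.primeFactors : (0:ℝ) ≤ _)]
  rw [div_le_iff₀ (by positivity)] at h2
  rw [h1]
  have h7 : 0 ≤ ∏ p ∈ q.primeFactors, (1 - (p:ℝ)⁻¹) := by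
    by_contra! h
    nlinarith [mul_nonneg_of_nonpos_of_nonpos h.le h.le, (Nat.cast_nonneg #q.primeFactors : (0:ℝ) ≤ _)]
  calc (q:ℝ) = q * 1 := by ring
    _ ≤ q * ((∏ p ∈ q.primeFactors, (1 - (p:ℝ)⁻¹)) * (2 * (1 + Real.log q))) := by
        gcongr; exact h2.trans (by gcongr)
    _ = _ := by ring

noncomputable def PQ (θ : ℝ) (Q : Polynomial ℕ) : Polynomial ℝ := Polynomial.C θ * Q.map (Nat.castRingHom ℝ)

lemma PQ_eval (θ : ℝ) (Q : Polynomial ℕ) (n : ℕ) : (PQ θ Q).eval (n:ℝ) = θ * (Q.eval n : ℕ) := by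
  rw [PQ, Polynomial.eval_mul, Polynomial.eval_C, Polynomial.eval_natCast_map]; rfl

lemma PQ_deg (θ : ℝ) (Q : Polynomial ℕ) : (PQ θ Q).natDegree ≤ Q.natDegree :=
  (Polynomial.natDegree_C_mul_le _ _).trans Polynomial.natDegree_map_le

lemma PQ_coeff (θ : ℝ) (Q : Polynomial ℕ) : (PQ θ Q).coeff Q.natDegree = (Q.leadingCoeff : ℝ) * θ := by
  rw [PQ, Polynomial.coeff_C_mul, Polynomial.coeff_map]; simp [mul_comm]

noncomputable def gq (a : ℤ) (q : ℕ) (Q : Polynomial ℕ) (n : ℕ) : ℂ := ee ((PQ ((a:ℝ) / q) Q).eval (n:ℝ))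

lemma gq_norm (a : ℤ) (q : ℕ) (Q : Polynomial ℕ) (n : ℕ) : ‖gq a q Q n‖ = 1 := norm_ee _

lemma gq_mod (a : ℤ) (q : ℕ) (hq : 0 < q) (Q : Polynomial ℕ) (m n : ℕ) (h : m ≡ n [MOD q]) : gq a q Q m = gq a q Q n := by
  have h1 : (q:ℤ) ∣ ((Q.eval m : ℕ) : ℤ) - ((Q.eval n : ℕ) : ℤ) := by
    have h2 := Polynomial.sub_dvd_eval_sub (m:ℤ) (n:ℤ) (Q.map (Nat.castRingHom ℤ))
    rw [Polynomial.eval_natCast_map, Polynomial.eval_natCast_map] at h2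
    exact (Nat.modEq_iff_dvd.1 h.symm).trans h2
  obtain ⟨c, hc⟩ := h1
  have hq' : (q:ℝ) ≠ 0 := by exact_mod_cast hq.ne'
  have hc' : ((Q.eval m : ℕ) : ℝ) = (Q.eval n : ℕ) + q * c := by
    have : (((Q.eval m : ℕ) : ℤ) : ℝ) - (((Q.eval n : ℕ) : ℤ) : ℝ) = q * c := by exact_mod_cast hc
    push_cast at this; linarith
  rw [gq, gq, PQ_eval, PQ_eval, hc']
  have : (a:ℝ) / q * ((Q.eval n : ℕ) + q * c) = (a:ℝ) / q * (Q.eval n : ℕ) + ((a * c : ℤ) : ℝ) := by push_cast; field_simp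
  rw [this, ee_add_int]

lemma qbil (Q : Polynomial ℕ) (hQ : 0 < Q.natDegree) (η0 : ℝ) (hη : 0 < η0) : ∃ q0 : ℕ, ∀ q : ℕ, q0 ≤ q → 0 < q → ∀ a : ℤ, IsCoprime a (q:ℤ) →
    ∀ u v : ℕ → ℂ, (∀ d, ‖u d‖ ≤ 1) → (∀ m, ‖v m‖ ≤ 1) →
    ‖∑ r ∈ range q, ∑ s ∈ range q, u r * v s * gq a q Q (r * s)‖ ≤ η0 * (q.totient : ℝ) ^ 2 := by
  have hc0 : 0 < Q.leadingCoeff := by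
    rw [Nat.pos_iff_ne_zero, Polynomial.leadingCoeff_ne_zero]; rintro rfl; simp at hQ
  obtain ⟨C, hC⟩ := BLn Q.natDegree Q.leadingCoeff hQ hc0
  obtain ⟨n, hn⟩ : ∃ n, n = 2 ^ (2 * Q.natDegree) := ⟨_, rfl⟩
  have hn1 : 1 ≤ n := by rw [hn]; exact Nat.one_le_two_pow
  obtain ⟨q0, h0⟩ := logpow_small (2 * (C + 2)) (2 * C + 4 * n + 1) (η0 ^ (2 * n)) (by positivity)
  refine ⟨q0, fun q hq0 hq a ha u v hu hv => ?_⟩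
  have hq' : (1:ℝ) ≤ q := by exact_mod_cast hq
  obtain ⟨t, ht⟩ : ∃ t, t = 1 + Real.log q := ⟨_, rfl⟩
  have ht1 : 1 ≤ t := by rw [ht]; linarith [Real.log_natCast_nonneg q]
  have hb := hC q q q hq hq hq a ha ((a:ℝ) / q) (by rw [sub_self, abs_zero]; positivity) (PQ ((a:ℝ) / q) Q) (PQ_deg _ _) (PQ_coeff _ _) 0 q 0 q (by omega) (by omega) u v hu hv (η0 / (2 * t) ^ 2) (by positivity) ?_
  · rw [range_eq_Ico]
    refine hb.trans ?_
    have := totient_ge q hq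
    rw [← ht] at this
    calc (q:ℝ) * q * (η0 / (2 * t) ^ 2) ≤ (q.totient * (2 * t)) * (q.totient * (2 * t)) * (η0 / (2 * t) ^ 2) := by gcongr
      _ = _ := by field_simp
  · rw [← hn]
    have hE : E2 Q.natDegree q q q ≤ 4 * t / q := by
      rw [E2, ← ht]
      have h4 : q * t / ((q:ℝ) * q) ^ Q.natDegree ≤ t / q := by
        rw [div_le_div_iff₀ (by positivity) (by positivity)]
        calc q * t * q = t * (q * q : ℝ) ^ 1 := by ring
          _ ≤ _ := mul_le_mul_of_nonneg_left (pow_le_pow_right₀ (by nlinarith) hQ) (by linarith)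
      have h5 : 1 / (q:ℝ) ≤ t / q := by gcongr
      have : 4 * t / q = t / q + t / q + t / q + t / q := by ring
      linarith
    have h1 := h0 q hq0
    rw [← ht] at h1
    have h2 : 1 + Real.log ((q:ℝ) * q) ≤ 2 * t := by
      rw [Real.log_mul (by positivity) (by positivity), ht]; linarith
    have h20 : 0 ≤ 1 + Real.log ((q:ℝ) * q) := by
      rw [Real.log_mul (by positivity) (by positivity)]; linarith [Real.log_natCast_nonneg q]
    rw [div_pow, le_div_iff₀ (by positivity)]
    have h3 : C * (1 + Real.log ((q:ℝ) * q)) ^ C * √(E2 Q.natDegree q q q) * ((2 * t) ^ 2) ^ n ≤ (C * (2 * t) ^ C * ((2 * t) ^ 2) ^ n) * √(4 * t / q) := by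
      calc _ ≤ C * (2 * t) ^ C * √(4 * t / q) * ((2 * t) ^ 2) ^ n := by gcongr
        _ = _ := by ring
    refine h3.trans ?_
    apply le_of_sq_le_sq _ (by positivity)
    rw [mul_pow, Real.sq_sqrt (by positivity), mul_div_assoc', div_le_iff₀ (by positivity)]
    calc (C * (2 * t) ^ C * ((2 * t) ^ 2) ^ n) ^ 2 * (4 * t) = (2 * C ^ 2) * (2 * t) ^ (2 * C + 4 * n + 1) := by
          obtain ⟨y, hy⟩ : ∃ y, y = 2 * t := ⟨_, rfl⟩
          rw [← hy, show 4 * t = 2 * y by rw [hy]; ring, ← pow_mul]; ring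
      _ ≤ (C + 2 : ℝ) ^ (2 * C + 4 * n + 1) * (2 * t) ^ (2 * C + 4 * n + 1) := by
          gcongr
          calc (2 * C ^ 2 : ℝ) ≤ (C + 2) ^ 3 := by nlinarith [pow_nonneg (Nat.cast_nonneg C : (0:ℝ) ≤ C) 3, (Nat.cast_nonneg C : (0:ℝ) ≤ C)]
            _ ≤ _ := pow_le_pow_right₀ (by linarith [(Nat.cast_nonneg C : (0:ℝ) ≤ C)]) (by omega)
      _ = (2 * (C + 2) * t) ^ (2 * C + 4 * n + 1) := by rw [← mul_pow]; ring
      _ ≤ _ := h1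
      _ = _ := by ring

lemma complete_sum (Q : Polynomial ℕ) (hQ : 0 < Q.natDegree) (η0 : ℝ) (hη : 0 < η0) : ∃ q0 : ℕ, ∀ q : ℕ, q0 ≤ q → 0 < q → ∀ a : ℤ, IsCoprime a (q:ℤ) →
    ‖∑ b ∈ range q with b.Coprime q, gq a q Q b‖ ≤ η0 * q.totient := by
  obtain ⟨q0, h0⟩ := qbil Q hQ η0 hη
  refine ⟨q0, fun q hq0 hq a ha => ?_⟩
  have hφ : (0:ℝ) < q.totient := by exact_mod_cast Nat.totient_pos.2 hq
  have hu : ∀ d : ℕ, ‖(if d.Coprime q then (1:ℂ) else 0)‖ ≤ 1 := fun d => by split_ifs <;> simp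
  have h1 := h0 q hq0 hq a ha _ _ hu hu
  have e : ∑ r ∈ range q, ∑ s ∈ range q, (if r.Coprime q then (1:ℂ) else 0) * (if s.Coprime q then (1:ℂ) else 0) * gq a q Q (r * s) = q.totient * ∑ b ∈ range q with b.Coprime q, gq a q Q b := by
    have : ∀ r ∈ (range q).filter (fun b => b.Coprime q), ∑ s ∈ range q with s.Coprime q, gq a q Q (r * s) = ∑ b ∈ range q with b.Coprime q, gq a q Q b := by
      intro r hr
      rw [mem_filter] at hr
      have hm : Set.MapsTo (fun s => r * s % q) ((range q).filter (fun b => b.Coprime q) : Finset ℕ) ((range q).filter (fun b => b.Coprime q) : Finset ℕ) := by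
        intro s hs
        simp only [coe_filter, Set.mem_ofPred_eq, mem_range] at hs ⊢
        refine ⟨Nat.mod_lt _ hq, ?_⟩
        rw [Nat.Coprime, (Nat.mod_modEq _ q).gcd_eq]; exact Nat.Coprime.mul_left hr.2 hs.2
      have hi : Set.InjOn (fun s => r * s % q) ((range q).filter (fun b => b.Coprime q) : Finset ℕ) := by
        intro s hs t ht h
        simp only [coe_filter, Set.mem_ofPred_eq, mem_range] at hs ht h
        have h2 : s ≡ t [MOD q] := Nat.ModEq.cancel_left_of_coprime (by rw [Nat.gcd_comm]; exact hr.2) h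
        rw [Nat.ModEq, Nat.mod_eq_of_lt hs.1, Nat.mod_eq_of_lt ht.1] at h2; exact h2
      exact sum_nbij _ hm hi (surjOn_of_injOn_of_card_le _ hm hi le_rfl) fun s _ => gq_mod a q hq Q _ _ (Nat.mod_modEq _ q).symm
    have h2 : ∀ r ∈ range q, ∑ s ∈ range q, (if r.Coprime q then (1:ℂ) else 0) * (if s.Coprime q then (1:ℂ) else 0) * gq a q Q (r * s) = if r.Coprime q then ∑ s ∈ range q with s.Coprime q, gq a q Q (r * s) else 0 := by
      intro r _; split_ifs <;> simp [sum_filter]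
    rw [sum_congr rfl h2, ← sum_filter, sum_congr rfl this, sum_const, card_cop, nsmul_eq_mul]
  rw [e, norm_mul, Complex.norm_natCast] at h1
  have : (q.totient:ℝ) * ‖∑ b ∈ range q with b.Coprime q, gq a q Q b‖ ≤ q.totient * (η0 * q.totient) := by linarith
  exact le_of_mul_le_mul_left this hφ

end P6

section P6
open ArithmeticFunction

def HS (N l q R Z : ℕ) (ε : ℝ) : Prop := ∀ X : ℕ, Z ≤ X → X ≤ N → ∃ Mn : ℝ, |Mn| ≤ 151 * (X / R : ℕ) * l / q.totient ∧
  ∀ b : ℕ, b.Coprime q → |Hb X (X / R) q b - Mn| ≤ ε * (X / R : ℕ) * l / q ∧ Hb X (X / R) q b ≤ 152 * (X / R : ℕ) * l / q.totient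

def HP (N R : ℕ) (ψ : ℕ → ℂ) (η : ℝ) : Prop := (∀ n, ‖ψ n‖ ≤ 1) ∧ ∀ X n : ℕ, X ≤ n → n ≤ N → (n - X) * R ≤ N → ‖ψ n - ψ X‖ ≤ η

lemma type1 (N l q R Z : ℕ) (ε η0 η1 : ℝ) (hq : 0 < q) (hR : 0 < R) (hRZ : R ≤ Z) (hZN : Z ≤ N) (hε : 0 ≤ ε) (hη : 0 ≤ η0) (hη1 : 0 ≤ η1) (hl : Real.log N ≤ l)
    (hS : HS N l q R Z ε) (ψ : ℕ → ℂ) (hψ : HP N R ψ η1) (a : ℤ) (Q : Polynomial ℕ)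
    (hg : ‖∑ b ∈ range q with b.Coprime q, gq a q Q b‖ ≤ η0 * q.totient) :
    ‖∑ n ∈ Ioc 0 N, (hh n : ℂ) * (if n.Coprime q then gq a q Q n * ψ n else 0)‖ ≤
      36 * Z * (Real.log Z + 1) + N * (151 * η0 * l + ε * l + 2 * l ^ 2 * η1) + (N / R + 1) * (2 * l ^ 2) := by
  have hq' : (0:ℝ) < q := by exact_mod_cast hq
  have hR' : (0:ℝ) < R := by exact_mod_cast hR
  have hφ : (0:ℝ) < q.totient := by exact_mod_cast Nat.totient_pos.2 hq
  have hhl : ∀ n, n ≤ N → hh n ≤ 2 * l ^ 2 := fun n hn => (hh_le n).trans (by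
    have := log_le_of n N l hn hl
    have := Real.log_natCast_nonneg n
    gcongr)
  obtain ⟨F, hF⟩ : ∃ F : ℕ → ℂ, F = fun n => (hh n : ℂ) * (if n.Coprime q then gq a q Q n * ψ n else 0) := ⟨_, rfl⟩
  have hFn : ∀ n, ‖F n‖ ≤ hh n := by
    intro n
    rw [hF]; simp only
    rw [norm_mul, Complex.norm_real, Real.norm_of_nonneg (hh_nonneg n)]
    refine mul_le_of_le_one_right (hh_nonneg n) ?_
    split_ifs
    · rw [norm_mul, gq_norm, one_mul]; exact hψ.1 n
    · simp
  have e0 : ∑ n ∈ Ioc 0 N, (hh n : ℂ) * (if n.Coprime q then gq a q Q n * ψ n else 0) = ∑ n ∈ Ico 1 Z, F n + ∑ n ∈ Ico Z (N + 1), F n := by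
    rw [sum_Ico_consecutive _ (by omega) (by omega), hF]; rfl
  rw [e0]
  have h1 : ‖∑ n ∈ Ico 1 Z, F n‖ ≤ 36 * Z * (Real.log Z + 1) := by
    refine (norm_sum_le _ _).trans ((sum_le_sum fun n _ => hFn n).trans (le_trans ?_ (sum_hh Z)))
    exact sum_le_sum_of_subset_of_nonneg (fun n hn => by simp at hn ⊢; omega) fun n _ _ => hh_nonneg n
  obtain ⟨c, hc⟩ : ∃ c : ℝ, c = 151 * η0 * l + ε * l + 2 * l ^ 2 * η1 := ⟨_, rfl⟩
  have hc0 : 0 ≤ c := by rw [hc]; positivity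
  have h2 := block_sum F (fun _ => c) R Z (N + 1) ((N / R + 1) * (2 * l ^ 2)) hR hRZ (fun _ => hc0) ?_ ?_ (by omega)
  · refine (norm_add_le _ _).trans ?_
    rw [← hc]
    have h3 : ∑ m ∈ Ico Z (N + 1), c ≤ N * c := by
      rw [sum_const, nsmul_eq_mul, Nat.card_Ico]; gcongr; omega
    linarith
  · intro X hX hXN
    obtain ⟨W, hW⟩ : ∃ W, W = X / R := ⟨_, rfl⟩
    obtain ⟨Mn, hM, hb⟩ := hS X hX (by have : 0 < X / R := Nat.div_pos (hRZ.trans hX) hR; omega)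
    rw [← hW] at hM hb hXN ⊢
    have hWR : W * R ≤ X := by rw [hW]; exact Nat.div_mul_le_self X R
    have e1 : ∑ m ∈ Ico X (X + W), F m = ψ X * ∑ m ∈ Ico X (X + W) with m.Coprime q, (hh m : ℂ) * gq a q Q m + ∑ m ∈ Ico X (X + W) with m.Coprime q, (hh m : ℂ) * gq a q Q m * (ψ m - ψ X) := by
      rw [mul_sum, ← sum_add_distrib, sum_filter]
      refine sum_congr rfl fun m _ => ?_
      rw [hF]; simp only; split_ifs
      · ring
      · simp
    have h3 : ‖∑ m ∈ Ico X (X + W) with m.Coprime q, (hh m : ℂ) * gq a q Q m * (ψ m - ψ X)‖ ≤ W * (2 * l ^ 2 * η1) := by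
      refine (norm_sum_le _ _).trans ?_
      calc _ ≤ ∑ m ∈ Ico X (X + W) with m.Coprime q, 2 * (l:ℝ) ^ 2 * η1 := sum_le_sum fun m hm => by
            rw [mem_filter, mem_Ico] at hm
            rw [norm_mul, norm_mul, gq_norm, mul_one, Complex.norm_real, Real.norm_of_nonneg (hh_nonneg m)]
            refine mul_le_mul (hhl m (by omega)) (hψ.2 X m hm.1.1 (by omega) ?_) (norm_nonneg _) (by positivity)
            calc (m - X) * R ≤ W * R := by gcongr; omega
              _ ≤ N := by omega
        _ ≤ ∑ m ∈ Ico X (X + W), 2 * (l:ℝ) ^ 2 * η1 := sum_le_sum_of_subset_of_nonneg (filter_subset _ _) fun _ _ _ => by positivity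
        _ = _ := by rw [sum_const, nsmul_eq_mul, Nat.card_Ico]; simp
    have h4 : ‖∑ m ∈ Ico X (X + W) with m.Coprime q, (hh m : ℂ) * gq a q Q m‖ ≤ W * (151 * η0 * l + ε * l) := by
      have e2 : ∑ m ∈ Ico X (X + W) with m.Coprime q, (hh m : ℂ) * gq a q Q m = ∑ b ∈ range q with b.Coprime q, ((Hb X W q b - Mn : ℝ) : ℂ) * gq a q Q b + Mn * ∑ b ∈ range q with b.Coprime q, gq a q Q b := by
        rw [sum_mod _ q hq, mul_sum, ← sum_add_distrib]
        refine sum_congr rfl fun b _ => ?_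
        rw [← add_mul]; push_cast; rw [sub_add_cancel, Hb, Complex.ofReal_sum, sum_mul]
        refine sum_congr rfl fun m hm => ?_
        rw [gq_mod a q hq Q m b (mem_filter.1 hm).2]
      rw [e2]
      refine (norm_add_le _ _).trans ?_
      have h5 : ‖∑ b ∈ range q with b.Coprime q, ((Hb X W q b - Mn : ℝ) : ℂ) * gq a q Q b‖ ≤ W * (ε * l) := by
        refine (norm_sum_le _ _).trans ?_
        calc _ ≤ ∑ b ∈ range q with b.Coprime q, ε * W * l / q := sum_le_sum fun b hbb => by
              rw [norm_mul, gq_norm, mul_one, Complex.norm_real]; exact (hb b (mem_filter.1 hbb).2).1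
          _ ≤ ∑ b ∈ range q, ε * W * l / q := sum_le_sum_of_subset_of_nonneg (filter_subset _ _) fun _ _ _ => by positivity
          _ = _ := by rw [sum_const, nsmul_eq_mul, card_range]; field_simp
      have h6 : ‖(Mn : ℂ) * ∑ b ∈ range q with b.Coprime q, gq a q Q b‖ ≤ W * (151 * η0 * l) := by
        rw [norm_mul, Complex.norm_real]
        calc _ ≤ 151 * W * l / q.totient * (η0 * q.totient) := by gcongr; exact hM
          _ = _ := by field_simp
      linarith
    rw [e1, sum_const, nsmul_eq_mul, Nat.card_Ico, Nat.add_sub_cancel_left, hc]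
    refine (norm_add_le _ _).trans ?_
    rw [norm_mul]
    have := mul_le_mul (hψ.1 X) h4 (norm_nonneg _) zero_le_one
    linarith
  · intro X hX hXN hlt
    refine (norm_sum_le _ _).trans ?_
    calc _ ≤ ∑ m ∈ Ico X (N + 1), 2 * (l:ℝ) ^ 2 := sum_le_sum fun m hm => (hFn m).trans (hhl m (by rw [mem_Ico] at hm; omega))
      _ = (N + 1 - X : ℕ) * (2 * (l:ℝ) ^ 2) := by rw [sum_const, nsmul_eq_mul, Nat.card_Ico]
      _ ≤ _ := by
        gcongr
        by_cases hx : X ≤ N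
        · have h6 : X / R ≤ N / R := Nat.div_le_div_right hx
          have h7 := natdiv_le N R
          have h8 : ((N + 1 - X : ℕ) : ℝ) ≤ (N / R : ℕ) := by exact_mod_cast (by omega : N + 1 - X ≤ N / R)
          linarith
        · have : N + 1 - X = 0 := by omega
          rw [this]; push_cast; positivity

end P6

section P6
open ArithmeticFunction

lemma bt_short (N l q R Z : ℕ) (ε δ : ℝ) (hδ : 0 < δ) (hl1 : 1 ≤ l) (hq : 0 < q) (hδZ : δ * l ≤ Real.log Z) (hZ1 : 1 ≤ Z)
    (hS : HS N l q R Z ε) (X : ℕ) (hX : Z ≤ X) (hXN : X ≤ N) (b : ℕ) (hb : b.Coprime q) :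
    ∑ n ∈ Ico X (X + X / R) with n ≡ b [MOD q], Λ n ≤ (X / R : ℕ) * (152 / (δ * q.totient)) := by
  have hφ : (0:ℝ) < q.totient := by exact_mod_cast Nat.totient_pos.2 hq
  obtain ⟨Mn, -, h⟩ := hS X hX hXN
  have h1 := (h b hb).2
  have hl' : (1:ℝ) ≤ l := by exact_mod_cast hl1
  have h2 : ∑ n ∈ Ico X (X + X / R) with n ≡ b [MOD q], Λ n * (δ * l) ≤ Hb X (X / R) q b := by
    refine sum_le_sum fun n hn => ?_
    rw [mem_filter, mem_Ico] at hn
    refine le_trans ?_ (llm_le_hh n)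
    rw [llm_apply]
    refine mul_le_mul_of_nonneg_left (hδZ.trans (Real.log_le_log (by exact_mod_cast hZ1) (by exact_mod_cast hX.trans hn.1.1))) vonMangoldt_nonneg
  rw [← sum_mul] at h2
  have h3 := h2.trans h1
  rw [← le_div_iff₀ (by positivity)] at h3
  refine h3.trans (le_of_eq ?_)
  field_simp

lemma bt_long (N l q R Z : ℕ) (ε δ : ℝ) (hδ : 0 < δ) (hl1 : 1 ≤ l) (hq : 0 < q) (hR : 0 < R) (hRZ : R ≤ Z) (hδZ : δ * l ≤ Real.log Z)
    (hS : HS N l q R Z ε) (J : ℕ) (hJN : 2 * J ≤ N) (b : ℕ) (hb : b.Coprime q) :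
    ∑ n ∈ Ico Z (J + 1) with n ≡ b [MOD q], Λ n ≤ J * (456 / (δ * q.totient)) := by
  have hφ : (0:ℝ) < q.totient := by exact_mod_cast Nat.totient_pos.2 hq
  by_cases hJ : J + 1 ≤ Z
  · rw [Ico_eq_empty_of_le hJ, filter_empty, sum_empty]; positivity
  push Not at hJ
  have hJ1 : 1 ≤ J := by omega
  have hJ1' : (1:ℝ) ≤ J := by exact_mod_cast hJ1
  obtain ⟨c, hc⟩ : ∃ c : ℝ, c = 152 / (δ * q.totient) := ⟨_, rfl⟩
  have hc0 : 0 ≤ c := by rw [hc]; positivity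
  have key : ∀ X Y : ℕ, ‖∑ m ∈ Ico X Y, ((if m ≡ b [MOD q] then Λ m else 0 : ℝ) : ℂ)‖ = ∑ m ∈ Ico X Y with m ≡ b [MOD q], Λ m := by
    intro X Y
    rw [← Complex.ofReal_sum, ← sum_filter, Complex.norm_real, Real.norm_of_nonneg (sum_nonneg fun _ _ => vonMangoldt_nonneg)]
  have h := block_sum (fun m => ((if m ≡ b [MOD q] then Λ m else 0 : ℝ) : ℂ)) (fun _ => c) R Z (J + 1) ((J + 1) * c) hR hRZ (fun _ => hc0) ?_ ?_ hJ.le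
  · rw [key] at h
    refine h.trans ?_
    have h3 : ∑ m ∈ Ico Z (J + 1), c ≤ J * c := by
      rw [sum_const, nsmul_eq_mul, Nat.card_Ico]; gcongr; omega
    have h4 : (J:ℝ) * (456 / (δ * q.totient)) = J * c + (J + J) * c := by rw [hc]; ring
    rw [h4]
    have : ((J:ℝ) + 1) * c ≤ (J + J) * c := by gcongr
    linarith
  · intro X hX hXJ
    rw [key, sum_const, nsmul_eq_mul, Nat.card_Ico, Nat.add_sub_cancel_left, hc]
    exact bt_short N l q R Z ε δ hδ hl1 hq hδZ (by omega) hS X hX (by have := (Nat.le_add_right X (X / R)).trans hXJ; omega) b hb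
  · intro X hX hXJ hlt
    rw [key]
    calc _ ≤ ∑ n ∈ Ico X (X + X / R) with n ≡ b [MOD q], Λ n :=
          sum_le_sum_of_subset_of_nonneg (filter_subset_filter _ (Ico_subset_Ico_right hlt.le)) fun _ _ _ => vonMangoldt_nonneg
      _ ≤ (X / R : ℕ) * c := by rw [hc]; exact bt_short N l q R Z ε δ hδ hl1 hq hδZ (by omega) hS X hX (by omega) b hb
      _ ≤ _ := by gcongr; exact_mod_cast (Nat.div_le_self X R).trans hXJ

lemma scale_qbil (q : ℕ) (g : ℕ → ℕ → ℂ) (E a b : ℝ) (ha : 0 ≤ a) (hb : 0 ≤ b)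
    (h : ∀ u v : ℕ → ℂ, (∀ d, ‖u d‖ ≤ 1) → (∀ m, ‖v m‖ ≤ 1) → ‖∑ r ∈ range q, ∑ s ∈ range q, u r * v s * g r s‖ ≤ E)
    (Φ Ψ : ℕ → ℂ) (hΦ : ∀ r, ‖Φ r‖ ≤ a) (hΨ : ∀ r, ‖Ψ r‖ ≤ b) :
    ‖∑ r ∈ range q, ∑ s ∈ range q, Φ r * Ψ s * g r s‖ ≤ a * b * E := by
  rcases ha.eq_or_lt with rfl | ha
  · have : ∀ r, Φ r = 0 := fun r => norm_le_zero_iff.1 (hΦ r)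
    simp [this]
  rcases hb.eq_or_lt with rfl | hb
  · have : ∀ r, Ψ r = 0 := fun r => norm_le_zero_iff.1 (hΨ r)
    simp [this]
  have h1 := h (fun r => Φ r / a) (fun r => Ψ r / b) (fun r => by
    rw [norm_div, Complex.norm_real, Real.norm_of_nonneg ha.le]; exact div_le_one_of_le₀ (hΦ r) ha.le) (fun r => by
    rw [norm_div, Complex.norm_real, Real.norm_of_nonneg hb.le]; exact div_le_one_of_le₀ (hΨ r) hb.le)
  have ha' : (a:ℂ) ≠ 0 := by exact_mod_cast ha.ne'
  have hb' : (b:ℂ) ≠ 0 := by exact_mod_cast hb.ne'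
  have e : ∑ r ∈ range q, ∑ s ∈ range q, Φ r * Ψ s * g r s = ((a * b : ℝ) : ℂ) * ∑ r ∈ range q, ∑ s ∈ range q, Φ r / a * (Ψ s / b) * g r s := by
    rw [mul_sum]; refine sum_congr rfl fun r _ => ?_
    rw [mul_sum]; refine sum_congr rfl fun s _ => ?_
    push_cast; field_simp
  rw [e, norm_mul, Complex.norm_real, Real.norm_of_nonneg (by positivity)]
  gcongr

noncomputable def LC (q n : ℕ) : ℝ := if n.Coprime q then Λ n else 0

lemma LC_nonneg (q n : ℕ) : 0 ≤ LC q n := by rw [LC]; split_ifs; exacts [vonMangoldt_nonneg, le_rfl]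

lemma LC_le (q n N l : ℕ) (hn : n ≤ N) (hl : Real.log N ≤ l) : LC q n ≤ l := by
  rw [LC]; split_ifs; exacts [vonMangoldt_le_log.trans (log_le_of n N l hn hl), Nat.cast_nonneg l]

/- main part of a block -/
lemma t2_main (N l q R Z : ℕ) (ε δ η0 : ℝ) (hδ : 0 < δ) (hl1 : 1 ≤ l) (hq : 0 < q) (hR : 0 < R) (hRZ : R ≤ Z) (hδZ : δ * l ≤ Real.log Z)
    (hS : HS N l q R Z ε) (a : ℤ) (Q : Polynomial ℕ)
    (hg : ∀ u v : ℕ → ℂ, (∀ d, ‖u d‖ ≤ 1) → (∀ m, ‖v m‖ ≤ 1) → ‖∑ r ∈ range q, ∑ s ∈ range q, u r * v s * gq a q Q (r * s)‖ ≤ η0 * (q.totient : ℝ) ^ 2)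
    (φ : ℕ → ℂ) (hφ1 : ∀ n, ‖φ n‖ ≤ 1) (X J : ℕ) (hX : Z ≤ X) (hXN : X ≤ N) (hJ : 2 * J ≤ N) :
    ‖∑ d ∈ Ico X (X + X / R), ∑ m ∈ Ico Z (J + 1), (LC q d : ℂ) * LC q m * (gq a q Q (d * m) * φ m)‖ ≤
      (X / R : ℕ) * J * (69312 * η0 / δ ^ 2) := by
  have hφ : (0:ℝ) < q.totient := by exact_mod_cast Nat.totient_pos.2 hq
  obtain ⟨Φ, hΦ⟩ : ∃ Φ : ℕ → ℂ, Φ = fun b => ∑ n ∈ Ico X (X + X / R) with n ≡ b [MOD q], (LC q n : ℂ) := ⟨_, rfl⟩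
  obtain ⟨Ψ, hΨ⟩ : ∃ Ψ : ℕ → ℂ, Ψ = fun b => ∑ n ∈ Ico Z (J + 1) with n ≡ b [MOD q], (LC q n : ℂ) * φ n := ⟨_, rfl⟩
  have split : ∀ (s : Finset ℕ) (f : ℕ → ℂ), ∑ n ∈ s, f n = ∑ b ∈ range q, ∑ n ∈ s with n ≡ b [MOD q], f n := by
    intro s f
    rw [← sum_fiberwise_of_maps_to (s := s) (t := range q) (g := fun n => n % q) fun n _ => mem_range.2 (Nat.mod_lt _ hq)]
    refine sum_congr rfl fun b hb => sum_congr (filter_congr fun n _ => ?_) fun _ _ => rfl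
    rw [Nat.ModEq, Nat.mod_eq_of_lt (mem_range.1 hb)]
  have bd : ∀ (s : Finset ℕ) (b : ℕ) (B : ℝ), 0 ≤ B → (b.Coprime q → ∑ n ∈ s with n ≡ b [MOD q], Λ n ≤ B) → ∑ n ∈ s with n ≡ b [MOD q], LC q n ≤ B := by
    intro s b B hB h
    by_cases hb : b.Coprime q
    · refine le_trans (sum_le_sum fun n _ => ?_) (h hb)
      rw [LC]; split_ifs; exacts [le_rfl, vonMangoldt_nonneg]
    · rw [sum_eq_zero]; exact hB
      intro n hn
      rw [LC, if_neg]
      rw [Nat.Coprime, (mem_filter.1 hn).2.gcd_eq]; exact hb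
  have hB := scale_qbil q (fun r s => gq a q Q (r * s)) (η0 * (q.totient : ℝ) ^ 2) ((X / R : ℕ) * (152 / (δ * q.totient))) (J * (456 / (δ * q.totient)))
    (by positivity) (by positivity) hg Φ Ψ ?_ ?_
  · have e : ∑ d ∈ Ico X (X + X / R), ∑ m ∈ Ico Z (J + 1), (LC q d : ℂ) * LC q m * (gq a q Q (d * m) * φ m) = ∑ r ∈ range q, ∑ s ∈ range q, Φ r * Ψ s * gq a q Q (r * s) := by
      rw [split]
      refine sum_congr rfl fun r _ => ?_
      rw [sum_comm, split, hΦ, hΨ]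
      refine sum_congr rfl fun s _ => ?_
      simp only
      rw [sum_mul_sum, sum_mul, sum_comm]
      refine sum_congr rfl fun d hd => ?_
      rw [sum_mul]
      refine sum_congr rfl fun m hm => ?_
      rw [gq_mod a q hq Q (d * m) (r * s) (Nat.ModEq.mul (mem_filter.1 hd).2 (mem_filter.1 hm).2)]; ring
    rw [e]
    refine hB.trans (le_of_eq ?_)
    field_simp; ring
  · intro r
    rw [hΦ]; simp only
    rw [← Complex.ofReal_sum, Complex.norm_real, Real.norm_of_nonneg (sum_nonneg fun _ _ => LC_nonneg _ _)]
    exact bd _ _ _ (by positivity) fun hb => bt_short N l q R Z ε δ hδ hl1 hq hδZ (by omega) hS X hX hXN r hb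
  · intro r
    rw [hΨ]
    refine (norm_sum_le _ _).trans (le_trans (sum_le_sum fun n _ => ?_) (bd _ _ _ (by positivity) fun hb => bt_long N l q R Z ε δ hδ hl1 hq hR hRZ hδZ hS J hJ r hb))
    rw [norm_mul, Complex.norm_real, Real.norm_of_nonneg (LC_nonneg _ _)]
    exact mul_le_of_le_one_right (LC_nonneg _ _) (hφ1 n)

end P6

section P6
open ArithmeticFunction

lemma type2 (N l q R Z : ℕ) (ε δ η0 η1 : ℝ) (hδ : 0 < δ) (hη : 0 ≤ η0) (hη1 : 0 ≤ η1) (hl1 : 1 ≤ l) (hq : 0 < q) (hR : 0 < R) (hRZ : R ≤ Z) (hZ2 : 2 ≤ Z) (hZN : Z * Z ≤ N)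
    (hl : Real.log N ≤ l) (hδZ : δ * l ≤ Real.log Z)
    (hS : HS N l q R Z ε) (a : ℤ) (Q : Polynomial ℕ) (ψ : ℕ → ℂ) (hψ : HP N R ψ η1)
    (hg : ∀ u v : ℕ → ℂ, (∀ d, ‖u d‖ ≤ 1) → (∀ m, ‖v m‖ ≤ 1) → ‖∑ r ∈ range q, ∑ s ∈ range q, u r * v s * gq a q Q (r * s)‖ ≤ η0 * (q.totient : ℝ) ^ 2) :
    ‖∑ n ∈ Ioc 0 N, ((Λ * Λ : ArithmeticFunction ℝ) n : ℂ) * (if n.Coprime q then gq a q Q n * ψ n else 0)‖ ≤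
      12 * N * (Real.log Z + 6) + N * (1 + Real.log N) * (l ^ 2 / R + l ^ 2 * η1 + 69312 * η0 / δ ^ 2) + (N / Z + 1) * l ^ 2 + N / R * l ^ 2 := by
  have hR' : (0:ℝ) < R := by exact_mod_cast hR
  have hZ' : (0:ℝ) < Z := by exact_mod_cast (by omega : 0 < Z)
  obtain ⟨c, hc⟩ : ∃ c : ℕ → ℂ, c = fun n => if n.Coprime q then gq a q Q n * ψ n else 0 := ⟨_, rfl⟩
  have hc1 : ∀ n, ‖c n‖ ≤ 1 := by
    intro n; rw [hc]; simp only; split_ifs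
    · rw [norm_mul, gq_norm, one_mul]; exact hψ.1 n
    · simp
  have e0 : ∑ n ∈ Ioc 0 N, ((Λ * Λ : ArithmeticFunction ℝ) n : ℂ) * (if n.Coprime q then gq a q Q n * ψ n else 0) = ∑ n ∈ Ioc 0 N, ((Λ * Λ : ArithmeticFunction ℝ) n : ℂ) * c n := by rw [hc]
  rw [e0, conv_sum, split3 _ N Z (by omega)]
  have t1 : ‖∑ m ∈ Ico 1 Z, ∑ d ∈ Ico 1 (N / m + 1), (Λ d : ℂ) * Λ m * c (d * m)‖ ≤ 6 * N * (Real.log Z + 6) := by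
    have := triv_VV (fun m d => c (d * m)) (fun m d => hc1 _) N Z (fun m => Ico 1 (N / m + 1)) (fun m d hd => by rw [mem_Ico] at hd; rw [mem_Ioc]; omega)
    refine le_trans (le_of_eq ?_) this
    congr 1; refine sum_congr rfl fun m _ => sum_congr rfl fun d _ => ?_; ring
  have t2 := triv_VV (fun d m => c (d * m)) (fun d m => hc1 _) N Z (fun d => Ico Z (N / d + 1)) (fun m d hd => by rw [mem_Ico] at hd; rw [mem_Ioc]; omega)
  have t3 : ‖∑ d ∈ Ico Z (N / Z + 1), ∑ m ∈ Ico Z (N / d + 1), (Λ d : ℂ) * Λ m * c (d * m)‖ ≤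
      N * (1 + Real.log N) * (l ^ 2 / R + l ^ 2 * η1 + 69312 * η0 / δ ^ 2) + (N / Z + 1) * l ^ 2 + N / R * l ^ 2 := by
    have hcop : ∀ d m : ℕ, (Λ d : ℂ) * Λ m * c (d * m) = (LC q d : ℂ) * LC q m * (gq a q Q (d * m) * ψ (d * m)) := by
      intro d m
      rw [hc, LC, LC]; simp only [Nat.coprime_mul_iff_left]
      by_cases h1 : d.Coprime q <;> by_cases h2 : m.Coprime q <;> first | rw [if_pos ⟨h1, h2⟩, if_pos h1, if_pos h2] | simp only [h1, h2, if_false, and_self, and_false, false_and, Complex.ofReal_zero, mul_zero, zero_mul]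
    simp only [hcop]
    obtain ⟨T, hT⟩ : ∃ T : ℕ → ℕ → ℂ, T = fun d m => (LC q d : ℂ) * LC q m * (gq a q Q (d * m) * ψ (d * m)) := ⟨_, rfl⟩
    have hTl : ∀ d m φ, d ≤ N → m ≤ N → ‖(LC q d : ℂ) * LC q m * (gq a q Q (d * m) * φ)‖ ≤ l ^ 2 * ‖φ‖ := by
      intro d m φ hd hm
      rw [norm_mul, norm_mul, norm_mul, gq_norm, one_mul, Complex.norm_real, Complex.norm_real, Real.norm_of_nonneg (LC_nonneg _ _), Real.norm_of_nonneg (LC_nonneg _ _), sq]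
      have := LC_le q d N l hd hl
      have := LC_le q m N l hm hl
      have := LC_nonneg q m
      gcongr
    have hTl' : ∀ d m, d ≤ N → m ≤ N → ‖T d m‖ ≤ l ^ 2 := by
      intro d m hd hm; rw [hT]
      exact (hTl d m _ hd hm).trans (mul_le_of_le_one_right (by positivity) (hψ.1 _))
    have e1 : ∑ d ∈ Ico Z (N / Z + 1), ∑ m ∈ Ico Z (N / d + 1), (LC q d : ℂ) * LC q m * (gq a q Q (d * m) * ψ (d * m)) = ∑ d ∈ Ico Z (N / Z + 1), ∑ m ∈ Ico Z (N / d + 1), T d m := by rw [hT]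
    rw [e1]
    have hdN : ∀ d, 0 < d → N / d ≤ N := fun d _ => Nat.div_le_self N d
    obtain ⟨κ, hκ⟩ : ∃ κ : ℝ, κ = l ^ 2 / R + l ^ 2 * η1 + 69312 * η0 / δ ^ 2 := ⟨_, rfl⟩
    have hκ0 : 0 ≤ κ := by rw [hκ]; positivity
    rw [← hκ]
    have hNZ : Z ≤ N / Z := (Nat.le_div_iff_mul_le (by omega)).2 hZN
    have h := block_sum (fun d => ∑ m ∈ Ico Z (N / d + 1), T d m) (fun d => N * κ * (1 / d) + l ^ 2) R Z (N / Z + 1) (N / R * l ^ 2) hR hRZ (fun _ => by positivity) ?_ ?_ (by omega)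
    · refine h.trans ?_
      rw [sum_add_distrib, ← mul_sum, sum_const, nsmul_eq_mul, Nat.card_Ico]
      have h1 := harm_Ico Z (N / Z + 1) N (by omega) (by have := Nat.div_le_self N Z; omega)
      have h2 : ((N / Z + 1 - Z : ℕ) : ℝ) ≤ N / Z + 1 := by
        have h3 : N / Z + 1 - Z ≤ N / Z + 1 := Nat.sub_le _ _
        have h4 := natdiv_le N Z
        have : ((N / Z + 1 - Z : ℕ) : ℝ) ≤ (N / Z : ℕ) + 1 := by exact_mod_cast h3
        linarith
      have h5 : N * κ * ∑ m ∈ Ico Z (N / Z + 1), 1 / (m:ℝ) ≤ N * κ * (1 + Real.log N) := by gcongr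
      have h6 : ((N / Z + 1 - Z : ℕ) : ℝ) * (l:ℝ) ^ 2 ≤ (N / Z + 1) * l ^ 2 := by gcongr
      linarith
    · intro X hX hXN
      obtain ⟨W, hW⟩ : ∃ W, W = X / R := ⟨_, rfl⟩
      have hWR : W * R ≤ X := by rw [hW]; exact Nat.div_mul_le_self X R
      have hW1 : 1 ≤ W := by rw [hW]; exact Nat.div_pos (hRZ.trans hX) hR
      have hXW : (0:ℝ) < (X:ℝ) + W := by exact_mod_cast (by omega : 0 < X + W)
      have hXN' : X + W ≤ N := by
        have : N / Z + 1 ≤ N := by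
          have : N / Z * 2 ≤ N := (Nat.mul_le_mul_left _ hZ2).trans (Nat.div_mul_le_self N Z)
          omega
        rw [hW]; omega
      obtain ⟨J, hJ⟩ : ∃ J, J = N / (X + W) := ⟨_, rfl⟩
      have hJX : J * (X + W) ≤ N := by rw [hJ]; exact Nat.div_mul_le_self _ _
      have hJd : ∀ d, d < X + W → 0 < d → J ≤ N / d := fun d hd h0 => by rw [hJ]; exact Nat.div_le_div_left hd.le h0
      rw [← hW]
      have e2 : ∀ d ∈ Ico X (X + W), ∑ m ∈ Ico Z (N / d + 1), T d m = ∑ m ∈ Ico Z (J + 1), (LC q d : ℂ) * LC q m * (gq a q Q (d * m) * ψ (X * m)) +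
          (∑ m ∈ Ico Z (J + 1), (LC q d : ℂ) * LC q m * (gq a q Q (d * m) * (ψ (d * m) - ψ (X * m))) + ∑ m ∈ Ico Z (N / d + 1) with J < m, T d m) := by
        intro d hd
        rw [mem_Ico] at hd
        have hJd' := hJd d hd.2 (by omega)
        rw [← add_assoc, ← sum_add_distrib, ← sum_filter_add_sum_filter_not (Ico Z (N / d + 1)) (fun m => J < m), add_comm]
        congr 1
        refine sum_congr ?_ fun m _ => by rw [hT]; ring
        ext m; simp only [mem_filter, mem_Ico]; omega
      rw [sum_congr rfl e2, sum_add_distrib]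
      have h1 := t2_main N l q R Z ε δ η0 hδ hl1 hq hR hRZ hδZ hS a Q hg (fun m => ψ (X * m)) (fun m => hψ.1 _) X J hX (by omega) (by nlinarith)
      rw [← hW] at h1
      have h2 : (W:ℝ) * J * (69312 * η0 / δ ^ 2) ≤ ∑ d ∈ Ico X (X + W), N * (69312 * η0 / δ ^ 2) * (1 / d) := by
        calc (W:ℝ) * J * (69312 * η0 / δ ^ 2) = ∑ d ∈ Ico X (X + W), J * (69312 * η0 / δ ^ 2) := by
              rw [sum_const, nsmul_eq_mul, Nat.card_Ico, Nat.add_sub_cancel_left]; ring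
          _ ≤ _ := sum_le_sum fun d hd => by
              rw [mem_Ico] at hd
              have h3 : (J:ℝ) ≤ N / d := le_trans (by exact_mod_cast hJd d hd.2 (by omega)) (natdiv_le N d)
              calc _ ≤ N / d * (69312 * η0 / δ ^ 2) := by gcongr
                _ = _ := by ring
      have h3 : ∀ d ∈ Ico X (X + W), ‖∑ m ∈ Ico Z (J + 1), (LC q d : ℂ) * LC q m * (gq a q Q (d * m) * (ψ (d * m) - ψ (X * m))) + ∑ m ∈ Ico Z (N / d + 1) with J < m, T d m‖ ≤ N * (l ^ 2 / R + l ^ 2 * η1) * (1 / d) + l ^ 2 := by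
        intro d hd
        rw [mem_Ico] at hd
        have hd0 : 0 < d := by omega
        have hd0' : (0:ℝ) < d := by exact_mod_cast hd0
        have hJd' := hJd d hd.2 hd0
        have hJN : (J:ℝ) ≤ N / d := le_trans (by exact_mod_cast hJd') (natdiv_le N d)
        have hNd := hdN d hd0
        have b1 : ‖∑ m ∈ Ico Z (J + 1), (LC q d : ℂ) * LC q m * (gq a q Q (d * m) * (ψ (d * m) - ψ (X * m)))‖ ≤ N / d * (l ^ 2 * η1) := by
          refine (norm_sum_le _ _).trans ?_
          calc _ ≤ ∑ m ∈ Ico Z (J + 1), (l:ℝ) ^ 2 * η1 := sum_le_sum fun m hm => by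
                rw [mem_Ico] at hm
                refine (hTl d m _ (by omega) (by omega)).trans ?_
                have hdm : d * m ≤ N := (Nat.mul_le_mul hd.2.le (by omega : m ≤ J)).trans (by rw [mul_comm]; exact hJX)
                have := hψ.2 (X * m) (d * m) (Nat.mul_le_mul_right _ hd.1) hdm (by
                  rw [← Nat.sub_mul]
                  calc (d - X) * m * R ≤ W * m * R := by gcongr; omega
                    _ = W * R * m := by ring
                    _ ≤ X * m := by gcongr
                    _ ≤ d * m := by gcongr; exact hd.1
                    _ ≤ N := hdm)
                gcongr
            _ = (J + 1 - Z : ℕ) * ((l:ℝ) ^ 2 * η1) := by rw [sum_const, nsmul_eq_mul, Nat.card_Ico]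
            _ ≤ _ := by
                have : ((J + 1 - Z : ℕ) : ℝ) ≤ J := by exact_mod_cast (by omega : J + 1 - Z ≤ J)
                gcongr; linarith
        have b2 : ‖∑ m ∈ Ico Z (N / d + 1) with J < m, T d m‖ ≤ (N / (d * R) + 1) * l ^ 2 := by
          refine (norm_sum_le _ _).trans ?_
          calc _ ≤ ∑ m ∈ Ico Z (N / d + 1) with J < m, (l:ℝ) ^ 2 := sum_le_sum fun m hm => by
                rw [mem_filter, mem_Ico] at hm
                exact hTl' d m (by omega) (by omega)
            _ ≤ ∑ m ∈ Ico (J + 1) (N / d + 1), (l:ℝ) ^ 2 := sum_le_sum_of_subset_of_nonneg (fun m hm => by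
                rw [mem_filter, mem_Ico] at hm; rw [mem_Ico]; omega) fun _ _ _ => by positivity
            _ = ((N / d : ℕ) - J : ℝ) * (l:ℝ) ^ 2 := by
                rw [sum_const, nsmul_eq_mul, Nat.card_Ico, Nat.add_sub_add_right, Nat.cast_sub hJd']
            _ ≤ _ := by
                gcongr
                have b3 := natdiv_le N d
                have b4 := natdiv_ge N (X + W)
                rw [← hJ] at b4
                push_cast at b4
                have b5 : (N:ℝ) / d - N / (X + W) ≤ N / (d * R) := by
                  have b6 : (X:ℝ) ≤ d := by exact_mod_cast hd.1
                  have b7 : (W:ℝ) * R ≤ X := by exact_mod_cast hWR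
                  rw [div_sub_div _ _ hd0'.ne' hXW.ne', div_le_div_iff₀ (by positivity) (by positivity)]
                  have : (N:ℝ) * d * ((X + W - d) * R) ≤ N * d * (X + W) := by
                    gcongr
                    linarith [mul_le_mul_of_nonneg_right b6 (Nat.cast_nonneg R : (0:ℝ) ≤ R), (Nat.cast_nonneg W : (0:ℝ) ≤ W)]
                  linarith
                linarith
        refine (norm_add_le _ _).trans ((add_le_add b1 b2).trans (le_of_eq ?_))
        field_simp; ring
      calc _ ≤ _ := norm_add_le _ _
        _ ≤ (W:ℝ) * J * (69312 * η0 / δ ^ 2) + ∑ d ∈ Ico X (X + W), (N * (l ^ 2 / R + l ^ 2 * η1) * (1 / d) + l ^ 2) :=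
            add_le_add h1 ((norm_sum_le _ _).trans (sum_le_sum h3))
        _ ≤ ∑ d ∈ Ico X (X + W), N * (69312 * η0 / δ ^ 2) * (1 / d) + ∑ d ∈ Ico X (X + W), (N * (l ^ 2 / R + l ^ 2 * η1) * (1 / d) + l ^ 2) := by gcongr
        _ = _ := by rw [← sum_add_distrib, hκ]; refine sum_congr rfl fun d _ => ?_; ring
    · intro X hX hXN hlt
      have hX0 : (0:ℝ) < X := by exact_mod_cast (by omega : 0 < X)
      refine (norm_sum_le _ _).trans ?_
      have hZN2 : N / Z ≤ N := Nat.div_le_self N Z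
      calc _ ≤ ∑ d ∈ Ico X (N / Z + 1), N / X * (l:ℝ) ^ 2 := sum_le_sum fun d hd => by
            rw [mem_Ico] at hd
            have hd0 : 0 < d := by omega
            have := hdN d hd0
            refine (norm_sum_le _ _).trans ?_
            calc _ ≤ ∑ m ∈ Ico Z (N / d + 1), (l:ℝ) ^ 2 := sum_le_sum fun m hm => by
                  rw [mem_Ico] at hm; exact hTl' d m (by omega) (by omega)
              _ = (N / d + 1 - Z : ℕ) * (l:ℝ) ^ 2 := by rw [sum_const, nsmul_eq_mul, Nat.card_Ico]
              _ ≤ _ := by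
                  gcongr
                  have h1 : N / d + 1 - Z ≤ N / d := by generalize N / d = y; omega
                  calc ((N / d + 1 - Z : ℕ) : ℝ) ≤ (N / d : ℕ) := by exact_mod_cast h1
                    _ ≤ (N:ℝ) / d := natdiv_le N d
                    _ ≤ _ := by gcongr; exact_mod_cast hd.1
        _ = (N / Z + 1 - X : ℕ) * (N / X * (l:ℝ) ^ 2) := by rw [sum_const, nsmul_eq_mul, Nat.card_Ico]
        _ ≤ (X / R) * (N / X * (l:ℝ) ^ 2) := by
            gcongr
            have h2 : N / Z + 1 - X ≤ X / R := by omega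
            exact le_trans (by exact_mod_cast h2) (natdiv_le X R)
        _ = _ := by field_simp
  refine (norm_add_le _ _).trans ?_
  have := norm_add_le (∑ d ∈ Ico 1 Z, ∑ m ∈ Ico Z (N / d + 1), (Λ d : ℂ) * Λ m * c (d * m)) (∑ d ∈ Ico Z (N / Z + 1), ∑ m ∈ Ico Z (N / d + 1), (Λ d : ℂ) * Λ m * c (d * m))
  linarith

end P6

section P6
open ArithmeticFunction

lemma noncop (N l q : ℕ) (hq : 0 < q) (hl : Real.log N ≤ l) (F : ℕ → ℂ) (hF : ∀ n, ‖F n‖ ≤ 1) :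
    ‖∑ n ∈ Ioc 0 N, (llm n : ℂ) * (if n.Coprime q then 0 else F n)‖ ≤ (q + 1) * (2 * l + 1) * l ^ 2 := by
  obtain ⟨S, hS⟩ : ∃ S : Finset ℕ, S = (range (q + 1) ×ˢ range (2 * l + 1)).image (fun x => x.1 ^ x.2) := ⟨_, rfl⟩
  have hc : #S ≤ (q + 1) * (2 * l + 1) := by
    rw [hS]; refine card_image_le.trans ?_
    rw [card_product, card_range, card_range]
  have h0 : ∀ n ∈ Ioc 0 N, n ∉ S → (llm n : ℂ) * (if n.Coprime q then 0 else F n) = 0 := by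
    intro n hn hnS
    rw [mem_Ioc] at hn
    by_contra h
    rw [mul_eq_zero, not_or, ite_eq_left_iff, Complex.ofReal_eq_zero, llm_apply] at h
    obtain ⟨h1, h2⟩ := h
    have h3 : Λ n ≠ 0 := fun h => h1 (by rw [h, zero_mul])
    rw [vonMangoldt_ne_zero_iff, isPrimePow_nat_iff] at h3
    obtain ⟨p, j, hp, hj, rfl⟩ := h3
    apply hnS
    rw [hS, mem_image]
    refine ⟨(p, j), ?_, rfl⟩
    rw [mem_product, mem_range, mem_range]
    constructor
    · have h4 : ¬ (p ^ j).Coprime q := fun h => h2 fun h' => absurd h h'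
      rw [Nat.coprime_pow_left_iff hj, hp.coprime_iff_not_dvd, not_not] at h4
      exact Nat.lt_succ_of_le (Nat.le_of_dvd hq h4)
    · have h5 := log_le_of (p ^ j) N l hn.2 hl
      push_cast at h5
      rw [Real.log_pow] at h5
      have h6 : Real.log 2 ≤ Real.log p := Real.log_le_log two_pos (by exact_mod_cast hp.two_le)
      have h7 := Real.log_two_gt_d9
      have h8 : (j:ℝ) ≤ 2 * l := by nlinarith [(Nat.cast_nonneg j : (0:ℝ) ≤ j)]
      have h9 : j ≤ 2 * l := by exact_mod_cast h8
      simp only; omega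
  rw [← sum_filter_of_ne (p := fun n => n ∈ S) fun n hn h => by by_contra h'; exact h (h0 n hn h')]
  refine (norm_sum_le _ _).trans ?_
  calc _ ≤ ∑ n ∈ Ioc 0 N with n ∈ S, (l:ℝ) ^ 2 := sum_le_sum fun n hn => by
        rw [mem_filter, mem_Ioc] at hn
        rw [norm_mul, Complex.norm_real, Real.norm_of_nonneg (llm_nonneg n)]
        have h1 : llm n ≤ (l:ℝ) ^ 2 := (llm_le n).trans (by
          have := log_le_of n N l hn.1.2 hl
          have := Real.log_natCast_nonneg n
          gcongr)
        refine (mul_le_of_le_one_right (llm_nonneg n) ?_).trans h1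
        split_ifs; exacts [by simp, hF n]
    _ ≤ ∑ n ∈ S, (l:ℝ) ^ 2 := sum_le_sum_of_subset_of_nonneg (fun n hn => (mem_filter.1 hn).2) fun _ _ _ => by positivity
    _ = #S * (l:ℝ) ^ 2 := by rw [sum_const, nsmul_eq_mul]
    _ ≤ _ := by gcongr; exact_mod_cast hc

lemma ee_lip (x y : ℝ) : ‖ee x - ee y‖ ≤ 7 * |x - y| := by
  have h1 : ee x - ee y = ee y * (ee (x - y) - 1) := by
    rw [mul_sub, ← ee_add]; congr 2 <;> ring
  rw [h1, norm_mul, norm_ee, one_mul]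
  have h2 := Real.norm_exp_I_mul_ofReal_sub_one_le (x := 2 * Real.pi * (x - y))
  have h3 : ee (x - y) = Complex.exp (Complex.I * ((2 * Real.pi * (x - y) : ℝ) : ℂ)) := by
    rw [ee]; congr 1; push_cast; ring
  rw [h3]
  refine h2.trans ?_
  rw [Real.norm_eq_abs, abs_mul, abs_of_pos (by positivity)]
  gcongr
  linarith [Real.pi_lt_d2]

lemma Q_lip (Q : Polynomial ℕ) (N R u v : ℕ) (hN : 1 ≤ N) (huv : v ≤ u) (hu : u ≤ N) (h : (u - v) * R ≤ N) :
    (((Q.eval u : ℕ) : ℝ) - (Q.eval v : ℕ)) * R ≤ Q.natDegree * (Q.eval 1 : ℕ) * N ^ Q.natDegree ∧ (0:ℝ) ≤ ((Q.eval u : ℕ) : ℝ) - (Q.eval v : ℕ) := by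
  have hN' : (1:ℝ) ≤ N := by exact_mod_cast hN
  have huv' : (v:ℝ) ≤ u := by exact_mod_cast huv
  have hu' : (u:ℝ) ≤ N := by exact_mod_cast hu
  have h' : ((u:ℝ) - v) * R ≤ N := by
    rw [← Nat.cast_sub huv]; exact_mod_cast h
  have hp : ∀ i : ℕ, ((u:ℝ) ^ i - v ^ i) * R ≤ i * N ^ i ∧ (0:ℝ) ≤ (u:ℝ) ^ i - v ^ i := by
    intro i
    constructor
    · induction i with
      | zero => simp
      | succ i ih =>
        calc ((u:ℝ) ^ (i + 1) - v ^ (i + 1)) * R = u * (((u:ℝ) ^ i - v ^ i) * R) + v ^ i * ((u - v) * R) := by ring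
          _ ≤ N * (i * N ^ i) + N ^ i * N := by
              gcongr
              · exact mul_nonneg (sub_nonneg.2 (pow_le_pow_left₀ (Nat.cast_nonneg _) huv' i)) (Nat.cast_nonneg _)
              · linarith
          _ = _ := by push_cast; ring
    · exact sub_nonneg.2 (pow_le_pow_left₀ (Nat.cast_nonneg _) huv' i)
  simp only [Polynomial.eval_eq_sum_range, one_pow, mul_one]
  push_cast
  rw [← sum_sub_distrib]
  constructor
  · rw [sum_mul, mul_sum, sum_mul]
    refine sum_le_sum fun i hi => ?_
    rw [mem_range] at hi
    calc _ = (Q.coeff i : ℝ) * (((u:ℝ) ^ i - v ^ i) * R) := by ring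
      _ ≤ Q.coeff i * (Q.natDegree * N ^ Q.natDegree) := by
          refine mul_le_mul_of_nonneg_left ((hp i).1.trans ?_) (Nat.cast_nonneg _)
          gcongr <;> first | exact hN' | omega
      _ = _ := by ring
  · refine sum_nonneg fun i _ => ?_
    rw [← mul_sub]; exact mul_nonneg (Nat.cast_nonneg _) (hp i).2

lemma HP_psi (Q : Polynomial ℕ) (N R l A : ℕ) (hN : 1 ≤ N) (hR : 0 < R) (β : ℝ) (hβ : |β| ≤ l ^ A / N ^ Q.natDegree) :
    HP N R (fun n => ee (β * (Q.eval n : ℕ))) (7 * (l ^ A * (Q.natDegree * (Q.eval 1 : ℕ)) / R)) := by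
  refine ⟨fun n => (norm_ee _).le, fun X n hX hn h => ?_⟩
  have hR' : (0:ℝ) < R := by exact_mod_cast hR
  have hN' : (0:ℝ) < N := by exact_mod_cast hN
  obtain ⟨h1, h2⟩ := Q_lip Q N R n X hN hX hn h
  refine (ee_lip _ _).trans ?_
  rw [← mul_sub, abs_mul, abs_of_nonneg h2]
  gcongr
  rw [← le_div_iff₀ hR'] at h1
  calc _ ≤ l ^ A / N ^ Q.natDegree * (Q.natDegree * (Q.eval 1 : ℕ) * N ^ Q.natDegree / R : ℝ) := by gcongr
    _ = _ := by field_simp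

lemma params (δ : ℝ) (hδ : 0 < δ) (hδ1 : δ ≤ 1 / 16) (e : ℕ) : ∃ l0 : ℕ, ∀ N l : ℕ, l0 ≤ l → 1 ≤ N → (l:ℝ) ≤ Real.log N + 1 →
    ∃ Z : ℕ, δ * l ≤ Real.log Z ∧ Real.log Z ≤ 2 * δ * l ∧ 4 * l ^ e ≤ Z ∧ l * (Z * Z) ≤ N ∧ 2 ≤ Z := by
  have h1 := (isLittleO_pow_exp_pos_mul_atTop e hδ).bound (by norm_num : (0:ℝ) < 1 / 8)
  have h2 := (isLittleO_pow_exp_pos_mul_atTop 1 (by norm_num : (0:ℝ) < 1 / 2)).bound (by norm_num : (0:ℝ) < 1 / 4)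
  have h3 : ∀ᶠ x : ℝ in atTop, 4 / δ ≤ x := eventually_ge_atTop _
  obtain ⟨l0, h⟩ := eventually_atTop.1 (tendsto_natCast_atTop_atTop.eventually ((h1.and h2).and h3))
  refine ⟨l0, fun N l hl hN hlN => ?_⟩
  obtain ⟨⟨h1, h2⟩, h3⟩ := h l hl
  rw [div_le_iff₀ hδ] at h3
  rw [Real.norm_of_nonneg (by positivity), Real.norm_of_nonneg (by positivity)] at h1 h2
  have hE : 4 ≤ Real.exp (δ * l) := by linarith [Real.add_one_le_exp (δ * l)]
  have hE2 : Real.exp (2 * δ * l) = Real.exp (δ * l) * Real.exp (δ * l) := by rw [← Real.exp_add]; ring_nf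
  obtain ⟨Z, hZ⟩ : ∃ Z, Z = ⌊Real.exp (2 * δ * l)⌋₊ := ⟨_, rfl⟩
  have hZ1 : (Z:ℝ) ≤ Real.exp (2 * δ * l) := by rw [hZ]; exact Nat.floor_le (by positivity)
  have hZ2 : Real.exp (δ * l) ≤ Z := by
    have := Nat.lt_floor_add_one (Real.exp (2 * δ * l))
    rw [← hZ] at this; nlinarith
  have hZ0 : (0:ℝ) < Z := by linarith
  refine ⟨Z, ?_, ?_, ?_, ?_, ?_⟩
  · rw [Real.le_log_iff_exp_le hZ0]; exact hZ2
  · rw [Real.log_le_iff_le_exp hZ0]; exact hZ1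
  · have : (4 * l ^ e : ℝ) ≤ Z := by
      have := Real.exp_pos (δ * l)
      linarith
    exact_mod_cast this
  · have hN0 : (0:ℝ) < N := by exact_mod_cast hN
    have h4 : Real.exp ((l:ℝ) - 1) ≤ N := by rw [← Real.le_log_iff_exp_le hN0]; linarith
    have h5 : (Z * Z : ℝ) ≤ Real.exp (l / 4) := by
      calc (Z * Z : ℝ) ≤ Real.exp (2 * δ * l) * Real.exp (2 * δ * l) := by gcongr
        _ = Real.exp (4 * δ * l) := by rw [← Real.exp_add]; ring_nf
        _ ≤ _ := by
          apply Real.exp_le_exp.2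
          nlinarith [(Nat.cast_nonneg l : (0:ℝ) ≤ l)]
    have h6 : (l * (Z * Z) : ℝ) ≤ N := by
      refine le_trans ?_ h4
      rw [pow_one] at h2
      calc (l * (Z * Z) : ℝ) ≤ 1 / 4 * Real.exp (1 / 2 * l) * Real.exp (l / 4) := by gcongr
        _ ≤ Real.exp (-1) * Real.exp (1 / 2 * l) * Real.exp (l / 2 ) := by
          have h7 : 1 / 4 ≤ Real.exp (-1) := by
            rw [Real.exp_neg, one_div]; gcongr; linarith [Real.exp_one_lt_d9]
          gcongr; norm_num
        _ = _ := by rw [← Real.exp_add, ← Real.exp_add]; ring_nf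
    exact_mod_cast h6
  · have : (2:ℝ) ≤ Z := by linarith
    exact_mod_cast this

end P6

section P6
open ArithmeticFunction

set_option maxHeartbeats 600000 in
lemma major (Q : Polynomial ℕ) (hQ : 0 < Q.natDegree) (A : ℕ) (ε : ℝ) (hε : 0 < ε) : ∃ q0 l0 : ℕ, ∀ N l q : ℕ, l0 ≤ l → 1 ≤ N → Real.log N ≤ l → (l:ℝ) ≤ Real.log N + 1 →
    q0 ≤ q → 0 < q → q ≤ l ^ A → ∀ a : ℤ, IsCoprime a (q:ℤ) → ∀ θ : ℝ, |θ - a / q| ≤ l ^ A / N ^ Q.natDegree →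
    ‖∑ n ∈ Ioc 0 N, (llm n : ℂ) * ee ((PQ θ Q).eval (n:ℝ))‖ ≤ ε * N * l := by
  wlog hε1 : ε ≤ 1 generalizing ε
  · obtain ⟨q0, l0, h⟩ := this 1 one_pos le_rfl
    refine ⟨q0, l0, fun N l q h1 h2 h3 h4 h5 h6 h7 a ha θ hθ => (h N l q h1 h2 h3 h4 h5 h6 h7 a ha θ hθ).trans ?_⟩
    push Not at hε1
    gcongr
  obtain ⟨δ, hδ⟩ : ∃ δ, δ = ε / 200 := ⟨_, rfl⟩
  have hδ0 : 0 < δ := by rw [hδ]; positivity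
  obtain ⟨η0, hη⟩ : ∃ η0, η0 = ε * δ ^ 2 / 10000000 := ⟨_, rfl⟩
  have hη0 : 0 < η0 := by rw [hη]; positivity
  have hηε : 151 * η0 ≤ ε / 100 := by
    have : ε * δ ^ 2 ≤ ε * 1 ^ 2 := by gcongr; rw [hδ]; linarith
    rw [hη]; linarith
  have hηδ : 69312 * η0 / δ ^ 2 ≤ ε / 100 := by
    rw [hη]; rw [div_le_iff₀ (by positivity)]; nlinarith [mul_pos hε (pow_pos hδ0 2)]
  obtain ⟨q1, hq1⟩ := qbil Q hQ η0 hη0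
  obtain ⟨q2, hq2⟩ := complete_sum Q hQ η0 hη0
  obtain ⟨l1, hl1⟩ := S2 A (A + 5) (ε / 10) (by positivity) (by linarith)
  obtain ⟨l2, hl2⟩ := params δ hδ0 (by linarith) (A + (A + 5) + 2 + A + (A + 5))
  obtain ⟨D, hD⟩ : ∃ D : ℝ, D = Q.natDegree * (Q.eval 1 : ℕ) := ⟨_, rfl⟩
  have hD0 : 0 ≤ D := by rw [hD]; positivity
  obtain ⟨l3, hl3⟩ := exists_nat_ge ((1000 + 60 * D) / ε)
  refine ⟨max q1 q2, max (max l1 l2) (max l3 2), fun N l q hl hN hlN hlN' hqq hq hqA a ha θ hθ => ?_⟩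
  simp only [max_le_iff] at hl hqq
  obtain ⟨Z, hZ1, hZ2, hZ3, hZ4, hZ5⟩ := hl2 N l hl.1.2 hN hlN'
  have hlr : (2:ℝ) ≤ l := by exact_mod_cast hl.2.2
  have hl10 : 1 ≤ l := by omega
  have hNr : (1:ℝ) ≤ N := by exact_mod_cast hN
  have hll : 1000 + 60 * D ≤ ε * l := by
    have : (1000 + 60 * D) / ε ≤ l := hl3.trans (by exact_mod_cast hl.2.1)
    rw [div_le_iff₀ hε] at this; linarith
  obtain ⟨R, hR⟩ : ∃ R, R = l ^ (A + 4) := ⟨_, rfl⟩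
  have hR0 : 0 < R := by rw [hR]; positivity
  have hRr : (0:ℝ) < R := by exact_mod_cast hR0
  have hRZ : R ≤ Z := by
    rw [hR]; refine le_trans ?_ hZ3
    calc l ^ (A + 4) ≤ l ^ (A + (A + 5) + 2 + A + (A + 5)) := Nat.pow_le_pow_right hl10 (by omega)
      _ ≤ _ := by omega
  have hZZ : Z * Z ≤ N := (Nat.le_mul_of_pos_left _ hl10).trans hZ4
  have hlZ : l * Z ≤ N := (Nat.mul_le_mul_left l (Nat.le_mul_of_pos_left Z (by omega))).trans hZ4
  have hZN : Z ≤ N := (Nat.le_mul_of_pos_left Z hl10).trans hlZ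
  have hl2R : (l:ℝ) ^ 2 ≤ R := by rw [hR]; push_cast; exact pow_le_pow_right₀ (by linarith) (by omega)
  have hS : HS N l q R Z (ε / 10) := by
    intro X hX hXN
    have hW1 : 1 ≤ X / R := Nat.div_pos (hRZ.trans hX) hR0
    have hWR : X / R * R ≤ X := Nat.div_mul_le_self X R
    refine hl1 l X (X / R) q hl.1.1 hl10 hq hqA ?_ ?_ (log_le_of X N l hXN hlN) (hZ3.trans hX)
    · refine le_trans ?_ hWR
      gcongr; exact_mod_cast hl2R
    · have h1 : X < (X / R + 1) * R := by rw [add_mul, one_mul]; exact Nat.lt_div_mul_add hR0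
      calc X ≤ (X / R + 1) * R := h1.le
        _ ≤ (X / R * 2) * R := by gcongr; omega
        _ = X / R * (2 * R) := by ring
        _ ≤ X / R * (l * R) := by gcongr; exact hl.2.2
        _ = _ := by rw [hR]; ring
  obtain ⟨ψ, hψ⟩ : ∃ ψ : ℕ → ℂ, ψ = fun n => ee ((θ - a / q) * (Q.eval n : ℕ)) := ⟨_, rfl⟩
  obtain ⟨η1, hη1⟩ : ∃ η1 : ℝ, η1 = 7 * (l ^ A * D / R) := ⟨_, rfl⟩
  have hη10 : 0 ≤ η1 := by rw [hη1]; positivity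
  have hη1' : l ^ 2 * η1 = 7 * D / l ^ 2 := by
    rw [hη1, hR]; push_cast; field_simp; ring
  have hDl : D * (2 * l) ≤ D * l ^ 2 := by rw [sq]; gcongr
  have hDl' : D * 2 ≤ D * l := by gcongr
  have hη2 : l ^ 2 * η1 ≤ 4 * D := by
    rw [hη1', div_le_iff₀ (by positivity)]; linarith
  have hη3 : l * (l ^ 2 * η1) ≤ 4 * D := by
    rw [hη1', mul_div_assoc', div_le_iff₀ (by positivity)]; linarith
  have hPsi : HP N R ψ η1 := by rw [hψ, hη1, hD]; exact HP_psi Q N R l A hN hR0 _ hθ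
  have hF : ∀ n : ℕ, ee ((PQ θ Q).eval (n:ℝ)) = gq a q Q n * ψ n := by
    intro n; rw [hψ, gq, ← ee_add, PQ_eval, PQ_eval]; congr 1; ring
  have T1 := type1 N l q R Z (ε / 10) η0 η1 hq hR0 hRZ hZN (by positivity) hη0.le hη10 hlN hS ψ hPsi a Q (hq2 q hqq.2 hq a ha)
  have T2 := type2 N l q R Z (ε / 10) δ η0 η1 hδ0 hη0.le hη10 hl10 hq hR0 hRZ hZ5 hZZ hlN hZ1 hS a Q ψ hPsi (hq1 q hqq.1 hq a ha)
  have T3 := noncop N l q hq hlN (fun n => gq a q Q n * ψ n) (fun n => by rw [norm_mul, gq_norm, one_mul]; exact hPsi.1 n)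
  have e : ∑ n ∈ Ioc 0 N, (llm n : ℂ) * ee ((PQ θ Q).eval (n:ℝ)) = ∑ n ∈ Ioc 0 N, (hh n : ℂ) * (if n.Coprime q then gq a q Q n * ψ n else 0)
      - ∑ n ∈ Ioc 0 N, ((Λ * Λ : ArithmeticFunction ℝ) n : ℂ) * (if n.Coprime q then gq a q Q n * ψ n else 0) + ∑ n ∈ Ioc 0 N, (llm n : ℂ) * (if n.Coprime q then 0 else gq a q Q n * ψ n) := by
    rw [← sum_sub_distrib, ← sum_add_distrib]
    refine sum_congr rfl fun n _ => ?_
    rw [hF, hh_apply]; split_ifs <;> push_cast <;> ring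
  rw [e]
  refine (norm_add_le _ _).trans ((add_le_add (norm_sub_le _ _) le_rfl).trans ?_)
  have hZr : (l:ℝ) * Z ≤ N := by exact_mod_cast hlZ
  have hRN : (R:ℝ) ≤ N := by exact_mod_cast hRZ.trans hZN
  have hRZr : (R:ℝ) ≤ Z := by exact_mod_cast hRZ
  have hlogZ : Real.log Z ≤ l := log_le_of Z N l hZN hlN
  have b1 : 36 * Z * (Real.log Z + 1) ≤ 72 * (N:ℝ) := by
    calc 36 * Z * (Real.log Z + 1) ≤ 36 * Z * (l + l) := by gcongr; linarith
      _ ≤ _ := by linarith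
  have b2 : N * (151 * η0 * l + ε / 10 * l + 2 * l ^ 2 * η1) ≤ N * (ε / 100 * l + ε / 10 * l + 8 * D) := by
    have : 151 * η0 * l ≤ ε / 100 * l := by gcongr
    exact mul_le_mul_of_nonneg_left (by linarith) (by linarith)
  have b3 : (l:ℝ) ^ 2 / R ≤ 1 := div_le_one_of_le₀ hl2R hRr.le
  have b4 : (N / R + 1) * (2 * (l:ℝ) ^ 2) ≤ 4 * N := by
    have : (N / R : ℝ) * l ^ 2 = N * (l ^ 2 / R) := by ring
    have : (N:ℝ) * (l ^ 2 / R) ≤ N * 1 := by gcongr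
    linarith
  have b5 : 12 * N * (Real.log Z + 6) ≤ 12 * N * (2 * δ * l + 6) := by gcongr
  have b6 : (l:ℝ) * (l ^ 2 / R) ≤ 1 := by
    rw [hR, mul_div_assoc']; apply div_le_one_of_le₀ _ (by positivity)
    push_cast
    rw [← pow_succ']; exact pow_le_pow_right₀ (by linarith) (by omega)
  have b7 : N * (1 + Real.log N) * (l ^ 2 / R + l ^ 2 * η1 + 69312 * η0 / δ ^ 2) ≤ N * (2 + 8 * D + 2 * l * (ε / 100)) := by
    calc N * (1 + Real.log N) * (l ^ 2 / R + l ^ 2 * η1 + 69312 * η0 / δ ^ 2) ≤ N * (2 * l) * (l ^ 2 / R + l ^ 2 * η1 + ε / 100) := by gcongr; linarith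
      _ = N * (2 * (l * (l ^ 2 / R)) + 2 * (l * (l ^ 2 * η1)) + 2 * l * (ε / 100)) := by ring
      _ ≤ _ := mul_le_mul_of_nonneg_left (by linarith) (by linarith)
  have b8 : (N / Z + 1) * (l:ℝ) ^ 2 ≤ 2 * N := by
    have : (N / Z : ℝ) * l ^ 2 ≤ N / R * l ^ 2 := by gcongr
    have : (N / R : ℝ) * l ^ 2 = N * (l ^ 2 / R) := by ring
    have : (N:ℝ) * (l ^ 2 / R) ≤ N * 1 := by gcongr
    linarith
  have b9 : (N / R : ℝ) * l ^ 2 ≤ N := by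
    have : (N / R : ℝ) * l ^ 2 = N * (l ^ 2 / R) := by ring
    have : (N:ℝ) * (l ^ 2 / R) ≤ N * 1 := by gcongr
    linarith
  have b10 : ((q:ℝ) + 1) * (2 * l + 1) * l ^ 2 ≤ 6 * N := by
    have hqr : (q:ℝ) ≤ (l:ℝ) ^ A := by exact_mod_cast hqA
    have h1l : (1:ℝ) ≤ (l:ℝ) ^ A := one_le_pow₀ (by linarith)
    calc ((q:ℝ) + 1) * (2 * l + 1) * l ^ 2 ≤ ((l:ℝ) ^ A + (l:ℝ) ^ A) * (2 * l + l) * l ^ 2 := by gcongr; linarith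
      _ = 6 * (l:ℝ) ^ (A + 3) := by ring
      _ ≤ 6 * R := by rw [hR]; push_cast; gcongr; linarith; omega
      _ ≤ _ := by linarith
  have b11 : N * (1000 + 60 * D) ≤ N * (ε * l) := by gcongr
  have b12 : 24 * N * δ * l = N * (24 / 200 * (ε * l)) := by rw [hδ]; ring
  have b13 : 0 ≤ N * D := by positivity
  linarith

end P6

section P6
open ArithmeticFunction

lemma l_small (A : ℕ) (c : ℝ) (hc : 0 < c) : ∃ l0 : ℕ, ∀ N l : ℕ, l0 ≤ l → 1 ≤ N → (l:ℝ) ≤ Real.log N + 1 → (l:ℝ) ^ A ≤ c * N := by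
  have h1 := (isLittleO_pow_exp_pos_mul_atTop A one_pos).bound (by positivity : 0 < c / 3)
  obtain ⟨l0, h⟩ := eventually_atTop.1 (tendsto_natCast_atTop_atTop.eventually h1)
  refine ⟨l0, fun N l hl hN hlN => ?_⟩
  have h := h l hl
  have hN0 : (0:ℝ) < N := by exact_mod_cast hN
  rw [Real.norm_of_nonneg (by positivity), Real.norm_of_nonneg (by positivity), one_mul] at h
  have h4 : Real.exp (l:ℝ) ≤ 3 * N := by
    calc Real.exp (l:ℝ) ≤ Real.exp (Real.log N + 1) := Real.exp_le_exp.2 hlN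
      _ = N * Real.exp 1 := by rw [Real.exp_add, Real.exp_log hN0]
      _ ≤ 3 * N := by nlinarith [Real.exp_one_lt_d9]
  calc _ ≤ _ := h
    _ ≤ c / 3 * (3 * N) := by gcongr
    _ = _ := by ring

lemma irr_away (θ : ℝ) (hθ : Irrational θ) (q0 : ℕ) : ∃ c : ℝ, 0 < c ∧ ∀ q : ℕ, q < q0 → 0 < q → ∀ a : ℤ, c < |θ - a / q| := by
  induction q0 with
  | zero => exact ⟨1, one_pos, fun q hq => by omega⟩
  | succ n ih =>
    obtain ⟨c, hc, h⟩ := ih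
    rcases Nat.eq_zero_or_pos n with rfl | hn
    · exact ⟨1, one_pos, fun q hq => by omega⟩
    have hn' : (0:ℝ) < n := by exact_mod_cast hn
    have hd : 0 < |(n:ℝ) * θ - round ((n:ℝ) * θ)| := abs_pos.2 (sub_ne_zero.2 ((hθ.natCast_mul hn.ne').ne_int _))
    refine ⟨min c (|(n:ℝ) * θ - round ((n:ℝ) * θ)| / (2 * n)), lt_min hc (by positivity), fun q hq hq0 a => ?_⟩
    rcases Nat.lt_succ_iff_lt_or_eq.1 hq with h1 | rfl
    · exact (min_le_left _ _).trans_lt (h q h1 hq0 a)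
    · refine (min_le_right _ _).trans_lt ?_
      have h2 := round_le ((q:ℝ) * θ) a
      have h3 : |(q:ℝ) * θ - a| = q * |θ - a / q| := by
        rw [← abs_of_pos hn', ← abs_mul, abs_of_pos hn']; congr 1; field_simp
      rw [div_lt_iff₀ (by positivity)]
      linarith

lemma irr_llm (Q : Polynomial ℕ) (hQ : 0 < Q.natDegree) (θ : ℝ) (hθ : Irrational θ) (ε : ℝ) (hε : 0 < ε) : ∃ N0 : ℕ, ∀ N, N0 ≤ N →
    ‖∑ n ∈ Ioc 0 N, (llm n : ℂ) * ee (θ * (Q.eval n : ℕ))‖ ≤ ε * N * Real.log N := by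
  have hc0 : 0 < Q.leadingCoeff := by
    rw [Nat.pos_iff_ne_zero, Polynomial.leadingCoeff_ne_zero]; rintro rfl; simp at hQ
  obtain ⟨A, B, hA⟩ := minor Q.natDegree Q.leadingCoeff hQ hc0
  obtain ⟨l1, hm⟩ := hA A le_rfl
  obtain ⟨q0, l2, hM⟩ := major Q hQ A (ε / 2) (by positivity)
  obtain ⟨c, hc, hir⟩ := irr_away θ hθ q0
  obtain ⟨l3, hs1⟩ := l_small A c hc
  obtain ⟨l4, hs2⟩ := l_small A 1 one_pos
  obtain ⟨l5, hs3⟩ := logpow_small (110 * (1 + B)) 3 (ε / 2) (by positivity)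
  obtain ⟨M, hMl⟩ : ∃ M, M = l1 + l2 + l3 + l4 + l5 + 2 := ⟨_, rfl⟩
  have hev : ∀ᶠ N : ℕ in atTop, (M:ℝ) ≤ Real.log N := (Real.tendsto_log_atTop.comp tendsto_natCast_atTop_atTop).eventually_ge_atTop _
  obtain ⟨N0, hN0⟩ := eventually_atTop.1 hev
  refine ⟨N0 + 1, fun N hN => ?_⟩
  have hN1 : 1 ≤ N := by omega
  have hlog := hN0 N (by omega)
  obtain ⟨l, hl⟩ : ∃ l, l = ⌈Real.log N⌉₊ := ⟨_, rfl⟩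
  have hl1 : Real.log N ≤ l := by rw [hl]; exact Nat.le_ceil _
  have hl2 : (l:ℝ) ≤ Real.log N + 1 := by rw [hl]; exact (Nat.ceil_lt_add_one (Real.log_natCast_nonneg N)).le
  have hMle : M ≤ l := by exact_mod_cast hlog.trans hl1
  have hMr : (2:ℝ) ≤ M := by rw [hMl]; push_cast; linarith [(Nat.cast_nonneg l1 : (0:ℝ) ≤ l1), (Nat.cast_nonneg l2 : (0:ℝ) ≤ l2), (Nat.cast_nonneg l3 : (0:ℝ) ≤ l3), (Nat.cast_nonneg l4 : (0:ℝ) ≤ l4), (Nat.cast_nonneg l5 : (0:ℝ) ≤ l5)]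
  have hNr : (1:ℝ) ≤ N := by exact_mod_cast hN1
  simp only [← PQ_eval]
  suffices h : ‖∑ n ∈ Ioc 0 N, (llm n : ℂ) * ee ((PQ θ Q).eval (n:ℝ))‖ ≤ ε / 2 * N * l by
    refine h.trans ?_
    calc ε / 2 * N * l ≤ ε / 2 * N * (2 * Real.log N) := by gcongr; linarith
      _ = _ := by ring
  have hlA : 0 < l ^ A := Nat.pow_pos (by omega)
  have hlAr : (0:ℝ) < (l:ℝ) ^ A := by exact_mod_cast hlA
  have hNk : (N:ℝ) ≤ (N:ℝ) ^ Q.natDegree := le_self_pow₀ hNr (by omega)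
  have hlN : l ^ A ≤ N ^ Q.natDegree := by
    have := hs2 N l (by omega) hN1 hl2
    exact_mod_cast (by linarith : (l:ℝ) ^ A ≤ (N:ℝ) ^ Q.natDegree)
  obtain ⟨n, hn⟩ : ∃ n, n = N ^ Q.natDegree / l ^ A := ⟨_, rfl⟩
  have hn0 : 0 < n := by rw [hn]; exact Nat.div_pos hlN hlA
  obtain ⟨r, hr1, hr2⟩ := Real.exists_rat_abs_sub_le_and_den_le θ hn0
  obtain ⟨q, hq⟩ : ∃ q, q = r.den := ⟨_, rfl⟩
  obtain ⟨a, ha⟩ : ∃ a, a = r.num := ⟨_, rfl⟩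
  have hraq : (r:ℝ) = a / q := by rw [ha, hq]; exact Rat.cast_def r
  have hcop : IsCoprime a (q:ℤ) := by rw [ha, hq, Int.isCoprime_iff_gcd_eq_one]; exact r.reduced
  have hqp : 0 < q := by rw [hq]; exact r.den_pos
  rw [hraq, ← hq] at hr1
  rw [← hq] at hr2
  have hq1 : (1:ℝ) ≤ q := by exact_mod_cast hqp
  have hnN : (N:ℝ) ^ Q.natDegree / (l:ℝ) ^ A ≤ n + 1 := by
    have := natdiv_ge (N ^ Q.natDegree) (l ^ A)
    rw [← hn] at this; push_cast at this; linarith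
  by_cases hql : l ^ A ≤ q
  · have hb := hm N l q (by omega) (by omega) hl1 hql ?_ a hcop θ ?_ (PQ θ Q) (PQ_deg _ _) (PQ_coeff _ _)
    · refine hb.trans ?_
      have h1 := hs3 l (by omega)
      have hll : 0 ≤ Real.log l := Real.log_natCast_nonneg l
      have hB : (0:ℝ) ≤ B := Nat.cast_nonneg B
      calc 110 * N * (1 + B * Real.log l) ^ 3 ≤ 110 * N * ((1 + B) * (1 + Real.log l)) ^ 3 := by gcongr; nlinarith
        _ ≤ N * (110 * (1 + B) * (1 + Real.log l)) ^ 3 := by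
            have : 0 ≤ N * ((1 + B) * (1 + Real.log l)) ^ 3 := by positivity
            linarith
        _ ≤ N * (ε / 2 * l) := by gcongr
        _ = _ := by ring
    · rw [hn] at hr2; exact (Nat.le_div_iff_mul_le hlA).1 hr2
    · refine hr1.trans ?_
      have : (q:ℝ) ≤ n + 1 := by exact_mod_cast hr2.trans (Nat.le_succ n)
      rw [sq]; gcongr
  · push Not at hql
    have hb : |θ - a / q| ≤ (l:ℝ) ^ A / N ^ Q.natDegree := by
      refine hr1.trans ?_
      calc 1 / (((n:ℝ) + 1) * q) ≤ 1 / ((N:ℝ) ^ Q.natDegree / (l:ℝ) ^ A * 1) := by gcongr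
        _ = _ := by field_simp
    refine hM N l q (by omega) hN1 hl1 hl2 ?_ hqp hql.le a hcop θ hb
    by_contra! hlt
    have h1 := hir q hlt hqp a
    have h2 := hs1 N l (by omega) hN1 hl2
    have h3 : (l:ℝ) ^ A / N ^ Q.natDegree ≤ c := by
      rw [div_le_iff₀ (by positivity)]
      exact h2.trans (by gcongr)
    linarith

end P6

section P7
open MeasureTheory

noncomputable def KK (v : ℝ) : ℝ := Real.sinc (v/2)^2

lemma KK_cont : Continuous KK := by
  have := Real.continuous_sinc; unfold KK; fun_prop

lemma KK_nonneg (v : ℝ) : 0 ≤ KK v := sq_nonneg _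

lemma KK_sq (v : ℝ) : v^2 * KK v = 2 * (1 - Real.cos v) := by
  by_cases hv : v = 0
  · simp [hv]
  have h := Real.cos_sq (v/2)
  have h2 := Real.sin_sq_add_cos_sq (v/2)
  rw [show 2*(v/2) = v by ring] at h
  unfold KK
  rw [Real.sinc_of_ne_zero (by simpa using hv)]
  field_simp
  linarith

lemma KK_le (v : ℝ) : KK v ≤ 5 * (1+v^2)⁻¹ := by
  have h1 : KK v ≤ 1 := by
    unfold KK; rw [← sq_abs]
    exact pow_le_one₀ (abs_nonneg _) (Real.abs_sinc_le_one _)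
  have h2 := KK_sq v
  have h3 := Real.neg_one_le_cos v
  rw [← div_eq_mul_inv, le_div_iff₀ (by positivity)]
  linarith

lemma KK_int : Integrable KK := by
  refine (integrable_inv_one_add_sq.const_mul 5).mono' KK_cont.aestronglyMeasurable (ae_of_all _ fun v => ?_)
  rw [Real.norm_of_nonneg (KK_nonneg v)]; exact KK_le v

lemma KK_pos : 0 < ∫ v, KK v := by
  rw [integral_pos_iff_support_of_nonneg KK_nonneg KK_int]
  refine IsOpen.measure_pos _ KK_cont.isOpen_support ⟨0, ?_⟩
  simp [KK]

lemma KK_eq (v : ℝ) : KK v = ∫ t in (0:ℝ)..1, 2*(1-t) * Real.cos (t*v) := by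
  by_cases hv : v = 0
  · subst hv
    simp only [KK, mul_zero, Real.cos_zero, mul_one, zero_div, Real.sinc_zero, one_pow]
    rw [intervalIntegral.integral_eq_sub_of_hasDerivAt (f := fun t => 2*t - t^2)]
    · norm_num
    · intro x _
      refine (((hasDerivAt_id' x).const_mul 2).sub ((hasDerivAt_pow 2 x))).congr_deriv ?_
      push_cast; ring
    · apply Continuous.intervalIntegrable; fun_prop
  · have h := KK_sq v
    rw [intervalIntegral.integral_eq_sub_of_hasDerivAt
      (f := fun t => 2*((1-t)*(Real.sin (t*v)/v)) - 2*(Real.cos (t*v)/v^2))]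
    · simp; field_simp; linarith
    · intro x _
      have h0 : HasDerivAt (fun t:ℝ => t*v) v x := by simpa using (hasDerivAt_id x).mul_const v
      have h1 := ((((hasDerivAt_id x).const_sub 1).mul (h0.sin.div_const v)).const_mul 2).sub ((h0.cos.div_const (v^2)).const_mul 2)
      refine h1.congr_deriv ?_
      simp only [id]; field_simp; ring
    · apply Continuous.intervalIntegrable; fun_prop

lemma wi_fub (f : ℝ → ℝ) (hf : Measurable f) (C : ℝ) (hC : ∀ u, |f u| ≤ C) (σ : ℝ) (hσ : 0 < σ)
    (g : ℂ → ℂ) (hg : ∀ s : ℂ, 0 < s.re → ∫ u in Set.Ioi (0:ℝ), (f u : ℂ) * Complex.exp (-s * u) = g s)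
    (l y : ℝ) :
    ∫ u in Set.Ioi (0:ℝ), (f u * Real.exp (-σ*u)) * KK (l*(y-u)) =
     ∫ t in (0:ℝ)..1, 2*(1-t) * (Complex.exp ((l*t*y:ℝ)*Complex.I) * g (σ + (l*t:ℝ)*Complex.I)).re := by
  have hE : IntegrableOn (fun u => C * Real.exp (-σ*u)) (Set.Ioi 0) :=
    (integrableOn_exp_mul_Ioi (by linarith : -σ < 0) 0).const_mul C
  have h1 : ∀ u, (f u * Real.exp (-σ*u)) * KK (l*(y-u)) =
      ∫ t in Set.Ioc (0:ℝ) 1, (f u * Real.exp (-σ*u)) * (2*(1-t) * Real.cos (t*(l*(y-u)))) := by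
    intro u
    rw [KK_eq, intervalIntegral.integral_of_le zero_le_one, integral_const_mul]
  simp_rw [h1]
  rw [integral_integral_swap, intervalIntegral.integral_of_le zero_le_one]
  · refine integral_congr_ae (ae_of_all _ fun t => ?_)
    simp only
    have hre : 0 < ((σ:ℂ) + (l*t:ℝ)*Complex.I).re := by simpa using hσ
    rw [← hg _ hre, ← integral_const_mul]
    have hi : IntegrableOn (fun u:ℝ => Complex.exp ((l*t*y:ℝ)*Complex.I) * ((f u:ℂ) * Complex.exp (-((σ:ℂ) + (l*t:ℝ)*Complex.I) * u))) (Set.Ioi 0) := by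
      refine hE.mono' (by fun_prop) (ae_of_all _ fun u => ?_)
      rw [norm_mul, norm_mul, Complex.norm_exp_ofReal_mul_I, Complex.norm_exp, one_mul, Complex.norm_real]
      simp only [Complex.mul_re, Complex.neg_re, Complex.add_re, Complex.ofReal_re, Complex.I_re, Complex.ofReal_im, Complex.I_im, mul_zero, mul_one, sub_zero, zero_mul, add_zero]
      exact mul_le_mul_of_nonneg_right (hC u) (Real.exp_pos _).le
    have := integral_re hi
    simp only [RCLike.re_to_complex] at this
    rw [← this, ← integral_const_mul]
    refine integral_congr_ae (ae_of_all _ fun u => ?_)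
    simp only
    have : Complex.exp ((l*t*y:ℝ)*Complex.I) * ((f u:ℂ) * Complex.exp (-((σ:ℂ) + (l*t:ℝ)*Complex.I) * u)) = ((f u * Real.exp (-σ*u) : ℝ):ℂ) * Complex.exp ((t*(l*(y-u)):ℝ)*Complex.I) := by
      push_cast
      rw [mul_left_comm, ← Complex.exp_add, mul_assoc (f u : ℂ), ← Complex.exp_add]
      ring_nf
    rw [this, Complex.re_ofReal_mul, Complex.exp_ofReal_mul_I_re]; ring
  · have h2 : Integrable (fun _ : ℝ => (2:ℝ)) (volume.restrict (Set.Ioc (0:ℝ) 1)) := by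
      exact integrable_const _
    refine (hE.mul_prod h2).mono' (by unfold Function.uncurry; fun_prop) ?_
    have : ∀ᵐ z : ℝ × ℝ ∂((volume.restrict (Set.Ioi (0:ℝ))).prod (volume.restrict (Set.Ioc (0:ℝ) 1))), z.2 ∈ Set.Ioc (0:ℝ) 1 := by
      apply Measure.quasiMeasurePreserving_snd.ae
      exact ae_restrict_mem measurableSet_Ioc
    filter_upwards [this] with z hz
    simp only [Function.uncurry, norm_mul, Real.norm_eq_abs]
    have h3 : |1-z.2| ≤ 1 := by rw [abs_le]; constructor <;> linarith [hz.1, hz.2]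
    have h4 := Real.abs_cos_le_one (z.2*(l*(y-z.1)))
    rw [Real.abs_exp]
    have h5 := hC z.1
    have h6 : |(2:ℝ)| = 2 := by norm_num
    rw [h6]
    have h7 : |1-z.2| * |Real.cos (z.2*(l*(y-z.1)))| ≤ 1 := mul_le_one₀ h3 (abs_nonneg _) h4
    calc |f z.1| * Real.exp (-σ*z.1) * (2 * |1-z.2| * |Real.cos (z.2*(l*(y-z.1)))|)
        = |f z.1| * Real.exp (-σ*z.1) * (2 * (|1-z.2| * |Real.cos (z.2*(l*(y-z.1)))|)) := by ring
      _ ≤ C * Real.exp (-σ*z.1) * (2 * 1) := by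
          have : 0 ≤ C := (abs_nonneg _).trans h5
          gcongr
      _ = _ := by ring

lemma wi_lim (f : ℝ → ℝ) (hf : Measurable f) (C : ℝ) (hC : ∀ u, |f u| ≤ C)
    (g : ℂ → ℂ) (hg : ∀ s : ℂ, 0 < s.re → ∫ u in Set.Ioi (0:ℝ), (f u : ℂ) * Complex.exp (-s * u) = g s)
    (hgc : ContinuousOn g {s | 0 ≤ s.re}) (l : ℝ) (hl : 0 < l) :
    Tendsto (fun y => ∫ u in Set.Ioi (0:ℝ), f u * KK (l*(y-u))) atTop (nhds 0) := by
  have hG : Continuous fun z : ℝ × ℝ => g ((max z.1 0 : ℝ) + (l*z.2:ℝ)*Complex.I) := by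
    refine hgc.comp_continuous (by fun_prop) ?_
    intro z; simp
  have hKi : ∀ y, Integrable fun u => KK (l*(y-u)) := by
    intro y
    exact (KK_int.comp_mul_left' hl.ne').comp_sub_left y
  have key : ∀ y, ∫ u in Set.Ioi (0:ℝ), f u * KK (l*(y-u)) =
      ∫ t in (0:ℝ)..1, 2*(1-t) * (Complex.exp ((l*t*y:ℝ)*Complex.I) * g ((l*t:ℝ)*Complex.I)).re := by
    intro y
    have c1 : Continuous fun σ : ℝ => ∫ t in (0:ℝ)..1, 2*(1-t) * (Complex.exp ((l*t*y:ℝ)*Complex.I) * g ((max σ 0 : ℝ) + (l*t:ℝ)*Complex.I)).re := by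
      apply intervalIntegral.continuous_parametric_intervalIntegral_of_continuous'
      unfold Function.uncurry
      have : Continuous fun z : ℝ × ℝ => (Complex.exp ((l*z.2*y:ℝ)*Complex.I) * g ((max z.1 0 : ℝ) + (l*z.2:ℝ)*Complex.I)).re :=
        Complex.continuous_re.comp (Continuous.mul (by fun_prop) hG)
      fun_prop
    have t1 := (c1.tendsto 0).mono_left (nhdsWithin_le_nhds (s := Set.Ioi 0))
    have t2 : Tendsto (fun σ : ℝ => ∫ u in Set.Ioi (0:ℝ), (f u * Real.exp (-σ*u)) * KK (l*(y-u))) (nhdsWithin 0 (Set.Ioi 0)) (nhds (∫ u in Set.Ioi (0:ℝ), f u * KK (l*(y-u)))) := by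
      refine tendsto_integral_filter_of_dominated_convergence (fun u => C * KK (l*(y-u))) ?_ ?_ ((hKi y).const_mul C).integrableOn ?_
      · have := KK_cont
        exact Eventually.of_forall fun σ => by fun_prop
      · filter_upwards [self_mem_nhdsWithin] with σ hσ
        filter_upwards [ae_restrict_mem measurableSet_Ioi] with u hu
        rw [norm_mul, norm_mul, Real.norm_eq_abs, Real.norm_eq_abs, Real.abs_exp, Real.norm_of_nonneg (KK_nonneg _)]
        have : Real.exp (-σ*u) ≤ 1 := by
          rw [Real.exp_le_one_iff]
          have : 0 < σ*u := mul_pos hσ hu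
          linarith
        have h0 : |f u| * Real.exp (-σ*u) ≤ C * 1 := mul_le_mul (hC u) this (Real.exp_pos _).le ((abs_nonneg _).trans (hC u))
        rw [mul_one] at h0
        exact mul_le_mul_of_nonneg_right h0 (KK_nonneg _)
      · refine ae_of_all _ fun u => ?_
        have : Continuous fun σ : ℝ => f u * Real.exp (-σ*u) * KK (l*(y-u)) := by fun_prop
        have := (this.tendsto 0).mono_left (nhdsWithin_le_nhds (s := Set.Ioi 0))
        simpa using this
    have t3 := tendsto_nhds_unique t2 (t1.congr' ?_)
    · simpa using t3
    filter_upwards [self_mem_nhdsWithin] with σ hσ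
    rw [wi_fub f hf C hC σ hσ g hg, max_eq_left (le_of_lt hσ)]
  simp_rw [key]
  obtain ⟨φ, hφ⟩ : ∃ φ : ℝ → ℂ, φ = (Set.Ioc (0:ℝ) 1).indicator fun t => ((2*(1-t):ℝ):ℂ) * g ((l*t:ℝ)*Complex.I) := ⟨_, rfl⟩
  have hRL := Real.tendsto_integral_exp_smul_cocompact φ
  have hy : Tendsto (fun y : ℝ => -(l/(2*Real.pi))*y) atTop (cocompact ℝ) := by
    refine Tendsto.mono_right ?_ atBot_le_cocompact
    apply Tendsto.const_mul_atTop_of_neg _ tendsto_id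
    have : 0 < l/(2*Real.pi) := by positivity
    linarith
  have h3 := Complex.continuous_re.tendsto 0 |>.comp (hRL.comp hy)
  simp only [Complex.zero_re] at h3
  refine h3.congr fun y => ?_
  simp only [Function.comp]
  have hc : Continuous fun t : ℝ => g ((l*t:ℝ)*Complex.I) := by
    have := hG.comp (show Continuous fun t : ℝ => ((0:ℝ),t) by fun_prop)
    simpa [Function.comp_def] using this
  have e1 : ∀ v : ℝ, Real.fourierChar (-(v * (-(l/(2*Real.pi))*y))) • φ v = (Set.Ioc (0:ℝ) 1).indicator (fun t => Complex.exp ((l*t*y:ℝ)*Complex.I) * (((2*(1-t):ℝ):ℂ) * g ((l*t:ℝ)*Complex.I))) v := by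
    intro v
    rw [hφ]
    by_cases hv : v ∈ Set.Ioc (0:ℝ) 1
    · rw [Set.indicator_of_mem hv, Set.indicator_of_mem hv, Circle.smul_def, Real.fourierChar_apply, smul_eq_mul]
      congr 3
      push_cast
      have : (Real.pi:ℂ) ≠ 0 := by exact_mod_cast Real.pi_ne_zero
      field_simp
    · rw [Set.indicator_of_notMem hv, Set.indicator_of_notMem hv, smul_zero]
  simp_rw [e1]
  rw [integral_indicator measurableSet_Ioc, intervalIntegral.integral_of_le zero_le_one]
  have hi : IntegrableOn (fun t : ℝ => Complex.exp ((l*t*y:ℝ)*Complex.I) * (((2*(1-t):ℝ):ℂ) * g ((l*t:ℝ)*Complex.I))) (Set.Ioc 0 1) := by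
    refine (Continuous.integrableOn_Icc ?_).mono_set Set.Ioc_subset_Icc_self
    exact Continuous.mul (by fun_prop) (Continuous.mul (by fun_prop) hc)
  have := integral_re hi
  simp only [RCLike.re_to_complex] at this
  rw [← this]
  refine integral_congr_ae (ae_of_all _ fun t => ?_)
  simp only
  rw [mul_left_comm, Complex.re_ofReal_mul]

end P7

section P7
open MeasureTheory

lemma KK_tail (η : ℝ) (hη : 0 < η) : ∃ M : ℝ, 0 < M ∧ ∫ w, {w : ℝ | M < |w|}.indicator KK w ≤ η := by
  have hm : ∀ M : ℝ, MeasurableSet {w : ℝ | M < |w|} := fun M => measurableSet_lt (by fun_prop) (by fun_prop)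
  have h : Tendsto (fun M : ℝ => ∫ w, {w : ℝ | M < |w|}.indicator KK w) atTop (nhds (∫ _ : ℝ, (0:ℝ))) := by
    refine tendsto_integral_filter_of_dominated_convergence KK ?_ ?_ KK_int ?_
    · exact Eventually.of_forall fun M => (KK_int.indicator (hm M)).aestronglyMeasurable
    · refine Eventually.of_forall fun M => ae_of_all _ fun w => ?_
      exact (norm_indicator_le_norm_self _ _).trans (by rw [Real.norm_of_nonneg (KK_nonneg w)])
    · refine ae_of_all _ fun w => tendsto_const_nhds.congr' ?_
      filter_upwards [eventually_ge_atTop |w|] with M hM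
      rw [Set.indicator_of_notMem]
      simpa using hM
  rw [integral_zero] at h
  obtain ⟨M, h1, h2⟩ := ((h.eventually_le_const hη).and (eventually_gt_atTop 0)).exists
  exact ⟨M, h2, h1⟩

lemma int_scale (G : ℝ → ℝ) (l y : ℝ) (hl : 0 < l) : ∫ u, G (l*(y-u)) = l⁻¹ * ∫ w, G w := by
  rw [integral_sub_left_eq_self (fun u => G (l*u)) volume y, Measure.integral_comp_mul_left,
    abs_of_pos (by positivity), smul_eq_mul]

lemma wi_taub (β : ℝ → ℝ) (hβ : Measurable β) (C A : ℝ) (h0 : ∀ u, 0 ≤ β u) (hC : ∀ u, β u ≤ C)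
    (hA0 : 0 ≤ A) (hA : A ≤ C) (hmono : ∀ y v, 0 ≤ v → β y * Real.exp (-v) ≤ β (y+v))
    (g : ℂ → ℂ) (hg : ∀ s : ℂ, 0 < s.re → ∫ u in Set.Ioi (0:ℝ), ((β u - A : ℝ) : ℂ) * Complex.exp (-s * u) = g s)
    (hgc : ContinuousOn g {s | 0 ≤ s.re}) : Tendsto β atTop (nhds A) := by
  have hC0 : 0 ≤ C := hA0.trans hA
  have habs : ∀ u, |β u - A| ≤ C := fun u => by
    rw [abs_le]; constructor <;> linarith [h0 u, hC u]
  have hκ := KK_pos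
  obtain ⟨κ, hκe⟩ : ∃ κ, κ = ∫ v, KK v := ⟨_, rfl⟩
  rw [← hκe] at hκ
  rw [Metric.tendsto_atTop]
  intro δ hδ
  obtain ⟨h, hh0, hh⟩ : ∃ h : ℝ, 0 < h ∧ C * (2*h) ≤ δ/4 := by
    refine ⟨δ/(8*(C+1)), by positivity, ?_⟩
    rw [mul_div_assoc', mul_div_assoc', div_le_iff₀ (by positivity)]
    nlinarith
  obtain ⟨M, hM0, hM⟩ := KK_tail (κ * (δ/(8*(C+1)))) (by positivity)
  obtain ⟨τ, hτ⟩ : ∃ τ, τ = ∫ w, {w : ℝ | M < |w|}.indicator KK w := ⟨_, rfl⟩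
  rw [← hτ] at hM
  have hMτ : 2*C*τ ≤ κ * (δ/4) := by
    have : 2*C*τ ≤ 2*(C+1)*(κ * (δ/(8*(C+1)))) := by
      have h1 : 2*C*τ ≤ 2*C*(κ * (δ/(8*(C+1)))) := mul_le_mul_of_nonneg_left hM (by positivity)
      refine h1.trans (mul_le_mul_of_nonneg_right (by linarith) (by positivity))
    refine this.trans (le_of_eq ?_)
    field_simp; norm_num
  obtain ⟨l, hl⟩ : ∃ l, l = M/h := ⟨_, rfl⟩
  have hl0 : 0 < l := by rw [hl]; positivity
  have hlim := wi_lim (fun u => β u - A) (by fun_prop) C habs g hg hgc l hl0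
  obtain ⟨Y, hY⟩ := (Metric.tendsto_atTop.1 hlim) (l⁻¹ * (κ * (δ/4))) (by positivity)
  obtain ⟨J, hJ⟩ : ∃ J : ℝ → ℝ, J = fun y => ∫ u, (Set.Ioi (0:ℝ)).indicator (fun u => β u - A) u * KK (l*(y-u)) := ⟨_, rfl⟩
  have hJb : ∀ y, Y ≤ y → |J y| ≤ l⁻¹ * (κ * (δ/4)) := by
    intro y hy
    have := hY y hy
    rw [Real.dist_eq, sub_zero] at this
    refine le_of_eq_of_le (congrArg _ ?_) this.le
    rw [hJ, ← integral_indicator measurableSet_Ioi]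
    refine integral_congr_ae (ae_of_all _ fun u => ?_)
    simp only
    by_cases hu : u ∈ Set.Ioi (0:ℝ)
    · rw [Set.indicator_of_mem hu, Set.indicator_of_mem hu]
    · rw [Set.indicator_of_notMem hu, Set.indicator_of_notMem hu, zero_mul]
  have hm : MeasurableSet {w : ℝ | M < |w|} := measurableSet_lt (by fun_prop) (by fun_prop)
  have hKi : ∀ y, Integrable fun u => KK (l*(y-u)) := fun y =>
    (KK_int.comp_mul_left' hl0.ne').comp_sub_left y
  have hTi : ∀ y, Integrable fun u => {w : ℝ | M < |w|}.indicator KK (l*(y-u)) := fun y =>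
    ((KK_int.indicator hm).comp_mul_left' hl0.ne').comp_sub_left y
  have hF : ∀ u, |(Set.Ioi (0:ℝ)).indicator (fun u => β u - A) u| ≤ C := by
    intro u
    by_cases hu : u ∈ Set.Ioi (0:ℝ)
    · rw [Set.indicator_of_mem hu]; exact habs u
    · rw [Set.indicator_of_notMem hu, abs_zero]; exact hC0
  have hJi : ∀ y, Integrable fun u => (Set.Ioi (0:ℝ)).indicator (fun u => β u - A) u * KK (l*(y-u)) := by
    intro y
    refine (hKi y).bdd_mul (c := C) ?_ (ae_of_all _ hF)
    exact ((hβ.sub_const A).indicator measurableSet_Ioi).aestronglyMeasurable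
  have hkey : ∀ y c s : ℝ,
      (∀ u, s * (Set.Ioi (0:ℝ)).indicator (fun u => β u - A) u * KK (l*(y-u)) ≥ c * KK (l*(y-u)) - 2*C*{w : ℝ | M < |w|}.indicator KK (l*(y-u))) →
      s * J y ≥ l⁻¹ * (c * κ - 2*C*τ) := by
    intro y c s hp
    have h1 := integral_mono (((hKi y).const_mul c).sub ((hTi y).const_mul (2*C))) ((hJi y).const_mul s)
      (fun u => by have := hp u; rw [mul_assoc] at this; simpa using this)
    simp only [Pi.sub_apply] at h1
    rw [integral_sub ((hKi y).const_mul c) ((hTi y).const_mul (2*C)), integral_const_mul, integral_const_mul, integral_const_mul,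
      int_scale KK l y hl0, int_scale _ l y hl0, ← hκe, ← hτ] at h1
    rw [hJ]
    linarith
  have hwin : ∀ y u, ¬ M < |l*(y-u)| → |y-u| ≤ h := by
    intro y u hu
    rw [not_lt, abs_mul, abs_of_pos hl0, hl, div_mul_eq_mul_div, div_le_iff₀ hh0] at hu
    exact le_of_mul_le_mul_left hu hM0
  have hlow : ∀ y, Y ≤ y → h < y → β (y-h) * Real.exp (-(2*h)) - A ≤ δ/2 := by
    intro y hy hyh
    obtain ⟨c, hc⟩ : ∃ c, c = β (y-h) * Real.exp (-(2*h)) - A := ⟨_, rfl⟩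
    have hcC : c ≤ C := by
      have := mul_le_mul (hC (y-h)) (Real.exp_le_one_iff.2 (by linarith : -(2*h) ≤ 0)) (Real.exp_pos _).le hC0
      linarith
    have := hkey y c 1 (by
      intro u
      by_cases hu : M < |l*(y-u)|
      · rw [Set.indicator_of_mem (s := {w : ℝ | M < |w|}) (by exact hu)]
        have := mul_le_mul_of_nonneg_right (show c - 2*C ≤ 1 * (Set.Ioi (0:ℝ)).indicator (fun u => β u - A) u by
          linarith [(abs_le.1 (hF u)).1]) (KK_nonneg (l*(y-u)))
        linarith
      · rw [Set.indicator_of_notMem (s := {w : ℝ | M < |w|}) (by exact hu), mul_zero, sub_zero]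
        have hw := abs_le.1 (hwin y u hu)
        refine mul_le_mul_of_nonneg_right ?_ (KK_nonneg _)
        rw [Set.indicator_of_mem (by simp only [Set.mem_Ioi]; linarith), one_mul, hc]
        have h1 := hmono (y-h) (u-(y-h)) (by linarith)
        rw [add_sub_cancel] at h1
        have h2 : β (y-h) * Real.exp (-(2*h)) ≤ β (y-h) * Real.exp (-(u-(y-h))) :=
          mul_le_mul_of_nonneg_left (Real.exp_le_exp.2 (by linarith)) (h0 _)
        linarith)
    have h3 := (abs_le.1 (hJb y hy)).2
    have h4 : l⁻¹ * (c * κ - 2*C*τ) ≤ l⁻¹ * (κ * (δ/4)) := by linarith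
    have h5 := le_of_mul_le_mul_left h4 (by positivity)
    rw [← hc]
    have h6 : c * κ ≤ (δ/2) * κ := by linarith
    exact le_of_mul_le_mul_right h6 hκ
  have hup : ∀ y, Y ≤ y → h < y → A - β (y+h) * Real.exp (2*h) ≤ δ/2 := by
    intro y hy hyh
    obtain ⟨c, hc⟩ : ∃ c, c = A - β (y+h) * Real.exp (2*h) := ⟨_, rfl⟩
    have hcC : c ≤ C := by
      have := mul_nonneg (h0 (y+h)) (Real.exp_pos (2*h)).le
      linarith
    have := hkey y c (-1) (by
      intro u
      by_cases hu : M < |l*(y-u)|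
      · rw [Set.indicator_of_mem (s := {w : ℝ | M < |w|}) (by exact hu)]
        have := mul_le_mul_of_nonneg_right (show c - 2*C ≤ (-1) * (Set.Ioi (0:ℝ)).indicator (fun u => β u - A) u by
          linarith [(abs_le.1 (hF u)).2]) (KK_nonneg (l*(y-u)))
        linarith
      · rw [Set.indicator_of_notMem (s := {w : ℝ | M < |w|}) (by exact hu), mul_zero, sub_zero]
        have hw := abs_le.1 (hwin y u hu)
        refine mul_le_mul_of_nonneg_right ?_ (KK_nonneg _)
        rw [Set.indicator_of_mem (by simp only [Set.mem_Ioi]; linarith), hc]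
        have h1 := hmono u (y+h-u) (by linarith)
        rw [add_sub_cancel] at h1
        have h2 : β u * Real.exp (-(2*h)) ≤ β u * Real.exp (-(y+h-u)) :=
          mul_le_mul_of_nonneg_left (Real.exp_le_exp.2 (by linarith)) (h0 _)
        have h3 := mul_le_mul_of_nonneg_right (h2.trans h1) (Real.exp_pos (2*h)).le
        rw [mul_assoc, ← Real.exp_add, neg_add_cancel, Real.exp_zero, mul_one] at h3
        linarith)
    have h3 := (abs_le.1 (hJb y hy)).1
    have h4 : l⁻¹ * (c * κ - 2*C*τ) ≤ l⁻¹ * (κ * (δ/4)) := by linarith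
    have h5 := le_of_mul_le_mul_left h4 (by positivity)
    rw [← hc]
    have h6 : c * κ ≤ (δ/2) * κ := by linarith
    exact le_of_mul_le_mul_right h6 hκ
  refine ⟨max Y 0 + 2*h+1, fun y hy => ?_⟩
  have hYm := le_max_left Y 0
  have h0m := le_max_right Y 0
  have a1 := hlow (y+h) (by linarith) (by linarith)
  have a2 := hup (y-h) (by linarith) (by linarith)
  rw [add_sub_cancel_right] at a1
  rw [sub_add_cancel] at a2
  have he : 1 - 2*h ≤ Real.exp (-(2*h)) := by have := Real.add_one_le_exp (-(2*h)); linarith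
  have he1 : Real.exp (-(2*h)) ≤ 1 := Real.exp_le_one_iff.2 (by linarith)
  have b1 : β y * (1-2*h) ≤ β y * Real.exp (-(2*h)) := mul_le_mul_of_nonneg_left he (h0 y)
  have b2 : β y * (2*h) ≤ C * (2*h) := mul_le_mul_of_nonneg_right (hC y) (by linarith)
  have b3 := mul_le_mul_of_nonneg_right a2 (Real.exp_pos (-(2*h))).le
  rw [sub_mul, mul_assoc, ← Real.exp_add, add_neg_cancel, Real.exp_zero, mul_one] at b3
  have b4 : A * (1-2*h) ≤ A * Real.exp (-(2*h)) := mul_le_mul_of_nonneg_left he hA0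
  have b5 : A * (2*h) ≤ C * (2*h) := mul_le_mul_of_nonneg_right hA (by linarith)
  have b6 : δ/2 * Real.exp (-(2*h)) ≤ δ/2 * 1 := mul_le_mul_of_nonneg_left he1 (by linarith)
  rw [Real.dist_eq, abs_lt]
  constructor <;> linarith

end P7

section P7
open MeasureTheory ArithmeticFunction.vonMangoldt

lemma Icc1 (N : ℕ) : Icc 1 N = Ioc 0 N := by ext; simp; omega

lemma res_pnt (q : ℕ) [NeZero q] (a : ZMod q) (ha : IsUnit a) :
    Tendsto (fun N : ℕ => (∑ n ∈ Ioc 0 N, residueClass a n) / N) atTop (nhds ((q.totient : ℝ)⁻¹)) := by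
  obtain ⟨B, hB⟩ : ∃ B : ℕ → ℝ, B = fun N => ∑ n ∈ Icc 1 N, residueClass a n := ⟨_, rfl⟩
  have hB0 : ∀ N, 0 ≤ B N := fun N => by rw [hB]; exact Finset.sum_nonneg fun n _ => residueClass_nonneg a n
  have hBm : Monotone B := fun M N h => by
    rw [hB]
    exact Finset.sum_le_sum_of_subset_of_nonneg (Finset.Icc_subset_Icc_right h) fun n _ _ => residueClass_nonneg a n
  have hB6 : ∀ N : ℕ, B N ≤ 6*N := fun N => by
    rw [hB]; refine le_trans ?_ (psi_bd N)
    rw [← Icc1]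
    exact Finset.sum_le_sum fun n _ => residueClass_le a n
  obtain ⟨β, hβ⟩ : ∃ β : ℝ → ℝ, β = fun u => Real.exp (-u) * B ⌊Real.exp u⌋₊ := ⟨_, rfl⟩
  have hβm : Measurable β := by
    rw [hβ]
    exact (by fun_prop : Measurable fun u : ℝ => Real.exp (-u)).mul
      (measurable_from_nat.comp (Nat.measurable_floor.comp Real.measurable_exp))
  have hβ0 : ∀ u, 0 ≤ β u := fun u => by rw [hβ]; exact mul_nonneg (Real.exp_pos _).le (hB0 _)
  have hβ6 : ∀ u, β u ≤ 6 := fun u => by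
    rw [hβ]
    have h1 := hB6 ⌊Real.exp u⌋₊
    have h2 := Nat.floor_le (Real.exp_pos u).le
    have h3 := mul_le_mul_of_nonneg_left (h1.trans (by linarith : _ ≤ 6 * Real.exp u)) (Real.exp_pos (-u)).le
    rw [mul_left_comm, ← Real.exp_add, neg_add_cancel, Real.exp_zero] at h3
    linarith
  have hA1 : ((q.totient : ℝ)⁻¹) ≤ 6 := by
    have : 1 ≤ (q.totient:ℝ) := by exact_mod_cast Nat.totient_pos.2 (Nat.pos_of_ne_zero (NeZero.ne q))
    have := inv_le_one_of_one_le₀ this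
    linarith
  obtain ⟨A, hA⟩ : ∃ A : ℝ, A = (q.totient:ℝ)⁻¹ := ⟨_, rfl⟩
  have hA0 : 0 ≤ A := by rw [hA]; positivity
  rw [← hA] at hA1 ⊢
  have main := wi_taub β hβm 6 A hβ0 hβ6 hA0 hA1 (fun y v hv => by
      rw [hβ]; simp only
      rw [mul_right_comm, ← Real.exp_add, neg_add]
      refine mul_le_mul_of_nonneg_left (hBm (Nat.floor_mono (Real.exp_le_exp.2 (by linarith)))) (Real.exp_pos _).le)
    (fun s => (LFunctionResidueClassAux a (s+1) - A)/(s+1)) ?_ ?_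
  · have h1 : Tendsto (fun N : ℕ => β (Real.log N)) atTop (nhds A) :=
      main.comp (Real.tendsto_log_atTop.comp tendsto_natCast_atTop_atTop)
    refine h1.congr' ?_
    filter_upwards [eventually_gt_atTop 0] with N hN
    have : (0:ℝ) < N := by exact_mod_cast hN
    rw [hβ]; simp only
    rw [Real.exp_neg, Real.exp_log this, Nat.floor_natCast, hB, ← Icc1]
    field_simp
  · intro s hs
    have hs1 : 1 < (s+1).re := by simpa using hs
    have hs0 : s ≠ 0 := fun h => by simp [h] at hs
    have hs10 : s + 1 ≠ 0 := fun h => by rw [h] at hs1; norm_num at hs1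
    have e1 := eqOn_LFunctionResidueClassAux ha (show s+1 ∈ {s : ℂ | 1 < s.re} from hs1)
    simp only [add_sub_cancel_right] at e1
    have e2 := LSeries_eq_mul_integral_of_nonneg (fun n => residueClass a n) zero_le_one hs1 (by
      refine Asymptotics.IsBigO.of_bound 6 (Eventually.of_forall fun N => ?_)
      have := hB6 N
      have h0 := hB0 N
      rw [hB] at this h0
      simp only at this h0
      rw [Real.norm_of_nonneg h0, Real.rpow_one, Real.norm_of_nonneg (by positivity)]
      exact this) (fun n => residueClass_nonneg a n)
    have himg : Real.exp '' Set.Ioi 0 = Set.Ioi 1 := by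
      ext t
      constructor
      · rintro ⟨u, hu, rfl⟩; exact Real.one_lt_exp_iff.2 hu
      · intro ht
        exact ⟨Real.log t, Real.log_pos ht, Real.exp_log (lt_trans one_pos ht)⟩
    rw [← himg, integral_image_eq_integral_abs_deriv_smul measurableSet_Ioi
      (fun x _ => (Real.hasDerivAt_exp x).hasDerivWithinAt) Real.exp_injective.injOn] at e2
    have e3 : ∀ u : ℝ, |Real.exp u| • ((∑ k ∈ Icc 1 ⌊Real.exp u⌋₊, ((residueClass a k : ℝ):ℂ)) * ((Real.exp u : ℝ):ℂ)^(-(s+1+1)))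
        = (β u : ℂ) * Complex.exp (-s * u) := by
      intro u
      rw [Real.abs_exp, hβ, hB]
      simp only
      rw [Complex.cpow_def_of_ne_zero (by exact_mod_cast (Real.exp_pos u).ne'), ← Complex.ofReal_log (Real.exp_pos u).le, Real.log_exp, Complex.real_smul]
      push_cast
      rw [mul_left_comm, ← Complex.exp_add, mul_right_comm, ← Complex.exp_add, mul_comm]
      ring_nf
    simp_rw [e3] at e2
    have hre : (-s).re < 0 := by simpa using hs
    have i0 := integrableOn_exp_mul_complex_Ioi hre 0
    have i1 : IntegrableOn (fun u : ℝ => (β u : ℂ) * Complex.exp (-s * u)) (Set.Ioi 0) := by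
      refine i0.bdd_mul (c := 6) (by fun_prop) (ae_of_all _ fun u => ?_)
      rw [Complex.norm_real, Real.norm_of_nonneg (hβ0 u)]; exact hβ6 u
    have e4 := integral_exp_mul_complex_Ioi hre 0
    simp_rw [Complex.ofReal_sub, sub_mul]
    rw [integral_sub i1 (i0.const_mul _), integral_const_mul, e4, e1, e2, hA]
    simp only [Complex.ofReal_zero, mul_zero, Complex.exp_zero]
    have : (q.totient:ℂ) ≠ 0 := by exact_mod_cast (Nat.totient_pos.2 (Nat.pos_of_ne_zero (NeZero.ne q))).ne'
    push_cast
    field_simp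
    ring
  · have hc : ContinuousOn (fun s : ℂ => LFunctionResidueClassAux a (s+1)) {s | 0 ≤ s.re} :=
      (continuousOn_LFunctionResidueClassAux a).comp (by fun_prop) (fun s hs => by
        simp only [Set.mem_ofPred_eq, Complex.add_re, Complex.one_re] at hs ⊢; linarith)
    refine (hc.sub continuousOn_const).div (by fun_prop) ?_
    intro s hs h
    have := congrArg Complex.re h
    simp only [Set.mem_ofPred_eq, Complex.add_re, Complex.one_re, Complex.zero_re] at hs this
    linarith

end P7

section P8
open ArithmeticFunction ArithmeticFunction.vonMangoldt

lemma pnt_psi : Tendsto (fun N : ℕ => (∑ n ∈ Ioc 0 N, vonMangoldt n) / N) atTop (nhds 1) := by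
  have h := res_pnt 1 1 isUnit_one
  simp only [Nat.totient_one, Nat.cast_one, inv_one] at h
  refine h.congr fun N => ?_
  congr 1
  refine sum_congr rfl fun n _ => ?_
  unfold residueClass
  rw [Set.indicator_of_mem]
  exact Subsingleton.elim _ _

lemma pnt_theta : Tendsto (fun N : ℕ => Chebyshev.theta N / N) atTop (nhds 1) := by
  have h1 : Tendsto (fun N : ℕ => (Chebyshev.psi N - Chebyshev.theta N) / N) atTop (nhds 0) := by
    have h2 : (fun x : ℝ => Chebyshev.psi x - Chebyshev.theta x) =o[atTop] (fun x => x) := by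
      refine Chebyshev.isBigO_psi_sub_theta_sqrt.trans_isLittleO ?_
      refine Asymptotics.isLittleO_of_tendsto' ?_ ?_
      · filter_upwards [eventually_gt_atTop 0] with x hx h
        exact absurd h hx.ne'
      · simp_rw [Real.sqrt_div_self]
        exact Real.tendsto_sqrt_atTop.inv_tendsto_atTop
    exact h2.tendsto_div_nhds_zero.comp tendsto_natCast_atTop_atTop
  have h2 := pnt_psi.sub h1
  rw [sub_zero] at h2
  refine h2.congr fun N => ?_
  rw [← sub_div]
  congr 1
  simp [Chebyshev.psi]

lemma pi_card (N : ℕ) : N.primeCounting = #{p ∈ Ioc 0 N | p.Prime} := by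
  rw [Nat.primeCounting, Nat.primeCounting', Nat.count_eq_card_filter_range]
  congr 1; ext p; simp only [mem_filter, mem_range, mem_Ioc]
  constructor
  · rintro ⟨h, hp⟩; exact ⟨⟨hp.pos, by omega⟩, hp⟩
  · rintro ⟨h, hp⟩; exact ⟨by omega, hp⟩

lemma pnt_pi : Tendsto (fun N : ℕ => ((N.primeCounting : ℝ) * Real.log N) / N) atTop (nhds 1) := by
  have h1 := Chebyshev.integral_theta_div_log_sq_isLittleO.tendsto_div_nhds_zero.comp (tendsto_natCast_atTop_atTop (R := ℝ))
  have h2 := pnt_theta.add h1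
  rw [add_zero] at h2
  refine h2.congr' ?_
  filter_upwards [eventually_ge_atTop 2] with N hN
  have hN' : (2:ℝ) ≤ N := by exact_mod_cast hN
  have h3 := Chebyshev.primeCounting_eq_theta_div_log_add_integral hN'
  rw [Nat.floor_natCast] at h3
  have hl : 0 < Real.log N := Real.log_pos (by linarith)
  rw [h3]
  simp only [Function.comp]
  field_simp

lemma transfer (F : ℕ → ℂ) (hF : ∀ n, ‖F n‖ ≤ 1) (c : ℂ)
    (h : Tendsto (fun N : ℕ => (∑ n ∈ Ioc 0 N, (vonMangoldt n : ℂ) * F n) / N) atTop (nhds c)) :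
    Tendsto (fun n : ℕ => (n:ℂ)⁻¹ * ∑ j ∈ range n, F (Nat.nth Nat.Prime j)) atTop (nhds c) := by
  have hS : ∀ G : ℕ → ℂ, ∀ n, ∑ j ∈ range (n+1), G (Nat.nth Nat.Prime j) = ∑ p ∈ Ioc 0 (Nat.nth Nat.Prime n) with p.Prime, G p := by
    intro G n
    have h1 : ∀ n, ∑ j ∈ range n, G (Nat.nth Nat.Prime j) = ∑ p ∈ range (Nat.nth Nat.Prime n) with p.Prime, G p := by
      intro n
      induction n with
      | zero =>
        rw [Nat.nth_prime_zero_eq_two]; rfl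
      | succ k ih =>
        rw [sum_range_succ, ih, Nat.filter_range_nth_eq_insert_of_infinite Nat.infinite_setOfPred_prime, sum_insert (by simp), add_comm]
    rw [h1, Nat.filter_range_nth_eq_insert_of_infinite Nat.infinite_setOfPred_prime]
    congr 1; ext p
    have hp := Nat.prime_nth_prime n
    simp only [mem_insert, mem_filter, mem_range, mem_Ioc]
    constructor
    · rintro (rfl | ⟨h, hp⟩)
      · exact ⟨⟨hp.pos, le_rfl⟩, hp⟩
      · exact ⟨⟨hp.pos, h.le⟩, hp⟩
    · rintro ⟨⟨_, h⟩, hp⟩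
      rcases h.lt_or_eq with h | h
      · exact Or.inr ⟨h, hp⟩
      · exact Or.inl h
  have hb : ∀ N : ℕ, ‖(Real.log N : ℂ) * ∑ p ∈ Ioc 0 N with p.Prime, F p - ∑ n ∈ Ioc 0 N, (vonMangoldt n : ℂ) * F n‖
      ≤ N.primeCounting * Real.log N + ∑ n ∈ Ioc 0 N, vonMangoldt n - 2 * Chebyshev.theta N := by
    intro N
    rw [sum_filter, mul_sum, ← sum_sub_distrib]
    have e : (N.primeCounting:ℝ) * Real.log N + ∑ n ∈ Ioc 0 N, vonMangoldt n - 2 * Chebyshev.theta N =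
        ∑ n ∈ Ioc 0 N, ((if n.Prime then Real.log N else 0) + vonMangoldt n - 2 * (if n.Prime then Real.log n else 0)) := by
      rw [sum_sub_distrib, sum_add_distrib, ← mul_sum, ← sum_filter, ← sum_filter, sum_const, nsmul_eq_mul, ← pi_card]
      simp [Chebyshev.theta]
    rw [e]
    refine (norm_sum_le _ _).trans (sum_le_sum fun n hn => ?_)
    rw [mem_Ioc] at hn
    have hl : Real.log n ≤ Real.log N := Real.log_le_log (by exact_mod_cast hn.1) (by exact_mod_cast hn.2)
    by_cases hp : n.Prime
    · rw [if_pos hp, if_pos hp, if_pos hp, vonMangoldt_apply_prime hp, ← sub_mul, norm_mul, ← Complex.ofReal_sub, Complex.norm_real, Real.norm_of_nonneg (by linarith)]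
      have := mul_le_mul_of_nonneg_left (hF n) (by linarith : 0 ≤ Real.log N - Real.log n)
      linarith
    · rw [if_neg hp, if_neg hp, if_neg hp, mul_zero, zero_sub, norm_neg, norm_mul, Complex.norm_real, Real.norm_of_nonneg vonMangoldt_nonneg]
      have := mul_le_mul_of_nonneg_left (hF n) (vonMangoldt_nonneg (n := n))
      linarith
  have h0 : Tendsto (fun N : ℕ => ((Real.log N : ℂ) * ∑ p ∈ Ioc 0 N with p.Prime, F p) / N) atTop (nhds c) := by
    have h1 : Tendsto (fun N : ℕ => ((Real.log N : ℂ) * ∑ p ∈ Ioc 0 N with p.Prime, F p - ∑ n ∈ Ioc 0 N, (vonMangoldt n : ℂ) * F n)/N) atTop (nhds 0) := by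
      have h2 := (pnt_pi.add pnt_psi).sub (pnt_theta.const_mul 2)
      norm_num at h2
      refine squeeze_zero_norm (fun N => ?_) h2
      rw [norm_div, Complex.norm_natCast]
      refine (div_le_div_of_nonneg_right (hb N) (Nat.cast_nonneg N)).trans (le_of_eq ?_)
      ring
    have h2 := h1.add h
    rw [zero_add] at h2
    refine h2.congr fun N => ?_
    ring
  have h3 : Tendsto (fun N : ℕ => (N.primeCounting : ℂ)⁻¹ * ∑ p ∈ Ioc 0 N with p.Prime, F p) atTop (nhds c) := by
    have hp : Tendsto (fun N : ℕ => ((((N.primeCounting : ℝ) * Real.log N) / N : ℝ):ℂ)) atTop (nhds 1) := by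
      have := (Complex.continuous_ofReal.tendsto 1).comp pnt_pi
      simpa [Function.comp_def] using this
    have h4 := h0.div hp one_ne_zero
    rw [div_one] at h4
    refine h4.congr' ?_
    filter_upwards [eventually_ge_atTop 2] with N hN
    have hN' : (1:ℝ) < N := by exact_mod_cast hN
    have hl : (Real.log N : ℂ) ≠ 0 := by exact_mod_cast (Real.log_pos hN').ne'
    have hN0 : (N:ℂ) ≠ 0 := by exact_mod_cast (by omega : N ≠ 0)
    have hpi : (N.primeCounting : ℂ) ≠ 0 := by
      have : 0 < N.primeCounting := by
        rw [pi_card, card_pos]; exact ⟨2, by simp [Nat.prime_two, hN]⟩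
      exact_mod_cast this.ne'
    simp only [Pi.div_apply]
    rw [Complex.ofReal_div, Complex.ofReal_mul, Complex.ofReal_natCast, Complex.ofReal_natCast]
    field_simp
  rw [← tendsto_add_atTop_iff_nat 1]
  have hnth : Tendsto (Nat.nth Nat.Prime) atTop atTop := (Nat.nth_strictMono Nat.infinite_setOfPred_prime).tendsto_atTop
  refine (h3.comp hnth).congr fun n => ?_
  simp only [Function.comp]
  rw [hS F n]
  congr 2
  have := hS (fun _ => 1) n
  simp only [sum_const, nsmul_eq_mul, mul_one, card_range] at this
  rw [pi_card]
  exact this.symm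

end P8

section P8
open ArithmeticFunction ArithmeticFunction.vonMangoldt

lemma lam_log (ε : ℝ) (hε : 0 < ε) : ∃ N0 : ℕ, ∀ N, N0 ≤ N →
    ∑ n ∈ Ioc 0 N, vonMangoldt n * (Real.log N - Real.log n) ≤ ε * N * Real.log N := by
  obtain ⟨δ, hδ, hδε⟩ : ∃ δ : ℝ, 0 < δ ∧ 12*δ ≤ ε := ⟨ε/12, by positivity, by linarith⟩
  have hlog : Tendsto (fun N : ℕ => Real.log N) atTop atTop := Real.tendsto_log_atTop.comp tendsto_natCast_atTop_atTop
  obtain ⟨N0, hN0⟩ := eventually_atTop.1 ((hlog.eventually_ge_atTop (|Real.log δ|/δ)).and (eventually_ge_atTop 1))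
  refine ⟨N0, fun N hN => ?_⟩
  obtain ⟨h1, h2⟩ := hN0 N hN
  rw [div_le_iff₀ hδ] at h1
  have hN1 : (1:ℝ) ≤ N := by exact_mod_cast h2
  have hL : 0 ≤ Real.log N := Real.log_nonneg hN1
  have hp : ∀ n ∈ Ioc 0 N, vonMangoldt n * (Real.log N - Real.log n) ≤
      (if n ≤ ⌊δ*N⌋₊ then vonMangoldt n else 0) * Real.log N + vonMangoldt n * |Real.log δ| := by
    intro n hn
    rw [mem_Ioc] at hn
    have h0 := vonMangoldt_nonneg (n := n)
    have hn1 : (1:ℝ) ≤ n := by exact_mod_cast hn.1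
    have hn0 := Real.log_nonneg hn1
    split_ifs with h
    · have := mul_le_mul_of_nonneg_left (by linarith : Real.log N - Real.log n ≤ Real.log N) h0
      have := mul_nonneg h0 (abs_nonneg (Real.log δ))
      linarith
    · have h3 : δ * N < n := Nat.lt_of_floor_lt (not_le.1 h)
      have h4 := Real.log_le_log (by positivity) h3.le
      rw [Real.log_mul hδ.ne' (by linarith)] at h4
      have := neg_abs_le (Real.log δ)
      have := mul_le_mul_of_nonneg_left (by linarith : Real.log N - Real.log n ≤ |Real.log δ|) h0
      linarith
  have hs := sum_le_sum hp
  rw [sum_add_distrib, ← sum_mul, ← sum_mul, ← sum_filter] at hs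
  have h5 : ∑ n ∈ Ioc 0 N with n ≤ ⌊δ*N⌋₊, vonMangoldt n ≤ 6*(δ*N) := by
    calc _ ≤ ∑ n ∈ Ioc 0 ⌊δ*N⌋₊, vonMangoldt n := by
          refine sum_le_sum_of_subset_of_nonneg (fun n hn => ?_) fun _ _ _ => vonMangoldt_nonneg
          simp only [mem_filter, mem_Ioc] at hn ⊢; omega
      _ ≤ 6*(⌊δ*N⌋₊:ℝ) := psi_bd _
      _ ≤ _ := by have := Nat.floor_le (by positivity : 0 ≤ δ*N); linarith
  have h6 := mul_le_mul_of_nonneg_right h5 hL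
  have h7 := mul_le_mul_of_nonneg_right (psi_bd N) (abs_nonneg (Real.log δ))
  have h8 := mul_le_mul_of_nonneg_left h1 (by positivity : (0:ℝ) ≤ 6*N)
  have h9 := mul_le_mul_of_nonneg_right hδε (by positivity : 0 ≤ N*Real.log N)
  linarith

lemma irr_psi (Q : Polynomial ℕ) (hQ : 0 < Q.natDegree) (θ : ℝ) (hθ : Irrational θ) :
    Tendsto (fun N : ℕ => (∑ n ∈ Ioc 0 N, (vonMangoldt n : ℂ) * ee (θ * (Q.eval n : ℕ))) / N) atTop (nhds 0) := by
  rw [Metric.tendsto_atTop]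
  intro ε hε
  obtain ⟨N1, h1⟩ := irr_llm Q hQ θ hθ (ε/3) (by positivity)
  obtain ⟨N2, h2⟩ := lam_log (ε/3) (by positivity)
  refine ⟨max (max N1 N2) 2, fun N hN => ?_⟩
  have hN2 : 2 ≤ N := le_trans (le_max_right _ _) hN
  have hNr : (2:ℝ) ≤ N := by exact_mod_cast hN2
  have hL : 0 < Real.log N := Real.log_pos (by linarith)
  have a1 := h1 N (le_trans (le_max_left _ _) (le_trans (le_max_left _ _) hN))
  have a2 := h2 N (le_trans (le_max_right _ _) (le_trans (le_max_left _ _) hN))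
  have e : (Real.log N : ℂ) * ∑ n ∈ Ioc 0 N, (vonMangoldt n : ℂ) * ee (θ * (Q.eval n : ℕ)) =
      ∑ n ∈ Ioc 0 N, (llm n : ℂ) * ee (θ * (Q.eval n : ℕ)) +
      ∑ n ∈ Ioc 0 N, ((vonMangoldt n * (Real.log N - Real.log n) : ℝ):ℂ) * ee (θ * (Q.eval n : ℕ)) := by
    rw [mul_sum, ← sum_add_distrib]
    refine sum_congr rfl fun n _ => ?_
    rw [llm_apply, ← add_mul, ← Complex.ofReal_add, ← mul_assoc, ← Complex.ofReal_mul]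
    ring_nf
  have a3 : ‖∑ n ∈ Ioc 0 N, ((vonMangoldt n * (Real.log N - Real.log n) : ℝ):ℂ) * ee (θ * (Q.eval n : ℕ))‖ ≤
      ∑ n ∈ Ioc 0 N, vonMangoldt n * (Real.log N - Real.log n) := by
    refine (norm_sum_le _ _).trans (sum_le_sum fun n hn => ?_)
    rw [mem_Ioc] at hn
    have hl : Real.log n ≤ Real.log N := Real.log_le_log (by exact_mod_cast hn.1) (by exact_mod_cast hn.2)
    rw [norm_mul, norm_ee, mul_one, Complex.norm_real, Real.norm_of_nonneg (mul_nonneg vonMangoldt_nonneg (by linarith))]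
  have a4 := congrArg norm e
  rw [norm_mul, Complex.norm_real, Real.norm_of_nonneg hL.le] at a4
  have a5 := a4.le.trans (norm_add_le _ _)
  rw [dist_zero_right, norm_div, Complex.norm_natCast, div_lt_iff₀ (by linarith)]
  have a6 : 0 < N * Real.log N := by positivity
  have a7 : 0 < ε * (N * Real.log N) := by positivity
  refine lt_of_mul_lt_mul_left (?_ : Real.log N * _ < Real.log N * _) hL.le
  linarith

lemma res_all (q : ℕ) [NeZero q] (b : ZMod q) : ∃ c : ℝ,
    Tendsto (fun N : ℕ => (∑ n ∈ Ioc 0 N, residueClass b n) / N) atTop (nhds c) := by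
  classical
  by_cases hb : IsUnit b
  · exact ⟨_, res_pnt q b hb⟩
  refine ⟨0, ?_⟩
  have hsum : ∀ n, vonMangoldt n = ∑ b : ZMod q, residueClass b n := by
    intro n
    unfold residueClass
    rw [sum_eq_single (n : ZMod q)]
    · rw [Set.indicator_of_mem]; rfl
    · intro b _ hb
      rw [Set.indicator_of_notMem]; exact fun h => hb h.symm
    · simp
  have hu : Tendsto (fun N : ℕ => ∑ b ∈ (univ : Finset (ZMod q)) with IsUnit b, (∑ n ∈ Ioc 0 N, residueClass b n) / (N:ℝ)) atTop (nhds 1) := by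
    have h := tendsto_finsetSum (univ.filter fun b : ZMod q => IsUnit b) (fun b hb => res_pnt q b (by simpa using hb))
    convert h using 2
    have : #(univ.filter fun b : ZMod q => IsUnit b) = q.totient := by
      rw [← ZMod.card_units_eq_totient, ← card_univ, ← card_image_of_injective univ (Units.val_injective (α := ZMod q))]
      congr 1; ext x; rw [mem_filter, mem_image]; simp only [mem_univ, true_and]; rfl
    rw [sum_const, this, nsmul_eq_mul, mul_inv_cancel₀]
    exact_mod_cast (Nat.totient_pos.2 (Nat.pos_of_ne_zero (NeZero.ne q))).ne'
  have h := pnt_psi.sub hu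
  rw [sub_self] at h
  refine squeeze_zero (fun N => div_nonneg (sum_nonneg fun n _ => residueClass_nonneg _ _) (Nat.cast_nonneg N)) (fun N => ?_) h
  simp_rw [hsum]
  rw [sum_comm, sum_div (s := (univ : Finset (ZMod q))), ← sum_filter_add_sum_filter_not univ (fun b : ZMod q => IsUnit b), add_sub_cancel_left]
  exact single_le_sum (f := fun b : ZMod q => (∑ n ∈ Ioc 0 N, residueClass b n) / (N:ℝ)) (fun b _ => div_nonneg (sum_nonneg fun n _ => residueClass_nonneg _ _) (Nat.cast_nonneg N)) (by simp [hb])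

lemma rat_psi (q : ℕ) [NeZero q] (F : ℕ → ℂ) (hF : ∀ n : ℕ, F n = F (n : ZMod q).val) : ∃ c,
    Tendsto (fun N : ℕ => (∑ n ∈ Ioc 0 N, (vonMangoldt n : ℂ) * F n) / N) atTop (nhds c) := by
  classical
  choose c hc using res_all q
  refine ⟨∑ b : ZMod q, (c b : ℂ) * F b.val, ?_⟩
  have h1 : ∀ b ∈ (univ : Finset (ZMod q)), Tendsto (fun N : ℕ => (((∑ n ∈ Ioc 0 N, residueClass b n) / (N:ℝ) : ℝ):ℂ) * F b.val) atTop (nhds ((c b : ℂ) * F b.val)) :=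
    fun b _ => ((Complex.continuous_ofReal.tendsto _).comp (hc b)).mul_const _
  refine (tendsto_finsetSum _ h1).congr fun N => ?_
  rw [sum_div]
  push_cast
  simp_rw [sum_div, sum_mul]
  rw [sum_comm]
  refine sum_congr rfl fun n _ => ?_
  unfold residueClass
  rw [sum_eq_single (n : ZMod q)]
  · rw [Set.indicator_of_mem (by rfl), hF n]; ring
  · intro b _ hb
    rw [Set.indicator_of_notMem (fun h => hb h.symm)]; simp
  · simp

lemma ptwise (Q : Polynomial ℕ) (t : ℝ) : ∃ c : ℂ,
    Tendsto (fun n : ℕ => (n:ℂ)⁻¹ * ∑ j ∈ range n, ee (t * (Q.eval (Nat.nth Nat.Prime j) : ℕ))) atTop (nhds c) := by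
  suffices h : ∃ c, Tendsto (fun N : ℕ => (∑ n ∈ Ioc 0 N, (vonMangoldt n : ℂ) * ee (t * (Q.eval n : ℕ))) / N) atTop (nhds c) by
    obtain ⟨c, hc⟩ := h
    exact ⟨c, transfer (fun n => ee (t * (Q.eval n : ℕ))) (fun n => (norm_ee _).le) c hc⟩
  by_cases ht : Irrational t
  · rcases Nat.eq_zero_or_pos Q.natDegree with hQ | hQ
    · rw [Polynomial.eq_C_of_natDegree_eq_zero hQ]
      exact rat_psi 1 (fun n => ee (t * ((Polynomial.C (Q.coeff 0)).eval n : ℕ))) (fun n => by simp)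
    · exact ⟨0, irr_psi Q hQ t ht⟩
  · obtain ⟨r, rfl⟩ : ∃ r : ℚ, (r:ℝ) = t := by
      unfold Irrational at ht; simpa using ht
    have : NeZero r.den := ⟨r.den_nz⟩
    refine rat_psi r.den (fun n => ee ((r:ℝ) * (Q.eval n : ℕ))) fun n => ?_
    have h1 : n ≡ (n : ZMod r.den).val [MOD r.den] := by
      rw [ZMod.val_natCast]; exact (Nat.mod_modEq _ _).symm
    have h2 := gq_mod r.num r.den (Nat.pos_of_ne_zero r.den_nz) Q _ _ h1
    unfold gq at h2
    rw [PQ_eval, PQ_eval] at h2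
    rw [Rat.cast_def]
    exact h2

end P8

section P9
open MeasureTheory AddCircle

lemma int_fourier (n : ℤ) : ∫ t : UnitAddCircle, fourier n t ∂haarAddCircle = if n = 0 then 1 else 0 := by
  split_ifs with h
  · subst h; simp
  · exact integral_eq_zero_of_add_right_eq_neg (μ := haarAddCircle) (fourier_add_half_inv_index h one_pos)

lemma herglotz (r : ℤ → ℝ) (hs : ∀ k, r (-k) = r k) (h0 : r 0 = 1)
    (hpd : ∀ (N : ℕ) (c : ℕ → ℝ), 0 ≤ ∑ m ∈ range N, ∑ n ∈ range N, c m * c n * r (m-n)) :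
    ∃ μ : ProbabilityMeasure UnitAddCircle, ∀ k : ℤ, ∫ t, fourier k t ∂(μ : Measure UnitAddCircle) = (r k : ℂ) := by
  obtain ⟨W, hW⟩ : ∃ W : ℕ → UnitAddCircle → ℂ, W = fun N t => ∑ m ∈ range (N+1), ∑ n ∈ range (N+1), (r (m-n) : ℂ) * fourier ((m:ℤ)-n) t := ⟨_, rfl⟩
  have hWc : ∀ N, Continuous (W N) := by
    intro N; rw [hW]; fun_prop
  have hWr : ∀ N t, W N t = ((W N t).re : ℂ) := by
    intro N t
    refine (Complex.conj_eq_iff_re.1 ?_).symm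
    rw [hW]
    simp only [map_sum, map_mul, Complex.conj_ofReal, ← fourier_neg]
    rw [sum_comm]
    refine sum_congr rfl fun m _ => sum_congr rfl fun n _ => ?_
    rw [← hs, neg_sub]
  have hW0 : ∀ N t, 0 ≤ (W N t).re := by
    intro N t
    have h1 := add_nonneg (hpd (N+1) fun n => (fourier (n:ℤ) t : ℂ).re) (hpd (N+1) fun n => (fourier (n:ℤ) t : ℂ).im)
    refine h1.trans (le_of_eq ?_)
    rw [hW]
    simp only [Complex.re_sum, Complex.re_ofReal_mul]
    rw [← sum_add_distrib]
    refine sum_congr rfl fun m _ => ?_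
    rw [← sum_add_distrib]
    refine sum_congr rfl fun n _ => ?_
    rw [sub_eq_add_neg (m:ℤ) n, fourier_add, fourier_neg, Complex.mul_re, Complex.conj_re, Complex.conj_im]
    ring
  have hWi : ∀ N (k : ℕ), ∫ t : UnitAddCircle, W N t * fourier (k:ℤ) t ∂haarAddCircle = ((N+1-k : ℕ) : ℂ) * r k := by
    intro N k
    rw [hW]
    simp only [sum_mul]
    have hi : ∀ m n : ℕ, Integrable (fun t : UnitAddCircle => (r (m-n) : ℂ) * fourier ((m:ℤ)-n) t * fourier (k:ℤ) t) haarAddCircle := by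
      intro m n
      exact (by fun_prop : Continuous _).integrable_of_hasCompactSupport (HasCompactSupport.of_compactSpace _)
    rw [integral_finsetSum _ fun m _ => integrable_finsetSum _ fun n _ => hi m n]
    have h1 : ∀ m ∈ range (N+1), ∫ t : UnitAddCircle, ∑ n ∈ range (N+1), (r (m-n) : ℂ) * fourier ((m:ℤ)-n) t * fourier (k:ℤ) t ∂haarAddCircle = if m < N+1-k then (r k : ℂ) else 0 := by
      intro m _
      rw [integral_finsetSum _ fun n _ => hi m n]
      have h2 : ∀ n ∈ range (N+1), ∫ t : UnitAddCircle, (r (m-n) : ℂ) * fourier ((m:ℤ)-n) t * fourier (k:ℤ) t ∂haarAddCircle = if m + k = n then (r k : ℂ) else 0 := by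
        intro n _
        simp_rw [mul_assoc, ← fourier_add]
        rw [integral_const_mul, int_fourier]
        by_cases h : m + k = n
        · rw [if_pos h, if_pos (by omega), mul_one, ← hs]
          congr 2; omega
        · rw [if_neg h, if_neg (by omega), mul_zero]
      rw [sum_congr rfl h2, sum_ite_eq]
      simp only [mem_range]
      congr 1
      exact propext (by omega)
    rw [sum_congr rfl h1, ← sum_filter, sum_const, nsmul_eq_mul]
    congr 2
    rw [show (range (N+1)).filter (fun m => m < N+1-k) = range (N+1-k) by ext; simp; omega, card_range]
  obtain ⟨d, hd⟩ : ∃ d : ℕ → UnitAddCircle → NNReal, d = fun N t => ((W N t).re / (N+1)).toNNReal := ⟨_, rfl⟩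
  have hdm : ∀ N, Measurable (d N) := by
    intro N; rw [hd]
    have := hWc N
    exact Continuous.measurable (by fun_prop)
  have hdi : ∀ N (k : ℕ), ∫ t, fourier (k:ℤ) t ∂(haarAddCircle.withDensity fun t => (d N t : ENNReal)) = ((N+1-k : ℕ) : ℂ) * r k / (N+1) := by
    intro N k
    rw [integral_withDensity_eq_integral_smul (hdm N), ← hWi, ← integral_div]
    refine integral_congr_ae (ae_of_all _ fun t => ?_)
    simp only
    rw [NNReal.smul_def, hd, Real.coe_toNNReal _ (div_nonneg (hW0 N t) (by positivity)), Complex.real_smul]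
    push_cast
    rw [← hWr]; ring
  have hdp : ∀ N, IsProbabilityMeasure (haarAddCircle.withDensity fun t => (d N t : ENNReal)) := by
    intro N
    constructor
    have h1 := hdi N 0
    have h2 : ∫ t : UnitAddCircle, (d N t : ℝ) ∂haarAddCircle = 1 := by
      rw [integral_withDensity_eq_integral_smul (hdm N)] at h1
      simp only [Nat.cast_zero, fourier_zero, NNReal.smul_def, Complex.real_smul, mul_one, h0, Nat.sub_zero, Complex.ofReal_one] at h1
      rw [integral_complex_ofReal] at h1
      have : ((N+1:ℕ):ℂ) / (N+1) = 1 := by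
        push_cast; exact div_self (by exact_mod_cast Nat.succ_ne_zero N)
      rw [this] at h1
      exact_mod_cast h1
    have hc : Continuous fun t => (d N t : ℝ) := by
      rw [hd]; have := hWc N; fun_prop
    rw [withDensity_apply _ MeasurableSet.univ, Measure.restrict_univ]
    have h3 := ofReal_integral_eq_lintegral_ofReal (hc.integrable_of_hasCompactSupport (μ := haarAddCircle) (HasCompactSupport.of_compactSpace _)) (ae_of_all _ fun t => (d N t).2)
    rw [h2] at h3
    simpa using h3.symm
  obtain ⟨μN, hμN⟩ : ∃ μN : ℕ → ProbabilityMeasure UnitAddCircle, μN = fun N => ⟨_, hdp N⟩ := ⟨_, rfl⟩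
  obtain ⟨μ, -, hμ⟩ := isCompact_univ.ultrafilter_le_nhds (Ultrafilter.map μN (hyperfilter ℕ)) (by simp)
  have hμ' : Tendsto μN (hyperfilter ℕ) (nhds μ) := hμ
  rw [ProbabilityMeasure.tendsto_iff_forall_integral_rclike_tendsto ℂ] at hμ'
  have hk : ∀ k : ℕ, ∫ t, fourier (k:ℤ) t ∂(μ : Measure UnitAddCircle) = (r k : ℂ) := by
    intro k
    have h1 := hμ' (BoundedContinuousFunction.mkOfCompact (fourier (k:ℤ)))
    simp only [BoundedContinuousFunction.mkOfCompact_apply] at h1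
    refine tendsto_nhds_unique h1 (Tendsto.mono_left ?_ Nat.hyperfilter_le_atTop)
    have h2 : Tendsto (fun N : ℕ => (1 - (k:ℂ) * (1/((N:ℂ)+1))) * r k) atTop (nhds ((1 - (k:ℂ) * 0) * r k)) :=
      ((tendsto_one_div_add_atTop_nhds_zero_nat.const_mul _).const_sub 1).mul_const _
    rw [mul_zero, sub_zero, one_mul] at h2
    refine h2.congr' ?_
    filter_upwards [eventually_ge_atTop k] with N hN
    rw [hμN]
    simp only [ProbabilityMeasure.coe_mk]
    rw [hdi, Nat.cast_sub (by omega)]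
    have : (N:ℂ)+1 ≠ 0 := by exact_mod_cast Nat.succ_ne_zero N
    push_cast; field_simp
  refine ⟨μ, fun k => ?_⟩
  obtain ⟨n, rfl | rfl⟩ := Int.eq_nat_or_neg k
  · exact hk n
  · simp_rw [fourier_neg]
    rw [integral_conj, hk, Complex.conj_ofReal, hs]

end P9

section P9b
open MeasureTheory AddCircle
lemma pd_aux {𝕜 H : Type*} [RCLike 𝕜] [NormedAddCommGroup H] [InnerProductSpace 𝕜 H]
    (T : H →L[𝕜] H) (hT : ‖T‖ ≤ 1) (x : H) (N : ℕ) : ∀ c : ℕ → ℝ,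
    ‖∑ k ∈ range N, ((c k : ℝ) : 𝕜) • (T ^ k) x‖ ^ 2 ≤
      ∑ m ∈ range N, ∑ n ∈ range N, c m * c n * RCLike.re (inner 𝕜 ((T ^ ((m:ℤ) - n).natAbs) x) x) := by
  induction N with
  | zero => intro c; simp
  | succ N ih =>
    intro c
    have h := ih fun n => c (n+1)
    obtain ⟨y, hy⟩ : ∃ y, y = ∑ k ∈ range N, ((c (k+1) : ℝ) : 𝕜) • (T ^ k) x := ⟨_, rfl⟩
    rw [← hy] at h
    have hTy : T y = ∑ k ∈ range N, ((c (k+1) : ℝ) : 𝕜) • (T ^ (k+1)) x := by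
      rw [hy, map_sum]
      refine sum_congr rfl fun k _ => ?_
      rw [map_smul, pow_succ', mul_apply_eq_comp]
    have hle : ‖T y‖ ^ 2 ≤ ‖y‖ ^ 2 := by
      have := T.le_of_opNorm_le hT y
      rw [one_mul] at this
      gcongr
    obtain ⟨z, hz⟩ : ∃ z, z = ∑ n ∈ range N, c (n+1) * RCLike.re (inner 𝕜 ((T ^ (n+1)) x) x) := ⟨_, rfl⟩
    have hre : RCLike.re (inner 𝕜 (T y) x) = z := by
      rw [hTy, hz, sum_inner, map_sum]
      refine sum_congr rfl fun k _ => ?_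
      rw [inner_smul_left, RCLike.conj_ofReal, RCLike.re_ofReal_mul]
    rw [sum_range_succ', ← hTy]
    have h1 : ‖T y + ((c 0 : ℝ) : 𝕜) • (T ^ 0) x‖ ^ 2 = ‖T y‖ ^ 2 + 2 * (c 0 * z) + c 0 ^ 2 * ‖x‖ ^ 2 := by
      rw [norm_add_sq (𝕜 := 𝕜), inner_smul_right, RCLike.re_ofReal_mul, pow_zero, one_apply_eq_self, hre, norm_smul, RCLike.norm_ofReal, mul_pow, sq_abs]
    rw [h1]
    have h2 : ∑ m ∈ range (N+1), ∑ n ∈ range (N+1), c m * c n * RCLike.re (inner 𝕜 ((T ^ ((m:ℤ) - n).natAbs) x) x)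
        = ∑ m ∈ range N, ∑ n ∈ range N, c (m+1) * c (n+1) * RCLike.re (inner 𝕜 ((T ^ ((m:ℤ) - n).natAbs) x) x) + c 0 * z + c 0 * z + c 0 ^ 2 * ‖x‖ ^ 2 := by
      rw [sum_range_succ']
      simp only [sum_range_succ' _ N]
      rw [sum_add_distrib, hz, mul_sum]
      have e1 : ∀ m n : ℕ, (((m+1:ℕ):ℤ) - ((n+1:ℕ):ℤ)).natAbs = ((m:ℤ)-n).natAbs := by intros; omega
      have e2 : ∀ m : ℕ, (((m+1:ℕ):ℤ) - ((0:ℕ):ℤ)).natAbs = m+1 := by intros; omega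
      have e3 : ∀ m : ℕ, (((0:ℕ):ℤ) - ((m+1:ℕ):ℤ)).natAbs = m+1 := by intros; omega
      have e4 : (((0:ℕ):ℤ) - ((0:ℕ):ℤ)).natAbs = 0 := by omega
      simp only [e1, e2, e3, e4, pow_zero, one_apply_eq_self]
      rw [inner_self_eq_norm_sq, add_assoc, add_assoc, add_assoc]
      congr 1
      congr 1
      · exact sum_congr rfl fun _ _ => by ring
      congr 1
      · exact sum_congr rfl fun _ _ => by ring
      ring
    rw [h2]
    linarith

lemma avg_aux {𝕜 M : Type*} [RCLike 𝕜] [AddCommGroup M] [Module 𝕜 M] (a : ℕ → ℕ) (g : ℕ → M) (n N : ℕ)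
    (h : ∀ j < n, a j < N) :
    (n : 𝕜)⁻¹ • ∑ j ∈ range n, g (a j) = ∑ k ∈ range N, (((n:ℝ)⁻¹ * #{j ∈ range n | a j = k} : ℝ) : 𝕜) • g k := by
  rw [← sum_fiberwise_of_maps_to (t := range N) (g := a) (fun j hj => mem_range.2 (h j (mem_range.1 hj))), smul_sum]
  refine sum_congr rfl fun k _ => ?_
  rw [sum_congr rfl (g := fun _ => g k) (fun j hj => by rw [(mem_filter.1 hj).2]), sum_const, ← Nat.cast_smul_eq_nsmul 𝕜, smul_smul]
  push_cast; rfl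

lemma spec_aux {𝕜 H : Type*} [RCLike 𝕜] [NormedAddCommGroup H] [InnerProductSpace 𝕜 H]
    (T : H →L[𝕜] H) (hT : ‖T‖ ≤ 1) (x : H) (hx : ‖x‖ = 1) : ∃ μ : ProbabilityMeasure UnitAddCircle,
    ∀ (N : ℕ) (c : ℕ → ℝ), ‖∑ k ∈ range N, ((c k : ℝ) : 𝕜) • (T ^ k) x‖ ^ 2 ≤
      ∫ t : UnitAddCircle, ‖∑ k ∈ range N, ((c k : ℝ) : ℂ) • fourier (k:ℤ) t‖ ^ 2 ∂(μ : Measure UnitAddCircle) := by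
  obtain ⟨μ, hμ⟩ := herglotz (fun k : ℤ => RCLike.re (inner 𝕜 ((T ^ k.natAbs) x) x)) (fun k => by simp only [Int.natAbs_neg])
    (by simp [hx]) (fun N c => (sq_nonneg _).trans (pd_aux T hT x N c))
  refine ⟨μ, fun N c => (pd_aux T hT x N c).trans (le_of_eq ?_)⟩
  apply Complex.ofReal_injective
  rw [← integral_complex_ofReal]
  have h1 : ∀ t : UnitAddCircle, ((‖∑ k ∈ range N, ((c k : ℝ) : ℂ) • fourier (k:ℤ) t‖ ^ 2 : ℝ) : ℂ) =
      ∑ m ∈ range N, ∑ n ∈ range N, ((c m * c n : ℝ) : ℂ) * fourier ((m:ℤ)-n) t := by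
    intro t
    rw [Complex.ofReal_pow, ← Complex.mul_conj', map_sum, sum_mul_sum]
    refine sum_congr rfl fun m _ => sum_congr rfl fun n _ => ?_
    rw [sub_eq_add_neg (m:ℤ) n, fourier_add, fourier_neg, smul_eq_mul, smul_eq_mul, map_mul, Complex.conj_ofReal, Complex.ofReal_mul]
    ring
  simp_rw [h1]
  have hi : ∀ m n : ℕ, Integrable (fun t : UnitAddCircle => ((c m * c n : ℝ) : ℂ) * fourier ((m:ℤ)-n) t) (μ : Measure UnitAddCircle) := by
    intro m n
    exact (by fun_prop : Continuous _).integrable_of_hasCompactSupport (HasCompactSupport.of_compactSpace _)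
  rw [integral_finsetSum _ fun m _ => integrable_finsetSum _ fun n _ => hi m n, Complex.ofReal_sum]
  refine sum_congr rfl fun m _ => ?_
  rw [integral_finsetSum _ fun n _ => hi m n, Complex.ofReal_sum]
  refine sum_congr rfl fun n _ => ?_
  rw [integral_const_mul, hμ, Complex.ofReal_mul]

lemma unit_case {𝕜 H : Type*} [RCLike 𝕜] [NormedAddCommGroup H] [InnerProductSpace 𝕜 H] [CompleteSpace H]
    (Q : Polynomial ℕ) (T : H →L[𝕜] H) (hT : ‖T‖ ≤ 1) (x : H) (hx : ‖x‖ = 1) :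
    ∃ y : H, Tendsto (fun n : ℕ =>
        (n : 𝕜)⁻¹ • ∑ j ∈ range n, (T ^ (Q.eval (Nat.nth Nat.Prime j))) x)
      atTop (nhds y) := by
  obtain ⟨μ, hμ⟩ := spec_aux T hT x hx
  obtain ⟨a, ha⟩ : ∃ a : ℕ → ℕ, a = fun j => Q.eval (Nat.nth Nat.Prime j) := ⟨_, rfl⟩
  obtain ⟨f, hf⟩ : ∃ f : ℕ → UnitAddCircle → ℂ, f = fun (n : ℕ) t => (n:ℂ)⁻¹ • ∑ j ∈ range n, fourier (a j : ℤ) t := ⟨_, rfl⟩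
  obtain ⟨A, hA⟩ : ∃ A : ℕ → H, A = fun n : ℕ => (n:𝕜)⁻¹ • ∑ j ∈ range n, (T ^ a j) x := ⟨_, rfl⟩
  have hfc : ∀ n, Continuous (f n) := by
    intro n; rw [hf]; fun_prop
  have hfb : ∀ n t, ‖f n t‖ ≤ 1 := by
    intro n t
    rw [hf]
    simp only [norm_smul, norm_inv, Complex.norm_natCast]
    have : ‖∑ j ∈ range n, (fourier (a j : ℤ) t : ℂ)‖ ≤ n := by
      refine (norm_sum_le _ _).trans ?_
      simp [Circle.norm_coe]
    calc _ ≤ (n:ℝ)⁻¹ * n := by gcongr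
      _ ≤ 1 := inv_mul_le_one
  have hfl : ∀ t, ∃ c, Tendsto (fun n => f n t) atTop (nhds c) := by
    intro t
    obtain ⟨s, rfl⟩ := QuotientAddGroup.mk_surjective t
    obtain ⟨c, hc⟩ := ptwise Q s
    refine ⟨c, hc.congr fun n => ?_⟩
    rw [hf, ha]
    simp only [smul_eq_mul]
    congr 1
    refine sum_congr rfl fun j _ => ?_
    have := fourier_coe_apply (T := 1) (n := ((Q.eval (Nat.nth Nat.Prime j) : ℕ) : ℤ)) (x := s)
    refine Eq.trans ?_ this.symm
    unfold ee
    congr 1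
    push_cast; ring
  have hd : ∀ n m, dist (A n) (A m) ^ 2 ≤ ∫ t, ‖f n t - f m t‖ ^ 2 ∂(μ : Measure UnitAddCircle) := by
    intro n m
    obtain ⟨N, hN⟩ : ∃ N, ∀ j < max n m, a j < N := by
      refine ⟨(range (max n m)).sup a + 1, fun j hj => Nat.lt_succ_of_le (le_sup (mem_range.2 hj))⟩
    have hn : ∀ j < n, a j < N := fun j hj => hN j (hj.trans_le (le_max_left _ _))
    have hm : ∀ j < m, a j < N := fun j hj => hN j (hj.trans_le (le_max_right _ _))
    have h := hμ N fun k => (n:ℝ)⁻¹ * #{j ∈ range n | a j = k} - (m:ℝ)⁻¹ * #{j ∈ range m | a j = k}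
    rw [dist_eq_norm, hA, hf]
    simp only
    rw [avg_aux (𝕜 := 𝕜) a (fun k => (T ^ k) x) n N hn, avg_aux (𝕜 := 𝕜) a (fun k => (T ^ k) x) m N hm, ← sum_sub_distrib]
    have e : ∀ t : UnitAddCircle, (n:ℂ)⁻¹ • ∑ j ∈ range n, (fourier (a j : ℤ) t : ℂ) - (m:ℂ)⁻¹ • ∑ j ∈ range m, (fourier (a j : ℤ) t : ℂ)
      = ∑ k ∈ range N, (((n:ℝ)⁻¹ * #{j ∈ range n | a j = k} - (m:ℝ)⁻¹ * #{j ∈ range m | a j = k} : ℝ) : ℂ) • (fourier (k:ℤ) t : ℂ) := by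
      intro t
      have e1 := avg_aux (𝕜 := ℂ) a (fun k => (fourier (k:ℤ) t : ℂ)) n N hn
      have e2 := avg_aux (𝕜 := ℂ) a (fun k => (fourier (k:ℤ) t : ℂ)) m N hm
      rw [e1, e2, ← sum_sub_distrib]
      refine sum_congr rfl fun k _ => ?_
      rw [← sub_smul, Complex.ofReal_sub]; rfl
    simp_rw [e]
    refine le_trans (le_of_eq ?_) h
    congr 2
    refine sum_congr rfl fun k _ => ?_
    rw [← sub_smul, RCLike.ofReal_sub]
  have hlim : Tendsto (fun p : ℕ × ℕ => ∫ t, ‖f p.1 t - f p.2 t‖ ^ 2 ∂(μ : Measure UnitAddCircle)) atTop (nhds (∫ _, (0:ℝ) ∂(μ : Measure UnitAddCircle))) := by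
    refine tendsto_integral_filter_of_dominated_convergence (fun _ => 4) ?_ ?_ (integrable_const _) ?_
    · refine Eventually.of_forall fun p => ?_
      have h1 := hfc p.1
      have h2 := hfc p.2
      exact (by fun_prop : Continuous _).aestronglyMeasurable
    · refine Eventually.of_forall fun p => ae_of_all _ fun t => ?_
      rw [Real.norm_of_nonneg (by positivity)]
      have h1 : ‖f p.1 t - f p.2 t‖ ≤ 2 := by
        have := norm_sub_le (f p.1 t) (f p.2 t)
        linarith [hfb p.1 t, hfb p.2 t]
      nlinarith [norm_nonneg (f p.1 t - f p.2 t)]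
    · refine ae_of_all _ fun t => ?_
      obtain ⟨c, hc⟩ := hfl t
      rw [← prod_atTop_atTop_eq]
      have := (((hc.comp tendsto_fst).sub (hc.comp (tendsto_snd (f := atTop)))).norm).pow 2
      simpa using this
  rw [integral_zero] at hlim
  have hC : CauchySeq A := by
    rw [cauchySeq_iff_tendsto_dist_atTop_0]
    have h1 := squeeze_zero (fun p : ℕ × ℕ => sq_nonneg (dist (A p.1) (A p.2))) (fun p => hd p.1 p.2) hlim
    have h2 := h1.sqrt
    simpa [Real.sqrt_sq dist_nonneg] using h2
  obtain ⟨y, hy⟩ := cauchySeq_tendsto_of_complete hC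
  exact ⟨y, by rw [hA, ha] at hy; exact hy⟩

end P9b

/-- Let `Q` be a polynomial with non-negative integer coefficients. Then for
every contraction `T` on a (real or complex) Hilbert space `H` and every `x ∈ H`, the averages
`(1/n) ∑_{j=1}^n T^{Q(p_j)} x` converge in norm. -/
theorem stmt15 {𝕜 : Type*} [RCLike 𝕜] {H : Type*} [NormedAddCommGroup H]
    [InnerProductSpace 𝕜 H] [CompleteSpace H]
    (Q : Polynomial ℕ) (T : H →L[𝕜] H) (hT : ‖T‖ ≤ 1) (x : H) :
    ∃ y : H, Tendsto (fun n : ℕ =>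
        (n : 𝕜)⁻¹ • ∑ j ∈ range n, (T ^ (Q.eval (Nat.nth Nat.Prime j))) x)
      atTop (nhds y) := by
  by_cases hx : x = 0
  · exact ⟨0, by simp [hx]⟩
  obtain ⟨y, hy⟩ := unit_case Q T hT (((‖x‖ : ℝ) : 𝕜)⁻¹ • x) (norm_smul_inv_norm hx)
  refine ⟨((‖x‖ : ℝ) : 𝕜) • y, (hy.const_smul ((‖x‖ : ℝ) : 𝕜)).congr fun n => ?_⟩
  rw [smul_comm, smul_sum]
  congr 1
  refine sum_congr rfl fun j _ => ?_
  rw [map_smul, smul_inv_smul₀]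
  simpa using hx
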